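/- Let d be a positive odd integer such that 4d^2+1 is prime. Then there exists N such that every integer n > N can be written as n = x^2 + y^2 + z^2 + 2w^2 with x, y, z, w nonnegative integers such that x + 2dy is prime. -/

import Mathlib

open Finset

/-- Representability by the binary form `z ^ 2 + 2 * w ^ 2`. -/
def IsSqAddTwoSq (k : ℕ) : Prop := ∃ z w : ℕ, k = z ^ 2 + 2 * w ^ 2

lemma IsSqAddTwoSq.of_int {k : ℕ} {z w : ℤ} (h : (k : ℤ) = z ^ 2 + 2 * w ^ 2) :
    IsSqAddTwoSq k := by
  refine ⟨z.natAbs, w.natAbs, ?_⟩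
  zify
  simpa using h

lemma IsSqAddTwoSq.mul {a b : ℕ} (ha : IsSqAddTwoSq a) (hb : IsSqAddTwoSq b) :
    IsSqAddTwoSq (a * b) := by
  obtain ⟨x, y, rfl⟩ := ha
  obtain ⟨z, w, rfl⟩ := hb
  refine IsSqAddTwoSq.of_int (z := (x : ℤ) * z - 2 * y * w) (w := (x : ℤ) * w + y * z) ?_
  push_cast
  ring

lemma IsSqAddTwoSq.sq (a : ℕ) : IsSqAddTwoSq (a ^ 2) := ⟨a, 0, by ring⟩

lemma IsSqAddTwoSq.two : IsSqAddTwoSq 2 := ⟨0, 1, by norm_num⟩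

lemma IsSqAddTwoSq.pow {a : ℕ} (ha : IsSqAddTwoSq a) (j : ℕ) : IsSqAddTwoSq (a ^ j) := by
  induction j with
  | zero => exact ⟨1, 0, by norm_num⟩
  | succ j ih => rw [pow_succ]; exact ih.mul ha

/-- Thue's argument for the form `z ^ 2 + 2 * w ^ 2`. -/
lemma isSqAddTwoSq_of_prime {p : ℕ} (hp : p.Prime) (h : p % 8 = 1 ∨ p % 8 = 3) :
    IsSqAddTwoSq p := by
  haveI : Fact p.Prime := ⟨hp⟩
  have hp2 : p ≠ 2 := by rintro rfl; omega
  obtain ⟨s, hs⟩ := (ZMod.exists_sq_eq_neg_two_iff hp2).2 h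
  set r := Nat.sqrt p with hr
  have hcard : (univ : Finset (ZMod p)).card < (range (r + 1) ×ˢ range (r + 1)).card := by
    rw [card_product, card_range, card_univ, ZMod.card]
    exact Nat.lt_succ_sqrt p
  obtain ⟨⟨a, b⟩, hab, ⟨a', b'⟩, hab', hne, heq⟩ :=
    Finset.exists_ne_map_eq_of_card_lt_of_maps_to hcard
      (f := fun q : ℕ × ℕ => (q.1 : ZMod p) - s * q.2) (fun _ _ => mem_coe.2 (mem_univ _))
  simp only [coe_product, coe_range, Set.mem_prod, Set.mem_Iio, mem_product, mem_range] at hab hab'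
  have hrr : r ^ 2 ≤ p := Nat.sqrt_le' p
  have hrp : r ^ 2 ≠ p := by
    intro h
    exact (Nat.Prime.not_prime_pow (le_refl 2)) (h ▸ hp)
  set A : ℤ := (a : ℤ) - a' with hA
  set B : ℤ := (b : ℤ) - b' with hB
  have hA2 : A ^ 2 ≤ r ^ 2 := sq_le_sq' (by omega) (by omega)
  have hB2 : B ^ 2 ≤ r ^ 2 := sq_le_sq' (by omega) (by omega)
  have hrp' : (r : ℤ) ^ 2 < p := by exact_mod_cast lt_of_le_of_ne hrr hrp
  have hdvd : (p : ℤ) ∣ A ^ 2 + 2 * B ^ 2 := by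
    rw [← ZMod.intCast_zmod_eq_zero_iff_dvd]
    have h1 : (A : ZMod p) = s * B := by
      simp only [hA, hB]; push_cast
      simp only at heq
      linear_combination heq
    push_cast
    rw [h1]
    linear_combination (-(B : ZMod p) ^ 2) * hs
  have hpos : 0 < A ^ 2 + 2 * B ^ 2 := by
    rcases eq_or_ne A 0 with h0 | h0
    · rcases eq_or_ne B 0 with h1 | h1
      · exfalso; apply hne
        simp only [Prod.mk.injEq]; constructor <;> omega
      · positivity
    · positivity
  obtain ⟨c, hc⟩ := hdvd
  have hp0 : (0 : ℤ) < p := by exact_mod_cast hp.pos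
  have hc1 : 0 < c := by
    by_contra! hcn
    nlinarith
  have hc3 : c < 3 := by
    by_contra! hcn
    nlinarith
  interval_cases c
  · exact IsSqAddTwoSq.of_int (z := A) (w := B) (by linarith)
  · have hev : Even (A ^ 2) := by
      rw [Int.even_iff]; omega
    rw [Int.even_pow' (by norm_num)] at hev
    obtain ⟨e, he⟩ := hev
    refine IsSqAddTwoSq.of_int (z := B) (w := e) ?_
    rw [he] at hc
    linarith

lemma sum_divisors_mul_of_coprime {a b : ℕ} (hab : a.Coprime b) :
    ∑ e ∈ (a * b).divisors, ZMod.χ₈' e =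
      (∑ e ∈ a.divisors, ZMod.χ₈' e) * ∑ e ∈ b.divisors, ZMod.χ₈' e := by
  rw [Finset.sum_mul_sum, ← Finset.sum_product', Nat.divisors_mul, Finset.mul_def,
    Finset.sum_image hab.mul_injOn_divisors]
  refine Finset.sum_congr rfl fun q _ => ?_
  rw [Nat.cast_mul, map_mul]

lemma isSqAddTwoSq_or_sum_divisors_eq_zero (k : ℕ) (hk : k ≠ 0) :
    IsSqAddTwoSq k ∨ ∑ e ∈ k.divisors, ZMod.χ₈' e = 0 := by
  induction k using Nat.recOnPosPrimePosCoprime with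
  | prime_pow p j hp hj =>
    by_cases h2 : p = 2
    · left; subst h2; exact IsSqAddTwoSq.two.pow j
    by_cases h13 : p % 8 = 1 ∨ p % 8 = 3
    · left; exact (isSqAddTwoSq_of_prime hp h13).pow j
    rcases Nat.even_or_odd j with he | ho
    · left
      obtain ⟨i, rfl⟩ := he
      rw [← two_mul, mul_comm, pow_mul]
      exact IsSqAddTwoSq.sq _
    · right
      have hχ : ZMod.χ₈' p = -1 := by
        rw [ZMod.χ₈'_nat_eq_if_mod_eight]
        have := hp.eq_two_or_odd
        simp [h13]; omega
      rw [Nat.sum_divisors_prime_pow hp]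
      simp only [Nat.cast_pow, map_pow, hχ]
      rw [neg_one_geom_sum, if_pos]
      exact ho.add_one
  | zero => exact absurd rfl hk
  | one => left; exact ⟨1, 0, by norm_num⟩
  | coprime a b ha hb hab iha ihb =>
    rcases iha (by omega) with h1 | h1
    · rcases ihb (by omega) with h2 | h2
      · exact Or.inl (h1.mul h2)
      · right
        rw [sum_divisors_mul_of_coprime hab, h2, mul_zero]
    · right
      rw [sum_divisors_mul_of_coprime hab, h1, zero_mul]

lemma sum_small_divisors_eq_zero {k : ℕ} (hk : k % 8 = 1 ∨ k % 8 = 3) (hrep : ¬ IsSqAddTwoSq k) :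
    ∑ e ∈ k.divisors with e ^ 2 < k, ZMod.χ₈' e = 0 := by
  have hk0 : k ≠ 0 := by omega
  have hsum := (isSqAddTwoSq_or_sum_divisors_eq_zero k hk0).resolve_left hrep
  have hχ : ZMod.χ₈' k = 1 := by
    rw [ZMod.χ₈'_nat_eq_if_mod_eight, if_neg (by omega), if_pos hk]
  have hsw : ∑ e ∈ k.divisors with ¬ e ^ 2 < k, ZMod.χ₈' e =
      ∑ e ∈ k.divisors with e ^ 2 < k, ZMod.χ₈' e := by
    have key : ∀ e ∈ k.divisors, (k / e) ∈ k.divisors ∧ k / (k / e) = e ∧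
        ZMod.χ₈' (k / e : ℕ) = ZMod.χ₈' e ∧ (e ^ 2 < k ↔ ¬ (k / e) ^ 2 < k) := by
      intro e he
      obtain ⟨f, rfl⟩ := Nat.dvd_of_mem_divisors he
      have he0 : 0 < e := Nat.pos_of_ne_zero (by rintro rfl; simp at hk0)
      have hf0 : 0 < f := Nat.pos_of_ne_zero (by rintro rfl; simp at hk0)
      rw [Nat.mul_div_cancel_left _ he0, Nat.mul_div_cancel _ hf0]
      refine ⟨by simp [Nat.mem_divisors, he0.ne', hf0.ne'], rfl, ?_, ?_⟩
      · have := ZMod.isQuadratic_χ₈' (e : ZMod 8)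
        have := ZMod.isQuadratic_χ₈' (f : ZMod 8)
        push_cast at hχ
        rw [map_mul] at hχ
        rcases ZMod.isQuadratic_χ₈' (e : ZMod 8) with h | h | h <;>
        rcases ZMod.isQuadratic_χ₈' (f : ZMod 8) with h' | h' | h' <;>
          simp [h, h'] at hχ ⊢
      · have hne : e ≠ f := by
          rintro rfl
          exact hrep (by rw [← pow_two]; exact IsSqAddTwoSq.sq e)
        rw [not_lt, sq, sq]
        constructor
        · intro h; exact Nat.mul_le_mul_right _ (Nat.lt_of_mul_lt_mul_left h).le
        · intro h
          exact Nat.mul_lt_mul_of_pos_left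
            (lt_of_le_of_ne (Nat.le_of_mul_le_mul_right h hf0) hne) he0
    refine Finset.sum_bij' (fun e _ => k / e) (fun e _ => k / e) ?_ ?_ ?_ ?_ ?_
    · intro e he
      rw [mem_filter] at he ⊢
      obtain ⟨h1, h2, h3, h4⟩ := key e he.1
      obtain ⟨-, -, -, h5⟩ := key _ h1
      rw [h2] at h5
      exact ⟨h1, h5.2 he.2⟩
    · intro e he
      rw [mem_filter] at he ⊢
      obtain ⟨h1, h2, h3, h4⟩ := key e he.1
      exact ⟨h1, h4.1 he.2⟩
    · intro e he; exact (key e (mem_filter.1 he).1).2.1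
    · intro e he; exact (key e (mem_filter.1 he).1).2.1
    · intro e he; exact ((key e (mem_filter.1 he).1).2.2.1).symm
  have := Finset.sum_filter_add_sum_filter_not k.divisors (fun e => e ^ 2 < k)
    (fun e => ZMod.χ₈' (e : ZMod 8))
  rw [hsw, hsum] at this
  omega

lemma local_residues_mod_thirtyTwo : ∀ n : Fin 32, ∀ p : Fin 8, ∀ d : Fin 4,
    ∃ y : Fin 16, ∃ j : Fin 3,
      ((n.val : ℤ) - ((2 * p.val + 1 : ℕ) - 2 * ((2 * d.val + 1 : ℕ)) * (y.val : ℤ)) ^ 2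
        - (y.val : ℤ) ^ 2) % 32 % 2 ^ j.val = 0 ∧
      (((n.val : ℤ) - ((2 * p.val + 1 : ℕ) - 2 * ((2 * d.val + 1 : ℕ)) * (y.val : ℤ)) ^ 2
        - (y.val : ℤ) ^ 2) % 32 / 2 ^ j.val % 8 = 1 ∨
      ((n.val : ℤ) - ((2 * p.val + 1 : ℕ) - 2 * ((2 * d.val + 1 : ℕ)) * (y.val : ℤ)) ^ 2
        - (y.val : ℤ) ^ 2) % 32 / 2 ^ j.val % 8 = 3) := by decide

lemma exists_local_residue {n d p : ℕ} (hodd : Odd d) (hm : (4 * d ^ 2 + 1).Prime)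
    (hp : p.Prime) (hp2 : p ≠ 2) (hpm : p ≠ 4 * d ^ 2 + 1) :
    ∃ y₀ : ℕ, y₀ < 16 * (4 * d ^ 2 + 1) ∧ ∃ j : ℕ, j ≤ 2 ∧ ∀ y k : ℤ,
      y ≡ y₀ [ZMOD 16 * (4 * d ^ 2 + 1)] → k = n - (p - 2 * d * y) ^ 2 - y ^ 2 →
      2 ^ j ∣ k ∧ (k / 2 ^ j % 8 = 1 ∨ k / 2 ^ j % 8 = 3) ∧ ¬ ((4 * d ^ 2 + 1 : ℕ) : ℤ) ∣ k := by
  set m := 4 * d ^ 2 + 1 with hmdef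
  obtain ⟨d', hd'⟩ := hodd
  have hp2' : p % 2 = 1 := hp.eq_two_or_odd.resolve_left hp2
  obtain ⟨⟨a, ha⟩, ⟨j, hj⟩, hj0, hj1⟩ := local_residues_mod_thirtyTwo ⟨n % 32, by omega⟩
    ⟨p / 2 % 8, by omega⟩ ⟨d' % 4, by omega⟩
  simp only at hj0 hj1
  haveI : Fact m.Prime := ⟨hm⟩
  have hmodd : Odd m := ⟨2 * d ^ 2, by rw [hmdef]; ring⟩
  have hcop : Nat.Coprime 16 m := by
    rw [show 16 = 2 ^ 4 by norm_num]
    exact Nat.Coprime.pow_left 4 (Nat.coprime_two_left.2 hmodd)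
  -- a residue `b` modulo `m` making the value `≡ 1`
  have h4 : ((4 * d * p : ℕ) : ZMod m) ≠ 0 := by
    rw [Ne, ZMod.natCast_eq_zero_iff]
    intro hdvd
    rcases (Nat.Prime.dvd_mul hm).1 hdvd with h | h
    · have h1 : m ≤ 4 * d := Nat.le_of_dvd (by omega) h
      have h2 : d = 1 ∨ 2 ≤ d := by omega
      rcases h2 with rfl | h2
      · simp [hmdef] at h1
      · nlinarith
    · exact hpm ((Nat.prime_dvd_prime_iff_eq hm hp).1 h).symm
  set b : ZMod m := (1 - n + p ^ 2) / ((4 * d * p : ℕ) : ZMod m) with hb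
  obtain ⟨y₁, hy1, hy2⟩ := Nat.chineseRemainder hcop a b.val
  refine ⟨y₁ % (16 * m), Nat.mod_lt _ (by positivity), j, by omega, fun y k hy hk => ?_⟩
  have hy' : y ≡ y₁ [ZMOD 16 * m] := by
    refine hy.trans ?_
    push_cast
    exact Int.mod_modEq _ _
  have hya : y ≡ a [ZMOD 16] := by
    refine (hy'.of_mul_right _).trans ?_
    exact_mod_cast (Int.natCast_modEq_iff.2 hy1)
  have hyb : y ≡ (b.val : ℕ) [ZMOD m] := (hy'.of_mul_left _).trans (Int.natCast_modEq_iff.2 hy2)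
  have hk32 : k % 32 = ((n % 32 : ℕ) - ((2 * (p / 2 % 8) + 1 : ℕ)
      - 2 * ((2 * (d' % 4) + 1 : ℕ)) * (a : ℤ)) ^ 2 - (a : ℤ) ^ 2) % 32 := by
    obtain ⟨c, hc⟩ := hya.symm.dvd
    have hpp : ∃ p' : ℤ, (p : ℤ) = 16 * p' + ((2 * (p / 2 % 8) + 1 : ℕ) : ℤ) :=
      ⟨p / 16, by omega⟩
    have hdd : ∃ d'' : ℤ, (d : ℤ) = 8 * d'' + ((2 * (d' % 4) + 1 : ℕ) : ℤ) :=
      ⟨d' / 4, by omega⟩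
    have hnn : ∃ n' : ℤ, (n : ℤ) = 32 * n' + ((n % 32 : ℕ) : ℤ) := ⟨n / 32, by omega⟩
    obtain ⟨p', hp'⟩ := hpp
    obtain ⟨d'', hd''⟩ := hdd
    obtain ⟨n', hn'⟩ := hnn
    generalize ((2 * (p / 2 % 8) + 1 : ℕ) : ℤ) = P at *
    generalize ((2 * (d' % 4) + 1 : ℕ) : ℤ) = Q at *
    generalize ((n % 32 : ℕ) : ℤ) = R at *
    have hyc : y = a + 16 * c := by linarith
    rw [hk, hn', hp', hd'', hyc]
    refine Int.ModEq.symm ((Int.modEq_iff_dvd).2 ⟨n' - (p' - d'' * a - 16 * d'' * c - 2 * Q * c) *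
      ((P - 2 * Q * a) + 8 * (p' - d'' * a - 16 * d'' * c - 2 * Q * c)) - c * a - 8 * c ^ 2, ?_⟩)
    ring
  have hdvd : (2 : ℤ) ^ j ∣ 32 := by
    interval_cases j <;> norm_num
  rw [← hk32] at hj0 hj1
  have hkj : (2 : ℤ) ^ j ∣ k := by
    rw [Int.emod_emod_of_dvd _ hdvd] at hj0
    exact Int.dvd_of_emod_eq_zero hj0
  refine ⟨hkj, ?_, ?_⟩
  · have : k / 2 ^ j % 8 = k % 32 / 2 ^ j % 8 := by
      interval_cases j <;> omega
    rw [this]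
    exact hj1
  · rw [← ZMod.intCast_zmod_eq_zero_iff_dvd]
    have hyb' : (y : ZMod m) = b := by
      have := (ZMod.intCast_eq_intCast_iff y (b.val : ℕ) m).2 hyb
      rw [this]
      simp
    have hm0 : (4 * (d : ZMod m) ^ 2 + 1) = 0 := by
      have : ((4 * d ^ 2 + 1 : ℕ) : ZMod m) = 0 := ZMod.natCast_self m
      push_cast at this
      exact this
    have hb' : b * (4 * d * p) = 1 - n + p ^ 2 := by
      push_cast at h4
      rw [hb]
      push_cast
      exact div_mul_cancel₀ _ h4
    have : (k : ZMod m) = 1 := by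
      rw [hk]
      push_cast
      rw [hyb']
      linear_combination hb' - b ^ 2 * hm0
    rw [this]
    exact one_ne_zero

lemma Ioc_succ_insert {a b : ℕ} (h : a ≤ b) : Ioc a (b + 1) = insert (b + 1) (Ioc a b) := by
  ext; simp; omega

/-- The primes in the interval `(a, b]`. -/
def primesIoc (a b : ℕ) : Finset ℕ := (Ioc a b).filter Nat.Prime

lemma mem_primesIoc {a b p : ℕ} : p ∈ primesIoc a b ↔ a < p ∧ p ≤ b ∧ p.Prime := by
  simp [primesIoc, and_assoc]

lemma primesIoc_subset {a b a' b' : ℕ} (ha : a' ≤ a) (hb : b ≤ b') :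
    primesIoc a b ⊆ primesIoc a' b' := by
  intro p hp
  rw [mem_primesIoc] at hp ⊢
  exact ⟨by omega, by omega, hp.2.2⟩

lemma sum_primesIoc_log_le_theta (a b : ℕ) :
    ∑ p ∈ primesIoc 0 b, Real.log p = Chebyshev.theta b := by
  rw [Chebyshev.theta, Nat.floor_natCast]; rfl

/-- Partial summation against Chebyshev's bound `θ(x) ≤ x log 4`. -/
lemma sum_primesIoc_log_mul_le (f : ℕ → ℝ) (a b : ℕ) (hab : a < b) (hf0 : ∀ k, a < k → 0 ≤ f k)
    (hf : ∀ k, a < k → f (k + 1) ≤ f k) :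
    ∑ p ∈ primesIoc a b, Real.log p * f p ≤
      Real.log 4 * ((a + 1) * f (a + 1) + ∑ k ∈ Ioc (a + 1) b, f k) := by
  set c : ℕ → ℝ := fun k => if k.Prime then Real.log k else 0 with hc
  have hC : ∀ k : ℕ, ∑ i ∈ Ioc 0 k, c i ≤ Real.log 4 * k := by
    intro k
    have := Chebyshev.theta_le_log4_mul_x (x := (k : ℝ)) (by positivity)
    rw [← sum_primesIoc_log_le_theta 0, primesIoc, sum_filter] at this
    exact this
  have hmain : ∀ b : ℕ, a < b → ∑ k ∈ Ioc a b, c k * f k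
      + (Real.log 4 * b - ∑ i ∈ Ioc 0 b, c i) * f b ≤
      Real.log 4 * ((a + 1) * f (a + 1) + ∑ k ∈ Ioc (a + 1) b, f k) := by
    intro b hb
    induction b, hb using Nat.le_induction with
    | base =>
      simp only [Nat.succ_eq_add_one, Nat.Ioc_succ_singleton, sum_singleton, Ioc_self, sum_empty]
      rw [Ioc_succ_insert (by omega : 0 ≤ a), sum_insert (by simp)]
      have h0 : 0 ≤ ∑ i ∈ Ioc 0 a, c i := sum_nonneg fun i _ => by
        simp only [hc]; split_ifs <;> simp [Real.log_natCast_nonneg]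
      have := mul_nonneg h0 (hf0 (a + 1) (by omega))
      push_cast
      nlinarith
    | succ b hb ih =>
      rw [Ioc_succ_insert (by omega : a ≤ b), sum_insert (by simp),
        Ioc_succ_insert (by omega : 0 ≤ b), sum_insert (by simp),
        Ioc_succ_insert (by omega : a + 1 ≤ b), sum_insert (by simp)]
      have h1 := mul_le_mul_of_nonneg_left (hf b hb)
        (sub_nonneg.2 (hC b))
      push_cast
      simp only [Nat.succ_eq_add_one] at *
      nlinarith
  have h1 := hmain b hab
  have h2 := mul_nonneg (sub_nonneg.2 (hC b)) (hf0 b hab)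
  have h3 : ∑ p ∈ primesIoc a b, Real.log p * f p = ∑ k ∈ Ioc a b, c k * f k := by
    rw [primesIoc, sum_filter]
    refine sum_congr rfl fun k _ => ?_
    simp only [hc]; split_ifs <;> simp
  rw [h3]
  linarith

lemma sum_primesIoc_log_div_le (b : ℕ) (hb : 1 ≤ b) :
    ∑ p ∈ primesIoc 0 b, Real.log p / p ≤ Real.log 4 * (1 + Real.log b) := by
  have h := sum_primesIoc_log_mul_le (fun k => 1 / (k : ℝ)) 0 b hb (fun k _ => by positivity)
    (fun k hk => by
      apply one_div_le_one_div_of_le (by exact_mod_cast hk)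
      push_cast; linarith)
  have h2 := harmonic_le_one_add_log b
  rw [harmonic_eq_sum_Icc] at h2
  push_cast at h2
  rw [Icc_eq_cons_Ioc hb, sum_cons] at h2
  simp only [mul_one_div] at h
  refine h.trans ?_
  have h4 : 0 ≤ Real.log 4 := Real.log_nonneg (by norm_num)
  apply mul_le_mul_of_nonneg_left _ h4
  simp only [zero_add, one_div]
  push_cast at h2 ⊢
  linarith

lemma one_div_mul_log_le (k : ℕ) (hk : 2 ≤ k) :
    1 / ((k + 1 : ℕ) * Real.log (k + 1 : ℕ)) ≤
      Real.log (Real.log (k + 1 : ℕ)) - Real.log (Real.log k) := by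
  have hk' : (2 : ℝ) ≤ k := by exact_mod_cast hk
  have hl : 0 < Real.log k := Real.log_pos (by linarith)
  have hl1 : 0 < Real.log (k + 1 : ℕ) := Real.log_pos (by push_cast; linarith)
  have h1 : 1 / ((k : ℝ) + 1) ≤ Real.log (k + 1 : ℕ) - Real.log k := by
    rw [← Real.log_div (by positivity) (by positivity)]
    have := Real.one_sub_inv_le_log_of_pos (x := ((k + 1 : ℕ) : ℝ) / k) (by positivity)
    refine le_trans (le_of_eq ?_) this
    push_cast
    field_simp
    ring
  have h2 : (Real.log (k + 1 : ℕ) - Real.log k) / Real.log (k + 1 : ℕ) ≤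
      Real.log (Real.log (k + 1 : ℕ)) - Real.log (Real.log k) := by
    rw [← Real.log_div hl1.ne' hl.ne']
    have := Real.one_sub_inv_le_log_of_pos (x := Real.log (k + 1 : ℕ) / Real.log k) (by positivity)
    refine le_trans (le_of_eq ?_) this
    field_simp
  refine le_trans ?_ h2
  rw [← div_div]
  push_cast at *
  gcongr

lemma sum_primesIoc_inv_le (a b : ℕ) (ha : 1 ≤ a) (hab : a < b) :
    ∑ p ∈ primesIoc a b, 1 / (p : ℝ) ≤ Real.log 4 * (1 / Real.log (a + 1 : ℕ) +
      (Real.log (Real.log b) - Real.log (Real.log (a + 1 : ℕ)))) := by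
  have hlog : ∀ k : ℕ, a < k → 0 < Real.log k := fun k hk =>
    Real.log_pos (by exact_mod_cast (by omega : 1 < k))
  have h := sum_primesIoc_log_mul_le (fun k => 1 / ((k : ℝ) * Real.log k)) a b hab
    (fun k hk => by have := hlog k hk; positivity)
    (fun k hk => by
      have := hlog k hk
      have hk0 : 0 < k := by omega
      gcongr <;> simp)
  have h1 : ∑ p ∈ primesIoc a b, 1 / (p : ℝ) =
      ∑ p ∈ primesIoc a b, Real.log p * (1 / ((p : ℝ) * Real.log p)) := by
    refine sum_congr rfl fun p hp => ?_
    have := hlog p (mem_primesIoc.1 hp).1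
    field_simp
  rw [h1]
  refine h.trans ?_
  have h4 : 0 ≤ Real.log 4 := Real.log_nonneg (by norm_num)
  apply mul_le_mul_of_nonneg_left _ h4
  have h2 := hlog (a + 1) (by omega)
  apply add_le_add
  · apply le_of_eq
    push_cast at *
    field_simp
  · clear h h1
    induction b, hab using Nat.le_induction with
    | base => simp
    | succ b hb ih =>
      rw [Ioc_succ_insert (by omega : a + 1 ≤ b), sum_insert (by simp)]
      have := one_div_mul_log_le b (by omega)
      simp only [Nat.succ_eq_add_one] at *
      linarith

/-- Sum of reciprocals of primes up to `b`. -/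
lemma sum_primesIoc_inv_le' (b : ℕ) (hb : 2 ≤ b) :
    ∑ p ∈ primesIoc 0 b, 1 / (p : ℝ) ≤ 2 * Real.log (Real.log b) + 3 := by
  have h0 : primesIoc 0 b = primesIoc 1 b := by
    ext p; simp only [mem_primesIoc]
    constructor
    · rintro ⟨_, h, hp⟩; exact ⟨hp.one_lt, h, hp⟩
    · rintro ⟨_, h, hp⟩; exact ⟨hp.pos, h, hp⟩
  rw [h0]
  have h := sum_primesIoc_inv_le 1 b le_rfl (by omega)
  refine h.trans ?_
  norm_num
  have e4 : Real.log 4 = 2 * Real.log 2 := by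
    rw [show (4 : ℝ) = 2 ^ 2 by norm_num, Real.log_pow]; norm_num
  have l1 := Real.log_two_gt_d9
  have l2 := Real.log_two_lt_d9
  have hll : Real.log (Real.log 2) ≤ Real.log (Real.log b) :=
    Real.log_le_log (by linarith) (Real.log_le_log (by norm_num) (by exact_mod_cast hb))
  have hll2 : -Real.log (Real.log 2) ≤ 1 / 2 := by
    have := Real.one_sub_inv_le_log_of_pos (x := Real.log 2) (by linarith)
    have h3 : (Real.log 2)⁻¹ ≤ 3 / 2 := by
      rw [inv_le_comm₀ (by linarith) (by norm_num)]
      linarith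
    linarith
  have h5 : Real.log 4 * (Real.log 2)⁻¹ = 2 := by
    rw [e4]; field_simp
  rw [mul_add, h5, e4]
  nlinarith

/-- A finite Euler product bound for nonnegative submultiplicative functions. -/
lemma sum_le_prod_one_add {F : ℕ → ℝ} {b : ℕ → ℝ} (hF0 : ∀ n, 0 ≤ F n) (hF1 : F 1 ≤ 1)
    (hF : ∀ m n, m ≠ 0 → n ≠ 0 → m.Coprime n → F (m * n) ≤ F m * F n) (s : Finset ℕ)
    (hs : ∀ p ∈ s, p.Prime)
    (hb : ∀ p ∈ s, ∀ J : ℕ, ∑ j ∈ Icc 1 J, F (p ^ j) ≤ b p) (A : Finset ℕ)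
    (hA : ∀ n ∈ A, n ≠ 0 ∧ n.primeFactors ⊆ s) :
    ∑ n ∈ A, F n ≤ ∏ p ∈ s, (1 + b p) := by
  induction s using Finset.induction_on generalizing A with
  | empty =>
    have : A ⊆ {1} := by
      intro n hn
      obtain ⟨h0, h⟩ := hA n hn
      rw [subset_empty, Nat.primeFactors_eq_empty] at h
      simp; omega
    calc ∑ n ∈ A, F n ≤ ∑ n ∈ {1}, F n :=
          sum_le_sum_of_subset_of_nonneg this fun _ _ _ => hF0 _
      _ ≤ _ := by simpa using hF1
  | insert p s hps ih =>
    have hp : p.Prime := hs p (mem_insert_self _ _)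
    have ih' := ih (fun q hq => hs q (mem_insert_of_mem hq))
      (fun q hq => hb q (mem_insert_of_mem hq)) (A.image fun n => ordCompl[p] n) ?_
    · set J := A.sup fun n => n.factorization p with hJ
      have h1 : ∑ n ∈ A, F n ≤ ∑ q ∈ range (J + 1) ×ˢ A.image (fun n => ordCompl[p] n),
          F (p ^ q.1) * F q.2 := by
        calc ∑ n ∈ A, F n ≤ ∑ n ∈ A, F (p ^ n.factorization p) * F (ordCompl[p] n) := by
              refine sum_le_sum fun n hn => ?_
              have h0 := (hA n hn).1
              conv_lhs => rw [← Nat.ordProj_mul_ordCompl_eq_self n p]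
              exact hF _ _ (pow_ne_zero _ hp.ne_zero) (Nat.ordCompl_pos p h0).ne'
                ((Nat.coprime_ordCompl hp h0).pow_left _)
          _ = ∑ q ∈ A.image (fun n => (n.factorization p, ordCompl[p] n)),
              F (p ^ q.1) * F q.2 := by
              rw [sum_image]
              intro x hx y hy hxy
              simp only [Prod.mk.injEq] at hxy
              rw [← Nat.ordProj_mul_ordCompl_eq_self x p, ← Nat.ordProj_mul_ordCompl_eq_self y p,
                hxy.1, ← hxy.2, hxy.1]
          _ ≤ _ := by
              refine sum_le_sum_of_subset_of_nonneg ?_ fun _ _ _ => mul_nonneg (hF0 _) (hF0 _)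
              intro q hq
              obtain ⟨n, hn, rfl⟩ := mem_image.1 hq
              rw [mem_product]
              exact ⟨mem_range.2 (Nat.lt_succ_of_le
                (Finset.le_sup (f := fun n => n.factorization p) hn)), mem_image_of_mem _ hn⟩
      rw [sum_product] at h1
      simp only at h1
      rw [← sum_mul_sum] at h1
      rw [prod_insert hps]
      have h2 : ∑ j ∈ range (J + 1), F (p ^ j) ≤ 1 + b p := by
        rw [range_eq_Ico, sum_eq_sum_Ico_succ_bot (by omega)]
        have := hb p (mem_insert_self _ _) J
        simp only [pow_zero, zero_add]
        rw [show Ico 1 (J + 1) = Icc 1 J from rfl]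
        linarith
      exact h1.trans (mul_le_mul h2 ih' (sum_nonneg fun _ _ => hF0 _)
        ((sum_nonneg fun _ _ => hF0 _).trans h2))
    · intro m hm
      obtain ⟨n, hn, rfl⟩ := mem_image.1 hm
      obtain ⟨h0, hsub⟩ := hA n hn
      refine ⟨(Nat.ordCompl_pos p h0).ne', fun q hq => ?_⟩
      have hqn := hsub (Nat.primeFactors_mono (Nat.ordCompl_dvd n p) h0 hq)
      rcases mem_insert.1 hqn with rfl | h
      · exact absurd (Nat.dvd_of_mem_primeFactors hq) (Nat.not_dvd_ordCompl hp h0)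
      · exact h

lemma sum_Icc_pow_le {x : ℝ} (hx0 : 0 ≤ x) (hx1 : x < 1) (J : ℕ) :
    ∑ j ∈ Icc 1 J, x ^ j ≤ x / (1 - x) := by
  have h := geom_sum_Ico_le_of_lt_one (m := 1) (n := J + 1) hx0 hx1
  rw [show Icc 1 J = Ico 1 (J + 1) from rfl]
  simpa using h

/-- A lower bound for `Σ 1/n` gives `∏_{p ≤ b} (1 - 1/p) ≤ 1 / log b`. -/
lemma prod_primesIoc_one_sub_inv_le (b : ℕ) (hb : 2 ≤ b) :
    ∏ p ∈ primesIoc 0 b, (1 - 1 / (p : ℝ)) ≤ 1 / Real.log b := by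
  have h := sum_le_prod_one_add (F := fun n => 1 / (n : ℝ)) (b := fun p => 1 / ((p : ℝ) - 1))
    (fun n => by positivity) (by simp) (fun m n _ _ _ => by push_cast; rw [one_div_mul_one_div])
    (primesIoc 0 b) (fun p hp => (mem_primesIoc.1 hp).2.2) (fun p hp J => by
      have hp1 : (1 : ℝ) < p := by exact_mod_cast (mem_primesIoc.1 hp).2.2.one_lt
      have h1 := sum_Icc_pow_le (x := 1 / (p : ℝ)) (by positivity)
        (by rw [div_lt_one (by linarith)]; exact hp1) J
      have h2 : 1 / (p : ℝ) / (1 - 1 / p) = 1 / ((p : ℝ) - 1) := by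
        have : (p : ℝ) - 1 ≠ 0 := by linarith
        field_simp
      rw [h2] at h1
      refine le_trans (le_of_eq (sum_congr rfl fun j _ => ?_)) h1
      push_cast; rw [one_div_pow]) (Icc 1 b) (fun n hn => by
      rw [mem_Icc] at hn
      refine ⟨by omega, fun q hq => ?_⟩
      rw [mem_primesIoc]
      have := Nat.le_of_dvd (by omega) (Nat.dvd_of_mem_primeFactors hq)
      have := Nat.prime_of_mem_primeFactors hq
      exact ⟨this.pos, by omega, this⟩)
  have h2 := log_add_one_le_harmonic b
  rw [harmonic_eq_sum_Icc] at h2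
  push_cast at h2
  simp only [one_div] at h
  have hlog : 0 < Real.log b := Real.log_pos (by exact_mod_cast hb)
  have h3 : Real.log b ≤ Real.log (b + 1) := Real.log_le_log (by positivity) (by linarith)
  have h4 : (∏ p ∈ primesIoc 0 b, (1 - 1 / (p : ℝ))) * ∏ p ∈ primesIoc 0 b, (1 + ((p : ℝ) - 1)⁻¹) = 1 := by
    rw [← prod_mul_distrib]
    refine prod_eq_one fun p hp => ?_
    have hp1 : (1 : ℝ) < p := by exact_mod_cast (mem_primesIoc.1 hp).2.2.one_lt
    have : (p : ℝ) - 1 ≠ 0 := by linarith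
    field_simp
    ring
  have h5 : 0 ≤ ∏ p ∈ primesIoc 0 b, (1 - 1 / (p : ℝ)) := prod_nonneg fun p hp => by
    have : (1 : ℝ) ≤ p := by exact_mod_cast (mem_primesIoc.1 hp).2.2.one_le
    have : 1 / (p : ℝ) ≤ 1 := by rw [div_le_one (by linarith)]; exact this
    linarith
  rw [le_div_iff₀ hlog]
  calc _ ≤ (∏ p ∈ primesIoc 0 b, (1 - 1 / (p : ℝ))) * ∏ p ∈ primesIoc 0 b, (1 + ((p : ℝ) - 1)⁻¹) := by
        gcongr
        linarith
    _ = 1 := h4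

lemma sum_inv_le_neg_log_prod (b : ℕ) :
    Real.exp (∑ p ∈ primesIoc 0 b, 1 / (p : ℝ)) * ∏ p ∈ primesIoc 0 b, (1 - 1 / (p : ℝ)) ≤ 1 := by
  rw [Real.exp_sum, ← prod_mul_distrib]
  refine prod_le_one (fun p hp => ?_) (fun p hp => ?_)
  · have : (1 : ℝ) ≤ p := by exact_mod_cast (mem_primesIoc.1 hp).2.2.one_le
    have : 1 / (p : ℝ) ≤ 1 := by rw [div_le_one (by linarith)]; exact this
    exact mul_nonneg (Real.exp_pos _).le (by linarith)
  · have := Real.one_sub_le_exp_neg (1 / (p : ℝ))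
    calc Real.exp (1 / (p : ℝ)) * (1 - 1 / p) ≤ Real.exp (1 / (p : ℝ)) * Real.exp (-(1 / (p : ℝ))) := by
          gcongr
      _ = 1 := by rw [← Real.exp_add]; simp

lemma card_primesIoc_quarter : ∃ T₀ : ℕ, ∀ T : ℕ, T₀ ≤ T →
    (T : ℝ) / 4 ≤ (primesIoc (T / 4) T).card * Real.log T := by
  have h := (isLittleO_log_rpow_atTop (r := 1 / 2) (by norm_num)).bound
    (c := 1 / 100) (by norm_num)
  obtain ⟨T₀, hT₀⟩ := Filter.eventually_atTop.1
    (tendsto_natCast_atTop_atTop.eventually h)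
  refine ⟨max T₀ 2, fun T hT => ?_⟩
  have hT2 : (2 : ℝ) ≤ T := by exact_mod_cast (le_max_right _ _).trans hT
  have h1 := hT₀ T ((le_max_left _ _).trans hT)
  rw [← Real.sqrt_eq_rpow, Real.norm_of_nonneg (Real.log_natCast_nonneg _),
    Real.norm_of_nonneg (Real.sqrt_nonneg _)] at h1
  have h2 := Chebyshev.theta_ge T
  have h3 := Chebyshev.theta_le_log4_mul_x (x := ((T / 4 : ℕ) : ℝ)) (by positivity)
  have h4 : ((T / 4 : ℕ) : ℝ) ≤ T / 4 := Nat.cast_div_le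
  have hs : √(T : ℝ) * √(T : ℝ) = T := Real.mul_self_sqrt (by positivity)
  have hs1 : 1 ≤ √(T : ℝ) := Real.one_le_sqrt.2 (by linarith)
  have h5 : Real.log (T + 1) ≤ 2 * Real.log T := by
    rw [← Real.log_rpow (by positivity)]
    apply Real.log_le_log (by positivity)
    norm_num
    nlinarith
  have e4 : Real.log 4 = 2 * Real.log 2 := by
    rw [show (4 : ℝ) = 2 ^ 2 by norm_num, Real.log_pow]; norm_num
  have l1 := Real.log_two_gt_d9
  have h6 : Chebyshev.theta T - Chebyshev.theta (T / 4 : ℕ) ≤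
      (primesIoc (T / 4) T).card * Real.log T := by
    rw [← sum_primesIoc_log_le_theta 0, ← sum_primesIoc_log_le_theta 0, ← nsmul_eq_mul]
    have hd : primesIoc 0 T = primesIoc 0 (T / 4) ∪ primesIoc (T / 4) T := by
      ext p; simp only [mem_union, mem_primesIoc]
      constructor
      · rintro ⟨h, h', h''⟩
        rcases le_or_gt p (T / 4) with h3 | h3
        · exact Or.inl ⟨h, h3, h''⟩
        · exact Or.inr ⟨h3, h', h''⟩
      · rintro (⟨h, h', h''⟩ | ⟨h, h', h''⟩)
        · exact ⟨h, by omega, h''⟩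
        · exact ⟨by omega, by omega, h''⟩
    rw [hd, sum_union, add_sub_cancel_left]
    · refine sum_le_card_nsmul _ _ _ fun p hp => ?_
      rw [mem_primesIoc] at hp
      exact Real.log_le_log (by exact_mod_cast hp.2.2.pos) (by exact_mod_cast hp.2.1)
    · rw [disjoint_left]
      intro p hp hp'
      rw [mem_primesIoc] at hp hp'
      omega
  have h7 : 2 * √(T : ℝ) * Real.log T ≤ T / 50 := by nlinarith
  have h8 : Real.log (T + 1) ≤ T / 50 := by nlinarith
  nlinarith

lemma card_primeFactors_le_log (n : ℕ) (hn : n ≠ 0) :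
    (n.primeFactors.card : ℝ) ≤ 2 * Real.log n := by
  have h : 2 ^ n.primeFactors.card ≤ n := by
    calc 2 ^ n.primeFactors.card ≤ ∏ p ∈ n.primeFactors, p :=
          Finset.pow_card_le_prod _ _ _ fun p hp => (Nat.prime_of_mem_primeFactors hp).two_le
      _ ≤ n := Nat.le_of_dvd (Nat.pos_of_ne_zero hn) (Nat.prod_primeFactors_dvd n)
  have h2 : (n.primeFactors.card : ℝ) * Real.log 2 ≤ Real.log n := by
    rw [← Real.log_pow]
    exact Real.log_le_log (by positivity) (by exact_mod_cast h)
  have := Real.log_two_gt_d9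
  nlinarith [(Nat.cast_nonneg n.primeFactors.card : (0 : ℝ) ≤ _)]

/-- The number of square roots of `K` modulo `e`. -/
noncomputable def rootCount (K : ℤ) (e : ℕ) : ℕ := Nat.card {v : ZMod e // v ^ 2 = (K : ZMod e)}

lemma rootCount_eq_card (K : ℤ) (e : ℕ) [NeZero e] :
    rootCount K e = #{v : ZMod e | v ^ 2 = (K : ZMod e)} := by
  rw [rootCount, Nat.card_eq_fintype_card, Fintype.card_subtype]

lemma rootCount_one (K : ℤ) : rootCount K 1 = 1 := by
  rw [rootCount_eq_card]
  have : (univ.filter fun v : ZMod 1 => v ^ 2 = (K : ZMod 1)) = univ := by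
    apply filter_true_of_mem
    intro v _
    exact Subsingleton.elim _ _
  rw [this]; rfl

lemma rootCount_mul (K : ℤ) {a b : ℕ} (hab : a.Coprime b) :
    rootCount K (a * b) = rootCount K a * rootCount K b := by
  rw [rootCount, rootCount, rootCount, ← Nat.card_prod]
  let φ := ZMod.chineseRemainder hab
  refine Nat.card_congr ?_
  refine (Equiv.subtypeEquiv (q := fun w : ZMod a × ZMod b =>
    w.1 ^ 2 = (K : ZMod a) ∧ w.2 ^ 2 = (K : ZMod b)) φ.toEquiv fun v => ?_).trans
    (Equiv.subtypeProdEquivProd (p := fun v : ZMod a => v ^ 2 = (K : ZMod a))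
      (q := fun v : ZMod b => v ^ 2 = (K : ZMod b)))
  rw [← φ.injective.eq_iff, map_pow, map_intCast, Prod.ext_iff]
  simp

lemma card_castHom_fiber_le {d e : ℕ} [NeZero e] (hde : d ∣ e) (c : ZMod d) :
    #{v : ZMod e | ZMod.castHom hde (ZMod d) v = c} ≤ e / d := by
  have hd : d ≠ 0 := ne_zero_of_dvd_ne_zero (NeZero.ne e) hde
  haveI : NeZero d := ⟨hd⟩
  rw [← card_range (e / d)]
  refine card_le_card_of_injOn (fun v => v.val / d) (fun v _ => ?_) (fun v hv w hw h => ?_)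
  · simp only [coe_range, Set.mem_Iio]
    exact Nat.div_lt_div_of_lt_of_dvd hde (ZMod.val_lt v)
  · simp only [coe_filter, mem_univ, true_and, Set.mem_ofPred_eq] at hv hw
    have key : ∀ v : ZMod e, (ZMod.castHom hde (ZMod d) v).val = v.val % d := by
      intro v
      rw [ZMod.castHom_apply, ZMod.cast_eq_val, ZMod.val_natCast]
    have h1 : v.val % d = w.val % d := by rw [← key, ← key, hv, hw]
    apply ZMod.val_injective
    rw [← Nat.div_add_mod v.val d, ← Nat.div_add_mod w.val d, h1]
    simp only at h
    rw [h]

lemma rootCount_le_mul {d e : ℕ} [NeZero e] (hde : d ∣ e) (K : ℤ) :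
    rootCount K e ≤ e / d * rootCount K d := by
  have hd : d ≠ 0 := ne_zero_of_dvd_ne_zero (NeZero.ne e) hde
  haveI : NeZero d := ⟨hd⟩
  rw [rootCount_eq_card, rootCount_eq_card]
  refine card_le_mul_card_image_of_maps_to (f := ZMod.castHom hde (ZMod d)) (fun v hv => ?_) _
    (fun c _ => ?_)
  · simp only [mem_filter, mem_univ, true_and] at hv ⊢
    rw [← map_pow, hv, map_intCast]
  · refine (card_le_card ?_).trans (card_castHom_fiber_le hde c)
    intro v hv
    simp only [mem_filter, mem_univ, true_and] at hv ⊢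
    exact hv.2

lemma rootCount_prime_pow_succ_le {p : ℕ} (hp : p.Prime) (K : ℤ) (j : ℕ) :
    rootCount K (p ^ (j + 1)) ≤ p * rootCount K (p ^ j) := by
  haveI : NeZero (p ^ (j + 1)) := ⟨pow_ne_zero _ hp.ne_zero⟩
  have h := rootCount_le_mul (pow_dvd_pow p (Nat.le_succ j)) K
  rwa [Nat.pow_div (Nat.le_succ j) hp.pos, Nat.succ_sub (le_refl j), Nat.sub_self, pow_one] at h

/-- If every root is congruent to `± v₀` modulo `d`, there are few roots. -/
lemma rootCount_le_of_dvd {d e : ℕ} [NeZero e] (hde : d ∣ e) (K : ℤ)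
    (h : ∀ v w : ℤ, (e : ℤ) ∣ v ^ 2 - K → (e : ℤ) ∣ w ^ 2 - K →
      (d : ℤ) ∣ v - w ∨ (d : ℤ) ∣ v + w) :
    rootCount K e ≤ 2 * (e / d) := by
  rw [rootCount_eq_card]
  rcases (univ.filter fun v : ZMod e => v ^ 2 = (K : ZMod e)).eq_empty_or_nonempty with h0 | ⟨w, hw⟩
  · rw [h0]; simp
  have hroot : ∀ v : ZMod e, v ^ 2 = (K : ZMod e) → (e : ℤ) ∣ (v.val : ℤ) ^ 2 - K := by
    intro v hv
    rw [← ZMod.intCast_zmod_eq_zero_iff_dvd]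
    push_cast
    rw [ZMod.natCast_val, ZMod.cast_id', id, hv, sub_self]
  have hsub : (univ.filter fun v : ZMod e => v ^ 2 = (K : ZMod e)) ⊆
      (univ.filter fun v : ZMod e => ZMod.castHom hde (ZMod d) v = ZMod.castHom hde (ZMod d) w) ∪
      (univ.filter fun v : ZMod e => ZMod.castHom hde (ZMod d) v =
        -ZMod.castHom hde (ZMod d) w) := by
    intro v hv
    simp only [mem_filter, mem_univ, true_and, mem_union] at hv hw ⊢
    have key : ∀ v : ZMod e, ZMod.castHom hde (ZMod d) v = ((v.val : ℤ) : ZMod d) := by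
      intro v
      rw [ZMod.castHom_apply, ZMod.cast_eq_val]; simp
    rw [key, key]
    rcases h _ _ (hroot v hv) (hroot w hw) with h1 | h1
    · left
      rw [← sub_eq_zero, ← Int.cast_sub, ZMod.intCast_zmod_eq_zero_iff_dvd]; exact h1
    · right
      rw [← sub_eq_zero, sub_neg_eq_add, ← Int.cast_add, ZMod.intCast_zmod_eq_zero_iff_dvd]
      exact h1
  refine (card_le_card hsub).trans ((card_union_le _ _).trans ?_)
  have := card_castHom_fiber_le hde (ZMod.castHom hde (ZMod d) w)
  have := card_castHom_fiber_le hde (-ZMod.castHom hde (ZMod d) w)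
  omega

lemma pow_dvd_or_pow_dvd_of_dvd_mul {p : ℤ} (hp : Prime p) (k l : ℕ) {a b : ℤ}
    (h : p ^ (k + l + 1) ∣ a * b) : p ^ (k + 1) ∣ a ∨ p ^ (l + 1) ∣ b := by
  induction k generalizing a with
  | zero =>
    by_cases ha : p ∣ a
    · left; simpa using ha
    · right; exact hp.pow_dvd_of_dvd_mul_left _ ha (by simpa using h)
  | succ k ih =>
    by_cases ha : p ∣ a
    · obtain ⟨c, rfl⟩ := ha
      have h' : p * p ^ (k + l + 1) ∣ p * (c * b) := by
        rw [← pow_succ', ← mul_assoc]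
        convert h using 2
        ring
      rcases ih ((mul_dvd_mul_iff_left hp.ne_zero).1 h') with h1 | h1
      · left
        rw [pow_succ' p (k + 1)]
        exact mul_dvd_mul_left p h1
      · exact Or.inr h1
    · right
      exact (pow_dvd_pow p (by omega)).trans (hp.pow_dvd_of_dvd_mul_left _ ha h)

lemma rootCount_prime_pow_le {p : ℕ} (hp : p.Prime) (K : ℤ) (j : ℕ) :
    rootCount K (p ^ j) ≤ 2 * p ^ (j / 2) := by
  haveI : NeZero (p ^ j) := ⟨pow_ne_zero _ hp.ne_zero⟩
  have hdvd : p ^ ((j + 1) / 2) ∣ p ^ j := pow_dvd_pow p (by omega)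
  have h := rootCount_le_of_dvd hdvd K (fun v w hv hw => ?_)
  · rw [Nat.pow_div (by omega) hp.pos] at h
    rwa [show j - (j + 1) / 2 = j / 2 by omega] at h
  · have h1 : ((p ^ j : ℕ) : ℤ) ∣ (v - w) * (v + w) := by
      have := dvd_sub hv hw
      rwa [show v ^ 2 - K - (w ^ 2 - K) = (v - w) * (v + w) by ring] at this
    by_contra! hcon
    obtain ⟨ha, hb⟩ := hcon
    push_cast at h1 ha hb
    have h2 : (p : ℤ) ^ ((j + 1) / 2 - 1 + ((j + 1) / 2 - 1) + 1) ∣ (v - w) * (v + w) := by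
      refine (pow_dvd_pow _ ?_).trans h1
      rcases Nat.eq_zero_or_pos ((j + 1) / 2) with h0 | h0
      · rw [h0] at ha; simp at ha
      · omega
    rcases Nat.eq_zero_or_pos ((j + 1) / 2) with h0 | h0
    · rw [h0] at ha; simp at ha
    rcases pow_dvd_or_pow_dvd_of_dvd_mul (Nat.prime_iff_prime_int.1 hp) _ _ h2 with h3 | h3
    · rw [Nat.sub_add_cancel h0] at h3; exact ha h3
    · rw [Nat.sub_add_cancel h0] at h3; exact hb h3

lemma rootCount_prime_pow_le_two {p : ℕ} (hp : p.Prime) (hp2 : p ≠ 2) {K : ℤ}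
    (hK : ¬ (p : ℤ) ∣ K) (j : ℕ) : rootCount K (p ^ j) ≤ 2 := by
  haveI : NeZero (p ^ j) := ⟨pow_ne_zero _ hp.ne_zero⟩
  have h := rootCount_le_of_dvd (dvd_refl (p ^ j)) K (fun v w hv hw => ?_)
  · rwa [Nat.div_self (pow_pos hp.pos _), mul_one] at h
  · rcases Nat.eq_zero_or_pos j with rfl | hj
    · left; simp
    have hpp := Nat.prime_iff_prime_int.1 hp
    have h1 : ((p ^ j : ℕ) : ℤ) ∣ (v - w) * (v + w) := by
      have := dvd_sub hv hw
      rwa [show v ^ 2 - K - (w ^ 2 - K) = (v - w) * (v + w) by ring] at this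
    push_cast at h1 ⊢
    by_cases hd : (p : ℤ) ∣ v - w
    · left
      have hd2 : ¬ (p : ℤ) ∣ v + w := by
        intro hd2
        have h3 := dvd_add hd hd2
        rw [show v - w + (v + w) = 2 * v by ring] at h3
        rcases hpp.dvd_or_dvd h3 with h4 | h4
        · have h5 : p ∣ 2 := by exact_mod_cast h4
          exact hp2 ((Nat.prime_dvd_prime_iff_eq hp Nat.prime_two).1 h5)
        · apply hK
          have h5 : (p : ℤ) ∣ v ^ 2 - K :=
            (dvd_trans (by push_cast; exact dvd_pow_self _ hj.ne') hv)
          have h6 : (p : ℤ) ∣ v ^ 2 := dvd_pow h4 two_ne_zero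
          have := dvd_sub h6 h5
          simpa using this
      exact (hpp.pow_dvd_of_dvd_mul_right j hd2 h1)
    · right
      exact (hpp.pow_dvd_of_dvd_mul_left j hd h1)

lemma rootCount_prime_le_two {p : ℕ} (hp : p.Prime) (K : ℤ) : rootCount K p ≤ 2 := by
  have := rootCount_prime_pow_le hp K 1
  simpa using this

lemma rootCount_prime {p : ℕ} [hp : Fact p.Prime] (hp2 : p ≠ 2) (K : ℤ) :
    (rootCount K p : ℤ) = quadraticChar (ZMod p) K + 1 := by
  rw [← quadraticChar_card_sqrts (by rwa [ZMod.ringChar_zmod_n]), rootCount_eq_card]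
  congr 2
  ext v
  simp

/-- The exponential sum over the square roots of `K` modulo `e`, at the frequency `h`. -/
noncomputable def expSum (e : ℕ) (h K : ℤ) : ℂ :=
  ∑ v ∈ (range e).filter (fun v : ℕ => (e : ℤ) ∣ (v : ℤ) ^ 2 - K),
    Complex.exp (2 * Real.pi * Complex.I * ((h * v : ℤ) : ℂ) / e)

lemma expSum_eq (e : ℕ) [NeZero e] (h K : ℤ) :
    expSum e h K = ∑ v : ZMod e with v ^ 2 = (K : ZMod e), ZMod.stdAddChar ((h : ZMod e) * v) := by
  rw [expSum]
  have hiff : ∀ v : ZMod e, (e : ℤ) ∣ (v.val : ℤ) ^ 2 - K ↔ v ^ 2 = (K : ZMod e) := by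
    intro v
    rw [← ZMod.intCast_zmod_eq_zero_iff_dvd]
    push_cast
    rw [ZMod.natCast_val, ZMod.cast_id', id, sub_eq_zero]
  refine sum_bij' (fun v _ => (v : ZMod e)) (fun v _ => v.val) ?_ ?_ ?_ ?_ ?_
  · intro v hv
    simp only [mem_filter, mem_range, mem_univ, true_and] at hv ⊢
    rw [← hiff, ZMod.val_cast_of_lt hv.1]
    exact hv.2
  · intro v hv
    simp only [mem_filter, mem_range, mem_univ, true_and] at hv ⊢
    exact ⟨ZMod.val_lt v, (hiff v).2 hv⟩
  · intro v hv
    simp only [mem_filter, mem_range] at hv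
    exact ZMod.val_cast_of_lt hv.1
  · intro v hv
    simp
  · intro v hv
    rw [show (h : ZMod e) * (v : ZMod e) = ((h * v : ℤ) : ZMod e) by push_cast; rfl,
      ZMod.stdAddChar_coe]

lemma expSum_congr {e : ℕ} {h h' K K' : ℤ} (hh : (e : ℤ) ∣ h - h') (hK : (e : ℤ) ∣ K - K') :
    expSum e h K = expSum e h' K' := by
  rcases Nat.eq_zero_or_pos e with rfl | he
  · simp [expSum]
  haveI : NeZero e := ⟨he.ne'⟩
  have h1 : (h : ZMod e) = h' := by
    rw [← sub_eq_zero, ← Int.cast_sub, ZMod.intCast_zmod_eq_zero_iff_dvd]; exact hh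
  have h2 : (K : ZMod e) = K' := by
    rw [← sub_eq_zero, ← Int.cast_sub, ZMod.intCast_zmod_eq_zero_iff_dvd]; exact hK
  rw [expSum_eq, expSum_eq, h1, h2]

lemma rootCount_congr {e : ℕ} {K K' : ℤ} (hK : (e : ℤ) ∣ K - K') :
    rootCount K e = rootCount K' e := by
  have h2 : (K : ZMod e) = K' := by
    rw [← sub_eq_zero, ← Int.cast_sub, ZMod.intCast_zmod_eq_zero_iff_dvd]; exact hK
  rw [rootCount, rootCount, h2]

lemma norm_expSum_le (e : ℕ) [NeZero e] (h K : ℤ) : ‖expSum e h K‖ ≤ rootCount K e := by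
  rw [expSum_eq, rootCount_eq_card]
  refine (norm_sum_le _ _).trans ?_
  rw [card_eq_sum_ones]
  push_cast
  exact sum_le_sum fun v _ => (AddChar.norm_apply _ _).le

lemma expSum_mul {a b : ℕ} [NeZero a] [NeZero b] (hab : a.Coprime b) (a' b' : ℤ)
    (hbez : a' * a + b' * b = 1) (h K : ℤ) :
    expSum (a * b) h K = expSum a (h * b') K * expSum b (h * a') K := by
  have ha : (a : ℂ) ≠ 0 := by exact_mod_cast NeZero.ne a
  have hb : (b : ℂ) ≠ 0 := by exact_mod_cast NeZero.ne b
  rw [expSum_eq (a * b), expSum_eq a, expSum_eq b, sum_mul_sum, ← sum_product']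
  refine sum_equiv (ZMod.chineseRemainder hab).toEquiv ?_ ?_
  · intro v
    simp only [mem_filter, mem_univ, true_and, mem_product]
    rw [← (ZMod.chineseRemainder hab).injective.eq_iff, map_pow, map_intCast, Prod.ext_iff]
    simp
  · intro v _
    obtain ⟨x, rfl⟩ := ZMod.intCast_surjective v
    have h1 : (ZMod.chineseRemainder hab).toEquiv (x : ZMod (a * b)) = ((x : ZMod a), (x : ZMod b)) := by
      have := map_intCast (ZMod.chineseRemainder hab) x
      simp only [RingEquiv.toEquiv_eq_coe, EquivLike.coe_coe]
      rw [this]; rfl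
    rw [h1]
    simp only
    rw [← Int.cast_mul, ← Int.cast_mul, ← Int.cast_mul, ZMod.stdAddChar_coe, ZMod.stdAddChar_coe,
      ZMod.stdAddChar_coe, ← Complex.exp_add]
    congr 1
    have hc : (a' : ℂ) * a + b' * b = 1 := by exact_mod_cast hbez
    push_cast
    field_simp
    linear_combination (-(h : ℂ) * x) * hc

/-- The complete sum over `t` modulo `e` of the exponential sums attached to `D - t ^ 2`. -/
noncomputable def expSumAvg (e : ℕ) (h D : ℤ) : ℝ :=
  ∑ t ∈ range e, ‖expSum e h (D - (t : ℤ) ^ 2)‖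

lemma sum_range_eq_sum_zmod (e : ℕ) [NeZero e] (f : ℤ → ℝ)
    (hf : ∀ s t : ℤ, (e : ℤ) ∣ s - t → f s = f t) :
    ∑ t ∈ range e, f t = ∑ t : ZMod e, f t.val := by
  refine sum_bij' (fun v _ => (v : ZMod e)) (fun v _ => v.val) (fun _ _ => mem_univ _)
    (fun v _ => mem_range.2 (ZMod.val_lt v)) (fun v hv => ZMod.val_cast_of_lt (mem_range.1 hv))
    (fun v _ => by simp) (fun v hv => ?_)
  rw [ZMod.val_cast_of_lt (mem_range.1 hv)]

lemma sum_range_mul_coprime {a b : ℕ} [NeZero a] [NeZero b] (hab : a.Coprime b) (f g : ℤ → ℝ)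
    (hf : ∀ s t : ℤ, (a : ℤ) ∣ s - t → f s = f t) (hg : ∀ s t : ℤ, (b : ℤ) ∣ s - t → g s = g t) :
    ∑ t ∈ range (a * b), f t * g t = (∑ t ∈ range a, f t) * ∑ t ∈ range b, g t := by
  rw [sum_range_eq_sum_zmod (a * b) (fun t => f t * g t), sum_range_eq_sum_zmod a f hf,
    sum_range_eq_sum_zmod b g hg, sum_mul_sum, ← sum_product', univ_product_univ]
  · refine sum_equiv (ZMod.chineseRemainder hab).toEquiv (by simp) ?_
    intro v _
    obtain ⟨x, rfl⟩ := ZMod.intCast_surjective v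
    have h1 : (ZMod.chineseRemainder hab).toEquiv (x : ZMod (a * b)) = ((x : ZMod a), (x : ZMod b)) := by
      have := map_intCast (ZMod.chineseRemainder hab) x
      simp only [RingEquiv.toEquiv_eq_coe, EquivLike.coe_coe]
      rw [this]; rfl
    rw [h1]
    have key : ∀ (c : ℕ) [NeZero c], (c : ℤ) ∣ ((x : ZMod c).val : ℤ) - x := by
      intro c _
      rw [ZMod.val_intCast]
      exact ⟨-(x / c), by linarith [Int.emod_add_mul_ediv x c]⟩
    have k1 := key (a * b)
    push_cast at k1
    simp only
    rw [hf _ x (dvd_of_mul_right_dvd k1), hg _ x (dvd_of_mul_left_dvd k1), hf _ x (key a),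
      hg _ x (key b)]
  · intro s t hst
    push_cast at hst
    rw [hf s t (dvd_of_mul_right_dvd hst), hg s t (dvd_of_mul_left_dvd hst)]

lemma norm_expSum_periodic (e : ℕ) (h D : ℤ) (s t : ℤ) (hst : (e : ℤ) ∣ s - t) :
    ‖expSum e h (D - s ^ 2)‖ = ‖expSum e h (D - t ^ 2)‖ := by
  rw [expSum_congr (h' := h) (K' := D - t ^ 2) (by simp)]
  rw [show D - s ^ 2 - (D - t ^ 2) = (s - t) * (-(s + t)) by ring]
  exact hst.mul_right _

lemma expSumAvg_mul {a b : ℕ} [NeZero a] [NeZero b] (hab : a.Coprime b) (a' b' : ℤ)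
    (hbez : a' * a + b' * b = 1) (h D : ℤ) :
    expSumAvg (a * b) h D = expSumAvg a (h * b') D * expSumAvg b (h * a') D := by
  rw [expSumAvg, expSumAvg, expSumAvg, ← sum_range_mul_coprime hab
    (fun t => ‖expSum a (h * b') (D - t ^ 2)‖) (fun t => ‖expSum b (h * a') (D - t ^ 2)‖)
    (norm_expSum_periodic _ _ _) (norm_expSum_periodic _ _ _)]
  refine sum_congr rfl fun t _ => ?_
  rw [expSum_mul hab a' b' hbez, norm_mul]

/-- The complete sum of `ρ(D - t²) - 1` modulo an odd prime is at most one in size. -/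
lemma abs_sum_rootCount_sub_one_le {p : ℕ} [Fact p.Prime] (hp2 : p ≠ 2) {D : ℤ}
    (hD : ¬ (p : ℤ) ∣ D) :
    |∑ t ∈ range p, ((rootCount (D - (t : ℤ) ^ 2) p : ℝ) - 1)| ≤ 1 := by
  have hchar : ringChar (ZMod p) ≠ 2 := by rwa [ZMod.ringChar_zmod_n]
  set χ := quadraticChar (ZMod p) with hχ
  rw [sum_range_eq_sum_zmod p (fun t => (rootCount (D - t ^ 2) p : ℝ) - 1)]
  · have h1 : ∀ t : ZMod p, (rootCount (D - (t.val : ℤ) ^ 2) p : ℝ) - 1 =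
        ((χ ((D : ZMod p) - t ^ 2) : ℤ) : ℝ) := by
      intro t
      have := rootCount_prime hp2 (D - (t.val : ℤ) ^ 2)
      have h3 : ((D - (t.val : ℤ) ^ 2 : ℤ) : ZMod p) = D - t ^ 2 := by
        push_cast; rw [ZMod.natCast_val, ZMod.cast_id', id]
      rw [h3] at this
      have h2 : (rootCount (D - (t.val : ℤ) ^ 2) p : ℝ) =
        (((rootCount (D - (t.val : ℤ) ^ 2) p : ℤ)) : ℝ) := by push_cast; rfl
      rw [h2, this]; push_cast; ring
    rw [sum_congr rfl fun t _ => h1 t]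
    have hD' : (D : ZMod p) ≠ 0 := by
      rw [Ne, ZMod.intCast_zmod_eq_zero_iff_dvd]; exact hD
    have hnt : χ ≠ 1 := quadraticChar_ne_one hchar
    have h2 : ∑ t : ZMod p, χ ((D : ZMod p) - t ^ 2) = ∑ s : ZMod p, (χ s + 1) * χ ((D : ZMod p) - s) := by
      rw [← sum_fiberwise univ (fun t : ZMod p => t ^ 2)]
      refine sum_congr rfl fun s _ => ?_
      rw [← quadraticChar_card_sqrts hchar s]
      rw [sum_congr rfl (g := fun _ => χ ((D : ZMod p) - s))
        (fun t ht => by rw [(mem_filter.1 ht).2]), sum_const, nsmul_eq_mul]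
      congr 3
      ext v; simp
    have h3 : ∑ s : ZMod p, χ ((D : ZMod p) - s) = 0 := by
      rw [← MulChar.sum_eq_zero_of_ne_one hnt]
      exact (Equiv.subLeft (D : ZMod p)).sum_comp (fun s => χ s)
    have h4 : ∑ s : ZMod p, χ s * χ ((D : ZMod p) - s) = jacobiSum χ χ := by
      rw [jacobiSum, ← Equiv.sum_comp (Equiv.mulLeft₀ (D : ZMod p) hD')]
      refine sum_congr rfl fun s _ => ?_
      rw [show (Equiv.mulLeft₀ (D : ZMod p) hD') s = D * s from rfl]
      rw [show (D : ZMod p) - D * s = D * (1 - s) by ring, map_mul, map_mul]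
      have h5 : χ (D : ZMod p) * χ (D : ZMod p) = 1 := by
        rw [← sq]; exact quadraticChar_sq_one hD'
      linear_combination (χ s * χ (1 - s)) * h5
    have h5 : jacobiSum χ χ = -χ (-1) := by
      have := jacobiSum_nontrivial_inv hnt
      rwa [(quadraticChar_isQuadratic (ZMod p)).inv] at this
    have h6 : ∑ t : ZMod p, χ ((D : ZMod p) - t ^ 2) = -χ (-1) := by
      rw [h2, ← h5, ← h4]
      simp only [add_mul, one_mul, sum_add_distrib, h3, add_zero]
    rw [← Int.cast_sum, h6, ← Int.cast_abs]
    have h7 : |-χ (-1)| ≤ 1 := by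
      rcases quadraticChar_isQuadratic (ZMod p) (-1) with h | h | h <;> simp [hχ, h]
    exact_mod_cast h7
  · intro s t hst
    rw [rootCount_congr (K' := D - t ^ 2)]
    rw [show D - s ^ 2 - (D - t ^ 2) = (s - t) * (-(s + t)) by ring]
    exact hst.mul_right _

lemma rootCount_periodic (e : ℕ) (D s t : ℤ) (hst : (e : ℤ) ∣ s - t) :
    rootCount (D - s ^ 2) e = rootCount (D - t ^ 2) e := by
  rw [rootCount_congr (K' := D - t ^ 2)]
  rw [show D - s ^ 2 - (D - t ^ 2) = (s - t) * (-(s + t)) by ring]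
  exact hst.mul_right _

lemma norm_expSum_le_sum_abs_re (e : ℕ) [NeZero e] (h K : ℤ) :
    ‖expSum e h K‖ ≤ ∑ v : ZMod e with v ^ 2 = (K : ZMod e),
      |(ZMod.stdAddChar ((h : ZMod e) * v)).re| := by
  have h1 : expSum e h K = ∑ v : ZMod e with v ^ 2 = (K : ZMod e),
      (((ZMod.stdAddChar ((h : ZMod e) * v)).re : ℝ) : ℂ) := by
    have h2 : expSum e h K = ∑ v : ZMod e with v ^ 2 = (K : ZMod e),
        (starRingEnd ℂ) (ZMod.stdAddChar ((h : ZMod e) * v)) := by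
      rw [expSum_eq]
      refine sum_bij' (fun v _ => -v) (fun v _ => -v) ?_ ?_ (by simp) (by simp) ?_
      · intro v hv; simpa using hv
      · intro v hv; simpa using hv
      · intro v _
        rw [mul_neg, AddChar.map_neg_eq_conj, Complex.conj_conj]
    have h3 : expSum e h K = (expSum e h K + expSum e h K) / 2 := by ring
    rw [h3]
    nth_rewrite 2 [h2]
    rw [expSum_eq, ← sum_add_distrib, sum_div]
    refine sum_congr rfl fun v _ => ?_
    rw [Complex.add_conj]; push_cast; ring
  rw [h1]
  refine (norm_sum_le _ _).trans (sum_le_sum fun v _ => ?_)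
  rw [Complex.norm_real, Real.norm_eq_abs]

lemma sum_re_stdAddChar_mul_eq_zero {p : ℕ} [Fact p.Prime] {a : ZMod p} (ha : a ≠ 0) :
    ∑ v : ZMod p, (ZMod.stdAddChar (a * v)).re = 0 := by
  have h := AddChar.sum_mulShift a (ZMod.isPrimitive_stdAddChar p)
  rw [if_neg ha] at h
  rw [← Complex.re_sum]
  have : ∑ v : ZMod p, ZMod.stdAddChar (a * v) = (0 : ℂ) := by
    refine (sum_congr rfl fun v _ => by rw [mul_comm]).trans (h.trans Nat.cast_zero)
  rw [this]; rfl

lemma sum_range_rootCount_eq_zmod (p : ℕ) [NeZero p] (D : ℤ) :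
    ∑ t ∈ range p, (rootCount (D - (t : ℤ) ^ 2) p : ℝ) =
      ∑ t : ZMod p, (rootCount (D - (t.val : ℤ) ^ 2) p : ℝ) :=
  sum_range_eq_sum_zmod p (fun t => (rootCount (D - t ^ 2) p : ℝ))
    fun s t hst => by rw [rootCount_periodic p D s t hst]

lemma re_sq_of_norm_eq_one {w : ℂ} (hw : ‖w‖ = 1) : w.re ^ 2 = (1 + (w ^ 2).re) / 2 := by
  have : w.re ^ 2 + w.im ^ 2 = 1 := by
    have := Complex.sq_norm w
    rw [hw, Complex.normSq_apply] at this
    nlinarith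
  rw [sq w, Complex.mul_re]
  linarith [this, sq w.im, sq w.re]

/-- Averaged over `t`, the exponential sum over the two roots of `v² = D - t²` modulo a prime
is bounded by a constant smaller than one. -/
lemma expSumAvg_prime_le {p : ℕ} [Fact p.Prime] (hp2 : p ≠ 2) {D h : ℤ} (hD : ¬ (p : ℤ) ∣ D)
    (hh : ¬ (p : ℤ) ∣ h) : expSumAvg p h D ≤ 0.93 * p + 1 := by
  have hh' : (h : ZMod p) ≠ 0 := by rwa [Ne, ZMod.intCast_zmod_eq_zero_iff_dvd]
  have h20 : (2 : ZMod p) ≠ 0 := by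
    intro h0
    have : ((2 : ℕ) : ZMod p) = 0 := by exact_mod_cast h0
    rw [ZMod.natCast_eq_zero_iff] at this
    exact hp2 ((Nat.prime_dvd_prime_iff_eq Fact.out Nat.prime_two).1 this)
  set W : ZMod p → ℂ := fun v => ZMod.stdAddChar ((h : ZMod p) * v) with hW
  set c : ZMod p → ℝ := fun v => (rootCount (D - (v.val : ℤ) ^ 2) p : ℝ) with hc
  have hval : ∀ v : ZMod p, ((v.val : ℤ) : ZMod p) = v := fun v => by simp
  have hnorm : ∀ v, ‖W v‖ = 1 := fun v => AddChar.norm_apply _ _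
  have hW2 : ∀ v, W v ^ 2 = ZMod.stdAddChar ((2 * h : ZMod p) * v) := by
    intro v
    rw [hW]; simp only
    rw [← AddChar.map_nsmul_eq_pow]; congr 1; rw [nsmul_eq_mul]; push_cast; ring
  have hW4 : ∀ v, (W v ^ 2) ^ 2 = ZMod.stdAddChar ((2 * (2 * h) : ZMod p) * v) := by
    intro v
    rw [hW2, ← AddChar.map_nsmul_eq_pow]; congr 1; rw [nsmul_eq_mul]; push_cast; ring
  set y : ZMod p → ℝ := fun v => (W v ^ 2).re with hy
  have hx : ∀ v, (W v).re ^ 2 = (1 + y v) / 2 := fun v => re_sq_of_norm_eq_one (hnorm v)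
  have hysq : ∀ v, y v ^ 2 = (1 + ((W v ^ 2) ^ 2).re) / 2 := fun v =>
    re_sq_of_norm_eq_one (by rw [norm_pow, hnorm, one_pow])
  have hy0 : ∑ v, y v = 0 := by
    simp only [hy, hW2]
    exact sum_re_stdAddChar_mul_eq_zero (mul_ne_zero h20 hh')
  have hy2 : ∑ v, y v ^ 2 = p / 2 := by
    simp only [hysq, hW4]
    rw [← sum_div, sum_add_distrib,
      sum_re_stdAddChar_mul_eq_zero (mul_ne_zero h20 (mul_ne_zero h20 hh'))]
    simp [ZMod.card]
  have hc1 : ∀ v, |c v - 1| ≤ 1 := by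
    intro v
    have h1 : rootCount (D - (v.val : ℤ) ^ 2) p ≤ 2 := rootCount_prime_le_two Fact.out _
    have h2 : (rootCount (D - (v.val : ℤ) ^ 2) p : ℝ) ≤ 2 := by exact_mod_cast h1
    have h3 : (0 : ℝ) ≤ (rootCount (D - (v.val : ℤ) ^ 2) p : ℝ) := by positivity
    rw [abs_le]; constructor <;> simp only [hc] <;> linarith
  have hcs : ∑ v, c v ≤ p + 1 := by
    have := (abs_le.1 (abs_sum_rootCount_sub_one_le hp2 hD)).2
    rw [sum_sub_distrib, sum_range_rootCount_eq_zmod, sum_const, card_range, nsmul_eq_mul,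
      mul_one] at this
    simp only [hc]; linarith
  have hcy : ∑ v, c v * y v ≤ 0.708 * p := by
    have e1 : ∑ v, c v * y v = ∑ v, (c v - 1) * y v := by
      simp only [sub_mul, one_mul, sum_sub_distrib, hy0, sub_zero]
    rw [e1]
    calc ∑ v, (c v - 1) * y v ≤ ∑ v, (y v ^ 2 / 0.7 + 0.7) / 2 := by
          refine sum_le_sum fun v _ => ?_
          have h1 : (c v - 1) * y v ≤ |y v| := by
            calc (c v - 1) * y v ≤ |(c v - 1) * y v| := le_abs_self _
              _ = |c v - 1| * |y v| := abs_mul _ _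
              _ ≤ 1 * |y v| := by gcongr; exact hc1 v
              _ = _ := one_mul _
          have h2 : |y v| ^ 2 = y v ^ 2 := sq_abs _
          rw [← h2]
          have h3 := sq_nonneg (|y v| - 0.7)
          norm_num at h3 ⊢
          linarith
      _ = (p / 2 / 0.7 + 0.7 * p) / 2 := by
          rw [← sum_div, sum_add_distrib, ← sum_div, hy2]; simp [ZMod.card]; ring
      _ ≤ 0.708 * p := by
          have : (0 : ℝ) ≤ p := by positivity
          norm_num
          linarith
  have hstep : expSumAvg p h D ≤ ∑ v, c v * |(W v).re| := by
    rw [expSumAvg, sum_range_eq_sum_zmod p (fun t => ‖expSum p h (D - t ^ 2)‖)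
      (norm_expSum_periodic _ _ _)]
    calc ∑ t : ZMod p, ‖expSum p h (D - (t.val : ℤ) ^ 2)‖
        ≤ ∑ t : ZMod p, ∑ v : ZMod p, if v ^ 2 = (D : ZMod p) - t ^ 2 then |(W v).re| else 0 := by
          refine sum_le_sum fun t _ => ?_
          refine (norm_expSum_le_sum_abs_re p h _).trans_eq ?_
          rw [sum_filter]
          refine sum_congr rfl fun v _ => ?_
          congr 1
          rw [Int.cast_sub, Int.cast_pow, hval]
      _ = ∑ v : ZMod p, c v * |(W v).re| := by
          rw [sum_comm]
          refine sum_congr rfl fun v _ => ?_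
          simp only [hc]
          rw [rootCount_eq_card, ← sum_filter, sum_const, nsmul_eq_mul]
          congr 3
          ext t
          simp only [mem_filter, mem_univ, true_and]
          rw [Int.cast_sub, Int.cast_pow, hval]
          constructor <;> intro h <;> linear_combination h
  have hc0 : ∀ v, 0 ≤ c v := fun v => by simp only [hc]; positivity
  calc expSumAvg p h D ≤ ∑ v, c v * |(W v).re| := hstep
    _ ≤ ∑ v, c v * (((1 + y v) / 2 / 0.924 + 0.924) / 2) := by
        refine sum_le_sum fun v _ => mul_le_mul_of_nonneg_left ?_ (hc0 v)
        rw [← hx, ← sq_abs]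
        have h3 := sq_nonneg (|(W v).re| - 0.924)
        norm_num at h3 ⊢
        rw [sub_sq, sq_abs] at h3
        linarith
    _ = (1 / 2 / 0.924 + 0.924) / 2 * ∑ v, c v + 1 / 2 / 0.924 / 2 * ∑ v, c v * y v := by
        rw [mul_sum, mul_sum, ← sum_add_distrib]
        exact sum_congr rfl fun v _ => by ring
    _ ≤ (1 / 2 / 0.924 + 0.924) / 2 * (p + 1) + 1 / 2 / 0.924 / 2 * (0.708 * p) := by gcongr
    _ ≤ 0.93 * p + 1 := by
        have : (0 : ℝ) ≤ p := by positivity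
        norm_num
        linarith

lemma expSumAvg_nonneg (e : ℕ) (h D : ℤ) : 0 ≤ expSumAvg e h D :=
  sum_nonneg fun _ _ => norm_nonneg _

lemma expSumAvg_le_sum_rootCount (e : ℕ) [NeZero e] (h D : ℤ) :
    expSumAvg e h D ≤ ∑ t ∈ range e, (rootCount (D - (t : ℤ) ^ 2) e : ℝ) :=
  sum_le_sum fun _ _ => norm_expSum_le _ _ _

lemma expSumAvg_prime_le_add_one {p : ℕ} [Fact p.Prime] (hp2 : p ≠ 2) {D : ℤ}
    (hD : ¬ (p : ℤ) ∣ D) (h : ℤ) : expSumAvg p h D ≤ p + 1 := by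
  refine (expSumAvg_le_sum_rootCount p h D).trans ?_
  have := (abs_le.1 (abs_sum_rootCount_sub_one_le hp2 hD)).2
  rw [sum_sub_distrib] at this
  simp at this
  linarith

lemma card_range_dvd_sub_sq_le {p : ℕ} (hp : p.Prime) (D : ℤ) (j : ℕ) :
    #{t ∈ range (p ^ (j + 1)) | (p : ℤ) ∣ D - ((t : ℕ) : ℤ) ^ 2} ≤ 2 * p ^ j := by
  haveI : NeZero p := ⟨hp.ne_zero⟩
  calc #{t ∈ range (p ^ (j + 1)) | (p : ℤ) ∣ D - ((t : ℕ) : ℤ) ^ 2}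
      ≤ #((univ.filter fun v : ZMod p => v ^ 2 = (D : ZMod p)) ×ˢ range (p ^ j)) := by
        refine card_le_card_of_injOn (fun t => ((t : ZMod p), t / p)) ?_ ?_
        · intro t ht
          simp only [coe_filter, mem_range, Set.mem_setOf_eq] at ht
          simp only [coe_product, Set.mem_prod, coe_filter, mem_univ, true_and, Set.mem_setOf_eq,
            coe_range, Set.mem_Iio]
          refine ⟨?_, ?_⟩
          · have := (ZMod.intCast_zmod_eq_zero_iff_dvd _ p).2 ht.2
            push_cast at this
            linear_combination -this
          · rw [Nat.div_lt_iff_lt_mul hp.pos, ← pow_succ]; exact ht.1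
        · intro s _ t _ hst
          simp only [Prod.mk.injEq] at hst
          have h1 := (ZMod.natCast_eq_natCast_iff' _ _ _).1 hst.1
          rw [← Nat.div_add_mod s p, ← Nat.div_add_mod t p, hst.2, h1]
    _ ≤ 2 * p ^ j := by
        rw [card_product, card_range, ← rootCount_eq_card]
        gcongr
        exact rootCount_prime_le_two hp D

lemma expSumAvg_prime_pow_le {p : ℕ} (hp : p.Prime) (hp2 : p ≠ 2) (h D : ℤ) (j : ℕ) :
    expSumAvg (p ^ (j + 1)) h D ≤ 2 * p ^ (j + 1) + 4 * p ^ (j + (j + 1) / 2) := by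
  haveI : NeZero (p ^ (j + 1)) := ⟨(pow_pos hp.pos _).ne'⟩
  refine (expSumAvg_le_sum_rootCount _ h D).trans ?_
  have hcard : (#{t ∈ range (p ^ (j + 1)) | (p : ℤ) ∣ D - ((t : ℕ) : ℤ) ^ 2} : ℝ) ≤ 2 * p ^ j := by
    exact_mod_cast card_range_dvd_sub_sq_le hp D j
  rw [← sum_filter_add_sum_filter_not _ (fun t : ℕ => (p : ℤ) ∣ D - (t : ℤ) ^ 2)]
  have h1 : ∑ t ∈ range (p ^ (j + 1)) with (p : ℤ) ∣ D - ((t : ℕ) : ℤ) ^ 2,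
      (rootCount (D - (t : ℤ) ^ 2) (p ^ (j + 1)) : ℝ) ≤ 2 * p ^ j * (2 * p ^ ((j + 1) / 2)) := by
    calc _ ≤ ∑ t ∈ range (p ^ (j + 1)) with (p : ℤ) ∣ D - ((t : ℕ) : ℤ) ^ 2,
          (2 * p ^ ((j + 1) / 2) : ℝ) := by
          refine sum_le_sum fun t _ => ?_
          exact_mod_cast rootCount_prime_pow_le hp _ _
      _ ≤ _ := by
          rw [sum_const, nsmul_eq_mul]; gcongr
  have h2 : ∑ t ∈ range (p ^ (j + 1)) with ¬ (p : ℤ) ∣ D - ((t : ℕ) : ℤ) ^ 2,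
      (rootCount (D - (t : ℤ) ^ 2) (p ^ (j + 1)) : ℝ) ≤ p ^ (j + 1) * 2 := by
    calc _ ≤ ∑ t ∈ range (p ^ (j + 1)) with ¬ (p : ℤ) ∣ D - ((t : ℕ) : ℤ) ^ 2, (2 : ℝ) := by
          refine sum_le_sum fun t ht => ?_
          exact_mod_cast rootCount_prime_pow_le_two hp hp2 (mem_filter.1 ht).2 _
      _ ≤ _ := by
          rw [sum_const, nsmul_eq_mul]; gcongr
          refine (Nat.cast_le.2 (card_filter_le _ _)).trans ?_
          rw [card_range]; push_cast; rfl
  calc _ ≤ 2 * (p : ℝ) ^ j * (2 * p ^ ((j + 1) / 2)) + p ^ (j + 1) * 2 := add_le_add h1 h2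
    _ = _ := by rw [pow_add (p : ℝ) j ((j + 1) / 2)]; ring

lemma norm_geom_sum_stdAddChar_le {e : ℕ} [NeZero e] {h : ℕ} (h0 : 0 < h) (he : h < e) (a : ℤ)
    (L : ℕ) : ‖∑ k ∈ range L, ZMod.stdAddChar ((h : ZMod e) * ((a + (k : ℤ) : ℤ) : ZMod e))‖ ^ 2 ≤
      (e : ℝ) ^ 2 / 4 * (1 / (h : ℝ) ^ 2 + 1 / ((e - h : ℕ) : ℝ) ^ 2) := by
  set w : ℂ := ZMod.stdAddChar (h : ZMod e) with hw
  have hepos : (0 : ℝ) < e := by exact_mod_cast h0.trans he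
  have h0' : (0 : ℝ) < h := by exact_mod_cast h0
  have he' : (h : ℝ) < e := by exact_mod_cast he
  have hwn : ‖w‖ = 1 := AddChar.norm_apply _ _
  have hw1 : ‖w - 1‖ = 2 * Real.sin (Real.pi * (h / e)) := by
    have h1 : w = Complex.exp (Complex.I * ((2 * Real.pi * (h / e) : ℝ) : ℂ)) := by
      have := ZMod.stdAddChar_coe (N := e) (h : ℤ)
      rw [hw]
      push_cast at this
      rw [this]
      congr 1; push_cast; ring
    rw [h1, Complex.norm_exp_I_mul_ofReal_sub_one, Real.norm_eq_abs, abs_of_nonneg]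
    · congr 2; ring
    · have : 0 ≤ Real.sin (2 * Real.pi * (h / e) / 2) := by
        apply Real.sin_nonneg_of_nonneg_of_le_pi
        · positivity
        · have : (h : ℝ) / e ≤ 1 := by rw [div_le_one hepos]; exact he'.le
          nlinarith [Real.pi_pos]
      positivity
  have hsum : ‖∑ k ∈ range L, ZMod.stdAddChar ((h : ZMod e) * ((a + (k : ℤ) : ℤ) : ZMod e))‖ *
      ‖w - 1‖ ≤ 2 := by
    have h1 : ∀ k ∈ range L, (ZMod.stdAddChar ((h : ZMod e) * ((a + (k : ℤ) : ℤ) : ZMod e)) : ℂ) =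
        ZMod.stdAddChar ((h : ZMod e) * (a : ZMod e)) * w ^ k := by
      intro k _
      rw [hw, ← AddChar.map_nsmul_eq_pow, ← AddChar.map_add_eq_mul]
      congr 1; rw [nsmul_eq_mul]; push_cast; ring
    rw [sum_congr rfl h1, ← mul_sum, norm_mul, AddChar.norm_apply, one_mul, ← norm_mul, geom_sum_mul]
    refine (norm_sub_le _ _).trans ?_
    rw [norm_pow, hwn]; norm_num
  have key : ∀ x : ℝ, 0 < x → x ≤ 1 / 2 → Real.sin (Real.pi * (h / e)) = Real.sin (Real.pi * x) →
      ‖∑ k ∈ range L, ZMod.stdAddChar ((h : ZMod e) * ((a + (k : ℤ) : ℤ) : ZMod e))‖ ^ 2 ≤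
        1 / 4 * (1 / x ^ 2) := by
    intro x hx hx2 hsin
    have h2 : 2 * x ≤ Real.sin (Real.pi * x) := by
      have := Real.mul_le_sin (x := Real.pi * x) (by positivity) (by nlinarith [Real.pi_pos])
      rwa [show 2 / Real.pi * (Real.pi * x) = 2 * x by field_simp] at this
    rw [hw1, hsin] at hsum
    set N := ‖∑ k ∈ range L, ZMod.stdAddChar ((h : ZMod e) * ((a + (k : ℤ) : ℤ) : ZMod e))‖
    have hN : 0 ≤ N := norm_nonneg _
    have h3 : N * (2 * x) ≤ 1 := by nlinarith
    have h4 : (N * (2 * x)) ^ 2 ≤ 1 := by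
      rw [sq_le_one_iff₀ (by positivity)]; exact h3
    rw [show 1 / 4 * (1 / x ^ 2) = 1 / (4 * x ^ 2) by field_simp, le_div_iff₀ (by positivity)]
    nlinarith
  have hsub : ((e - h : ℕ) : ℝ) = e - h := by rw [Nat.cast_sub he.le]
  have hsubpos : (0 : ℝ) < e - h := by linarith
  rw [hsub]
  rcases le_total (2 * (h : ℝ)) e with hle | hle
  · refine (key (h / e) (by positivity) ?_ rfl).trans ?_
    · rw [div_le_iff₀ hepos]; linarith
    · have : 0 ≤ (e : ℝ) ^ 2 / 4 * (1 / (e - h) ^ 2) := by positivity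
      rw [mul_add]
      have h5 : 1 / 4 * (1 / ((h : ℝ) / e) ^ 2) = (e : ℝ) ^ 2 / 4 * (1 / (h : ℝ) ^ 2) := by field_simp
      linarith
  · refine (key ((e - h) / e) (by positivity) ?_ ?_).trans ?_
    · rw [div_le_iff₀ hepos]; linarith
    · rw [← Real.sin_pi_sub]; congr 1; field_simp
    · have : 0 ≤ (e : ℝ) ^ 2 / 4 * (1 / (h : ℝ) ^ 2) := by positivity
      rw [mul_add]
      have h5 : 1 / 4 * (1 / (((e : ℝ) - h) / e) ^ 2) = (e : ℝ) ^ 2 / 4 * (1 / (e - h : ℝ) ^ 2) := by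
        field_simp
      linarith

lemma sum_range_cast_zmod {M : Type*} [AddCommMonoid M] (e : ℕ) [NeZero e] (f : ZMod e → M) :
    ∑ h ∈ range e, f (h : ZMod e) = ∑ h : ZMod e, f h := by
  refine sum_bij' (fun v _ => (v : ZMod e)) (fun v _ => v.val) (fun _ _ => mem_univ _)
    (fun v _ => mem_range.2 (ZMod.val_lt v)) (fun v hv => ZMod.val_cast_of_lt (mem_range.1 hv))
    (fun v _ => by simp) (fun v hv => rfl)

lemma expSum_zero (e : ℕ) [NeZero e] (K : ℤ) : expSum e 0 K = rootCount K e := by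
  rw [expSum_eq, rootCount_eq_card]
  simp

lemma indicator_eq_sum_stdAddChar {e : ℕ} [NeZero e] (K α c c' : ℤ) (hc : (e : ℤ) ∣ c * c' - 1)
    (x : ℤ) : (e : ℂ) * (if (e : ℤ) ∣ (α + c * x) ^ 2 - K then 1 else 0) =
      ∑ h ∈ range e, expSum e (h * c') K * ZMod.stdAddChar ((h : ZMod e) * ((c' * α + x : ℤ) : ZMod e)) := by
  have hcc : (c : ZMod e) * c' = 1 := by
    rw [← ZMod.intCast_zmod_eq_zero_iff_dvd] at hc
    push_cast at hc; linear_combination hc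
  have h1 : ∀ h : ℕ, expSum e (h * c') K * ZMod.stdAddChar ((h : ZMod e) * ((c' * α + x : ℤ) : ZMod e)) =
      ∑ v : ZMod e with v ^ 2 = (K : ZMod e),
        ZMod.stdAddChar ((h : ZMod e) * ((c' : ZMod e) * v + (c' : ZMod e) * (α : ZMod e) + (x : ZMod e))) := by
    intro h
    rw [expSum_eq, sum_mul]
    refine sum_congr rfl fun v _ => ?_
    rw [← AddChar.map_add_eq_mul]; congr 1; push_cast; ring
  rw [sum_congr rfl fun h _ => h1 h, sum_comm]
  have h2 : ∀ v : ZMod e, ∑ h ∈ range e,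
      ZMod.stdAddChar ((h : ZMod e) * ((c' : ZMod e) * v + (c' : ZMod e) * (α : ZMod e) + (x : ZMod e))) =
        if (c' : ZMod e) * v + (c' : ZMod e) * (α : ZMod e) + (x : ZMod e) = 0 then (e : ℂ) else 0 := by
    intro v
    rw [sum_range_cast_zmod e fun h =>
      ZMod.stdAddChar (h * ((c' : ZMod e) * v + (c' : ZMod e) * (α : ZMod e) + (x : ZMod e))),
      AddChar.sum_mulShift _ (ZMod.isPrimitive_stdAddChar e), ZMod.card]
    split_ifs <;> simp
  have h3 : ∀ v : ZMod e, (c' : ZMod e) * v + (c' : ZMod e) * (α : ZMod e) + (x : ZMod e) = 0 ↔ -((α : ZMod e) + c * (x : ZMod e)) = v := by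
    intro v
    constructor
    · intro h
      linear_combination (-(c : ZMod e)) * h + (v + (α : ZMod e)) * hcc
    · intro h
      rw [← h]
      linear_combination (-(x : ZMod e)) * hcc
  rw [sum_congr rfl fun v _ => h2 v]
  simp only [h3]
  rw [sum_ite_eq]
  have h4 : (e : ℤ) ∣ (α + c * x) ^ 2 - K ↔ (-((α : ZMod e) + c * (x : ZMod e))) ^ 2 = (K : ZMod e) := by
    rw [← ZMod.intCast_zmod_eq_zero_iff_dvd]
    push_cast
    rw [neg_sq, sub_eq_zero]
  simp only [mem_filter, mem_univ, true_and, h4]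
  split_ifs <;> simp

lemma abs_smoothed_count_sub_le {e : ℕ} [NeZero e] (K α c c' : ℤ) (hc : (e : ℤ) ∣ c * c' - 1)
    (a : ℤ) (L j : ℕ) :
    |∑ k ∈ range L, ∑ s ∈ range j,
        (if (e : ℤ) ∣ (α + c * (a + k + s)) ^ 2 - K then (1 : ℝ) else 0) -
      rootCount K e * L * j / e| ≤
      e / 2 * ∑ h ∈ Ico 1 e, ‖expSum e (h * c') K‖ / (h : ℝ) ^ 2 := by
  have he0 : 0 < e := Nat.pos_of_ne_zero (NeZero.ne e)
  have hepos : (0 : ℝ) < e := by exact_mod_cast he0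
  set G : ℕ → ℂ := fun h => expSum e (h * c') K * ZMod.stdAddChar ((h : ZMod e) * ((c' * α : ℤ) : ZMod e)) *
    ((∑ k ∈ range L, ZMod.stdAddChar ((h : ZMod e) * ((a + (k : ℤ) : ℤ) : ZMod e))) *
      ∑ s ∈ range j, ZMod.stdAddChar ((h : ZMod e) * ((0 + (s : ℤ) : ℤ) : ZMod e))) with hG
  have h1 : (e : ℂ) * ∑ k ∈ range L, ∑ s ∈ range j,
      (if (e : ℤ) ∣ (α + c * (a + k + s)) ^ 2 - K then (1 : ℂ) else 0) = ∑ h ∈ range e, G h := by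
    simp only [mul_sum, indicator_eq_sum_stdAddChar K α c c' hc, hG]
    have h2 : ∀ k ∈ range L, ∑ s ∈ range j, ∑ h ∈ range e, expSum e (h * c') K *
        ZMod.stdAddChar ((h : ZMod e) * ((c' * α + (a + k + s) : ℤ) : ZMod e)) =
        ∑ h ∈ range e, ∑ s ∈ range j, expSum e (h * c') K *
        ZMod.stdAddChar ((h : ZMod e) * ((c' * α + (a + k + s) : ℤ) : ZMod e)) :=
      fun k _ => sum_comm
    rw [sum_congr rfl h2, sum_comm]
    refine sum_congr rfl fun h _ => ?_
    rw [sum_comm]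
    refine sum_congr rfl fun s _ => ?_
    rw [sum_mul, mul_sum]
    refine sum_congr rfl fun k _ => ?_
    rw [mul_assoc, ← AddChar.map_add_eq_mul, ← AddChar.map_add_eq_mul]
    congr 2; push_cast; ring
  have h0 : G 0 = rootCount K e * L * j := by
    simp only [hG]
    simp [expSum_zero]
    ring
  have hbound : ∀ h ∈ Ico 1 e, ‖G h‖ ≤ ‖expSum e (h * c') K‖ *
      ((e : ℝ) ^ 2 / 4 * (1 / (h : ℝ) ^ 2 + 1 / ((e - h : ℕ) : ℝ) ^ 2)) := by
    intro h hh
    rw [mem_Ico] at hh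
    simp only [hG, norm_mul, AddChar.norm_apply, mul_one]
    refine mul_le_mul_of_nonneg_left ?_ (norm_nonneg _)
    have b1 := norm_geom_sum_stdAddChar_le (e := e) (by omega) hh.2 a L
    have b2 := norm_geom_sum_stdAddChar_le (e := e) (by omega) hh.2 0 j
    nlinarith [sq_nonneg (‖∑ k ∈ range L, ZMod.stdAddChar ((h : ZMod e) * ((a + (k : ℤ) : ℤ) : ZMod e))‖ -
      ‖∑ s ∈ range j, ZMod.stdAddChar ((h : ZMod e) * ((0 + (s : ℤ) : ℤ) : ZMod e))‖)]
  have hsym : ∑ h ∈ Ico 1 e, ‖expSum e (h * c') K‖ * (1 / ((e - h : ℕ) : ℝ) ^ 2) =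
      ∑ h ∈ Ico 1 e, ‖expSum e (h * c') K‖ * (1 / (h : ℝ) ^ 2) := by
    refine sum_bij' (fun h _ => e - h) (fun h _ => e - h) ?_ ?_ ?_ ?_ ?_
    · intro h hh; rw [mem_Ico] at hh ⊢; omega
    · intro h hh; rw [mem_Ico] at hh ⊢; omega
    · intro h hh; rw [mem_Ico] at hh; omega
    · intro h hh; rw [mem_Ico] at hh; omega
    · intro h hh
      rw [mem_Ico] at hh
      congr 1
      have hneg : expSum e ((e - h : ℕ) * c') K = (starRingEnd ℂ) (expSum e (h * c') K) := by
        rw [expSum_congr (h' := -(h * c')) (K' := K) _ (by simp), expSum_eq, expSum_eq, map_sum]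
        · refine sum_congr rfl fun v _ => ?_
          rw [← AddChar.map_neg_eq_conj]; congr 1; push_cast; ring
        · push_cast [Nat.cast_sub hh.2.le]
          exact ⟨c', by ring⟩
      rw [hneg, RCLike.norm_conj]
  have hfin : ‖∑ h ∈ Ico 1 e, G h‖ ≤
      (e : ℝ) ^ 2 / 2 * ∑ h ∈ Ico 1 e, ‖expSum e (h * c') K‖ / (h : ℝ) ^ 2 := by
    calc ‖∑ h ∈ Ico 1 e, G h‖ ≤ ∑ h ∈ Ico 1 e, ‖G h‖ := norm_sum_le _ _
      _ ≤ _ := sum_le_sum hbound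
      _ = (e : ℝ) ^ 2 / 4 * (∑ h ∈ Ico 1 e, ‖expSum e (h * c') K‖ * (1 / (h : ℝ) ^ 2) +
          ∑ h ∈ Ico 1 e, ‖expSum e (h * c') K‖ * (1 / ((e - h : ℕ) : ℝ) ^ 2)) := by
        rw [← sum_add_distrib, mul_sum]
        exact sum_congr rfl fun h _ => by ring
      _ = _ := by
        rw [hsym, ← two_mul, ← mul_assoc]
        congr 1
        · ring
        · exact sum_congr rfl fun h _ => by ring
  set S : ℝ := ∑ k ∈ range L, ∑ s ∈ range j,
        (if (e : ℤ) ∣ (α + c * (a + k + s)) ^ 2 - K then (1 : ℝ) else 0) with hS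
  have hSc : (e : ℂ) * ((S - rootCount K e * L * j / e : ℝ) : ℂ) = ∑ h ∈ Ico 1 e, G h := by
    have h2 : ∑ h ∈ range e, G h = G 0 + ∑ h ∈ Ico 1 e, G h := by
      rw [range_eq_Ico, sum_eq_sum_Ico_succ_bot he0]
    have h3 : (S : ℂ) = ∑ k ∈ range L, ∑ s ∈ range j,
      (if (e : ℤ) ∣ (α + c * (a + k + s)) ^ 2 - K then (1 : ℂ) else 0) := by
      rw [hS]; push_cast
      refine sum_congr rfl fun k _ => sum_congr rfl fun s _ => ?_
      split_ifs <;> simp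
    have h4 : (e : ℂ) ≠ 0 := by exact_mod_cast he0.ne'
    have h5 : ∑ h ∈ Ico 1 e, G h = e * S - rootCount K e * L * j := by
      rw [h3, h1, h2, h0]; ring
    rw [h5]; push_cast; field_simp
  rw [← hSc, norm_mul, Complex.norm_natCast, Complex.norm_real, Real.norm_eq_abs] at hfin
  rw [← mul_le_mul_iff_right₀ hepos]
  calc _ ≤ _ := hfin
    _ = _ := by ring

/-- The discrepancy of the solutions of `(α + c u)² ≡ K` modulo `e` in an interval. -/
lemma abs_count_sub_le {e : ℕ} [NeZero e] (K α c c' : ℤ) (hc : (e : ℤ) ∣ c * c' - 1)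
    (A L j : ℕ) (hj : 0 < j) :
    |(#{u ∈ Ico A (A + L) | (e : ℤ) ∣ (α + c * ((u : ℕ) : ℤ)) ^ 2 - K} : ℝ) - rootCount K e * L / e| ≤
      rootCount K e * j / e + e / (2 * j) * ∑ h ∈ Ico 1 e, ‖expSum e (h * c') K‖ / (h : ℝ) ^ 2 := by
  set I : ℤ → ℝ := fun x => if (e : ℤ) ∣ (α + c * x) ^ 2 - K then (1 : ℝ) else 0 with hI
  have hI0 : ∀ x, 0 ≤ I x := fun x => by simp only [hI]; split_ifs <;> norm_num
  have hjpos : (0 : ℝ) < j := by exact_mod_cast hj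
  have hepos : (0 : ℝ) < e := by exact_mod_cast Nat.pos_of_ne_zero (NeZero.ne e)
  set N : ℝ := (#{u ∈ Ico A (A + L) | (e : ℤ) ∣ (α + c * ((u : ℕ) : ℤ)) ^ 2 - K} : ℝ) with hN
  have hNsum : N = ∑ k ∈ range L, I (A + k) := by
    rw [hN, card_filter]
    push_cast
    rw [sum_Ico_eq_sum_range]
    simp [hI]
  have hNj : j * N = ∑ s ∈ range j, ∑ k ∈ range L, I (A + k) := by
    rw [← hNsum]; simp
  have hup : j * N ≤ ∑ k ∈ range (L + j), ∑ s ∈ range j, I (((A : ℤ) - j) + k + s) := by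
    rw [hNj, sum_comm (s := range (L + j))]
    refine sum_le_sum fun s hs => ?_
    rw [mem_range] at hs
    calc ∑ k ∈ range L, I (A + k) = ∑ k ∈ Ico (j - s) (j - s + L), I (((A : ℤ) - j) + k + s) := by
          rw [sum_Ico_eq_sum_range, Nat.add_sub_cancel_left]
          refine sum_congr rfl fun k _ => ?_
          congr 1; push_cast [Nat.cast_sub hs.le]; ring
      _ ≤ _ := by
          refine sum_le_sum_of_subset_of_nonneg ?_ fun _ _ _ => hI0 _
          intro k hk
          rw [mem_Ico] at hk; rw [mem_range]; omega
  have hlow : ∑ k ∈ range (L - j), ∑ s ∈ range j, I ((A : ℤ) + k + s) ≤ j * N := by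
    rw [hNj, sum_comm (s := range (L - j))]
    refine sum_le_sum fun s hs => ?_
    rw [mem_range] at hs
    calc ∑ k ∈ range (L - j), I (A + k + s) = ∑ k ∈ Ico s (s + (L - j)), I (A + k) := by
          rw [sum_Ico_eq_sum_range, Nat.add_sub_cancel_left]
          refine sum_congr rfl fun k _ => ?_
          congr 1; push_cast; ring
      _ ≤ _ := by
          refine sum_le_sum_of_subset_of_nonneg ?_ fun _ _ _ => hI0 _
          intro k hk
          rw [mem_Ico] at hk; rw [mem_range]; omega
  have b1 := (abs_le.1 (abs_smoothed_count_sub_le K α c c' hc ((A : ℤ) - j) (L + j) j)).2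
  have b2 := (abs_le.1 (abs_smoothed_count_sub_le K α c c' hc (A : ℤ) (L - j) j)).1
  set R := ∑ h ∈ Ico 1 e, ‖expSum e (h * c') K‖ / (h : ℝ) ^ 2
  simp only [hI] at hup hlow
  have hsub : (L : ℝ) - j ≤ ((L - j : ℕ) : ℝ) := by
    rw [sub_le_iff_le_add]; exact_mod_cast (by omega : L ≤ L - j + j)
  have hρ : (0 : ℝ) ≤ rootCount K e * j / e := by positivity
  have h3 : rootCount K e * (L - j) * j / e ≤ (rootCount K e * (L - j : ℕ) * j / e : ℝ) := by gcongr
  have hdiv : (e : ℝ) / (2 * j) * R = (e / 2 * R) / j := by field_simp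
  rw [abs_le, hdiv]
  constructor
  · have : j * (-(rootCount K e * j / e + e / 2 * R / j)) ≤ j * (N - rootCount K e * L / e) := by
      have e1 : j * (-(rootCount K e * j / e + e / 2 * R / j)) =
        rootCount K e * (L - j) * j / e - e / 2 * R - j * (rootCount K e * L / e) := by
        field_simp; ring
      rw [e1, mul_sub (j : ℝ) N]; linarith
    exact le_of_mul_le_mul_left this hjpos
  · have : j * (N - rootCount K e * L / e) ≤ j * (rootCount K e * j / e + e / 2 * R / j) := by
      have e1 : j * (rootCount K e * j / e + e / 2 * R / j) =
        rootCount K e * ((L + j : ℕ) : ℝ) * j / e + e / 2 * R - j * (rootCount K e * L / e) := by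
        push_cast; field_simp; ring
      rw [e1, mul_sub (j : ℝ) N]; linarith
    exact le_of_mul_le_mul_left this hjpos

lemma card_root_window {e : ℕ} [NeZero e] (K α c c' : ℤ) (hc : (e : ℤ) ∣ c * c' - 1) (A : ℕ) :
    #{u ∈ Ico A (A + e) | (e : ℤ) ∣ (α + c * ((u : ℕ) : ℤ)) ^ 2 - K} = rootCount K e := by
  have hcc : (c : ZMod e) * c' = 1 := by
    rw [← ZMod.intCast_zmod_eq_zero_iff_dvd] at hc
    push_cast at hc; linear_combination hc
  rw [rootCount_eq_card]
  refine card_bij' (fun u _ => ((α + c * (u : ℤ) : ℤ) : ZMod e))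
    (fun v _ => A + ((c' : ZMod e) * (v - (α : ZMod e)) - (A : ZMod e)).val) ?_ ?_ ?_ ?_
  · intro u hu
    simp only [mem_filter, mem_univ, true_and] at hu ⊢
    have := (ZMod.intCast_zmod_eq_zero_iff_dvd _ e).2 hu.2
    push_cast at this ⊢
    linear_combination this
  · intro v hv
    simp only [mem_filter, mem_univ, true_and, mem_Ico] at hv ⊢
    refine ⟨⟨by omega, by have := ZMod.val_lt ((c' : ZMod e) * (v - (α : ZMod e)) - (A : ZMod e)); omega⟩, ?_⟩
    rw [← ZMod.intCast_zmod_eq_zero_iff_dvd]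
    push_cast
    rw [ZMod.natCast_val, ZMod.cast_id', id]
    linear_combination hv + ((v - (α : ZMod e)) * (2 * (α : ZMod e) + (1 + (c : ZMod e) * c') * (v - (α : ZMod e)))) * hcc
  · intro u hu
    simp only [mem_filter, mem_Ico] at hu
    have h1 : (c' : ZMod e) * (((α + c * (u : ℤ) : ℤ) : ZMod e) - (α : ZMod e)) - (A : ZMod e) = ((u - A : ℕ) : ZMod e) := by
      push_cast [Nat.cast_sub hu.1.1]
      linear_combination (u : ZMod e) * hcc
    rw [h1, ZMod.val_cast_of_lt (by omega)]
    omega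
  · intro v hv
    push_cast
    rw [ZMod.natCast_val, ZMod.cast_id', id]
    linear_combination (v - (α : ZMod e)) * hcc

lemma card_root_windows {e : ℕ} [NeZero e] (K α c c' : ℤ) (hc : (e : ℤ) ∣ c * c' - 1) (A q : ℕ) :
    #{u ∈ Ico A (A + e * q) | (e : ℤ) ∣ (α + c * ((u : ℕ) : ℤ)) ^ 2 - K} = q * rootCount K e := by
  induction q with
  | zero => simp
  | succ q ih =>
    rw [mul_add, mul_one, ← add_assoc, ← Ico_union_Ico_eq_Ico (b := A + e * q) (by omega) (by omega),
      filter_union, card_union_of_disjoint, ih, card_root_window K α c c' hc, add_mul, one_mul]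
    exact disjoint_filter_filter (Ico_disjoint_Ico_consecutive _ _ _)

/-- The trivial bound for the discrepancy. -/
lemma abs_count_sub_le_rootCount {e : ℕ} [NeZero e] (K α c c' : ℤ) (hc : (e : ℤ) ∣ c * c' - 1)
    (A L : ℕ) :
    |(#{u ∈ Ico A (A + L) | (e : ℤ) ∣ (α + c * ((u : ℕ) : ℤ)) ^ 2 - K} : ℝ) - rootCount K e * L / e| ≤
      rootCount K e := by
  have he : 0 < e := Nat.pos_of_ne_zero (NeZero.ne e)
  have hepos : (0 : ℝ) < e := by exact_mod_cast he
  set q := L / e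
  have h1 : e * q ≤ L := Nat.mul_div_le L e
  have h2 : L < e * (q + 1) := by
    have := Nat.lt_mul_div_succ L he
    simpa using this
  have lo : q * rootCount K e ≤ #{u ∈ Ico A (A + L) | (e : ℤ) ∣ (α + c * ((u : ℕ) : ℤ)) ^ 2 - K} := by
    rw [← card_root_windows K α c c' hc A q]
    exact card_le_card (filter_subset_filter _ (Ico_subset_Ico_right (by omega)))
  have hi : #{u ∈ Ico A (A + L) | (e : ℤ) ∣ (α + c * ((u : ℕ) : ℤ)) ^ 2 - K} ≤
      (q + 1) * rootCount K e := by
    rw [← card_root_windows K α c c' hc A (q + 1)]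
    exact card_le_card (filter_subset_filter _ (Ico_subset_Ico_right (by omega)))
  have lo' : (q : ℝ) * rootCount K e ≤
      (#{u ∈ Ico A (A + L) | (e : ℤ) ∣ (α + c * ((u : ℕ) : ℤ)) ^ 2 - K} : ℝ) := by exact_mod_cast lo
  have hi' : (#{u ∈ Ico A (A + L) | (e : ℤ) ∣ (α + c * ((u : ℕ) : ℤ)) ^ 2 - K} : ℝ) ≤
      (q + 1) * rootCount K e := by exact_mod_cast hi
  have h1' : (e : ℝ) * q ≤ L := by exact_mod_cast h1
  have h2' : (L : ℝ) ≤ e * (q + 1) := by exact_mod_cast h2.le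
  have h3 : (q : ℝ) ≤ L / e := by rw [le_div_iff₀ hepos]; linarith
  have h4 : (L : ℝ) / e ≤ q + 1 := by rw [div_le_iff₀ hepos]; linarith
  have hr : (0 : ℝ) ≤ rootCount K e := by positivity
  rw [mul_div_assoc, abs_le]
  constructor <;> nlinarith

lemma abs_card_Ioc_modEq_sub_le (N v : ℕ) {M : ℕ} (hM : 0 < M) :
    |(#{k ∈ Ioc 0 N | k ≡ v [MOD M]} : ℝ) - N / M| ≤ 1 := by
  have h := Nat.Ioc_filter_modEq_card 0 N hM v
  have hM' : (0 : ℚ) < M := by exact_mod_cast hM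
  have hmono : ⌊((0 : ℕ) - (v : ℚ)) / M⌋ ≤ ⌊((N : ℚ) - v) / M⌋ := by
    apply Int.floor_le_floor
    gcongr
    omega
  rw [max_eq_left (by linarith)] at h
  have h1 := Int.floor_le (((N : ℚ) - v) / M)
  have h2 := Int.lt_floor_add_one (((N : ℚ) - v) / M)
  have h3 := Int.floor_le (((0 : ℕ) - (v : ℚ)) / M)
  have h4 := Int.lt_floor_add_one (((0 : ℕ) - (v : ℚ)) / M)
  have h5 : (#{k ∈ Ioc 0 N | k ≡ v [MOD M]} : ℚ) =
      (⌊((N : ℚ) - v) / M⌋ : ℚ) - ⌊((0 : ℕ) - (v : ℚ)) / M⌋ := by exact_mod_cast h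
  have h6 : ((N : ℚ) - v) / M - ((0 : ℕ) - (v : ℚ)) / M = N / M := by push_cast; ring
  have h7 : |(#{k ∈ Ioc 0 N | k ≡ v [MOD M]} : ℚ) - N / M| ≤ 1 := by
    rw [h5, abs_le]; constructor <;> linarith
  have h8 : (((|(#{k ∈ Ioc 0 N | k ≡ v [MOD M]} : ℚ) - N / M| : ℚ)) : ℝ) ≤ ((1 : ℚ) : ℝ) := by
    exact_mod_cast h7
  push_cast at h8
  exact h8

/-- Bonferroni's inequality. -/
lemma indicator_empty_le_sum_neg_one_pow {α : Type*} [DecidableEq α] (A : Finset α) (r : ℕ) :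
    (if A = ∅ then (1 : ℝ) else 0) ≤ ∑ S ∈ A.powerset with #S ≤ 2 * r, (-1 : ℝ) ^ #S := by
  rw [sum_filter, sum_powerset_apply_card (fun i => if i ≤ 2 * r then (-1 : ℝ) ^ i else 0)]
  rcases A.eq_empty_or_nonempty with rfl | hA
  · simp
  rw [if_neg hA.ne_empty]
  obtain ⟨n, hn⟩ : ∃ n, #A = n + 1 := ⟨#A - 1, by have := hA.card_pos; omega⟩
  rw [hn]
  have h1 : ∑ k ∈ range (2 * r + 1), (-1 : ℝ) ^ k * ((n + 1).choose k : ℝ) = n.choose (2 * r) := by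
    have := Int.alternating_sum_range_choose_eq_choose (n := n) (m := 2 * r)
    rw [pow_mul, neg_one_sq, one_pow, one_mul] at this
    exact_mod_cast this
  have h2 : ∑ m ∈ range (n + 1 + 1), (n + 1).choose m • (if m ≤ 2 * r then (-1 : ℝ) ^ m else 0) =
      ∑ k ∈ range (2 * r + 1), (-1 : ℝ) ^ k * ((n + 1).choose k : ℝ) := by
    simp only [nsmul_eq_mul, mul_ite, mul_zero]
    rw [← sum_filter]
    rw [← sum_filter_of_ne (s := range (2 * r + 1)) (p := fun k => k < n + 1 + 1)]
    · refine sum_congr ?_ fun _ _ => mul_comm _ _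
      ext k; simp only [mem_filter, mem_range]; omega
    · intro k _ hk
      by_contra hlt
      rw [Nat.choose_eq_zero_of_lt (by omega)] at hk
      simp at hk
  rw [h2, h1]
  positivity

lemma card_powerset_card_le (P : Finset ℕ) (R : ℕ) :
    #{S ∈ P.powerset | #S ≤ R} ≤ (#P + 1) ^ R := by
  rw [card_filter, sum_powerset_apply_card (fun i => if i ≤ R then 1 else 0), add_pow]
  simp only [smul_eq_mul, mul_ite, mul_one, mul_zero, one_pow]
  rw [← sum_filter]
  calc _ ≤ ∑ k ∈ range (R + 1), (#P).choose k := by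
        refine sum_le_sum_of_subset ?_
        intro k; simp only [mem_filter, mem_range]; omega
    _ ≤ _ := by
        refine sum_le_sum fun k hk => ?_
        rw [mem_range] at hk
        refine (Nat.choose_le_pow _ _).trans ?_
        exact Nat.le_mul_of_pos_right _ (Nat.choose_pos (by omega))

lemma sum_powerset_le_prod_add_exp (P : Finset ℕ) (R : ℕ) :
    ∑ S ∈ P.powerset with #S ≤ R, (-1 : ℝ) ^ #S / (∏ ℓ ∈ S, (ℓ : ℝ)) ≤
      ∏ ℓ ∈ P, (1 - 1 / (ℓ : ℝ)) + Real.exp (Real.exp 1 * ∑ ℓ ∈ P, 1 / (ℓ : ℝ) - R) := by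
  have h1 : ∏ ℓ ∈ P, (1 - 1 / (ℓ : ℝ)) = ∑ S ∈ P.powerset, (-1 : ℝ) ^ #S / (∏ ℓ ∈ S, (ℓ : ℝ)) := by
    simp only [sub_eq_add_neg]
    rw [prod_one_add]
    refine sum_congr rfl fun S _ => ?_
    rw [← prod_const, ← prod_div_distrib]
    exact prod_congr rfl fun _ _ => by ring
  have h2 : ∑ S ∈ P.powerset with ¬ #S ≤ R, (-((-1 : ℝ) ^ #S / (∏ ℓ ∈ S, (ℓ : ℝ)))) ≤
      Real.exp (Real.exp 1 * ∑ ℓ ∈ P, 1 / (ℓ : ℝ) - R) := by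
    calc _ ≤ ∑ S ∈ P.powerset with ¬ #S ≤ R, Real.exp (-R) * ∏ ℓ ∈ S, (Real.exp 1 * (1 / (ℓ : ℝ))) := by
          refine sum_le_sum fun S hS => ?_
          rw [mem_filter, not_le] at hS
          rw [prod_mul_distrib, prod_const, ← Real.exp_nat_mul, mul_one, ← mul_assoc, ← Real.exp_add]
          have hpos : (0 : ℝ) ≤ 1 / ∏ ℓ ∈ S, (ℓ : ℝ) := by positivity
          have e1 : ∏ ℓ ∈ S, (1 / (ℓ : ℝ)) = 1 / ∏ ℓ ∈ S, (ℓ : ℝ) := by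
            rw [prod_div_distrib, prod_const_one]
          rw [e1, ← neg_div, div_eq_mul_one_div]
          refine mul_le_mul_of_nonneg_right ?_ hpos
          have e2 : -(-1 : ℝ) ^ #S ≤ 1 := by
            rcases neg_one_pow_eq_or ℝ #S with h | h <;> rw [h] <;> norm_num
          refine e2.trans (Real.one_le_exp ?_)
          have : (R : ℝ) ≤ #S := by exact_mod_cast hS.2.le
          linarith
      _ ≤ ∑ S ∈ P.powerset, Real.exp (-R) * ∏ ℓ ∈ S, (Real.exp 1 * (1 / (ℓ : ℝ))) := by
          refine sum_le_sum_of_subset_of_nonneg (filter_subset _ _) fun _ _ _ => by positivity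
      _ = Real.exp (-R) * ∏ ℓ ∈ P, (1 + Real.exp 1 * (1 / (ℓ : ℝ))) := by
          rw [← mul_sum, prod_one_add]
      _ ≤ Real.exp (-R) * Real.exp (∑ ℓ ∈ P, Real.exp 1 * (1 / (ℓ : ℝ))) := by
          gcongr
          exact Real.prod_one_add_le_exp_sum _ fun _ => by positivity
      _ = _ := by rw [← Real.exp_add, ← mul_sum]; congr 1; ring
  rw [h1, ← sum_filter_add_sum_filter_not P.powerset (fun S => #S ≤ R)
    (fun S => (-1 : ℝ) ^ #S / (∏ ℓ ∈ S, (ℓ : ℝ)))]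
  rw [sum_neg_distrib] at h2
  linarith

/-- Brun's pure sieve in an arithmetic progression. -/
lemma brun_pure_sieve (P : Finset ℕ) (hP : ∀ ℓ ∈ P, ℓ.Prime) {q : ℕ} (hq : 0 < q)
    (hcop : ∀ ℓ ∈ P, q.Coprime ℓ) (t N r : ℕ) :
    (#{k ∈ Ioc 0 N | k ≡ t [MOD q] ∧ ∀ ℓ ∈ P, ¬ ℓ ∣ k} : ℝ) ≤
      (N : ℝ) / q * (∏ ℓ ∈ P, (1 - 1 / (ℓ : ℝ)) +
        Real.exp (Real.exp 1 * ∑ ℓ ∈ P, 1 / (ℓ : ℝ) - (2 * r : ℕ))) + ((#P : ℝ) + 1) ^ (2 * r) := by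
  have hstep1 : (#{k ∈ Ioc 0 N | k ≡ t [MOD q] ∧ ∀ ℓ ∈ P, ¬ ℓ ∣ k} : ℝ) ≤
      ∑ S ∈ P.powerset with #S ≤ 2 * r, (-1 : ℝ) ^ #S *
        #{k ∈ Ioc 0 N | k ≡ t [MOD q] ∧ ∀ ℓ ∈ S, ℓ ∣ k} := by
    have h1 : ∀ k : ℕ, (if ∀ ℓ ∈ P, ¬ ℓ ∣ k then (1 : ℝ) else 0) ≤
        ∑ S ∈ P.powerset with #S ≤ 2 * r, (-1 : ℝ) ^ #S * if ∀ ℓ ∈ S, ℓ ∣ k then 1 else 0 := by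
      intro k
      have h2 := indicator_empty_le_sum_neg_one_pow (P.filter (· ∣ k)) r
      have h3 : (P.filter (· ∣ k) = ∅) ↔ ∀ ℓ ∈ P, ¬ ℓ ∣ k := by
        rw [filter_eq_empty_iff]
      simp only [h3] at h2
      refine h2.trans_eq ?_
      simp only [mul_ite, mul_one, mul_zero]
      rw [← sum_filter]
      refine sum_congr ?_ fun _ _ => rfl
      ext S
      simp only [mem_filter, mem_powerset, subset_iff]
      constructor
      · rintro ⟨h4, h5⟩; exact ⟨⟨fun x hx => (h4 hx).1, h5⟩, fun x hx => (h4 hx).2⟩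
      · rintro ⟨⟨h4, h5⟩, h6⟩; exact ⟨fun x hx => ⟨h4 hx, h6 x hx⟩, h5⟩
    calc (#{k ∈ Ioc 0 N | k ≡ t [MOD q] ∧ ∀ ℓ ∈ P, ¬ ℓ ∣ k} : ℝ)
        = ∑ k ∈ Ioc 0 N with k ≡ t [MOD q], (if ∀ ℓ ∈ P, ¬ ℓ ∣ k then (1 : ℝ) else 0) := by
          rw [← filter_filter, card_filter]; push_cast; rfl
      _ ≤ ∑ k ∈ Ioc 0 N with k ≡ t [MOD q], ∑ S ∈ P.powerset with #S ≤ 2 * r,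
            (-1 : ℝ) ^ #S * if ∀ ℓ ∈ S, ℓ ∣ k then 1 else 0 := sum_le_sum fun k _ => h1 k
      _ = _ := by
          rw [sum_comm]
          refine sum_congr rfl fun S _ => ?_
          rw [← mul_sum]
          congr 1
          rw [← filter_filter, card_filter]; push_cast; rfl
  have hstep2 : ∀ S ∈ P.powerset.filter (fun S => #S ≤ 2 * r), (-1 : ℝ) ^ #S *
        (#{k ∈ Ioc 0 N | k ≡ t [MOD q] ∧ ∀ ℓ ∈ S, ℓ ∣ k} : ℝ) ≤
        (N : ℝ) / q * ((-1 : ℝ) ^ #S / (∏ ℓ ∈ S, (ℓ : ℝ))) + 1 := by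
    intro S hS
    rw [mem_filter, mem_powerset] at hS
    set M := ∏ ℓ ∈ S, ℓ with hM
    have hMcop : q.Coprime M := Nat.Coprime.prod_right fun ℓ hℓ => hcop ℓ (hS.1 hℓ)
    have hM0 : 0 < M := prod_pos fun ℓ hℓ => (hP ℓ (hS.1 hℓ)).pos
    obtain ⟨v, hv1, hv2⟩ := Nat.chineseRemainder hMcop t 0
    have hset : {k ∈ Ioc 0 N | k ≡ t [MOD q] ∧ ∀ ℓ ∈ S, ℓ ∣ k} =
        {k ∈ Ioc 0 N | k ≡ v [MOD q * M]} := by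
      ext k
      simp only [mem_filter, and_congr_right_iff]
      intro _
      rw [← Nat.modEq_and_modEq_iff_modEq_mul hMcop]
      have h5 : (∀ ℓ ∈ S, ℓ ∣ k) ↔ k ≡ v [MOD M] := by
        have h6 : k ≡ v [MOD M] ↔ M ∣ k := by
          rw [← Nat.modEq_zero_iff_dvd]
          exact ⟨fun h => h.trans hv2, fun h => h.trans hv2.symm⟩
        rw [h6]
        constructor
        · intro h
          exact prod_primes_dvd k (fun ℓ hℓ => (hP ℓ (hS.1 hℓ)).prime) h
        · intro h ℓ hℓ
          exact (dvd_prod_of_mem _ hℓ).trans h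
      rw [h5]
      exact ⟨fun h => ⟨h.1.trans hv1.symm, h.2⟩, fun h => ⟨h.1.trans hv1, h.2⟩⟩
    rw [hset]
    have h7 := abs_card_Ioc_modEq_sub_le N v (Nat.mul_pos hq hM0)
    have h8 : (-1 : ℝ) ^ #S * ((#{k ∈ Ioc 0 N | k ≡ v [MOD q * M]} : ℝ) - N / (q * M : ℕ)) ≤ 1 := by
      refine (le_abs_self _).trans ?_
      rw [abs_mul, abs_pow, abs_neg, abs_one, one_pow, one_mul]
      exact h7
    have h9 : (N : ℝ) / q * ((-1 : ℝ) ^ #S / (∏ ℓ ∈ S, (ℓ : ℝ))) = (-1 : ℝ) ^ #S * (N / (q * M : ℕ)) := by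
      rw [hM]; push_cast; rw [div_mul_div_comm]; ring
    rw [h9]
    linarith
  refine hstep1.trans ((sum_le_sum hstep2).trans ?_)
  rw [sum_add_distrib, ← mul_sum]
  refine add_le_add (mul_le_mul_of_nonneg_left ?_ (by positivity)) ?_
  · exact sum_powerset_le_prod_add_exp P (2 * r)
  · simp only [sum_const, nsmul_eq_mul, mul_one]
    exact_mod_cast card_powerset_card_le P (2 * r)

theorem factorization_prod_mul {M : Type*} [CommMonoid M] (g : ℕ → ℕ → M) {a b : ℕ}
    (hab : a.Coprime b) :
    (a * b).factorization.prod g = a.factorization.prod g * b.factorization.prod g := by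
  rw [Nat.factorization_mul_of_coprime hab, Finsupp.prod_add_index_of_disjoint]
  exact hab.disjoint_primeFactors

theorem factorization_prod_prime_pow {M : Type*} [CommMonoid M] (g : ℕ → ℕ → M) {p : ℕ}
    (hp : p.Prime) (hg : g p 0 = 1) (j : ℕ) : (p ^ j).factorization.prod g = g p j := by
  rw [hp.factorization_pow, Finsupp.prod_single_index hg]

/-- The largest divisor of `e` all of whose prime factors are at most `z`. -/
def smoothPart (z e : ℕ) : ℕ := e.factorization.prod fun ℓ j => if ℓ ≤ z then ℓ ^ j else 1

/-- The largest divisor of `e` all of whose prime factors exceed `z`. -/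
def roughPart (z e : ℕ) : ℕ := e.factorization.prod fun ℓ j => if ℓ ≤ z then 1 else ℓ ^ j

theorem smoothPart_mul_roughPart (z : ℕ) {e : ℕ} (he : e ≠ 0) :
    smoothPart z e * roughPart z e = e := by
  unfold smoothPart roughPart
  rw [← Finsupp.prod_mul]
  conv_rhs => rw [← Nat.prod_factorization_pow_eq_self he]
  refine Finsupp.prod_congr fun ℓ _ => ?_
  split_ifs <;> simp

theorem prime_dvd_smoothPart {z e ℓ : ℕ} (hℓ : ℓ.Prime) (h : ℓ ∣ smoothPart z e) :
    ℓ ≤ z ∧ ℓ ∣ e := by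
  unfold smoothPart at h
  obtain ⟨q, hq, hd⟩ := (Prime.dvd_finset_prod_iff hℓ.prime _).1 h
  have hqp := Nat.prime_of_mem_primeFactors hq
  by_cases hz : q ≤ z
  · simp only [hz, if_true] at hd
    have := (Nat.prime_dvd_prime_iff_eq hℓ hqp).1 (hℓ.dvd_of_dvd_pow hd)
    subst this
    exact ⟨hz, Nat.dvd_of_mem_primeFactors hq⟩
  · simp only [hz, if_false, Nat.dvd_one] at hd
    exact absurd hd hℓ.one_lt.ne'

theorem prime_dvd_roughPart {z e ℓ : ℕ} (hℓ : ℓ.Prime) (h : ℓ ∣ roughPart z e) :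
    z < ℓ ∧ ℓ ∣ e := by
  unfold roughPart at h
  obtain ⟨q, hq, hd⟩ := (Prime.dvd_finset_prod_iff hℓ.prime _).1 h
  have hqp := Nat.prime_of_mem_primeFactors hq
  by_cases hz : q ≤ z
  · simp only [hz, if_true, Nat.dvd_one] at hd
    exact absurd hd hℓ.one_lt.ne'
  · simp only [hz, if_false] at hd
    have := (Nat.prime_dvd_prime_iff_eq hℓ hqp).1 (hℓ.dvd_of_dvd_pow hd)
    subst this
    exact ⟨not_le.1 hz, Nat.dvd_of_mem_primeFactors hq⟩

theorem smoothPart_coprime_roughPart (z : ℕ) (e : ℕ) :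
    (smoothPart z e).Coprime (roughPart z e) :=
  Nat.Coprime.symm <| Nat.coprime_of_dvd fun _ hℓ h1 h2 =>
    absurd (prime_dvd_roughPart hℓ h1).1 (not_lt.2 (prime_dvd_smoothPart hℓ h2).1)

theorem smoothPart_pos {z e : ℕ} (he : e ≠ 0) : 0 < smoothPart z e :=
  Nat.pos_of_ne_zero fun h => he (by rw [← smoothPart_mul_roughPart z he, h, zero_mul])

theorem roughPart_pos {z e : ℕ} (he : e ≠ 0) : 0 < roughPart z e :=
  Nat.pos_of_ne_zero fun h => he (by rw [← smoothPart_mul_roughPart z he, h, mul_zero])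

theorem smoothPart_mul (z : ℕ) {a b : ℕ} (hab : a.Coprime b) :
    smoothPart z (a * b) = smoothPart z a * smoothPart z b :=
  factorization_prod_mul _ hab

theorem smoothPart_prime_pow (z : ℕ) {p : ℕ} (hp : p.Prime) (j : ℕ) :
    smoothPart z (p ^ j) = if p ≤ z then p ^ j else 1 := by
  unfold smoothPart
  rw [factorization_prod_prime_pow _ hp (by simp)]

/-- Majorants for the root-counting functions of `v ^ 2 = K` on odd moduli. -/
structure RootLike (f : ℕ → ℝ) (K : ℤ) : Prop where
  nonneg : ∀ e, 0 ≤ f e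
  one_le : f 1 ≤ 1
  mul_le : ∀ a b, a ≠ 0 → b ≠ 0 → a.Coprime b → f (a * b) ≤ f a * f b
  even : ∀ e, 2 ∣ e → f e = 0
  prime_pow_le : ∀ p j : ℕ, p.Prime → f (p ^ j) ≤ 2 * p ^ (j / 2)
  prime_pow_le_two : ∀ p j : ℕ, p.Prime → ¬ (p : ℤ) ∣ K → f (p ^ j) ≤ 2

theorem rootLike_rootCount (K : ℤ) :
    RootLike (fun e => if 2 ∣ e then 0 else (rootCount K e : ℝ)) K where
  nonneg e := by split_ifs <;> positivity
  one_le := by simp [rootCount_one]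
  mul_le a b _ _ hab := by
    by_cases ha : 2 ∣ a
    · simp [ha, ha.mul_right b]
    by_cases hb : 2 ∣ b
    · simp [hb, hb.mul_left a]
    rw [if_neg, if_neg ha, if_neg hb, rootCount_mul K hab]
    · push_cast; rfl
    · rw [Nat.prime_two.dvd_mul]; tauto
  even e he := by simp [he]
  prime_pow_le p j hp := by
    split_ifs
    · positivity
    · exact_mod_cast rootCount_prime_pow_le hp K j
  prime_pow_le_two p j hp hK := by
    split_ifs with h
    · positivity
    · by_cases hp2 : p = 2
      · subst hp2
        have : j = 0 := by
          by_contra hj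
          exact h (dvd_pow_self 2 hj)
        subst this
        simp [rootCount_one]
      · exact_mod_cast rootCount_prime_pow_le_two hp hp2 hK j

/-- The local factor of a Rankin bound. -/
theorem sum_Icc_two_mul_pow_le {ℓ : ℕ} (hℓ : 3 ≤ ℓ) {x : ℝ} (hx : 1 ≤ x)
    (hx2 : x ^ 2 / ℓ ≤ 0.6) (J : ℕ) :
    ∑ j ∈ Icc 1 J, 2 * (ℓ : ℝ) ^ (j / 2) / (ℓ : ℝ) ^ j * x ^ j ≤ 10 * (x ^ 2 / ℓ) := by
  have hℓ0 : (0 : ℝ) < ℓ := by positivity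
  set y : ℝ := x ^ 2 / ℓ with hy
  have hy0 : 0 < y := by positivity
  have hterm : ∀ j, 2 * (ℓ : ℝ) ^ (j / 2) / (ℓ : ℝ) ^ j * x ^ j ≤ 2 * y ^ ((j + 1) / 2) := by
    intro j
    obtain ⟨i, rfl | rfl⟩ := j.even_or_odd'
    · have h1 : (2 * i) / 2 = i := by omega
      have h2 : (2 * i + 1) / 2 = i := by omega
      rw [h1, h2, hy, div_pow, ← pow_mul]
      apply le_of_eq
      have : (ℓ : ℝ) ^ (2 * i) = ℓ ^ i * ℓ ^ i := by rw [two_mul, pow_add]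
      rw [this]; field_simp
    · have h1 : (2 * i + 1) / 2 = i := by omega
      have h2 : (2 * i + 1 + 1) / 2 = i + 1 := by omega
      rw [h1, h2, hy, div_pow, ← pow_mul]
      have : (ℓ : ℝ) ^ (2 * i + 1) = ℓ ^ i * ℓ ^ (i + 1) := by rw [← pow_add]; congr 1; omega
      rw [this]
      have h3 : x ^ (2 * i + 1) ≤ x ^ (2 * (i + 1)) := pow_le_pow_right₀ hx (by omega)
      have h4 : 2 * (ℓ : ℝ) ^ i / (ℓ ^ i * ℓ ^ (i + 1)) * x ^ (2 * i + 1)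
          = 2 * (x ^ (2 * i + 1) / ℓ ^ (i + 1)) := by field_simp
      rw [h4]
      gcongr
  have hgeo : ∀ I : ℕ, ∑ j ∈ Icc 1 (2 * I), 2 * y ^ ((j + 1) / 2) = 4 * ∑ i ∈ Icc 1 I, y ^ i := by
    intro I
    induction I with
    | zero => simp
    | succ I ih =>
      rw [show 2 * (I + 1) = 2 * I + 1 + 1 by ring, sum_Icc_succ_top (by omega),
        sum_Icc_succ_top (by omega), ih, sum_Icc_succ_top (by omega),
        show (2 * I + 1 + 1) / 2 = I + 1 by omega, show (2 * I + 1 + 1 + 1) / 2 = I + 1 by omega]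
      ring
  calc _ ≤ ∑ j ∈ Icc 1 J, 2 * y ^ ((j + 1) / 2) := sum_le_sum fun j _ => hterm j
    _ ≤ ∑ j ∈ Icc 1 (2 * J), 2 * y ^ ((j + 1) / 2) :=
        sum_le_sum_of_subset_of_nonneg (Icc_subset_Icc_right (by omega))
          fun _ _ _ => by positivity
    _ = 4 * ∑ i ∈ Icc 1 J, y ^ i := hgeo J
    _ ≤ 4 * (y / (1 - y)) := by
        gcongr
        exact sum_Icc_pow_le hy0.le (by norm_num at hx2; linarith) J
    _ ≤ 10 * y := by
        have : y / (1 - y) ≤ 2.5 * y := by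
          rw [div_le_iff₀ (by norm_num at hx2; linarith)]
          norm_num at hx2 ⊢
          nlinarith
        norm_num at this ⊢
        linarith

/-- Rankin's bound for sums of `f e / e` weighted by a power of the smooth part. -/
theorem RootLike.sum_smoothPart_rpow_le {f : ℕ → ℝ} {K : ℤ} (hf : RootLike f K) (z : ℕ) {σ : ℝ}
    (hσ0 : 0 ≤ σ) (hσ : σ ≤ 0.2) (s : Finset ℕ) (hs : ∀ p ∈ s, p.Prime) (A : Finset ℕ)
    (hA : ∀ n ∈ A, n ≠ 0 ∧ n.primeFactors ⊆ s) :
    ∑ e ∈ A, f e / e * (smoothPart z e : ℝ) ^ σ ≤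
      ∏ ℓ ∈ s, (1 + 10 * ((if ℓ ≤ z then (ℓ : ℝ) ^ (2 * σ) else 1) / ℓ)) := by
  refine sum_le_prod_one_add (F := fun e => f e / e * (smoothPart z e : ℝ) ^ σ)
    (fun e => ?_) ?_ ?_ s hs ?_ A hA
  · exact mul_nonneg (div_nonneg (hf.nonneg e) (by positivity)) (by positivity)
  · have : smoothPart z 1 = 1 := by simp [smoothPart]
    simp [this, hf.one_le]
  · intro a b ha hb hab
    rw [smoothPart_mul z hab]
    push_cast
    rw [Real.mul_rpow (by positivity) (by positivity)]
    have := hf.mul_le a b ha hb hab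
    calc f (a * b) / (a * b) * ((smoothPart z a : ℝ) ^ σ * (smoothPart z b : ℝ) ^ σ)
        ≤ f a * f b / (a * b) * ((smoothPart z a : ℝ) ^ σ * (smoothPart z b : ℝ) ^ σ) := by gcongr
      _ = _ := by field_simp
  · intro p hp J
    have hpp := hs p hp
    rcases eq_or_ne p 2 with rfl | hp2
    · rw [sum_eq_zero]
      · positivity
      · intro j hj
        rw [hf.even _ (dvd_pow_self 2 (by simp at hj; omega))]
        simp
    have hp3 : 3 ≤ p := by have := hpp.two_le; omega
    set x : ℝ := if p ≤ z then (p : ℝ) ^ σ else 1 with hx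
    have hp1 : (1 : ℝ) ≤ p := by exact_mod_cast hpp.one_le
    have hx1 : 1 ≤ x := by
      rw [hx]; split_ifs
      · exact Real.one_le_rpow hp1 hσ0
      · exact le_rfl
    have hx2 : x ^ 2 = if p ≤ z then (p : ℝ) ^ (2 * σ) else 1 := by
      rw [hx]; split_ifs
      · rw [← Real.rpow_natCast, ← Real.rpow_mul (by positivity)]; congr 1; push_cast; ring
      · simp
    have hx3 : x ^ 2 / p ≤ 0.6 := by
      have h1 : x ^ 2 ≤ (p : ℝ) ^ (0.4 : ℝ) := by
        rw [hx2]; split_ifs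
        · apply Real.rpow_le_rpow_of_exponent_le hp1; norm_num at hσ ⊢; linarith
        · exact Real.one_le_rpow hp1 (by norm_num)
      have h2 : (p : ℝ) ^ (0.4 : ℝ) / p = (p : ℝ) ^ (-0.6 : ℝ) := by
        have hpp0 : (0:ℝ) < p := by positivity
        rw [div_eq_iff hpp0.ne', ← Real.rpow_add_one hpp0.ne']; norm_num
      have h3 : (p : ℝ) ^ (-0.6 : ℝ) ≤ (3 : ℝ) ^ (-0.6 : ℝ) := by
        apply Real.rpow_le_rpow_of_nonpos (by norm_num) (by exact_mod_cast hp3) (by norm_num)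
      have h4 : (3 : ℝ) ^ (-0.6 : ℝ) ≤ 0.6 := by
        have h5 : (3 : ℝ) ^ (-0.6 : ℝ) = ((3 : ℝ) ^ (-3 : ℝ)) ^ (1 / 5 : ℝ) := by
          rw [← Real.rpow_mul (by norm_num)]; norm_num
        have h6 : (0.6 : ℝ) = ((0.6 : ℝ) ^ (5 : ℝ)) ^ (1 / 5 : ℝ) := by
          rw [← Real.rpow_mul (by norm_num)]; norm_num
        rw [h5, h6]
        apply Real.rpow_le_rpow (by positivity) _ (by norm_num)
        rw [Real.rpow_neg (by norm_num)]
        have h7 : (3 : ℝ) ^ (3 : ℝ) = 27 := by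
          rw [show (3 : ℝ) = ((3 : ℕ) : ℝ) by norm_num, Real.rpow_natCast]; norm_num
        have h8 : (0.6 : ℝ) ^ (5 : ℝ) = 0.07776 := by
          rw [show (5 : ℝ) = ((5 : ℕ) : ℝ) by norm_num, Real.rpow_natCast]; norm_num
        rw [h7, h8]; norm_num
      calc x ^ 2 / p ≤ (p : ℝ) ^ (0.4 : ℝ) / p := by gcongr
        _ ≤ _ := by rw [h2]; exact h3.trans h4
    rw [← hx2]
    refine le_trans (sum_le_sum fun j hj => ?_) (sum_Icc_two_mul_pow_le hp3 hx1 hx3 J)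
    have hs1 : (smoothPart z (p ^ j) : ℝ) ^ σ = x ^ j := by
      rw [smoothPart_prime_pow z hpp, hx]
      split_ifs
      · push_cast
        rw [← Real.rpow_natCast, ← Real.rpow_natCast, ← Real.rpow_mul (by positivity),
          ← Real.rpow_mul (by positivity), mul_comm]
      · simp
    rw [hs1]
    push_cast
    gcongr
    exact hf.prime_pow_le p j hpp

theorem sum_le_sum_of_injOn_of_le {α β : Type*} [DecidableEq β] {A : Finset α} {B : Finset β}
    {F : α → ℝ} {G : β → ℝ} (i : α → β) (hi : ∀ a ∈ A, i a ∈ B)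
    (hinj : ∀ a ∈ A, ∀ b ∈ A, i a = i b → a = b) (hFG : ∀ a ∈ A, F a ≤ G (i a))
    (hG : ∀ b ∈ B, 0 ≤ G b) : ∑ a ∈ A, F a ≤ ∑ b ∈ B, G b := by
  calc ∑ a ∈ A, F a ≤ ∑ a ∈ A, G (i a) := sum_le_sum hFG
    _ = ∑ b ∈ A.image i, G b := (sum_image fun a ha b hb => hinj a ha b hb).symm
    _ ≤ ∑ b ∈ B, G b := sum_le_sum_of_subset_of_nonneg (image_subset_iff.2 hi)
        fun b hb _ => hG b hb

theorem primeFactors_subset_primesIoc {n X : ℕ} (h0 : n ≠ 0) (hn : n ≤ X) :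
    n.primeFactors ⊆ primesIoc 0 X := fun p hp => by
  have hpp := Nat.prime_of_mem_primeFactors hp
  exact mem_primesIoc.2 ⟨hpp.pos,
    (Nat.le_of_dvd (Nat.pos_of_ne_zero h0) (Nat.dvd_of_mem_primeFactors hp)).trans hn, hpp⟩

theorem RootLike.sum_div_le {f : ℕ → ℝ} {K : ℤ} (hf : RootLike f K) (X : ℕ) :
    ∑ e ∈ Icc 1 X, f e / e ≤ ∏ ℓ ∈ primesIoc 0 X, (1 + 10 / (ℓ : ℝ)) := by
  have := hf.sum_smoothPart_rpow_le 0 le_rfl (by norm_num) (primesIoc 0 X)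
    (fun p hp => (mem_primesIoc.1 hp).2.2) (Icc 1 X) (fun n hn => by
      have := mem_Icc.1 hn
      exact ⟨by omega, primeFactors_subset_primesIoc (by omega) this.2⟩)
  simpa [div_eq_mul_inv] using this

theorem RootLike.sum_prime_pow_le {f : ℕ → ℝ} {K : ℤ} (hf : RootLike f K) {ℓ : ℕ} (hℓ : ℓ.Prime)
    (X : ℕ) : ∑ j ∈ Icc 2 X, f (ℓ ^ j) / (ℓ : ℝ) ^ j ≤
      4 * ((ℓ : ℝ) ^ 2)⁻¹ + if (ℓ : ℤ) ∣ K then 10 / (ℓ : ℝ) else 0 := by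
  rcases eq_or_ne ℓ 2 with rfl | hp2
  · rw [sum_eq_zero]
    · positivity
    · intro j hj
      rw [hf.even _ (dvd_pow_self 2 (by simp at hj; omega))]
      simp
  have h3 : 3 ≤ ℓ := by have := hℓ.two_le; omega
  have h3' : (3 : ℝ) ≤ ℓ := by exact_mod_cast h3
  have hℓ0 : (0 : ℝ) < ℓ := by positivity
  split_ifs with hK
  · have h1 : (1:ℝ) ^ 2 / ℓ ≤ 0.6 := by
      rw [div_le_iff₀ hℓ0]; norm_num; linarith
    have h := sum_Icc_two_mul_pow_le h3 le_rfl h1 X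
    have h4 : ∑ j ∈ Icc 2 X, f (ℓ ^ j) / (ℓ : ℝ) ^ j ≤
        ∑ j ∈ Icc 1 X, 2 * (ℓ : ℝ) ^ (j / 2) / (ℓ : ℝ) ^ j * 1 ^ j := by
      refine le_trans (sum_le_sum_of_subset_of_nonneg (Icc_subset_Icc_left (by norm_num : 1 ≤ 2))
        fun j _ _ => div_nonneg (hf.nonneg _) (by positivity)) (sum_le_sum fun j _ => ?_)
      rw [one_pow, mul_one]
      gcongr
      exact hf.prime_pow_le ℓ j hℓ
    have h5 : (0:ℝ) ≤ 4 * ((ℓ : ℝ) ^ 2)⁻¹ := by positivity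
    have h6 : 10 * ((1:ℝ) ^ 2 / ℓ) = 10 / ℓ := by ring
    linarith
  · rw [add_zero]
    have hx : (0:ℝ) ≤ (ℓ : ℝ)⁻¹ := by positivity
    have hx1 : (ℓ : ℝ)⁻¹ ≤ 1 / 2 := by
      rw [inv_le_comm₀ hℓ0 (by norm_num)]; norm_num; linarith
    rcases Nat.lt_or_ge X 2 with hX | hX
    · rw [Icc_eq_empty (by omega), sum_empty]; positivity
    have h1 : ∑ j ∈ Icc 2 X, f (ℓ ^ j) / (ℓ : ℝ) ^ j ≤
        ∑ j ∈ Icc 1 (X - 1), 2 * (ℓ : ℝ)⁻¹ * ((ℓ : ℝ)⁻¹) ^ j := by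
      refine sum_le_sum_of_injOn_of_le (fun j => j - 1) ?_ ?_ ?_ ?_
      · intro j hj; simp only [mem_Icc] at *; omega
      · intro a ha b hb h; simp only [mem_Icc] at *; omega
      · intro j hj
        simp only [mem_Icc] at hj
        obtain ⟨i, rfl⟩ : ∃ i, j = i + 1 := ⟨j - 1, by omega⟩
        have := hf.prime_pow_le_two ℓ (i + 1) hℓ hK
        simp only [Nat.add_sub_cancel]
        calc f (ℓ ^ (i + 1)) / (ℓ : ℝ) ^ (i + 1) ≤ 2 / (ℓ : ℝ) ^ (i + 1) := by gcongr
          _ = _ := by rw [inv_pow, pow_succ]; field_simp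
      · intros; positivity
    refine h1.trans ?_
    rw [← mul_sum]
    have h2 := sum_Icc_pow_le hx (by linarith) (X - 1)
    have h3 : (ℓ : ℝ)⁻¹ / (1 - (ℓ : ℝ)⁻¹) ≤ 2 * (ℓ : ℝ)⁻¹ := by
      rw [div_le_iff₀ (by linarith)]; nlinarith
    calc 2 * (ℓ : ℝ)⁻¹ * ∑ i ∈ Icc 1 (X - 1), (ℓ : ℝ)⁻¹ ^ i
        ≤ 2 * (ℓ : ℝ)⁻¹ * (2 * (ℓ : ℝ)⁻¹) := by gcongr; exact h2.trans h3
      _ = _ := by rw [← inv_pow]; ring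

open Classical in
/-- The contribution of the moduli divisible by the square of a large prime. -/
theorem RootLike.sum_sq_dvd_le {f : ℕ → ℝ} {K : ℤ} (hf : RootLike f K) (hK : K ≠ 0) (X : ℕ)
    {w : ℕ} (hw : 0 < w) :
    ∑ e ∈ Icc 1 X with ∃ ℓ, ℓ.Prime ∧ w < ℓ ∧ ℓ ^ 2 ∣ e, f e / e ≤
      (4 + 10 * (#K.natAbs.primeFactors : ℝ)) / w * ∏ ℓ ∈ primesIoc 0 X, (1 + 10 / (ℓ : ℝ)) := by
  classical
  have key : ∀ e : ℕ, ∃ t : ℕ × ℕ × ℕ, e ∈ {e ∈ Icc 1 X | ∃ ℓ, ℓ.Prime ∧ w < ℓ ∧ ℓ ^ 2 ∣ e} →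
      t.1 ∈ primesIoc w X ∧ t.2.1 ∈ Icc 2 X ∧ t.2.2 ∈ Icc 1 X ∧ e = t.1 ^ t.2.1 * t.2.2 ∧
        t.1.Coprime t.2.2 := by
    intro e
    by_cases he : e ∈ {e ∈ Icc 1 X | ∃ ℓ, ℓ.Prime ∧ w < ℓ ∧ ℓ ^ 2 ∣ e}
    · obtain ⟨he1, ℓ, hℓ, hwℓ, hd⟩ := mem_filter.1 he
      obtain ⟨he1, heX⟩ := mem_Icc.1 he1
      obtain ⟨j, b, hb, hj⟩ := Nat.exists_eq_pow_mul_and_not_dvd (n := e) (by omega) ℓ hℓ.ne_one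
      refine ⟨⟨ℓ, j, b⟩, fun _ => ?_⟩
      have hb0 : 0 < b := Nat.pos_of_ne_zero fun h => hb (h ▸ dvd_zero ℓ)
      have hcop : ℓ.Coprime b := (Nat.Prime.coprime_iff_not_dvd hℓ).2 hb
      have hj2 : 2 ≤ j := by
        have h1 : ℓ ^ 2 ∣ ℓ ^ j := by
          rw [hj] at hd
          exact (Nat.Coprime.pow_left 2 hcop).dvd_of_dvd_mul_right hd
        exact (Nat.pow_dvd_pow_iff_le_right hℓ.one_lt).1 h1
      have hle : ℓ ^ j ≤ X := le_trans (by rw [hj]; exact Nat.le_mul_of_pos_right _ hb0) heX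
      have h1 : j < ℓ ^ j := Nat.lt_pow_self hℓ.one_lt
      have h2 : ℓ ≤ ℓ ^ j := Nat.le_self_pow (by omega) ℓ
      have h3 : b ≤ X := le_trans (by
        rw [hj]; exact Nat.le_mul_of_pos_left _ (pow_pos hℓ.pos j)) heX
      exact ⟨mem_primesIoc.2 ⟨hwℓ, h2.trans hle, hℓ⟩, mem_Icc.2 ⟨hj2, h1.le.trans hle⟩,
        mem_Icc.2 ⟨hb0, h3⟩, hj, hcop⟩
    · exact ⟨⟨0, 0, 0⟩, fun h => absurd h he⟩
  choose i hi using key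
  have step1 : ∑ e ∈ Icc 1 X with ∃ ℓ, ℓ.Prime ∧ w < ℓ ∧ ℓ ^ 2 ∣ e, f e / e ≤
      ∑ t ∈ primesIoc w X ×ˢ Icc 2 X ×ˢ Icc 1 X,
        f (t.1 ^ t.2.1) / (t.1 : ℝ) ^ t.2.1 * (f t.2.2 / t.2.2) := by
    refine sum_le_sum_of_injOn_of_le i ?_ ?_ ?_ ?_
    · intro e he
      obtain ⟨h1, h2, h3, -, -⟩ := hi e he
      simp only [mem_product]; exact ⟨h1, h2, h3⟩
    · intro a ha b hb hab
      rw [(hi a ha).2.2.2.1, (hi b hb).2.2.2.1, hab]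
    · intro e he
      obtain ⟨h1, h2, h3, h4, h5⟩ := hi e he
      have hp := (mem_primesIoc.1 h1).2.2
      have hm := hf.mul_le ((i e).1 ^ (i e).2.1) (i e).2.2 (pow_pos hp.pos _).ne'
        (by have := mem_Icc.1 h3; omega) (h5.pow_left _)
      rw [← h4] at hm
      have h6 : (e : ℝ) = (((i e).1 : ℝ) ^ (i e).2.1) * ((i e).2.2 : ℝ) := by exact_mod_cast h4
      calc f e / e ≤ f ((i e).1 ^ (i e).2.1) * f (i e).2.2 / e := by gcongr
        _ = _ := by rw [h6, mul_div_mul_comm]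
    · intro t _
      exact mul_nonneg (div_nonneg (hf.nonneg _) (by positivity))
        (div_nonneg (hf.nonneg _) (by positivity))
  refine step1.trans ?_
  have step2 : ∑ t ∈ primesIoc w X ×ˢ Icc 2 X ×ˢ Icc 1 X,
        f (t.1 ^ t.2.1) / (t.1 : ℝ) ^ t.2.1 * (f t.2.2 / t.2.2) =
      (∑ ℓ ∈ primesIoc w X, ∑ j ∈ Icc 2 X, f (ℓ ^ j) / (ℓ : ℝ) ^ j) *
        ∑ e ∈ Icc 1 X, f e / e := by
    rw [sum_product, sum_mul]
    refine sum_congr rfl fun ℓ _ => ?_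
    rw [sum_product, sum_mul]
    refine sum_congr rfl fun j _ => ?_
    rw [mul_sum]
  rw [step2]
  have hsum0 : 0 ≤ ∑ e ∈ Icc 1 X, f e / (e : ℝ) :=
    sum_nonneg fun e _ => div_nonneg (hf.nonneg _) (by positivity)
  have hw0 : (0 : ℝ) < w := by exact_mod_cast hw
  refine mul_le_mul ?_ (hf.sum_div_le X) hsum0 (by positivity)
  calc ∑ ℓ ∈ primesIoc w X, ∑ j ∈ Icc 2 X, f (ℓ ^ j) / (ℓ : ℝ) ^ j
      ≤ ∑ ℓ ∈ primesIoc w X, (4 * ((ℓ : ℝ) ^ 2)⁻¹ + if (ℓ : ℤ) ∣ K then 10 / (ℓ : ℝ) else 0) :=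
        sum_le_sum fun ℓ hℓ => hf.sum_prime_pow_le (mem_primesIoc.1 hℓ).2.2 X
    _ = 4 * ∑ ℓ ∈ primesIoc w X, ((ℓ : ℝ) ^ 2)⁻¹ +
          ∑ ℓ ∈ primesIoc w X with ((ℓ : ℕ) : ℤ) ∣ K, 10 / (ℓ : ℝ) := by
        rw [sum_add_distrib, mul_sum, sum_filter]
    _ ≤ 4 * (1 / w) + #K.natAbs.primeFactors * (10 / w) := by
        gcongr ?_ + ?_
        · gcongr 4 * ?_
          rcases le_total w X with hwX | hwX
          · calc ∑ ℓ ∈ primesIoc w X, ((ℓ : ℝ) ^ 2)⁻¹ ≤ ∑ ℓ ∈ Ioc w X, ((ℓ : ℝ) ^ 2)⁻¹ :=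
                  sum_le_sum_of_subset_of_nonneg (filter_subset _ _) fun _ _ _ => by positivity
              _ ≤ (w : ℝ)⁻¹ - (X : ℝ)⁻¹ := sum_Ioc_inv_sq_le_sub hw.ne' hwX
              _ ≤ 1 / w := by rw [one_div]; have : (0:ℝ) ≤ (X : ℝ)⁻¹ := by positivity
                              linarith
          · rw [primesIoc, Ioc_eq_empty (by omega)]
            simp
        · rw [← nsmul_eq_mul]
          refine le_trans (sum_le_card_nsmul _ _ (10 / (w : ℝ)) fun ℓ hℓ => ?_) ?_
          · have := (mem_primesIoc.1 (mem_filter.1 hℓ).1).1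
            gcongr
          · rw [nsmul_eq_mul, nsmul_eq_mul]
            gcongr
            intro ℓ hℓ
            obtain ⟨h1, h2⟩ := mem_filter.1 hℓ
            exact Nat.mem_primeFactors.2 ⟨(mem_primesIoc.1 h1).2.2,
              Int.natCast_dvd.1 h2, by simpa using hK⟩
    _ = _ := by ring

open Classical in
/-- The local bound for `expSumAvg (ℓ ^ j) h D / ℓ ^ j`. -/
noncomputable def avgLocal (h D : ℤ) (ℓ j : ℕ) : ℝ :=
  if j = 0 then 1 else if j = 1 then
    0.93 + 1 / (ℓ : ℝ) + 0.07 * (if (ℓ : ℤ) ∣ h then 1 else 0) +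
      1.07 * (if (ℓ : ℤ) ∣ D then 1 else 0)
  else 2 + 4 * (ℓ : ℝ) ^ (j / 2) / ℓ

/-- The multiplicative majorant of `expSumAvg e h D / e`. -/
noncomputable def avgBound (h D : ℤ) (e : ℕ) : ℝ := e.factorization.prod (avgLocal h D)

theorem avgLocal_nonneg (h D : ℤ) (ℓ j : ℕ) : 0 ≤ avgLocal h D ℓ j := by
  unfold avgLocal
  split_ifs <;> positivity

theorem avgBound_nonneg (h D : ℤ) (e : ℕ) : 0 ≤ avgBound h D e :=
  prod_nonneg (s := e.factorization.support) fun _ _ => avgLocal_nonneg ..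

theorem expSumAvg_prime_pow_le_avgLocal {p : ℕ} (hp : p.Prime) (hp2 : p ≠ 2) {h h' : ℤ} (D : ℤ)
    (hh : (p : ℤ) ∣ h' → (p : ℤ) ∣ h) {j : ℕ} (hj : 0 < j) :
    expSumAvg (p ^ j) h' D ≤ p ^ j * avgLocal h D p j := by
  haveI := Fact.mk hp
  have hp0 : (0 : ℝ) < p := by exact_mod_cast hp.pos
  rcases eq_or_ne j 1 with rfl | hj1
  · have hexp : (p : ℝ) ^ 1 * avgLocal h D p 1 = 0.93 * p + 1 +
        0.07 * (if (p : ℤ) ∣ h then 1 else 0) * p + 1.07 * (if (p : ℤ) ∣ D then 1 else 0) * p := by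
      unfold avgLocal
      rw [if_neg one_ne_zero, if_pos rfl]
      field_simp
    rw [hexp, pow_one]
    by_cases hD : (p : ℤ) ∣ D
    · have h1 : expSumAvg p h' D ≤ 2 * p := by
        refine (expSumAvg_le_sum_rootCount p h' D).trans ?_
        calc _ ≤ ∑ t ∈ range p, (2 : ℝ) := sum_le_sum fun t _ => by
              exact_mod_cast rootCount_prime_le_two hp _
          _ = _ := by simp [mul_comm]
      rw [if_pos hD]
      split_ifs <;> norm_num <;> linarith
    · rw [if_neg hD]
      by_cases hph : (p : ℤ) ∣ h
      · have := expSumAvg_prime_le_add_one hp2 hD h'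
        rw [if_pos hph]; norm_num; linarith
      · have := expSumAvg_prime_le hp2 hD (h := h') (fun h1 => hph (hh h1))
        rw [if_neg hph]; linarith
  · obtain ⟨i, rfl⟩ : ∃ i, j = i + 1 := ⟨j - 1, by omega⟩
    refine (expSumAvg_prime_pow_le hp hp2 h' D i).trans (le_of_eq ?_)
    unfold avgLocal
    rw [if_neg (by omega), if_neg hj1, pow_add (p : ℝ) i ((i + 1) / 2), pow_succ]
    field_simp

theorem expSumAvg_le_avgBound (h D : ℤ) {e : ℕ} : Odd e → ∀ h' : ℤ,
    (∀ ℓ : ℕ, ℓ.Prime → ℓ ∣ e → (ℓ : ℤ) ∣ h' → (ℓ : ℤ) ∣ h) →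
    expSumAvg e h' D ≤ e * avgBound h D e := by
  induction e using Nat.recOnPosPrimePosCoprime with
  | prime_pow p n hp hn =>
    intro hodd h' hh
    have hp2 : p ≠ 2 := by
      rintro rfl
      exact (Nat.not_even_iff_odd.2 hodd) ((Nat.even_pow.2 ⟨even_two, hn.ne'⟩))
    rw [avgBound, factorization_prod_prime_pow _ hp (by simp [avgLocal])]
    push_cast
    exact expSumAvg_prime_pow_le_avgLocal hp hp2 D (hh p hp (dvd_pow_self p hn.ne')) hn
  | zero => intro h0; simp at h0
  | one =>
    intro _ h' _
    have := expSumAvg_le_sum_rootCount 1 h' D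
    simpa [avgBound, rootCount_one] using this
  | coprime a b ha hb hab iha ihb =>
    intro hodd h' hh
    haveI : NeZero a := ⟨by omega⟩
    haveI : NeZero b := ⟨by omega⟩
    obtain ⟨ha1, hb1⟩ := Nat.odd_mul.1 hodd
    obtain ⟨a', b', hbez⟩ : ∃ a' b' : ℤ, a' * a + b' * b = 1 :=
      (Nat.isCoprime_iff_coprime.2 hab)
    rw [expSumAvg_mul hab a' b' hbez, avgBound, factorization_prod_mul _ hab]
    have h1 := iha ha1 (h' * b') (fun ℓ hℓ hd hd' => hh ℓ hℓ (hd.mul_right b) (by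
      rcases (Nat.prime_iff_prime_int.1 hℓ).dvd_or_dvd hd' with h2 | h2
      · exact h2
      · exfalso
        have h3 : (ℓ : ℤ) ∣ 1 := by
          rw [← hbez]
          exact dvd_add ((Int.natCast_dvd_natCast.2 hd).mul_left _) (h2.mul_right _)
        exact hℓ.one_lt.ne' (by exact_mod_cast Int.eq_one_of_dvd_one (by positivity) h3)))
    have h2 := ihb hb1 (h' * a') (fun ℓ hℓ hd hd' => hh ℓ hℓ (hd.mul_left a) (by
      rcases (Nat.prime_iff_prime_int.1 hℓ).dvd_or_dvd hd' with h2 | h2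
      · exact h2
      · exfalso
        have h3 : (ℓ : ℤ) ∣ 1 := by
          rw [← hbez]
          exact dvd_add (h2.mul_right _) ((Int.natCast_dvd_natCast.2 hd).mul_left _)
        exact hℓ.one_lt.ne' (by exact_mod_cast Int.eq_one_of_dvd_one (by positivity) h3)))
    have h3 := mul_le_mul h1 h2 (expSumAvg_nonneg _ _ _)
      (mul_nonneg (by positivity) (avgBound_nonneg h D a))
    refine h3.trans (le_of_eq ?_)
    unfold avgBound
    push_cast
    ring

open Classical in
theorem sum_avgLocal_div_totient_le (h D : ℤ) {p : ℕ} (hp : p.Prime) (hp2 : p ≠ 2) (J : ℕ) :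
    ∑ j ∈ Icc 1 J, avgLocal h D p j / (p ^ j).totient ≤
      (0.93 + 0.07 * (if (p : ℤ) ∣ h then 1 else 0) + 1.07 * (if (p : ℤ) ∣ D then 1 else 0)) / p +
        40 * ((p : ℝ) ^ 2)⁻¹ := by
  have h3 : 3 ≤ p := by have := hp.two_le; omega
  have h3' : (3 : ℝ) ≤ p := by exact_mod_cast h3
  have hp0 : (0 : ℝ) < p := by positivity
  have htot : ∀ j, 0 < j → (p : ℝ) ^ j / 1.5 ≤ ((p ^ j).totient : ℝ) := by
    intro j hj
    rw [Nat.totient_prime_pow hp hj]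
    obtain ⟨i, rfl⟩ : ∃ i, j = i + 1 := ⟨j - 1, by omega⟩
    have : ((p - 1 : ℕ) : ℝ) = p - 1 := by rw [Nat.cast_sub hp.one_le]; simp
    push_cast [this]
    rw [div_le_iff₀ (by norm_num), pow_succ]
    have hpi : (0 : ℝ) < (p : ℝ) ^ i := by positivity
    rw [mul_assoc]
    norm_num
    nlinarith
  set c0 : ℝ := 0.93 + 0.07 * (if (p : ℤ) ∣ h then 1 else 0) + 1.07 * (if (p : ℤ) ∣ D then 1 else 0)
    with hc0
  have hc0le : c0 ≤ 2.07 := by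
    rw [hc0]; split_ifs <;> norm_num
  have hc00 : 0 ≤ c0 := by rw [hc0]; split_ifs <;> norm_num
  rcases Nat.eq_zero_or_pos J with rfl | hJ
  · simp; positivity
  have hsplit : Icc 1 J = insert 1 (Icc 2 J) := by
    ext x; simp only [mem_Icc, mem_insert]; omega
  rw [hsplit, sum_insert (by simp)]
  have hfirst : avgLocal h D p 1 / (p ^ 1).totient ≤ c0 / p + 5 * ((p : ℝ) ^ 2)⁻¹ := by
    have : avgLocal h D p 1 = c0 + 1 / p := by
      unfold avgLocal
      rw [if_neg one_ne_zero, if_pos rfl, hc0]; ring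
    rw [this, pow_one, Nat.totient_prime hp, Nat.cast_sub hp.one_le, div_le_iff₀ (by norm_num; linarith)]
    rw [← sub_nonneg]
    have : (c0 / p + 5 * ((p : ℝ) ^ 2)⁻¹) * ((p : ℝ) - (1 : ℕ)) - (c0 + 1 / p)
      = (4 * p - c0 * p - 5) / p ^ 2 := by push_cast; field_simp; ring
    rw [this]
    apply div_nonneg _ (by positivity)
    norm_num at hc0le
    nlinarith
  have hrest : ∑ j ∈ Icc 2 J, avgLocal h D p j / (p ^ j).totient ≤ 35 * ((p : ℝ) ^ 2)⁻¹ := by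
    have hx : (0:ℝ) ≤ (p : ℝ)⁻¹ := by positivity
    have hx1 : (p : ℝ)⁻¹ ≤ 1 / 3 := by
      rw [inv_le_comm₀ hp0 (by norm_num)]; norm_num; linarith
    have h1 : ∑ j ∈ Icc 2 J, avgLocal h D p j / (p ^ j).totient ≤
        ∑ j ∈ Icc 2 J, (3 * (p : ℝ)⁻¹ ^ j +
          3 * (p : ℝ)⁻¹ * (2 * (p : ℝ) ^ (j / 2) / (p : ℝ) ^ j * 1 ^ j)) := by
      refine sum_le_sum fun j hj => ?_
      have hj2 := (mem_Icc.1 hj).1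
      have : avgLocal h D p j = 2 + 4 * (p : ℝ) ^ (j / 2) / p := by
        unfold avgLocal
        rw [if_neg (by omega), if_neg (by omega)]
      rw [this]
      calc (2 + 4 * (p : ℝ) ^ (j / 2) / p) / ((p ^ j).totient : ℝ)
          ≤ (2 + 4 * (p : ℝ) ^ (j / 2) / p) / ((p : ℝ) ^ j / 1.5) := by
            gcongr; exact htot j (by omega)
        _ = _ := by rw [inv_pow, one_pow]; field_simp; ring
    have h2 : ∑ j ∈ Icc 2 J, (p : ℝ)⁻¹ ^ j ≤ 1.5 * ((p : ℝ) ^ 2)⁻¹ := by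
      have : ∑ j ∈ Icc 2 J, (p : ℝ)⁻¹ ^ j ≤ ∑ j ∈ Icc 1 (J - 1), (p : ℝ)⁻¹ * ((p : ℝ)⁻¹) ^ j := by
        refine sum_le_sum_of_injOn_of_le (fun j => j - 1) ?_ ?_ ?_ ?_
        · intro j hj; simp only [mem_Icc] at *; omega
        · intro a ha b hb h; simp only [mem_Icc] at *; omega
        · intro j hj
          simp only [mem_Icc] at hj
          obtain ⟨i, rfl⟩ : ∃ i, j = i + 1 := ⟨j - 1, by omega⟩
          simp only [Nat.add_sub_cancel]
          rw [pow_succ, mul_comm]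
        · intros; positivity
      refine this.trans ?_
      rw [← mul_sum]
      have h2 := sum_Icc_pow_le hx (by linarith) (J - 1)
      have h3 : (p : ℝ)⁻¹ / (1 - (p : ℝ)⁻¹) ≤ 1.5 * (p : ℝ)⁻¹ := by
        rw [div_le_iff₀ (by linarith)]; norm_num; nlinarith
      calc (p : ℝ)⁻¹ * ∑ i ∈ Icc 1 (J - 1), (p : ℝ)⁻¹ ^ i
          ≤ (p : ℝ)⁻¹ * (1.5 * (p : ℝ)⁻¹) := by gcongr; exact h2.trans h3
        _ = _ := by rw [← inv_pow]; ring
    have h4 : ∑ j ∈ Icc 2 J, 2 * (p : ℝ) ^ (j / 2) / (p : ℝ) ^ j * 1 ^ j ≤ 10 * (p : ℝ)⁻¹ := by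
      have h5 : (1:ℝ) ^ 2 / p ≤ 0.6 := by
        rw [div_le_iff₀ hp0]; norm_num; linarith
      have h6 := sum_Icc_two_mul_pow_le h3 le_rfl h5 J
      refine le_trans (sum_le_sum_of_subset_of_nonneg (Icc_subset_Icc_left (by norm_num : 1 ≤ 2))
        fun j _ _ => by positivity) (h6.trans (le_of_eq (by rw [one_pow, one_div])))
    refine h1.trans ?_
    rw [sum_add_distrib, ← mul_sum, ← mul_sum]
    have h5 : 3 * (p : ℝ)⁻¹ * ∑ j ∈ Icc 2 J, 2 * (p : ℝ) ^ (j / 2) / (p : ℝ) ^ j * 1 ^ j ≤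
        3 * (p : ℝ)⁻¹ * (10 * (p : ℝ)⁻¹) := by gcongr
    have h6 : 3 * (p : ℝ)⁻¹ * (10 * (p : ℝ)⁻¹) = 30 * ((p : ℝ) ^ 2)⁻¹ := by rw [← inv_pow]; ring
    have h7 : 0 ≤ ((p : ℝ) ^ 2)⁻¹ := by positivity
    have h8 : (1.5 : ℝ) * ((p : ℝ) ^ 2)⁻¹ = 3 / 2 * ((p : ℝ) ^ 2)⁻¹ := by norm_num
    linarith
  linarith

theorem sum_primesIoc_inv_sq_le (X : ℕ) : ∑ p ∈ primesIoc 0 X, ((p : ℝ) ^ 2)⁻¹ ≤ 2 := by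
  rcases Nat.eq_zero_or_pos X with rfl | hX
  · simp [primesIoc]
  have h1 : ∑ p ∈ primesIoc 0 X, ((p : ℝ) ^ 2)⁻¹ ≤ ∑ p ∈ Ioc 1 X, ((p : ℝ) ^ 2)⁻¹ :=
    sum_le_sum_of_subset_of_nonneg (fun p hp => by
      obtain ⟨_, h2, h3⟩ := mem_primesIoc.1 hp
      exact mem_Ioc.2 ⟨h3.one_lt, h2⟩) fun _ _ _ => by positivity
  have h2 := sum_Ioc_inv_sq_le_sub (α := ℝ) (k := 1) one_ne_zero hX
  have : (0:ℝ) ≤ (X : ℝ)⁻¹ := by positivity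
  norm_num at h2
  linarith

open Classical in
/-- The average of the exponential sums over smooth odd moduli. -/
theorem sum_avgBound_div_totient_le (h D : ℤ) (z : ℕ) (A : Finset ℕ)
    (hA : ∀ e ∈ A, Odd e ∧ ∀ ℓ, ℓ.Prime → ℓ ∣ e → ℓ ≤ z) :
    ∑ e ∈ A, avgBound h D e / e.totient ≤
      Real.exp (0.93 * ∑ ℓ ∈ primesIoc 0 z, 1 / (ℓ : ℝ) +
        0.07 * ∑ ℓ ∈ primesIoc 0 z with ((ℓ : ℕ) : ℤ) ∣ h, 1 / (ℓ : ℝ) +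
        1.07 * ∑ ℓ ∈ primesIoc 0 z with ((ℓ : ℕ) : ℤ) ∣ D, 1 / (ℓ : ℝ) + 80) := by
  set b : ℕ → ℝ := fun p => (0.93 + 0.07 * (if (p : ℤ) ∣ h then 1 else 0) +
    1.07 * (if (p : ℤ) ∣ D then 1 else 0)) / p + 40 * ((p : ℝ) ^ 2)⁻¹ with hb
  have h1 : ∑ e ∈ A, avgBound h D e / e.totient ≤ ∏ p ∈ primesIoc 0 z, (1 + b p) := by
    have := sum_le_prod_one_add (F := fun e => if 2 ∣ e then 0 else avgBound h D e / e.totient)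
      (b := b) ?_ ?_ ?_ (primesIoc 0 z) (fun p hp => (mem_primesIoc.1 hp).2.2) ?_ A ?_
    · refine le_trans (le_of_eq (sum_congr rfl fun e he => ?_)) this
      rw [if_neg]
      have := (hA e he).1
      rw [← even_iff_two_dvd]; simpa using this
    · intro e
      split_ifs
      · exact le_rfl
      · exact div_nonneg (avgBound_nonneg ..) (by positivity)
    · simp [avgBound]
    · intro m n _ _ hmn
      by_cases hm : 2 ∣ m
      · simp [hm, hm.mul_right n]
      by_cases hn : 2 ∣ n
      · simp [hn, hn.mul_left m]
      rw [if_neg, if_neg hm, if_neg hn, avgBound, factorization_prod_mul _ hmn,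
        Nat.totient_mul hmn]
      · push_cast
        rw [mul_div_mul_comm]; rfl
      · rw [Nat.prime_two.dvd_mul]; tauto
    · intro p hp J
      have hpp := (mem_primesIoc.1 hp).2.2
      rcases eq_or_ne p 2 with rfl | hp2
      · rw [sum_eq_zero]
        · rw [hb]; dsimp only; split_ifs <;> positivity
        · intro j hj
          rw [if_pos (dvd_pow_self 2 (by simp at hj; omega))]
      · refine le_trans (sum_le_sum fun j hj => ?_) (sum_avgLocal_div_totient_le h D hpp hp2 J)
        rw [if_neg]
        · rw [avgBound, factorization_prod_prime_pow _ hpp (by simp [avgLocal])]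
        · intro h2
          exact hp2 ((Nat.prime_dvd_prime_iff_eq Nat.prime_two hpp).1
            (Nat.prime_two.dvd_of_dvd_pow h2)).symm
    · intro e he
      obtain ⟨ho, hl⟩ := hA e he
      refine ⟨by rintro rfl; simp at ho, fun p hp => ?_⟩
      have hpp := Nat.prime_of_mem_primeFactors hp
      exact mem_primesIoc.2 ⟨hpp.pos, hl p hpp (Nat.dvd_of_mem_primeFactors hp), hpp⟩
  refine h1.trans ((Real.prod_one_add_le_exp_sum _ fun p => ?_).trans (Real.exp_le_exp.2 ?_))
  · rw [hb]; dsimp only; split_ifs <;> positivity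
  · have h2 : ∑ p ∈ primesIoc 0 z, b p = 0.93 * ∑ ℓ ∈ primesIoc 0 z, 1 / (ℓ : ℝ) +
        0.07 * ∑ ℓ ∈ primesIoc 0 z with ((ℓ : ℕ) : ℤ) ∣ h, 1 / (ℓ : ℝ) +
        1.07 * ∑ ℓ ∈ primesIoc 0 z with ((ℓ : ℕ) : ℤ) ∣ D, 1 / (ℓ : ℝ) +
        40 * ∑ ℓ ∈ primesIoc 0 z, ((ℓ : ℝ) ^ 2)⁻¹ := by
      rw [sum_filter, sum_filter, mul_sum, mul_sum, mul_sum, mul_sum, ← sum_add_distrib,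
        ← sum_add_distrib, ← sum_add_distrib]
      refine sum_congr rfl fun p _ => ?_
      rw [hb]; dsimp only
      split_ifs <;> ring
    have := sum_primesIoc_inv_sq_le z
    rw [h2]; linarith

open Filter

theorem tendsto_log_log_natCast :
    Tendsto (fun T : ℕ => Real.log (Real.log T)) atTop atTop :=
  Real.tendsto_log_atTop.comp (Real.tendsto_log_atTop.comp tendsto_natCast_atTop_atTop)

/-- The level up to which the pure sieve is applied. -/
noncomputable def sieveLevel (T : ℕ) : ℕ :=
  ⌊Real.exp (Real.log T / (1000 * Real.log (Real.log T)))⌋₊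

/-- The bound separating smooth and rough parts of the moduli. -/
noncomputable def smoothLevel (T : ℕ) : ℕ :=
  ⌊Real.exp (100 * Real.log T / Real.log (Real.log T))⌋₊

/-- The sieve density. -/
noncomputable def sieveDensity (T : ℕ) : ℝ :=
  ∏ ℓ ∈ primesIoc 0 (sieveLevel T), (1 - 1 / (ℓ : ℝ))

theorem exp_neg_two_mul_le {x : ℝ} (hx0 : 0 ≤ x) (hx : x ≤ 1 / 2) :
    Real.exp (-(2 * x)) ≤ 1 - x := by
  rw [Real.exp_neg, inv_le_comm₀ (Real.exp_pos _) (by linarith)]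
  calc (1 - x)⁻¹ = x / (1 - x) + 1 := by
        have : 1 - x ≠ 0 := by linarith
        field_simp; ring
    _ ≤ Real.exp (x / (1 - x)) := Real.add_one_le_exp _
    _ ≤ Real.exp (2 * x) := Real.exp_le_exp.2 (by
        rw [div_le_iff₀ (by linarith)]; nlinarith)

theorem exp_neg_two_mul_sum_le_prod (s : Finset ℕ) (hs : ∀ p ∈ s, p.Prime) :
    Real.exp (-(2 * ∑ p ∈ s, 1 / (p : ℝ))) ≤ ∏ p ∈ s, (1 - 1 / (p : ℝ)) := by
  rw [mul_sum, ← sum_neg_distrib, Real.exp_sum]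
  refine prod_le_prod (fun _ _ => (Real.exp_pos _).le) fun p hp => ?_
  have : (2 : ℝ) ≤ p := by exact_mod_cast (hs p hp).two_le
  exact exp_neg_two_mul_le (by positivity) (by
    rw [div_le_div_iff₀ (by linarith) (by norm_num)]; linarith)

theorem log_natFloor_exp_ge {a : ℝ} (ha : 0 ≤ a) : a - Real.log 2 ≤ Real.log ⌊Real.exp a⌋₊ := by
  have h1 : 1 ≤ Real.exp a := Real.one_le_exp ha
  have h2 : Real.exp a < ⌊Real.exp a⌋₊ + 1 := Nat.lt_floor_add_one _
  have h3 : 1 ≤ ⌊Real.exp a⌋₊ := Nat.one_le_floor_iff _ |>.2 h1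
  have h3' : (1 : ℝ) ≤ ⌊Real.exp a⌋₊ := by exact_mod_cast h3
  have h4 : Real.exp a / 2 ≤ ⌊Real.exp a⌋₊ := by linarith
  calc a - Real.log 2 = Real.log (Real.exp a / 2) := by
        rw [Real.log_div (Real.exp_pos a).ne' (by norm_num), Real.log_exp]
    _ ≤ _ := Real.log_le_log (by positivity) h4

theorem natFloor_exp_le (a : ℝ) : (⌊Real.exp a⌋₊ : ℝ) ≤ Real.exp a := Nat.floor_le (Real.exp_pos a).le

/-- Every polynomial in `u` is eventually dominated by `exp u`. -/
theorem eventually_mul_le_exp (C k ε : ℝ) (hε : 0 < ε) :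
    ∀ᶠ u : ℝ in atTop, C * u ^ k ≤ Real.exp (ε * u) := by
  have h := (isLittleO_rpow_exp_pos_mul_atTop k hε).bound (c := 1 / (|C| + 1)) (by positivity)
  filter_upwards [h, eventually_ge_atTop 0] with u hu hu0
  rw [Real.norm_of_nonneg (by positivity), Real.norm_of_nonneg (by positivity)] at hu
  calc C * u ^ k ≤ (|C| + 1) * u ^ k := by
        gcongr; linarith [le_abs_self C]
    _ ≤ (|C| + 1) * (1 / (|C| + 1) * Real.exp (ε * u)) := by gcongr
    _ = _ := by field_simp

theorem eventually_loglog {P : ℝ → Prop} (h : ∀ᶠ u : ℝ in atTop, P u) :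
    ∀ᶠ T : ℕ in atTop, P (Real.log (Real.log T)) :=
  tendsto_log_log_natCast.eventually h

/-- The basic size facts for the sieve parameters. -/
theorem eventually_sieveLevel : ∀ᶠ T : ℕ in atTop, 2 ≤ sieveLevel T ∧
    Real.log T / (2000 * Real.log (Real.log T)) ≤ Real.log (sieveLevel T) ∧
    ((sieveLevel T : ℝ) + 1) ^ (2 * ⌊50 * Real.log (Real.log T)⌋₊) ≤
      (T : ℝ) ^ (0.2 : ℝ) * Real.exp (-(4 * Real.log (Real.log T) + 6)) ∧
    ∑ ℓ ∈ primesIoc 0 (sieveLevel T), 1 / (ℓ : ℝ) ≤ 2 * Real.log (Real.log T) + 3 := by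
  have hlog : ∀ᶠ u : ℝ in atTop, 1 ≤ u ∧ 100000 * u ≤ Real.exp u ∧ 4000 * u ≤ Real.exp u ∧
      (100 * u * 1 + 4 * u + 6 ≤ 0.1 * Real.exp u) := by
    filter_upwards [eventually_ge_atTop 1, eventually_mul_le_exp 100000 1 1 one_pos] with u h1 h2
    rw [Real.rpow_one, one_mul] at h2
    refine ⟨h1, h2, by linarith, ?_⟩
    norm_num; linarith
  filter_upwards [eventually_loglog hlog, eventually_ge_atTop 3] with T ⟨h1, h2, h2', h3⟩ hT
  have hT0 : (0 : ℝ) < T := by positivity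
  have hT3 : (3 : ℝ) ≤ T := by exact_mod_cast hT
  have hL0 : 0 < Real.log T := Real.log_pos (by linarith)
  set u := Real.log (Real.log T) with hu
  have hexp : Real.exp u = Real.log T := Real.exp_log hL0
  rw [hexp] at h2 h2' h3
  have hu0 : 0 < u := by linarith
  set a : ℝ := Real.log T / (1000 * u) with ha
  have ha1 : 4 ≤ a := by
    rw [ha, le_div_iff₀ (by positivity)]; linarith
  have hlog2 : Real.log 2 ≤ 1 := by have := Real.log_two_lt_d9; linarith
  have hfl := log_natFloor_exp_ge (a := a) (by linarith)
  have hz : sieveLevel T = ⌊Real.exp a⌋₊ := rfl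
  rw [← hz] at hfl
  have hle : (sieveLevel T : ℝ) ≤ Real.exp a := natFloor_exp_le a
  have hz2 : 2 ≤ sieveLevel T := by
    rw [hz]
    refine Nat.le_floor ?_
    have := Real.add_one_le_exp a
    push_cast; linarith
  have hz2' : (2 : ℝ) ≤ sieveLevel T := by exact_mod_cast hz2
  refine ⟨hz2, ?_, ?_, ?_⟩
  · have : Real.log T / (2000 * u) = a / 2 := by rw [ha]; field_simp; norm_num
    rw [this]; linarith
  · have hb : (sieveLevel T : ℝ) + 1 ≤ Real.exp (a + 1) := by
      rw [Real.exp_add]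
      have := Real.add_one_le_exp (1 : ℝ)
      nlinarith
    have hr : ((2 * ⌊50 * u⌋₊ : ℕ) : ℝ) ≤ 100 * u := by
      push_cast
      have := Nat.floor_le (a := 50 * u) (by positivity)
      linarith
    calc ((sieveLevel T : ℝ) + 1) ^ (2 * ⌊50 * u⌋₊) ≤ Real.exp (a + 1) ^ (2 * ⌊50 * u⌋₊) := by gcongr
      _ = Real.exp (((2 * ⌊50 * u⌋₊ : ℕ) : ℝ) * (a + 1)) := by rw [Real.exp_nat_mul]
      _ ≤ Real.exp (100 * u * (a + 1)) := by gcongr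
      _ ≤ Real.exp (Real.log T * 0.2 + -(4 * u + 6)) := by
          apply Real.exp_le_exp.2
          have : 100 * u * a = 0.1 * Real.log T := by rw [ha]; field_simp; norm_num
          norm_num at this h3 ⊢
          linarith
      _ = _ := by rw [Real.exp_add, Real.rpow_def_of_pos hT0]
  · refine (sum_primesIoc_inv_le' _ hz2).trans ?_
    have : Real.log (sieveLevel T) ≤ Real.log T := by
      calc Real.log (sieveLevel T) ≤ a := by
            rw [← Real.log_exp a]; exact Real.log_le_log (by linarith) hle
        _ ≤ Real.log T / 1 := by rw [ha]; gcongr; linarith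
        _ = _ := div_one _
    have hpos : 0 < Real.log (sieveLevel T) := Real.log_pos (by linarith)
    have := Real.log_le_log hpos this
    linarith

theorem sieveDensity_nonneg (T : ℕ) : 0 ≤ sieveDensity T :=
  prod_nonneg fun p hp => by
    have : (1 : ℝ) ≤ p := by exact_mod_cast (mem_primesIoc.1 hp).2.2.one_le
    rw [sub_nonneg, div_le_one (by linarith)]; exact this

theorem eventually_sieveDensity : ∀ᶠ T : ℕ in atTop,
    Real.exp (-(4 * Real.log (Real.log T) + 6)) ≤ sieveDensity T ∧
    sieveDensity T ≤ 2000 * Real.log (Real.log T) / Real.log T := by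
  filter_upwards [eventually_sieveLevel, eventually_loglog (eventually_ge_atTop 1),
    eventually_ge_atTop 3] with T ⟨h1, h2, _, h4⟩ hu hT
  have hT3 : (3 : ℝ) ≤ T := by exact_mod_cast hT
  have hL0 : 0 < Real.log T := Real.log_pos (by linarith)
  constructor
  · refine le_trans (Real.exp_le_exp.2 ?_) (exp_neg_two_mul_sum_le_prod _ fun p hp =>
      (mem_primesIoc.1 hp).2.2)
    linarith
  · refine (prod_primesIoc_one_sub_inv_le _ h1).trans ?_
    have h5 : 0 < Real.log T / (2000 * Real.log (Real.log T)) := by positivity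
    calc 1 / Real.log (sieveLevel T) ≤ 1 / (Real.log T / (2000 * Real.log (Real.log T))) := by gcongr
      _ = _ := by rw [one_div_div]

theorem prod_le_prod_of_subset_of_mem_unitInterval {ι : Type*} {s t : Finset ι} {f : ι → ℝ}
    (hst : s ⊆ t) (hf : ∀ i ∈ t, 0 ≤ f i ∧ f i ≤ 1) : ∏ i ∈ t, f i ≤ ∏ i ∈ s, f i := by
  classical
  rw [← prod_sdiff hst]
  exact mul_le_of_le_one_left (prod_nonneg fun i hi => (hf i (hst hi)).1)
    (prod_le_one (fun i hi => (hf i (mem_sdiff.1 hi).1).1) fun i hi => (hf i (mem_sdiff.1 hi).1).2)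

theorem prod_coprime_le (T : ℕ) {q : ℕ} (hq : 0 < q) :
    ∏ ℓ ∈ primesIoc 0 (sieveLevel T) with q.Coprime ℓ, (1 - 1 / (ℓ : ℝ)) ≤
      sieveDensity T * (q / q.totient) := by
  have htot : (q.totient : ℝ) = q * ∏ p ∈ q.primeFactors, (1 - (p : ℝ)⁻¹) := by
    have h := congrArg (fun x : ℚ => (x : ℝ)) (Nat.totient_eq_mul_prod_factors q)
    push_cast at h
    exact h
  have hq0 : (0 : ℝ) < q := by exact_mod_cast hq
  have hφ : (0 : ℝ) < q.totient := by exact_mod_cast Nat.totient_pos.2 hq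
  have hfac : ∀ p : ℕ, p.Prime → 0 ≤ 1 - 1 / (p : ℝ) ∧ 1 - 1 / (p : ℝ) ≤ 1 := fun p hp => by
    have : (1 : ℝ) ≤ p := by exact_mod_cast hp.one_le
    constructor
    · rw [sub_nonneg, div_le_one (by linarith)]; exact this
    · have : 0 ≤ 1 / (p : ℝ) := by positivity
      linarith
  have h1 : sieveDensity T = (∏ ℓ ∈ primesIoc 0 (sieveLevel T) with q.Coprime ℓ, (1 - 1 / (ℓ : ℝ))) *
      ∏ ℓ ∈ primesIoc 0 (sieveLevel T) with ¬ q.Coprime ℓ, (1 - 1 / (ℓ : ℝ)) :=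
    (prod_filter_mul_prod_filter_not _ _ _).symm
  have h2 : (q.totient : ℝ) / q ≤
      ∏ ℓ ∈ primesIoc 0 (sieveLevel T) with ¬ q.Coprime ℓ, (1 - 1 / (ℓ : ℝ)) := by
    rw [htot, mul_div_cancel_left₀ _ hq0.ne']
    simp only [← one_div]
    refine prod_le_prod_of_subset_of_mem_unitInterval ?_ fun ℓ hℓ =>
      hfac ℓ (Nat.prime_of_mem_primeFactors hℓ)
    · intro ℓ hℓ
      obtain ⟨h3, h4⟩ := mem_filter.1 hℓ
      have hp := (mem_primesIoc.1 h3).2.2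
      rw [Nat.coprime_comm, hp.coprime_iff_not_dvd, not_not] at h4
      exact Nat.mem_primeFactors.2 ⟨hp, h4, hq.ne'⟩
  rw [h1, mul_assoc]
  refine le_mul_of_one_le_right (prod_nonneg fun ℓ hℓ =>
    (hfac ℓ (mem_primesIoc.1 (mem_filter.1 hℓ).1).2.2).1) ?_
  calc (1 : ℝ) = q.totient / q * (q / q.totient) := by field_simp
    _ ≤ _ := by gcongr

/-- Sifting an arithmetic progression up to the sieve level. -/
theorem eventually_sieve_bound : ∀ᶠ T : ℕ in atTop, ∀ q t N : ℕ, 0 < q →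
    (q : ℝ) * (T : ℝ) ^ (0.2 : ℝ) ≤ N →
    (#{k ∈ Ioc 0 N | k ≡ t [MOD q] ∧ ∀ ℓ ∈ primesIoc 0 (sieveLevel T), q.Coprime ℓ → ¬ ℓ ∣ k} : ℝ)
      ≤ 3 * sieveDensity T * N / q.totient ∧
    (sieveLevel T : ℝ) ≤ sieveDensity T * N / q.totient := by
  classical
  filter_upwards [eventually_sieveLevel, eventually_sieveDensity,
    eventually_loglog (eventually_ge_atTop 1)] with T ⟨h1, _, h3, h4⟩ ⟨h5, _⟩ hu q t N hq hN
  set u := Real.log (Real.log T) with hudef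
  have hq0 : (0 : ℝ) < q := by exact_mod_cast hq
  have hφ : (0 : ℝ) < q.totient := by exact_mod_cast Nat.totient_pos.2 hq
  have hφq : (q.totient : ℝ) ≤ q := by exact_mod_cast Nat.totient_le q
  set P := {ℓ ∈ primesIoc 0 (sieveLevel T) | q.Coprime ℓ} with hP
  have hD0 := sieveDensity_nonneg T
  have hNq : (T : ℝ) ^ (0.2 : ℝ) ≤ N / q := by rw [le_div_iff₀ hq0]; linarith
  have hpow : ((sieveLevel T : ℝ) + 1) ^ (2 * ⌊50 * u⌋₊) ≤ N / q * sieveDensity T :=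
    h3.trans (by gcongr)
  have hNφ : (N : ℝ) / q * sieveDensity T ≤ sieveDensity T * N / q.totient := by
    rw [div_mul_eq_mul_div, mul_comm]
    gcongr
  constructor
  · have hb := brun_pure_sieve P (fun ℓ hℓ => (mem_primesIoc.1 (mem_filter.1 hℓ).1).2.2) hq
      (fun ℓ hℓ => (mem_filter.1 hℓ).2) t N ⌊50 * u⌋₊
    have hset : {k ∈ Ioc 0 N | k ≡ t [MOD q] ∧ ∀ ℓ ∈ primesIoc 0 (sieveLevel T), q.Coprime ℓ →
        ¬ ℓ ∣ k} = {k ∈ Ioc 0 N | k ≡ t [MOD q] ∧ ∀ ℓ ∈ P, ¬ ℓ ∣ k} := by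
      refine filter_congr fun k _ => and_congr_right fun _ => ?_
      constructor
      · intro h ℓ hℓ
        obtain ⟨h6, h7⟩ := mem_filter.1 hℓ
        exact h ℓ h6 h7
      · intro h ℓ hp hc
        exact h ℓ (mem_filter.2 ⟨hp, hc⟩)
    rw [hset]
    refine hb.trans ?_
    have hPS : ∑ ℓ ∈ P, 1 / (ℓ : ℝ) ≤ 2 * u + 3 :=
      le_trans (sum_le_sum_of_subset_of_nonneg (filter_subset _ _) fun _ _ _ => by positivity) h4
    have hexp : Real.exp (Real.exp 1 * ∑ ℓ ∈ P, 1 / (ℓ : ℝ) - (2 * ⌊50 * u⌋₊ : ℕ)) ≤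
        sieveDensity T := by
      refine le_trans (Real.exp_le_exp.2 ?_) h5
      have h6 : 50 * u < ⌊50 * u⌋₊ + 1 := Nat.lt_floor_add_one _
      have h7 : Real.exp 1 ≤ 3 := by have := Real.exp_one_lt_d9; linarith
      have h8 : Real.exp 1 * ∑ ℓ ∈ P, 1 / (ℓ : ℝ) ≤ 3 * (2 * u + 3) := by
        gcongr
      push_cast
      linarith
    have hcard : (#P : ℝ) ≤ sieveLevel T := by
      have : #P ≤ #(Ioc 0 (sieveLevel T)) :=
        card_le_card ((filter_subset _ _).trans (filter_subset _ _))
      simpa using this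
    have hprod := prod_coprime_le T hq
    calc _ ≤ (N : ℝ) / q * (sieveDensity T * (q / q.totient) + sieveDensity T) +
          N / q * sieveDensity T := by
          gcongr ?_ * (?_ + ?_) + ?_
          refine le_trans ?_ hpow
          gcongr
      _ = sieveDensity T * N / q.totient + N / q * sieveDensity T + N / q * sieveDensity T := by
          field_simp
      _ ≤ sieveDensity T * N / q.totient + sieveDensity T * N / q.totient +
          sieveDensity T * N / q.totient := by gcongr
      _ = _ := by ring
  · refine le_trans ?_ (hpow.trans hNφ)
    have hne : 2 * ⌊50 * u⌋₊ ≠ 0 := by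
      have : 1 ≤ ⌊50 * u⌋₊ := Nat.one_le_floor_iff _ |>.2 (by linarith)
      omega
    calc (sieveLevel T : ℝ) ≤ (sieveLevel T : ℝ) + 1 := by linarith
      _ ≤ _ := le_self_pow₀ (by linarith [show (0:ℝ) ≤ sieveLevel T by positivity]) hne

/-- Primes in arithmetic progressions to small moduli. -/
theorem eventually_primes_modEq_le : ∀ᶠ T : ℕ in atTop, ∀ q t : ℕ, 0 < q →
    (q : ℝ) ≤ (T : ℝ) ^ (0.1 : ℝ) →
    (#{p ∈ primesIoc 0 T | p ≡ t [MOD q]} : ℝ) ≤ 4 * sieveDensity T * T / q.totient := by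
  classical
  filter_upwards [eventually_sieve_bound, eventually_ge_atTop 3] with T hsv hT q t hq hqT
  have hT0 : (1 : ℝ) ≤ T := by exact_mod_cast (by omega : 1 ≤ T)
  obtain ⟨h1, h2⟩ := hsv q t T hq (by
    calc (q : ℝ) * (T : ℝ) ^ (0.2 : ℝ) ≤ (T : ℝ) ^ (0.1 : ℝ) * (T : ℝ) ^ (0.2 : ℝ) := by gcongr
      _ = (T : ℝ) ^ (0.3 : ℝ) := by rw [← Real.rpow_add (by linarith)]; norm_num
      _ ≤ (T : ℝ) ^ (1 : ℝ) := Real.rpow_le_rpow_of_exponent_le hT0 (by norm_num)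
      _ = _ := Real.rpow_one _)
  have hsub : {p ∈ primesIoc 0 T | p ≡ t [MOD q]} ⊆ Ioc 0 (sieveLevel T) ∪
      {k ∈ Ioc 0 T | k ≡ t [MOD q] ∧ ∀ ℓ ∈ primesIoc 0 (sieveLevel T), q.Coprime ℓ → ¬ ℓ ∣ k} := by
    intro p hp
    obtain ⟨h3, h4⟩ := mem_filter.1 hp
    obtain ⟨h5, h6, h7⟩ := mem_primesIoc.1 h3
    rcases le_or_gt p (sieveLevel T) with h8 | h8
    · exact mem_union_left _ (mem_Ioc.2 ⟨h5, h8⟩)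
    · refine mem_union_right _ (mem_filter.2 ⟨mem_Ioc.2 ⟨h5, h6⟩, h4, fun ℓ hℓ _ hd => ?_⟩)
      obtain ⟨_, hℓz, hℓ⟩ := mem_primesIoc.1 hℓ
      have := (Nat.prime_dvd_prime_iff_eq hℓ h7).1 hd
      omega
  have h3 : (#{p ∈ primesIoc 0 T | p ≡ t [MOD q]} : ℝ) ≤ sieveLevel T +
      #{k ∈ Ioc 0 T | k ≡ t [MOD q] ∧ ∀ ℓ ∈ primesIoc 0 (sieveLevel T), q.Coprime ℓ → ¬ ℓ ∣ k} := by
    have := (card_le_card hsub).trans (card_union_le _ _)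
    rw [Nat.card_Ioc, Nat.sub_zero] at this
    exact_mod_cast this
  have h4 : 4 * sieveDensity T * T / q.totient =
      sieveDensity T * T / q.totient + 3 * sieveDensity T * T / q.totient := by ring
  rw [h4]; linarith

theorem eventually_log_log_three_mul : ∀ᶠ T : ℕ in atTop, 3 ≤ T ∧ 1 ≤ Real.log (Real.log T) ∧
    Real.log (3 * T : ℕ) ≤ 1.1 * Real.log T ∧
    ∑ ℓ ∈ primesIoc 0 (3 * T), 1 / (ℓ : ℝ) ≤ 2 * Real.log (Real.log T) + 5 := by
  filter_upwards [eventually_ge_atTop 3, eventually_loglog (eventually_ge_atTop 3)] with T hT hu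
  have hT3 : (3 : ℝ) ≤ T := by exact_mod_cast hT
  have hL0 : 0 < Real.log T := Real.log_pos (by linarith)
  have hexp : Real.exp (Real.log (Real.log T)) = Real.log T := Real.exp_log hL0
  have hL : 16 ≤ Real.log T := by
    rw [← hexp]
    calc (16 : ℝ) ≤ 2.7 ^ 3 := by norm_num
      _ ≤ Real.exp 1 ^ 3 := by gcongr; have := Real.exp_one_gt_d9; norm_num at this ⊢; linarith
      _ = Real.exp 3 := by rw [← Real.exp_nat_mul]; norm_num
      _ ≤ _ := Real.exp_le_exp.2 hu
  have hlog3 : Real.log 3 ≤ 1.6 := by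
    have h1 : Real.log 3 ≤ Real.log 4 := Real.log_le_log (by norm_num) (by norm_num)
    have h2 : Real.log 4 = 2 * Real.log 2 := by
      rw [show (4 : ℝ) = 2 ^ 2 by norm_num, Real.log_pow]; norm_num
    have := Real.log_two_lt_d9
    norm_num at this ⊢
    linarith
  have h3 : Real.log (3 * T : ℕ) ≤ 1.1 * Real.log T := by
    push_cast
    rw [Real.log_mul (by norm_num) (by positivity)]
    norm_num at hlog3 ⊢
    linarith
  refine ⟨hT, by linarith, h3, ?_⟩
  refine (sum_primesIoc_inv_le' (3 * T) (by omega)).trans ?_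
  have h4 : 0 < Real.log (3 * T : ℕ) := Real.log_pos (by push_cast; linarith)
  have h5 : Real.log (Real.log (3 * T : ℕ)) ≤ 1 + Real.log (Real.log T) := by
    rw [← Real.log_exp 1, ← Real.log_mul (Real.exp_pos 1).ne' hL0.ne']
    refine Real.log_le_log h4 (h3.trans ?_)
    have := Real.exp_one_gt_d9
    gcongr
    norm_num at this ⊢; linarith
  linarith

/-- The moduli with a large smooth part contribute little. -/
theorem eventually_sum_smoothPart_large_le : ∀ᶠ T : ℕ in atTop, ∀ (f : ℕ → ℝ) (K : ℤ),
    RootLike f K → ∀ X : ℕ, X ≤ 3 * T →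
    ∑ e ∈ Icc 1 X with (T : ℝ) ^ (0.1 : ℝ) < (smoothPart (smoothLevel T) e : ℕ), f e / e ≤
      Real.exp (-(3 * Real.log (Real.log T))) := by
  set C : ℝ := 1212000 * Real.exp 60000 with hC
  have hev : ∀ᶠ u : ℝ in atTop, 1 ≤ u ∧ 300 * u / Real.exp u ≤ 0.2 ∧ 50 + C ≤ u ∧ u ≤ Real.exp u := by
    filter_upwards [eventually_ge_atTop 1, eventually_ge_atTop (50 + C),
      eventually_mul_le_exp 1500 1 1 one_pos] with u h1 h2 h3
    rw [Real.rpow_one, one_mul] at h3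
    refine ⟨h1, ?_, h2, by linarith⟩
    rw [div_le_iff₀ (Real.exp_pos u)]
    norm_num; linarith
  filter_upwards [eventually_loglog hev, eventually_log_log_three_mul]
    with T ⟨hu1, hσ2, huC, huL⟩ ⟨hT, _, _, hS⟩ f K hf X hX
  have hT3 : (3 : ℝ) ≤ T := by exact_mod_cast hT
  have hT0 : (0 : ℝ) < T := by linarith
  have hL0 : 0 < Real.log T := Real.log_pos (by linarith)
  set u := Real.log (Real.log T) with hu
  have hexp : Real.exp u = Real.log T := Real.exp_log hL0
  rw [hexp] at hσ2 huL
  set σ : ℝ := 300 * u / Real.log T with hσ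
  have hσ0 : 0 ≤ σ := by positivity
  set z := smoothLevel T with hz
  have hzle : (z : ℝ) ≤ Real.exp (100 * Real.log T / u) := natFloor_exp_le _
  set s := primesIoc 0 (3 * T) with hs
  have hsp : ∀ p ∈ s, p.Prime := fun p hp => (mem_primesIoc.1 hp).2.2
  have hR := hf.sum_smoothPart_rpow_le z hσ0 hσ2 s hsp
    ({e ∈ Icc 1 X | (T : ℝ) ^ (0.1 : ℝ) < (smoothPart z e : ℕ)}) (fun n hn => by
      have h1 := mem_Icc.1 (mem_filter.1 hn).1
      exact ⟨by omega, primeFactors_subset_primesIoc (by omega) (h1.2.trans hX)⟩)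
  have hV : ((T : ℝ) ^ (0.1 : ℝ)) ^ σ = Real.exp (30 * u) := by
    rw [← Real.rpow_mul hT0.le, Real.rpow_def_of_pos hT0, hσ]
    congr 1; field_simp; norm_num
  have h1 : ∑ e ∈ Icc 1 X with (T : ℝ) ^ (0.1 : ℝ) < (smoothPart z e : ℕ), f e / e ≤
      Real.exp (-(30 * u)) * ∑ e ∈ Icc 1 X with (T : ℝ) ^ (0.1 : ℝ) < (smoothPart z e : ℕ),
        f e / e * (smoothPart z e : ℝ) ^ σ := by
    rw [mul_sum]
    refine sum_le_sum fun e he => ?_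
    have h2 := (mem_filter.1 he).2
    have h3 : Real.exp (30 * u) ≤ (smoothPart z e : ℝ) ^ σ := by
      rw [← hV]; exact Real.rpow_le_rpow (by positivity) h2.le hσ0
    have h4 : 0 ≤ f e / e := div_nonneg (hf.nonneg e) (by positivity)
    calc f e / e = Real.exp (-(30 * u)) * (f e / e * Real.exp (30 * u)) := by
          rw [mul_left_comm, ← Real.exp_add]; simp
      _ ≤ _ := by gcongr
  have hprod : ∏ ℓ ∈ s, (1 + 10 * ((if ℓ ≤ z then (ℓ : ℝ) ^ (2 * σ) else 1) / ℓ)) ≤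
      Real.exp (20 * u + 50 + C) := by
    refine (Real.prod_one_add_le_exp_sum _ fun p => ?_).trans (Real.exp_le_exp.2 ?_)
    · split_ifs <;> positivity
    have h2 : ∑ ℓ ∈ s, 10 * ((if ℓ ≤ z then (ℓ : ℝ) ^ (2 * σ) else 1) / ℓ) ≤
        ∑ ℓ ∈ s, (10 * (1 / (ℓ : ℝ)) +
          if ℓ ≤ z then 20 * σ * Real.exp 60000 * (Real.log ℓ / ℓ) else 0) := by
      refine sum_le_sum fun ℓ hℓ => ?_
      split_ifs with hlz
      · have hℓ1 : (1 : ℝ) ≤ ℓ := by exact_mod_cast (hsp ℓ hℓ).one_le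
        have hℓ0 : (0 : ℝ) < ℓ := by linarith
        have hlogℓ : Real.log ℓ ≤ 100 * Real.log T / u := by
          rw [← Real.log_exp (100 * Real.log T / u)]
          exact Real.log_le_log hℓ0 (le_trans (by exact_mod_cast hlz) hzle)
        have hx0 : 0 ≤ Real.log ℓ := Real.log_nonneg hℓ1
        have hx : 2 * σ * Real.log ℓ ≤ 60000 := by
          calc 2 * σ * Real.log ℓ ≤ 2 * σ * (100 * Real.log T / u) := by gcongr
            _ = 60000 := by rw [hσ]; field_simp; norm_num
        have hpow : (ℓ : ℝ) ^ (2 * σ) ≤ 1 + 2 * σ * Real.log ℓ * Real.exp 60000 := by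
          rw [Real.rpow_def_of_pos hℓ0, mul_comm (Real.log (ℓ : ℝ))]
          set x := 2 * σ * Real.log ℓ with hxdef
          have hx0' : 0 ≤ x := by positivity
          have h3 := Real.add_one_le_exp (-x)
          have h4 : Real.exp x * Real.exp (-x) = 1 := by rw [← Real.exp_add]; simp
          have h5 : Real.exp x ≤ Real.exp 60000 := Real.exp_le_exp.2 hx
          have h6 : Real.exp x * (-x + 1) ≤ 1 := by
            calc Real.exp x * (-x + 1) ≤ Real.exp x * Real.exp (-x) := by gcongr
              _ = 1 := h4
          nlinarith
        calc 10 * ((ℓ : ℝ) ^ (2 * σ) / ℓ) ≤ 10 * ((1 + 2 * σ * Real.log ℓ * Real.exp 60000) / ℓ) := by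
              gcongr
          _ = _ := by ring
      · simp
    refine h2.trans ?_
    rw [sum_add_distrib, ← mul_sum, ← sum_filter, ← mul_sum]
    have h3 : ∑ ℓ ∈ s with ℓ ≤ z, Real.log ℓ / (ℓ : ℝ) ≤ 2 * (1 + 100 * Real.log T / u) := by
      rcases Nat.eq_zero_or_pos z with hz0 | hz0
      · rw [filter_false_of_mem, sum_empty]
        · positivity
        · intro p hp
          have := (hsp p hp).pos
          omega
      calc ∑ ℓ ∈ s with ℓ ≤ z, Real.log ℓ / (ℓ : ℝ) ≤ ∑ ℓ ∈ primesIoc 0 z, Real.log ℓ / (ℓ : ℝ) := by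
            refine sum_le_sum_of_subset_of_nonneg (fun p hp => ?_) fun p hp _ => ?_
            · obtain ⟨h4, h5⟩ := mem_filter.1 hp
              exact mem_primesIoc.2 ⟨(hsp p h4).pos, h5, hsp p h4⟩
            · have : (1 : ℝ) ≤ p := by exact_mod_cast (mem_primesIoc.1 hp).2.2.one_le
              exact div_nonneg (Real.log_nonneg this) (by linarith)
        _ ≤ Real.log 4 * (1 + Real.log z) := sum_primesIoc_log_div_le z hz0
        _ ≤ 2 * (1 + 100 * Real.log T / u) := by
            have h5 : Real.log z ≤ 100 * Real.log T / u := by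
              rw [← Real.log_exp (100 * Real.log T / u)]
              exact Real.log_le_log (by exact_mod_cast hz0) hzle
            have h6 : Real.log 4 ≤ 2 := by
              rw [show (4 : ℝ) = 2 ^ 2 by norm_num, Real.log_pow]
              have := Real.log_two_lt_d9
              push_cast; linarith
            have h7 : 0 ≤ 100 * Real.log T / u := by positivity
            have h8 : 0 ≤ Real.log z := Real.log_nonneg (by exact_mod_cast hz0)
            gcongr
    have h4 : 20 * σ * Real.exp 60000 * ∑ ℓ ∈ s with ℓ ≤ z, Real.log ℓ / (ℓ : ℝ) ≤ C := by
      calc _ ≤ 20 * σ * Real.exp 60000 * (2 * (1 + 100 * Real.log T / u)) := by gcongr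
        _ = (12000 * (u / Real.log T) + 1200000) * Real.exp 60000 := by
            rw [hσ]; field_simp; ring
        _ ≤ C := by
            rw [hC]
            have : u / Real.log T ≤ 1 := by rw [div_le_one hL0]; exact huL
            have h9 := Real.exp_pos 60000
            nlinarith
    linarith
  calc _ ≤ Real.exp (-(30 * u)) * Real.exp (20 * u + 50 + C) :=
        h1.trans (by gcongr; exact hR.trans hprod)
    _ = Real.exp (-(30 * u) + (20 * u + 50 + C)) := by rw [← Real.exp_add]
    _ ≤ _ := Real.exp_le_exp.2 (by linarith)

open Classical in
/-- The moduli divisible by the square of a large prime contribute little. -/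
theorem eventually_sum_sq_dvd_le : ∀ᶠ T : ℕ in atTop, ∀ (f : ℕ → ℝ) (K : ℤ),
    RootLike f K → K ≠ 0 → |K| ≤ (T : ℤ) ^ 3 → ∀ X : ℕ, X ≤ 3 * T →
    ∑ e ∈ Icc 1 X with ∃ ℓ, ℓ.Prime ∧ smoothLevel T < ℓ ∧ ℓ ^ 2 ∣ e, f e / e ≤
      Real.exp (-(3 * Real.log (Real.log T))) := by
  have hev : ∀ᶠ u : ℝ in atTop, 64 ≤ u ∧ u ^ 2 ≤ Real.exp u := by
    filter_upwards [eventually_ge_atTop 64, eventually_mul_le_exp 1 2 1 one_pos] with u h1 h3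
    rw [one_mul, one_mul] at h3
    exact ⟨h1, by exact_mod_cast h3⟩
  filter_upwards [eventually_loglog hev, eventually_log_log_three_mul]
    with T ⟨hu1, hu2⟩ ⟨hT, _, _, hS⟩ f K hf hK hKT X hX
  have hT3 : (3 : ℝ) ≤ T := by exact_mod_cast hT
  have hT0 : (0 : ℝ) < T := by linarith
  have hL0 : 0 < Real.log T := Real.log_pos (by linarith)
  set u := Real.log (Real.log T) with hu
  have hexp : Real.exp u = Real.log T := Real.exp_log hL0
  rw [hexp] at hu2
  set z := smoothLevel T with hz
  set a := 100 * Real.log T / u with ha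
  have ha1 : 100 * u ≤ a := by
    rw [ha, le_div_iff₀ (by linarith)]; nlinarith
  have hz1 : Real.exp (99 * u) ≤ z := by
    have h1 : Real.exp a < z + 1 := Nat.lt_floor_add_one _
    have h2 : Real.exp (99 * u) * Real.exp u ≤ Real.exp a := by
      rw [← Real.exp_add]; exact Real.exp_le_exp.2 (by linarith)
    have h3 := Real.add_one_le_exp u
    have h4 : 1 ≤ Real.exp (99 * u) := Real.one_le_exp (by linarith)
    nlinarith
  have hz0 : 0 < z := by
    have : (0 : ℝ) < z := (Real.exp_pos _).trans_le hz1
    exact_mod_cast this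
  refine (hf.sum_sq_dvd_le hK X hz0).trans ?_
  have hω : (#K.natAbs.primeFactors : ℝ) ≤ 6 * Real.log T := by
    refine (card_primeFactors_le_log K.natAbs (by simpa using hK)).trans ?_
    have h1 : ((K.natAbs : ℕ) : ℝ) ≤ (T : ℝ) ^ 3 := by
      have : (K.natAbs : ℤ) ≤ (T : ℤ) ^ 3 := by rw [Int.natCast_natAbs]; exact hKT
      exact_mod_cast this
    have h2 : (0 : ℝ) < K.natAbs := by exact_mod_cast Int.natAbs_pos.2 hK
    have h3 := Real.log_le_log h2 h1
    rw [Real.log_pow] at h3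
    push_cast at h3
    linarith
  have hprod : ∏ ℓ ∈ primesIoc 0 X, (1 + 10 / (ℓ : ℝ)) ≤ Real.exp (20 * u + 50) := by
    refine (Real.prod_one_add_le_exp_sum _ fun p => by positivity).trans (Real.exp_le_exp.2 ?_)
    have h1 : ∑ ℓ ∈ primesIoc 0 X, 1 / (ℓ : ℝ) ≤ ∑ ℓ ∈ primesIoc 0 (3 * T), 1 / (ℓ : ℝ) :=
      sum_le_sum_of_subset_of_nonneg (filter_subset_filter _ (Ioc_subset_Ioc_right hX))
        fun _ _ _ => by positivity
    have h2 : ∑ ℓ ∈ primesIoc 0 X, 10 / (ℓ : ℝ) = 10 * ∑ ℓ ∈ primesIoc 0 X, 1 / (ℓ : ℝ) := by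
      rw [mul_sum]; exact sum_congr rfl fun _ _ => by ring
    rw [h2]; linarith
  have hfirst : 4 + 10 * (#K.natAbs.primeFactors : ℝ) ≤ Real.exp (2 * u) := by
    have h1 : u + 1 ≤ Real.log T := by rw [← hexp]; exact Real.add_one_le_exp u
    have : Real.exp (2 * u) = Real.log T * Real.log T := by rw [two_mul, Real.exp_add, hexp]
    rw [this]
    nlinarith
  calc _ ≤ Real.exp (2 * u) / Real.exp (99 * u) * Real.exp (20 * u + 50) := by
        refine mul_le_mul ?_ hprod (prod_nonneg fun _ _ => by positivity) (by positivity)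
        gcongr
    _ = Real.exp (2 * u - 99 * u + (20 * u + 50)) := by rw [← Real.exp_sub, ← Real.exp_add]
    _ ≤ _ := Real.exp_le_exp.2 (by linarith)

theorem rootCount_le_two_pow_card_primeFactors (K : ℤ) {e : ℕ} :
    Squarefree e → rootCount K e ≤ 2 ^ #e.primeFactors := by
  induction e using Nat.recOnPosPrimePosCoprime with
  | prime_pow p n hp hn =>
    intro hsq
    have h1 : n = 1 := by
      rcases (Nat.squarefree_pow_iff hp.ne_one hn.ne').1 hsq with ⟨_, h⟩
      exact h
    subst h1
    rw [pow_one, hp.primeFactors, card_singleton, pow_one]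
    exact rootCount_prime_le_two hp K
  | zero => intro h; exact absurd h not_squarefree_zero
  | one => intro _; simp [rootCount_one]
  | coprime a b ha hb hab iha ihb =>
    intro hsq
    rw [rootCount_mul K hab, hab.primeFactors_mul,
      card_union_of_disjoint hab.disjoint_primeFactors, pow_add]
    exact Nat.mul_le_mul (iha hsq.of_mul_left) (ihb hsq.of_mul_right)

theorem card_primeFactors_mul_log_le {e z : ℕ} (he : e ≠ 0)
    (hz : ∀ ℓ, ℓ.Prime → ℓ ∣ e → z < ℓ) : #e.primeFactors * Real.log (z + 1 : ℕ) ≤ Real.log e := by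
  have h : (z + 1) ^ #e.primeFactors ≤ e := by
    calc (z + 1) ^ #e.primeFactors ≤ ∏ p ∈ e.primeFactors, p :=
          Finset.pow_card_le_prod _ _ _ fun p hp => hz p (Nat.prime_of_mem_primeFactors hp)
            (Nat.dvd_of_mem_primeFactors hp)
      _ ≤ e := Nat.le_of_dvd (Nat.pos_of_ne_zero he) (Nat.prod_primeFactors_dvd e)
  have h2 : ((z + 1 : ℕ) : ℝ) ^ #e.primeFactors ≤ e := by exact_mod_cast h
  have h3 := Real.log_le_log (by positivity) h2
  rwa [Real.log_pow] at h3

theorem norm_expSum_le_smoothPart (z : ℕ) {e : ℕ} (he : e ≠ 0)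
    (hsq : ∀ ℓ, ℓ.Prime → z < ℓ → ¬ ℓ ^ 2 ∣ e) (H : ℤ) :
    ∃ b : ℤ, IsCoprime b (smoothPart z e : ℤ) ∧ ∀ K, ‖expSum e H K‖ ≤
      ‖expSum (smoothPart z e) (H * b) K‖ * 2 ^ #(roughPart z e).primeFactors := by
  have hcop := smoothPart_coprime_roughPart z e
  haveI : NeZero (smoothPart z e) := ⟨(smoothPart_pos he).ne'⟩
  haveI : NeZero (roughPart z e) := ⟨(roughPart_pos he).ne'⟩
  obtain ⟨a', b', hbez⟩ : ∃ a' b' : ℤ, a' * smoothPart z e + b' * roughPart z e = 1 :=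
    Nat.isCoprime_iff_coprime.2 hcop
  refine ⟨b', ⟨roughPart z e, a', by linarith⟩, fun K => ?_⟩
  have hmul := smoothPart_mul_roughPart z he
  have h1 := expSum_mul hcop a' b' hbez H K
  rw [hmul] at h1
  rw [h1, norm_mul]
  gcongr
  refine (norm_expSum_le _ _ _).trans ?_
  have hsf : Squarefree (roughPart z e) := by
    rw [Nat.squarefree_iff_prime_squarefree]
    intro ℓ hℓ hd
    have h2 := prime_dvd_roughPart hℓ (dvd_of_mul_left_dvd hd)
    refine hsq ℓ hℓ h2.1 ?_
    rw [sq, ← hmul]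
    exact hd.mul_left _
  exact_mod_cast rootCount_le_two_pow_card_primeFactors K hsf

theorem sum_norm_expSum_le_expSumAvg (s : Finset ℕ) {e : ℕ} (he : 0 < e) (h D : ℤ) {B : ℝ}
    (hB : ∀ t, (#{p ∈ s | p ≡ t [MOD e]} : ℝ) ≤ B) :
    ∑ p ∈ s, ‖expSum e h (D - (p : ℤ) ^ 2)‖ ≤ expSumAvg e h D * B := by
  rw [← sum_fiberwise_of_maps_to (t := range e) (g := fun p => p % e)
    (fun p _ => mem_range.2 (Nat.mod_lt p he)), expSumAvg, sum_mul]
  refine sum_le_sum fun t ht => ?_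
  have h1 : ∀ p ∈ {p ∈ s | p % e = t}, ‖expSum e h (D - (p : ℤ) ^ 2)‖ =
      ‖expSum e h (D - (t : ℤ) ^ 2)‖ := by
    intro p hp
    have hpt : (p : ℤ) ≡ t [ZMOD e] := by
      have : p ≡ t [MOD e] := by
        rw [Nat.ModEq, (mem_filter.1 hp).2, Nat.mod_eq_of_lt (mem_range.1 ht)]
      exact_mod_cast (Int.natCast_modEq_iff.2 this)
    rw [expSum_congr (h' := h) (K' := D - (t : ℤ) ^ 2) (by simp)]
    have := ((hpt.pow 2).sub_left D).symm.dvd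
    exact this
  rw [sum_congr rfl h1, sum_const, nsmul_eq_mul, mul_comm]
  gcongr
  refine le_trans ?_ (hB t)
  have : {p ∈ s | p % e = t} ⊆ {p ∈ s | p ≡ t [MOD e]} := by
    intro p hp
    obtain ⟨h2, h3⟩ := mem_filter.1 hp
    exact mem_filter.2 ⟨h2, by rw [Nat.ModEq, h3, Nat.mod_eq_of_lt (mem_range.1 ht)]⟩
  exact_mod_cast card_le_card this

open Classical in
theorem eventually_sum_rough_le : ∀ᶠ T : ℕ in atTop, ∀ (D h : ℤ) (X : ℕ) (v : ℕ → ℤ),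
    (T : ℝ) ^ (0.9 : ℝ) ≤ X → X ≤ 3 * T →
    (h ≠ 0 → ∀ e, Odd e → IsCoprime (v e) (e : ℤ)) →
    ∑ e ∈ Icc 1 X with Odd e ∧ (smoothPart (smoothLevel T) e : ℝ) ≤ (T : ℝ) ^ (0.1 : ℝ) ∧
        ∀ ℓ, ℓ.Prime → smoothLevel T < ℓ → ¬ ℓ ^ 2 ∣ e,
      ∑ p ∈ primesIoc 0 T, ‖expSum e (h * v e) (D - (p : ℤ) ^ 2)‖ ≤
    Real.exp (0.0077 * Real.log (Real.log T)) * (12 * T * X * sieveDensity T ^ 2 *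
      Real.exp (0.93 * ∑ ℓ ∈ primesIoc 0 (smoothLevel T), 1 / (ℓ : ℝ) +
        0.07 * ∑ ℓ ∈ primesIoc 0 (smoothLevel T) with ((ℓ : ℕ) : ℤ) ∣ h, 1 / (ℓ : ℝ) +
        1.07 * ∑ ℓ ∈ primesIoc 0 (smoothLevel T) with ((ℓ : ℕ) : ℤ) ∣ D, 1 / (ℓ : ℝ) + 80)) := by
  filter_upwards [eventually_log_log_three_mul, eventually_sieve_bound,
    eventually_primes_modEq_le, eventually_ge_atTop 1100] with T ⟨hT, hu1, hlog3, _⟩ hsv hpr hT2 D h X v hX hX3 hv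
  have hT3 : (3 : ℝ) ≤ T := by exact_mod_cast hT
  have hT0 : (0 : ℝ) < T := by linarith
  have hL0 : 0 < Real.log T := Real.log_pos (by linarith)
  set u := Real.log (Real.log T) with hu
  set z := smoothLevel T with hz
  set ϖ := sieveDensity T with hϖ
  have hϖ0 : 0 ≤ ϖ := sieveDensity_nonneg T
  have hzlog : 100 * Real.log T / u ≤ Real.log (z + 1 : ℕ) := by
    rw [← Real.log_exp (100 * Real.log T / u)]
    refine Real.log_le_log (Real.exp_pos _) ?_
    push_cast
    exact (Nat.lt_floor_add_one _).le
  have hzz : sieveLevel T ≤ z := by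
    refine Nat.floor_mono (Real.exp_le_exp.2 ?_)
    gcongr
    · linarith
    · linarith
  set E := {e ∈ Icc 1 X | Odd e ∧ (smoothPart z e : ℝ) ≤ (T : ℝ) ^ (0.1 : ℝ) ∧
        ∀ ℓ, ℓ.Prime → z < ℓ → ¬ ℓ ^ 2 ∣ e} with hE
  set c := Real.exp (0.0077 * u) with hc
  set W : ℕ → ℝ := fun a => a * avgBound h D a * (4 * ϖ * T / a.totient) with hW
  have hW0 : ∀ a, 0 ≤ W a := fun a => by
    have := avgBound_nonneg h D a
    rw [hW]; positivity
  have hEmem : ∀ e ∈ E, e ≠ 0 ∧ e ≤ X ∧ Odd e ∧ (smoothPart z e : ℝ) ≤ (T : ℝ) ^ (0.1 : ℝ) ∧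
        ∀ ℓ, ℓ.Prime → z < ℓ → ¬ ℓ ^ 2 ∣ e := fun e he => by
    obtain ⟨h1, h2⟩ := mem_filter.1 he
    have := mem_Icc.1 h1
    exact ⟨by omega, this.2, h2⟩
  have hsmodd : ∀ e ∈ E, Odd (smoothPart z e) := fun e he => by
    obtain ⟨he0, _, hodd, _⟩ := hEmem e he
    rw [← smoothPart_mul_roughPart z he0] at hodd
    exact (Nat.odd_mul.1 hodd).1
  have hone : ∀ e ∈ E, ∑ p ∈ primesIoc 0 T, ‖expSum e (h * v e) (D - (p : ℤ) ^ 2)‖ ≤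
      c * W (smoothPart z e) := by
    intro e he
    obtain ⟨he0, heX, hodd, hsm, hsq⟩ := hEmem e he
    obtain ⟨b, hb, hbK⟩ := norm_expSum_le_smoothPart z he0 hsq (h * v e)
    have h1 := sum_norm_expSum_le_expSumAvg (primesIoc 0 T) (smoothPart_pos (z := z) he0)
      (h * v e * b) D (fun t => hpr (smoothPart z e) t (smoothPart_pos he0) hsm)
    have hdvd : ∀ ℓ : ℕ, ℓ.Prime → ℓ ∣ smoothPart z e → (ℓ : ℤ) ∣ h * v e * b → (ℓ : ℤ) ∣ h := by
      intro ℓ hℓ hd hd'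
      by_cases h0 : h = 0
      · simp [h0]
      have hℓp := Nat.prime_iff_prime_int.1 hℓ
      rcases hℓp.dvd_or_dvd hd' with h2 | h2
      · rcases hℓp.dvd_or_dvd h2 with h3 | h3
        · exact h3
        · exact absurd ((hv h0 e hodd).isUnit_of_dvd' h3
            (Int.natCast_dvd_natCast.2 (prime_dvd_smoothPart hℓ hd).2)) hℓp.not_unit
      · exact absurd (hb.isUnit_of_dvd' h2 (Int.natCast_dvd_natCast.2 hd)) hℓp.not_unit
    have h2 := expSumAvg_le_avgBound h D (hsmodd e he) (h * v e * b) hdvd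
    have hω : (2 : ℝ) ^ #(roughPart z e).primeFactors ≤ c := by
      have h3 := card_primeFactors_mul_log_le (roughPart_pos (z := z) he0).ne'
        (fun ℓ hℓ hd => (prime_dvd_roughPart hℓ hd).1)
      have h4 : Real.log (roughPart z e) ≤ 1.1 * Real.log T := by
        refine le_trans (Real.log_le_log (by exact_mod_cast roughPart_pos he0) ?_) hlog3
        have : roughPart z e ≤ e := Nat.le_of_dvd (Nat.pos_of_ne_zero he0)
          ⟨smoothPart z e, by rw [mul_comm, smoothPart_mul_roughPart z he0]⟩
        exact_mod_cast this.trans (heX.trans hX3)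
      set k := #(roughPart z e).primeFactors
      have h5 : (k : ℝ) * (100 * Real.log T / u) ≤ 1.1 * Real.log T :=
        le_trans (by gcongr) (h3.trans h4)
      have h6 : (k : ℝ) ≤ 0.011 * u := by
        rw [mul_div_assoc', div_le_iff₀ (by linarith)] at h5
        have : (k : ℝ) * 100 * Real.log T ≤ 1.1 * u * Real.log T := by
          norm_num at h5 ⊢; linarith
        have := le_of_mul_le_mul_right this hL0
        norm_num at this ⊢; linarith
      rw [hc]
      calc (2 : ℝ) ^ k = Real.exp (k * Real.log 2) := by
            rw [Real.exp_nat_mul, Real.exp_log (by norm_num)]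
        _ ≤ Real.exp (0.011 * u * 0.7) := by
            have := Real.log_two_lt_d9
            gcongr
            norm_num at this ⊢; linarith
        _ = _ := by congr 1; ring
    calc ∑ p ∈ primesIoc 0 T, ‖expSum e (h * v e) (D - (p : ℤ) ^ 2)‖
        ≤ ∑ p ∈ primesIoc 0 T, ‖expSum (smoothPart z e) (h * v e * b) (D - (p : ℤ) ^ 2)‖ *
            2 ^ #(roughPart z e).primeFactors := sum_le_sum fun p _ => hbK _
      _ = (∑ p ∈ primesIoc 0 T, ‖expSum (smoothPart z e) (h * v e * b) (D - (p : ℤ) ^ 2)‖) *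
            2 ^ #(roughPart z e).primeFactors := by rw [sum_mul]
      _ ≤ W (smoothPart z e) * c := by
          gcongr
          · exact hW0 _
          · refine h1.trans ?_
            rw [hW]; dsimp only
            gcongr
      _ = _ := mul_comm _ _
  have hfib : ∀ a ∈ E.image (smoothPart z), (#{e ∈ E | smoothPart z e = a} : ℝ) ≤ 3 * ϖ * X / a := by
    intro a ha
    obtain ⟨e₀, he₀, rfl⟩ := mem_image.1 ha
    obtain ⟨he0, heX, hodd, hsm, hsq⟩ := hEmem e₀ he₀
    set a := smoothPart z e₀ with hadef
    have ha0 : 0 < a := smoothPart_pos he0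
    have ha0' : (0 : ℝ) < a := by exact_mod_cast ha0
    have hXa : (T : ℝ) ^ (0.8 : ℝ) ≤ X / a := by
      rw [le_div_iff₀ ha0']
      calc (T : ℝ) ^ (0.8 : ℝ) * a ≤ (T : ℝ) ^ (0.8 : ℝ) * (T : ℝ) ^ (0.1 : ℝ) := by gcongr
        _ = (T : ℝ) ^ (0.9 : ℝ) := by rw [← Real.rpow_add hT0]; norm_num
        _ ≤ X := hX
    have hlow : ((1 : ℕ) : ℝ) * (T : ℝ) ^ (0.2 : ℝ) ≤ (X / a : ℕ) := by
      have h1 : (X : ℝ) / a < (X / a : ℕ) + 1 := by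
        rw [div_lt_iff₀ ha0']
        have := Nat.lt_mul_div_succ X ha0
        calc (X : ℝ) < ((a * (X / a + 1) : ℕ) : ℝ) := by exact_mod_cast this
          _ = _ := by push_cast; ring
      have h2 : (2 : ℝ) ≤ (T : ℝ) ^ (0.2 : ℝ) := by
        calc (2 : ℝ) = (32 : ℝ) ^ (0.2 : ℝ) := by
              rw [show (32 : ℝ) = 2 ^ (5 : ℝ) by norm_num, ← Real.rpow_mul (by norm_num)]; norm_num
          _ ≤ _ := Real.rpow_le_rpow (by norm_num)
              (by exact_mod_cast (by omega : 32 ≤ T)) (by norm_num)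
      have h3 : (T : ℝ) ^ (0.8 : ℝ) = ((T : ℝ) ^ (0.2 : ℝ)) ^ 4 := by
        rw [← Real.rpow_natCast, ← Real.rpow_mul hT0.le]; norm_num
      set y := (T : ℝ) ^ (0.2 : ℝ)
      have h4 : y + 1 ≤ y ^ 4 := by
        have : 4 ≤ y ^ 2 := by nlinarith
        nlinarith
      push_cast; linarith
    have h1 := (hsv 1 0 (X / a) one_pos hlow).1
    have hinj : #{e ∈ E | smoothPart z e = a} ≤ #{k ∈ Ioc 0 (X / a) | k ≡ 0 [MOD 1] ∧
        ∀ ℓ ∈ primesIoc 0 (sieveLevel T), (1 : ℕ).Coprime ℓ → ¬ ℓ ∣ k} := by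
      refine card_le_card_of_injOn (roughPart z) ?_ ?_
      · intro e he
        obtain ⟨h2, h3⟩ := mem_filter.1 he
        obtain ⟨he0', heX', _⟩ := hEmem e h2
        refine mem_filter.2 ⟨mem_Ioc.2 ⟨roughPart_pos he0', ?_⟩, Nat.modEq_one, ?_⟩
        · rw [Nat.le_div_iff_mul_le ha0, ← h3, mul_comm, smoothPart_mul_roughPart z he0']
          exact heX'
        · intro ℓ hℓ _ hd
          obtain ⟨_, h4, h5⟩ := mem_primesIoc.1 hℓ
          have := (prime_dvd_roughPart h5 hd).1
          omega
      · intro e he e' he' hee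
        obtain ⟨h2, h3⟩ := mem_filter.1 he
        obtain ⟨h2', h3'⟩ := mem_filter.1 he'
        have h4 := smoothPart_mul_roughPart z (hEmem e h2).1
        have h5 := smoothPart_mul_roughPart z (hEmem e' h2').1
        rw [← h4, ← h5, h3, h3', hee]
    calc (#{e ∈ E | smoothPart z e = a} : ℝ) ≤ _ := by exact_mod_cast hinj
      _ ≤ 3 * ϖ * (X / a : ℕ) / (Nat.totient 1) := h1
      _ ≤ 3 * ϖ * (X / a) := by
          rw [Nat.totient_one, Nat.cast_one, div_one]
          gcongr
          exact Nat.cast_div_le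
      _ = _ := by ring
  calc ∑ e ∈ E, ∑ p ∈ primesIoc 0 T, ‖expSum e (h * v e) (D - (p : ℤ) ^ 2)‖
      ≤ ∑ e ∈ E, c * W (smoothPart z e) := sum_le_sum hone
    _ = c * ∑ a ∈ E.image (smoothPart z), #{e ∈ E | smoothPart z e = a} • W a := by
        rw [← mul_sum, sum_comp]
    _ ≤ c * ∑ a ∈ E.image (smoothPart z), 12 * T * X * ϖ ^ 2 * (avgBound h D a / a.totient) := by
        gcongr with a ha
        have ha0 : (0 : ℝ) < a := by
          obtain ⟨e₀, he₀, rfl⟩ := mem_image.1 ha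
          exact_mod_cast smoothPart_pos (hEmem e₀ he₀).1
        rw [nsmul_eq_mul]
        calc (#{e ∈ E | smoothPart z e = a} : ℝ) * W a ≤ 3 * ϖ * X / a * W a := by
              gcongr
              · exact hW0 a
              · exact hfib a ha
          _ = _ := by rw [hW]; field_simp; ring
    _ ≤ _ := by
        rw [← mul_sum]
        gcongr
        refine sum_avgBound_div_totient_le h D z _ fun a ha => ?_
        obtain ⟨e₀, he₀, rfl⟩ := mem_image.1 ha
        exact ⟨hsmodd e₀ he₀, fun ℓ hℓ hd => (prime_dvd_smoothPart hℓ hd).1⟩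

theorem sum_primesIoc_inv_dvd_le {n : ℤ} (hn : n ≠ 0) (z : ℕ) {y : ℕ} (hy : 2 ≤ y) :
    ∑ ℓ ∈ primesIoc 0 z with ((ℓ : ℕ) : ℤ) ∣ n, 1 / (ℓ : ℝ) ≤
      2 * Real.log (Real.log y) + 3 + #n.natAbs.primeFactors / (y : ℝ) := by
  have hy0 : (0 : ℝ) < y := by exact_mod_cast (by omega : 0 < y)
  rw [← sum_filter_add_sum_filter_not _ (fun ℓ => ℓ ≤ y)]
  refine add_le_add ?_ ?_
  · refine le_trans (sum_le_sum_of_subset_of_nonneg ?_ fun _ _ _ => by positivity)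
      (sum_primesIoc_inv_le' y hy)
    intro ℓ hℓ
    simp only [mem_filter, mem_primesIoc] at hℓ ⊢
    exact ⟨hℓ.1.1.1, hℓ.2, hℓ.1.1.2.2⟩
  · calc _ ≤ ∑ _ℓ ∈ n.natAbs.primeFactors, 1 / (y : ℝ) := by
          refine le_trans (sum_le_sum (g := fun _ => 1 / (y : ℝ)) fun ℓ hℓ => ?_)
            (sum_le_sum_of_subset_of_nonneg ?_ fun _ _ _ => by positivity)
          · simp only [mem_filter, not_le] at hℓ
            gcongr
            exact hℓ.2.le
          · intro ℓ hℓ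
            simp only [mem_filter, mem_primesIoc] at hℓ
            exact Nat.mem_primeFactors.2 ⟨hℓ.1.1.2.2, Int.natCast_dvd.1 hℓ.1.2,
              Int.natAbs_ne_zero.2 hn⟩
      _ = _ := by rw [sum_const, nsmul_eq_mul, mul_one_div]

theorem sum_primesIoc_inv_dvd_le_log {n : ℤ} (hn : n ≠ 0) (z : ℕ) :
    ∑ ℓ ∈ primesIoc 0 z with ((ℓ : ℕ) : ℤ) ∣ n, 1 / (ℓ : ℝ) ≤ Real.log |(n : ℝ)| := by
  have h1 : ∑ ℓ ∈ primesIoc 0 z with ((ℓ : ℕ) : ℤ) ∣ n, 1 / (ℓ : ℝ) ≤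
      ∑ _ℓ ∈ n.natAbs.primeFactors, (1 / 2 : ℝ) := by
    refine le_trans (sum_le_sum (g := fun _ => (1 / 2 : ℝ)) fun ℓ hℓ => ?_)
      (sum_le_sum_of_subset_of_nonneg ?_ fun _ _ _ => by positivity)
    · simp only [mem_filter, mem_primesIoc] at hℓ
      gcongr
      exact_mod_cast hℓ.1.2.2.two_le
    · intro ℓ hℓ
      simp only [mem_filter, mem_primesIoc] at hℓ
      exact Nat.mem_primeFactors.2 ⟨hℓ.1.2.2, Int.natCast_dvd.1 hℓ.2, Int.natAbs_ne_zero.2 hn⟩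
  have h2 := card_primeFactors_le_log n.natAbs (Int.natAbs_ne_zero.2 hn)
  rw [sum_const, nsmul_eq_mul] at h1
  have h3 : ((n.natAbs : ℕ) : ℝ) = |(n : ℝ)| := by
    rw [Nat.cast_natAbs, Int.cast_abs]
  rw [h3] at h2
  linarith

theorem eventually_sum_inv_smoothLevel_le : ∀ᶠ T : ℕ in atTop, 0 < sieveDensity T ∧
    ∑ ℓ ∈ primesIoc 0 (smoothLevel T), 1 / (ℓ : ℝ) + Real.log (sieveDensity T) ≤ 20 ∧
    Real.log (sieveDensity T) ≤ 8 + Real.log (Real.log (Real.log T)) - Real.log (Real.log T) := by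
  filter_upwards [eventually_log_log_three_mul, eventually_sieveLevel, eventually_sieveDensity]
    with T ⟨hT, hu1, _, _⟩ ⟨hs2, _⟩ ⟨hd1, hd2⟩
  have hT3 : (3 : ℝ) ≤ T := by exact_mod_cast hT
  have hL0 : 0 < Real.log T := Real.log_pos (by linarith)
  set u := Real.log (Real.log T) with hu
  have hu0 : 0 < u := by linarith
  have hpos : 0 < sieveDensity T := lt_of_lt_of_le (Real.exp_pos _) hd1
  refine ⟨hpos, ?_, ?_⟩
  · have h1 : ∑ ℓ ∈ primesIoc 0 (sieveLevel T), 1 / (ℓ : ℝ) + Real.log (sieveDensity T) ≤ 0 := by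
      have := sum_inv_le_neg_log_prod (sieveLevel T)
      have h2 := Real.log_le_log (by exact mul_pos (Real.exp_pos _) hpos) this
      rwa [Real.log_mul (Real.exp_pos _).ne' (by exact hpos.ne'), Real.log_exp, Real.log_one] at h2
    set z := smoothLevel T with hz
    set y := sieveLevel T with hy
    have hzz : y ≤ z := by
      refine Nat.floor_mono (Real.exp_le_exp.2 ?_)
      gcongr
      · linarith
      · linarith
    have h3 : ∑ ℓ ∈ primesIoc 0 z, 1 / (ℓ : ℝ) ≤
        ∑ ℓ ∈ primesIoc 0 y, 1 / (ℓ : ℝ) + ∑ ℓ ∈ primesIoc y z, 1 / (ℓ : ℝ) := by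
      have hsub : primesIoc 0 z ⊆ primesIoc 0 y ∪ primesIoc y z := by
        intro ℓ hℓ
        simp only [mem_union, mem_primesIoc] at hℓ ⊢
        rcases le_or_gt ℓ y with h | h
        · exact Or.inl ⟨hℓ.1, h, hℓ.2.2⟩
        · exact Or.inr ⟨h, hℓ.2.1, hℓ.2.2⟩
      rw [← sum_union]
      · exact sum_le_sum_of_subset_of_nonneg hsub fun _ _ _ => by positivity
      · rw [disjoint_left]
        intro ℓ h h'
        simp only [mem_primesIoc] at h h'
        omega
    have h4 : ∑ ℓ ∈ primesIoc y z, 1 / (ℓ : ℝ) ≤ 20 := by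
      rcases hzz.eq_or_lt with h | h
      · rw [← h, primesIoc, Ioc_self, filter_empty, sum_empty]; norm_num
      · refine (sum_primesIoc_inv_le y z (by omega) h).trans ?_
        have h5 : Real.log T / (1000 * u) ≤ Real.log (y + 1 : ℕ) := by
          rw [← Real.log_exp (Real.log T / (1000 * u))]
          refine Real.log_le_log (Real.exp_pos _) ?_
          push_cast
          exact (Nat.lt_floor_add_one _).le
        have h6 : Real.log z ≤ 100 * Real.log T / u := by
          rw [← Real.log_exp (100 * Real.log T / u)]
          refine Real.log_le_log (by exact_mod_cast (by omega : 0 < z)) ?_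
          exact Nat.floor_le (Real.exp_pos _).le
        have h7 : Real.log 2 ≤ Real.log (y + 1 : ℕ) :=
          Real.log_le_log (by norm_num) (by exact_mod_cast (by omega : 2 ≤ y + 1))
        have h8 : Real.log 2 ≤ Real.log z :=
          Real.log_le_log (by norm_num) (by exact_mod_cast (by omega : 2 ≤ z))
        have h2l := Real.log_two_gt_d9
        have h2u := Real.log_two_lt_d9
        have h9 : Real.log z ≤ 100000 * Real.log (y + 1 : ℕ) := by
          calc Real.log z ≤ 100 * Real.log T / u := h6
            _ = 100000 * (Real.log T / (1000 * u)) := by field_simp; norm_num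
            _ ≤ _ := by gcongr
        have h10 := Real.log_le_log (by norm_num at h2l ⊢; linarith) h9
        have hy1 : 0 < Real.log (y + 1 : ℕ) := by norm_num at h2l ⊢; push_cast at h7; linarith
        rw [Real.log_mul (by norm_num) hy1.ne'] at h10
        have h11 : Real.log 100000 ≤ 17 * Real.log 2 := by
          rw [← Real.log_rpow (by norm_num)]
          exact Real.log_le_log (by norm_num) (by norm_num)
        have h12 : Real.log 4 = 2 * Real.log 2 := by
          rw [← Real.log_rpow (by norm_num)]; norm_num
        have h13 : 1 / Real.log (y + 1 : ℕ) ≤ 1 / Real.log 2 :=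
          one_div_le_one_div_of_le (by norm_num at h2l ⊢; linarith) h7
        calc _ ≤ Real.log 4 * (1 / Real.log 2 + 17 * Real.log 2) := by
              refine mul_le_mul_of_nonneg_left ?_ (Real.log_nonneg (by norm_num))
              linarith
          _ = 2 + 34 * Real.log 2 ^ 2 := by
              have : Real.log 2 ≠ 0 := by positivity
              rw [h12]; field_simp; ring
          _ ≤ 20 := by nlinarith
    linarith
  · have h1 := Real.log_le_log hpos hd2
    rw [Real.log_div (by positivity) hL0.ne', Real.log_mul (by norm_num) hu0.ne'] at h1
    have h2 : Real.log 2000 ≤ 8 := by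
      rw [Real.log_le_iff_le_exp (by norm_num)]
      have := Real.exp_one_gt_d9
      calc (2000 : ℝ) ≤ 2.7 ^ 8 := by norm_num
        _ ≤ Real.exp 1 ^ 8 := by gcongr; norm_num at this ⊢; linarith
        _ = _ := by rw [← Real.exp_nat_mul]; norm_num
    linarith

theorem sum_sum_norm_expSum_le {T X : ℕ} {D : ℤ} {B : ℝ} (hD : (T : ℤ) ^ 2 < D)
    (hD3 : D ≤ (T : ℤ) ^ 3) (A : Finset ℕ) (hA : ∀ e ∈ A, Odd e ∧ e ≤ X)
    (H : ℕ → ℤ) (hB : ∀ (f : ℕ → ℝ) (K : ℤ), RootLike f K → K ≠ 0 → |K| ≤ (T : ℤ) ^ 3 →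
      ∑ e ∈ A, f e / e ≤ B) :
    ∑ e ∈ A, ∑ p ∈ primesIoc 0 T, ‖expSum e (H e) (D - (p : ℤ) ^ 2)‖ ≤ T * X * B := by
  rw [sum_comm]
  calc _ ≤ ∑ p ∈ primesIoc 0 T, (X : ℝ) * B := by
        refine sum_le_sum fun p hp => ?_
        have hpT : (p : ℤ) ≤ T := by exact_mod_cast (mem_primesIoc.1 hp).2.1
        have hp2 : (p : ℤ) ^ 2 ≤ (T : ℤ) ^ 2 := pow_le_pow_left₀ (by positivity) hpT 2
        have hK : 0 < D - (p : ℤ) ^ 2 := by linarith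
        have h1 := hB _ _ (rootLike_rootCount (D - (p : ℤ) ^ 2)) hK.ne'
          (by rw [abs_of_pos hK]; linarith [sq_nonneg (p : ℤ)])
        refine le_trans ?_ (mul_le_mul_of_nonneg_left h1 (Nat.cast_nonneg X))
        rw [mul_sum]
        refine sum_le_sum fun e he => ?_
        obtain ⟨hodd, heX⟩ := hA e he
        have he0 : 0 < e := hodd.pos
        haveI : NeZero e := ⟨he0.ne'⟩
        have h2 : ¬ 2 ∣ e := by
          rw [← even_iff_two_dvd]; exact Nat.not_even_iff_odd.2 hodd
        rw [if_neg h2]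
        refine (norm_expSum_le e _ _).trans ?_
        rw [mul_div_assoc', le_div_iff₀ (by exact_mod_cast he0), mul_comm]
        gcongr
    _ = #(primesIoc 0 T) * (X * B) := by rw [sum_const, nsmul_eq_mul]
    _ ≤ T * (X * B) := by
        have hB0 : 0 ≤ X * B ∨ #(primesIoc 0 T) = 0 := by
          rcases Nat.eq_zero_or_pos T with h | h
          · right; subst h; simp [primesIoc]
          · left
            refine mul_nonneg (Nat.cast_nonneg _) (le_trans ?_ (hB _ _ (rootLike_rootCount 1)
              one_ne_zero (by rw [abs_one]; exact one_le_pow₀ (by exact_mod_cast h))))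
            refine sum_nonneg fun e _ => div_nonneg ?_ (Nat.cast_nonneg e)
            exact (rootLike_rootCount 1).nonneg e
        rcases hB0 with h | h
        · gcongr
          have h1 : #(primesIoc 0 T) ≤ #(Ioc 0 T) := card_filter_le _ _
          rwa [Nat.card_Ioc, Nat.sub_zero] at h1
        · have : T = 0 ∨ 0 < T := Nat.eq_zero_or_pos T
          rw [h, Nat.cast_zero, zero_mul]
          rcases this with h' | h'
          · rw [h']; simp
          · refine mul_nonneg (Nat.cast_nonneg _) (mul_nonneg (Nat.cast_nonneg _) (le_trans ?_
              (hB _ _ (rootLike_rootCount 1)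
              one_ne_zero (by rw [abs_one]; exact one_le_pow₀ (by exact_mod_cast h')))))
            refine sum_nonneg fun e _ => div_nonneg ?_ (Nat.cast_nonneg e)
            exact (rootLike_rootCount 1).nonneg e
    _ = _ := by ring

open Classical in
theorem eventually_sum_norm_expSum_le : ∀ᶠ T : ℕ in atTop, ∀ (D h : ℤ) (X : ℕ) (v : ℕ → ℤ),
    (T : ℤ) ^ 2 < D → D ≤ (T : ℤ) ^ 3 → (T : ℝ) ^ (0.9 : ℝ) ≤ X → X ≤ 3 * T →
    (h ≠ 0 → ∀ e, Odd e → IsCoprime (v e) (e : ℤ)) →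
    ∑ e ∈ Icc 1 X with Odd e,
      ∑ p ∈ primesIoc 0 T, ‖expSum e (h * v e) (D - (p : ℤ) ^ 2)‖ ≤
    T * X * (if h = 0 then Real.exp (-(0.99 * Real.log (Real.log T)))
      else √|(h : ℝ)| * Real.exp (-(1.06 * Real.log (Real.log T)))) := by
  have hlogo : ∀ᶠ u : ℝ in atTop, 5 * Real.log u + 300 ≤ 0.001 * u := by
    have h1 := (Real.isLittleO_log_id_atTop.bound (by norm_num : (0 : ℝ) < 0.0001))
    filter_upwards [h1, eventually_ge_atTop 1000000] with u hu hu2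
    rw [Real.norm_eq_abs, Real.norm_eq_abs, id, abs_of_nonneg (by linarith : 0 ≤ u)] at hu
    have := le_abs_self (Real.log u)
    norm_num at hu ⊢
    linarith
  filter_upwards [eventually_log_log_three_mul, eventually_sum_smoothPart_large_le,
    eventually_sum_sq_dvd_le, eventually_sum_rough_le, eventually_sum_inv_smoothLevel_le,
    eventually_loglog hlogo, eventually_loglog (eventually_ge_atTop (20 : ℝ)),
    eventually_ge_atTop 16]
    with T ⟨hT, hu1, hlog3, _⟩ hE1 hE2 hE3 ⟨hd0, hSd, hd⟩ hlog hu20 hT16 D h X v hD hD3 hX hX3 hv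
  have hT3 : (3 : ℝ) ≤ T := by exact_mod_cast hT
  have hL0 : 0 < Real.log T := Real.log_pos (by linarith)
  set u := Real.log (Real.log T) with hu
  have hu0 : 0 < u := by linarith
  have hLu : Real.log T = Real.exp u := by rw [hu, Real.exp_log hL0]
  set z := smoothLevel T with hz
  set F : ℕ → ℝ := fun e => ∑ p ∈ primesIoc 0 T, ‖expSum e (h * v e) (D - (p : ℤ) ^ 2)‖ with hF
  have hF0 : ∀ e, 0 ≤ F e := fun e => sum_nonneg fun _ _ => norm_nonneg _
  set A1 := {e ∈ Icc 1 X | Odd e ∧ (T : ℝ) ^ (0.1 : ℝ) < (smoothPart z e : ℕ)} with hA1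
  set A2 := {e ∈ Icc 1 X | Odd e ∧ ∃ ℓ, ℓ.Prime ∧ z < ℓ ∧ ℓ ^ 2 ∣ e} with hA2
  set A3 := {e ∈ Icc 1 X | Odd e ∧ (smoothPart z e : ℝ) ≤ (T : ℝ) ^ (0.1 : ℝ) ∧
        ∀ ℓ, ℓ.Prime → z < ℓ → ¬ ℓ ^ 2 ∣ e} with hA3
  have hcov : ∑ e ∈ Icc 1 X with Odd e, F e ≤ ∑ e ∈ A1, F e + ∑ e ∈ A2, F e + ∑ e ∈ A3, F e := by
    have hsub : {e ∈ Icc 1 X | Odd e} ⊆ A1 ∪ A2 ∪ A3 := by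
      intro e he
      obtain ⟨h1, h2⟩ := mem_filter.1 he
      simp only [mem_union, hA1, hA2, hA3, mem_filter]
      by_cases h3 : (T : ℝ) ^ (0.1 : ℝ) < (smoothPart z e : ℕ)
      · exact Or.inl (Or.inl ⟨h1, h2, h3⟩)
      · by_cases h4 : ∃ ℓ, ℓ.Prime ∧ z < ℓ ∧ ℓ ^ 2 ∣ e
        · exact Or.inl (Or.inr ⟨h1, h2, h4⟩)
        · refine Or.inr ⟨h1, h2, not_lt.1 h3, fun ℓ hℓ hzl hd => h4 ⟨ℓ, hℓ, hzl, hd⟩⟩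
    refine (sum_le_sum_of_subset_of_nonneg hsub fun _ _ _ => hF0 _).trans ?_
    have hun : ∀ A B : Finset ℕ, ∑ e ∈ A ∪ B, F e ≤ ∑ e ∈ A, F e + ∑ e ∈ B, F e := by
      intro A B
      rw [← sum_union_inter]
      exact le_add_of_nonneg_right (sum_nonneg fun _ _ => hF0 _)
    linarith [hun (A1 ∪ A2) A3, hun A1 A2]
  have hb1 : ∑ e ∈ A1, F e ≤ T * X * Real.exp (-(3 * u)) := by
    refine sum_sum_norm_expSum_le hD hD3 A1 (fun e he => ?_) _ fun f K hf _ _ => ?_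
    · obtain ⟨h1, h2⟩ := mem_filter.1 he
      exact ⟨h2.1, (mem_Icc.1 h1).2⟩
    · refine le_trans (sum_le_sum_of_subset_of_nonneg ?_ fun e _ _ =>
        div_nonneg (hf.nonneg e) (Nat.cast_nonneg e)) (hE1 f K hf X hX3)
      intro e he
      obtain ⟨h1, h2⟩ := mem_filter.1 he
      exact mem_filter.2 ⟨h1, h2.2⟩
  have hb2 : ∑ e ∈ A2, F e ≤ T * X * Real.exp (-(3 * u)) := by
    refine sum_sum_norm_expSum_le hD hD3 A2 (fun e he => ?_) _ fun f K hf hK0 hK => ?_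
    · obtain ⟨h1, h2⟩ := mem_filter.1 he
      exact ⟨h2.1, (mem_Icc.1 h1).2⟩
    · refine le_trans (sum_le_sum_of_subset_of_nonneg ?_ fun e _ _ =>
        div_nonneg (hf.nonneg e) (Nat.cast_nonneg e)) (hE2 f K hf hK0 hK X hX3)
      intro e he
      obtain ⟨h1, h2⟩ := mem_filter.1 he
      exact mem_filter.2 ⟨h1, h2.2⟩
  have hb3 := hE3 D h X v hX hX3 hv
  set S := ∑ ℓ ∈ primesIoc 0 z, 1 / (ℓ : ℝ) with hS
  set Sh := ∑ ℓ ∈ primesIoc 0 z with ((ℓ : ℕ) : ℤ) ∣ h, 1 / (ℓ : ℝ) with hSh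
  set SD := ∑ ℓ ∈ primesIoc 0 z with ((ℓ : ℕ) : ℤ) ∣ D, 1 / (ℓ : ℝ) with hSD
  set q := Real.log (sieveDensity T) with hq
  have hdq : sieveDensity T = Real.exp q := (Real.exp_log hd0).symm
  have hDpos : 0 < D := lt_of_le_of_lt (by positivity) hD
  have hSDle : SD ≤ 2 * Real.log u + 12 := by
    have hL1 : 1 ≤ Real.log T := by
      rw [hLu]; linarith [Real.add_one_le_exp u]
    set y := ⌊Real.log T⌋₊ + 1 with hy
    have hy2 : 2 ≤ y := by
      have := (Nat.one_le_floor_iff _).2 hL1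
      omega
    have hyL : Real.log T ≤ y := by
      rw [hy]; push_cast; exact (Nat.lt_floor_add_one _).le
    have hyU : (y : ℝ) ≤ Real.exp (2 * u) := by
      have h1 : (y : ℝ) ≤ Real.exp u + 1 := by
        rw [hy, ← hLu]; push_cast
        gcongr
        exact Nat.floor_le hL0.le
      rw [two_mul, Real.exp_add]
      have := Real.add_one_le_exp u
      nlinarith
    have hlogy : Real.log y ≤ 2 * u := by
      rw [Real.log_le_iff_le_exp (by exact_mod_cast (by omega : 0 < y))]
      exact hyU
    have hll : Real.log (Real.log y) ≤ Real.log 2 + Real.log u := by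
      rw [← Real.log_mul (by norm_num) hu0.ne']
      exact Real.log_le_log (Real.log_pos (by exact_mod_cast (by omega : 1 < y))) hlogy
    have h1 := sum_primesIoc_inv_dvd_le hDpos.ne' z hy2
    have h2 := card_primeFactors_le_log D.natAbs (Int.natAbs_ne_zero.2 hDpos.ne')
    have h3 : Real.log D.natAbs ≤ 3 * Real.log T := by
      rw [show 3 * Real.log T = Real.log ((T : ℝ) ^ 3) by rw [Real.log_pow]; norm_num]
      refine Real.log_le_log (by exact_mod_cast Int.natAbs_pos.2 hDpos.ne') ?_
      have : D.natAbs ≤ T ^ 3 := by zify; rw [abs_of_pos hDpos]; exact hD3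
      exact_mod_cast this
    have h4 : #D.natAbs.primeFactors / (y : ℝ) ≤ 6 := by
      rw [div_le_iff₀ (by linarith)]
      linarith
    have := Real.log_two_lt_d9
    norm_num at this
    linarith
  have hS0 : 0 ≤ S := sum_nonneg fun _ _ => by positivity
  have h12 : (12 : ℝ) ≤ Real.exp 11 := by linarith [Real.add_one_le_exp (11 : ℝ)]
  have hb3' : ∑ e ∈ A3, F e ≤ T * X * Real.exp (0.0077 * u + 91 + 2 * q + 0.93 * S + 0.07 * Sh +
      1.07 * SD) := by
    refine hb3.trans ?_
    rw [hdq]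
    calc _ = 12 * (T * X * Real.exp (0.0077 * u + 80 + 2 * q + 0.93 * S + 0.07 * Sh + 1.07 * SD)) := by
          rw [← Real.exp_nat_mul,
            show Real.exp (0.0077 * u + 80 + 2 * q + 0.93 * S + 0.07 * Sh + 1.07 * SD) =
              Real.exp (0.0077 * u) * (Real.exp ((2 : ℕ) * q) *
                Real.exp (0.93 * S + 0.07 * Sh + 1.07 * SD + 80)) by
              rw [← Real.exp_add, ← Real.exp_add]; congr 1; push_cast; ring]
          ring
      _ ≤ Real.exp 11 * (T * X *
          Real.exp (0.0077 * u + 80 + 2 * q + 0.93 * S + 0.07 * Sh + 1.07 * SD)) := by gcongr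
      _ = _ := by
          rw [mul_left_comm, ← Real.exp_add]
          congr 2; ring
  have h3exp : ∀ x : ℝ, 3 * Real.exp (x - 2) ≤ Real.exp x := fun x => by
    have : (3 : ℝ) ≤ Real.exp 2 := by linarith [Real.add_one_le_exp (2 : ℝ)]
    calc 3 * Real.exp (x - 2) ≤ Real.exp 2 * Real.exp (x - 2) := by gcongr
      _ = _ := by rw [← Real.exp_add]; congr 1; ring
  have hlu0 : 0 ≤ Real.log u := Real.log_nonneg hu1
  have hTX : (0 : ℝ) ≤ T * X := by positivity
  have hfinal : ∀ x : ℝ, -(3 * u) ≤ x - 2 →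
      0.0077 * u + 91 + 2 * q + 0.93 * S + 0.07 * Sh + 1.07 * SD ≤ x - 2 →
      ∑ e ∈ Icc 1 X with Odd e, F e ≤ T * X * Real.exp x := by
    intro x h1 h2
    have h4 := mul_le_mul_of_nonneg_left (Real.exp_le_exp.2 h1) hTX
    have h5 := mul_le_mul_of_nonneg_left (Real.exp_le_exp.2 h2) hTX
    have h6 := mul_le_mul_of_nonneg_left (h3exp x) hTX
    linarith
  split_ifs with h0
  · have h99 : (0.99 : ℝ) = 99 / 100 := by norm_num
    refine hfinal _ (by rw [h99]; linarith) ?_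
    have : Sh = S := by
      rw [hSh, hS, filter_true_of_mem]
      intro ℓ _; rw [h0]; exact dvd_zero _
    rw [this]
    norm_num at hlog ⊢
    linarith
  · have hShle := sum_primesIoc_inv_dvd_le_log h0 z
    rw [← hSh] at hShle
    have hh1 : 1 ≤ |(h : ℝ)| := by
      have := Int.one_le_abs h0
      exact_mod_cast this
    have hlh : 0 ≤ Real.log |(h : ℝ)| := Real.log_nonneg hh1
    have hsq : √|(h : ℝ)| = Real.exp (Real.log |(h : ℝ)| / 2) := by
      rw [Real.sqrt_eq_rpow, Real.rpow_def_of_pos (by linarith)]; congr 1; ring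
    rw [hsq, ← Real.exp_add]
    generalize Real.log |(h : ℝ)| = lh at hShle hlh ⊢
    have h106 : (1.06 : ℝ) = 106 / 100 := by norm_num
    refine hfinal _ (by rw [h106]; linarith) ?_
    norm_num at hlog ⊢
    linarith

theorem summable_sqrt_div_sq : Summable fun h : ℕ => √(h : ℝ) / (h : ℝ) ^ 2 := by
  refine (Real.summable_one_div_nat_rpow.2 (by norm_num : (1 : ℝ) < 3 / 2)).congr fun h => ?_
  rcases Nat.eq_zero_or_pos h with rfl | hh
  · simp
  · have h0 : (0 : ℝ) < h := by exact_mod_cast hh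
    rw [div_eq_div_iff (by positivity) (by positivity), one_mul, Real.sqrt_eq_rpow,
      ← Real.rpow_add h0, ← Real.rpow_natCast]
    norm_num

theorem exists_inverse_residues (c : ℤ) : ∃ v : ℕ → ℤ, ∀ e : ℕ, IsCoprime (v e) (e : ℤ) ∧
    (IsCoprime c (e : ℤ) → (e : ℤ) ∣ c * v e - 1) := by
  refine ⟨fun e => if h : IsCoprime c (e : ℤ) then h.choose else 1, fun e => ?_⟩
  by_cases h : IsCoprime c (e : ℤ)
  · obtain ⟨b, hb⟩ := h.choose_spec
    simp only [dif_pos h]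
    exact ⟨⟨c, b, by linarith⟩, fun _ => ⟨-b, by linarith⟩⟩
  · simp only [dif_neg h]
    exact ⟨isCoprime_one_left, fun h' => absurd h' h⟩

theorem abs_count_sub_le_add {e : ℕ} [NeZero e] (K α c c' : ℤ) (hc : (e : ℤ) ∣ c * c' - 1)
    {A U j X₀ X : ℕ} {κ μ : ℝ} (hj : 0 < j) (hA : A ≤ U) (hκ : 0 ≤ κ) (hμ : 0 ≤ μ)
    (hκe : X₀ < e → (j : ℝ) ≤ κ * e) (hμe : (e : ℝ) ≤ μ * (2 * j)) (heX : e ≤ X) :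
    |(#{u ∈ Ico A U | (e : ℤ) ∣ (α + c * ((u : ℕ) : ℤ)) ^ 2 - K} : ℝ) -
        rootCount K e * ((U - A : ℕ) : ℝ) / e| ≤
      (if e ≤ X₀ then ‖expSum e (0 * c') K‖ else 0) + κ * ‖expSum e (0 * c') K‖ +
        μ * ∑ h ∈ Icc 1 X, ‖expSum e (((h : ℕ) : ℤ) * c') K‖ / (h : ℝ) ^ 2 := by
  have he0 : (0 : ℝ) < e := by exact_mod_cast NeZero.pos e
  have hnn : ‖expSum e (0 * c') K‖ = rootCount K e := by
    rw [zero_mul, expSum_zero, Complex.norm_natCast]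
  have hsum0 : 0 ≤ ∑ h ∈ Icc 1 X, ‖expSum e (((h : ℕ) : ℤ) * c') K‖ / (h : ℝ) ^ 2 :=
    sum_nonneg fun _ _ => by positivity
  have hAU : A + (U - A) = U := Nat.add_sub_cancel' hA
  rw [hnn]
  have hκ0 : 0 ≤ κ * (rootCount K e : ℝ) := by positivity
  have hμ0 := mul_nonneg hμ hsum0
  split_ifs with h
  · have h2 := abs_count_sub_le_rootCount K α c c' hc A (U - A)
    rw [hAU] at h2
    linarith
  · have h2 := abs_count_sub_le K α c c' hc A (U - A) j hj
    rw [hAU] at h2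
    have h3 : (rootCount K e : ℝ) * j / e ≤ κ * rootCount K e := by
      rw [div_le_iff₀ he0]
      calc (rootCount K e : ℝ) * j ≤ rootCount K e * (κ * e) := by
            gcongr
            exact hκe (not_le.1 h)
        _ = _ := by ring
    have h4 : (e : ℝ) / (2 * j) ≤ μ := by
      rw [div_le_iff₀ (by positivity)]
      exact hμe
    have h5 : ∑ h ∈ Ico 1 e, ‖expSum e (((h : ℕ) : ℤ) * c') K‖ / (h : ℝ) ^ 2 ≤
        ∑ h ∈ Icc 1 X, ‖expSum e (((h : ℕ) : ℤ) * c') K‖ / (h : ℝ) ^ 2 := by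
      refine sum_le_sum_of_subset_of_nonneg ?_ fun _ _ _ => by positivity
      intro h hh
      have := mem_Ico.1 hh
      exact mem_Icc.2 ⟨this.1, by omega⟩
    have h6 := mul_le_mul h4 h5 (sum_nonneg fun _ _ => by positivity) hμ
    linarith

theorem eventually_sum_error_le (D₀ : ℕ) (hD₀ : 0 < D₀) (c : ℤ) : ∀ᶠ T : ℕ in atTop,
    ∀ (D : ℤ) (U : ℕ) (A : ℕ → ℕ → ℕ) (α : ℕ → ℤ),
    (T : ℤ) ^ 2 < D → D ≤ (T : ℤ) ^ 3 → D₀ * U = T → (∀ p e, A p e ≤ U) →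
    ∑ p ∈ primesIoc 0 T, ∑ e ∈ Icc 1 (3 * T) with Odd e ∧ IsCoprime c ((e : ℕ) : ℤ),
      |(#{u ∈ Ico (A p e) U | (e : ℤ) ∣ (α p + c * ((u : ℕ) : ℤ)) ^ 2 - (D - (p : ℤ) ^ 2)} : ℝ) -
        rootCount (D - (p : ℤ) ^ 2) e * ((U - A p e : ℕ) : ℝ) / e| ≤
      (T : ℝ) ^ 2 * Real.exp (-(1.005 * Real.log (Real.log T))) := by
  obtain ⟨v, hv⟩ := exists_inverse_residues c
  set C := ∑' h : ℕ, √(h : ℝ) / (h : ℝ) ^ 2 with hC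
  have hC0 : 0 ≤ C := tsum_nonneg fun _ => by positivity
  have hlarge : ∀ᶠ u : ℝ in atTop, 7 + 9 / 2 * D₀ * C ≤ Real.exp (0.005 * u) :=
    (Real.tendsto_exp_atTop.comp (tendsto_id.const_mul_atTop (by norm_num : (0 : ℝ) < 0.005))
      ).eventually_ge_atTop _
  have hlog2 : ∀ᶠ u : ℝ in atTop, 0.04 * u + (Real.log (2 * D₀)) ≤ 0.1 * Real.exp u := by
    have h1 := eventually_mul_le_exp (20 * (0.04 + |Real.log (2 * D₀)|)) 1 1 one_pos
    filter_upwards [h1, eventually_ge_atTop 1] with u hu hu1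
    rw [Real.rpow_one, one_mul] at hu
    have h2 : Real.log (2 * D₀) ≤ |Real.log (2 * D₀)| * u :=
      (le_abs_self _).trans (le_mul_of_one_le_right (abs_nonneg _) hu1)
    have h3 := abs_nonneg (Real.log (2 * D₀))
    generalize Real.log (2 * D₀) = l at *
    have h01 : (0.1 : ℝ) = 1 / 10 := by norm_num
    have h04 : (0.04 : ℝ) = 4 / 100 := by norm_num
    rw [h04] at *; rw [h01]
    nlinarith
  filter_upwards [eventually_log_log_three_mul, eventually_sum_norm_expSum_le,
    eventually_loglog hlarge, eventually_loglog hlog2]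
    with T ⟨hT, hu1, _, _⟩ hav hlarge hlog2 D U A α hD hD3 hU hA
  have hT3 : (3 : ℝ) ≤ T := by exact_mod_cast hT
  have hT0 : (0 : ℝ) < T := by linarith
  have hL0 : 0 < Real.log T := Real.log_pos (by linarith)
  set u := Real.log (Real.log T) with hu
  have hLu : Real.log T = Real.exp u := by rw [hu, Real.exp_log hL0]
  have hD₀' : (1 : ℝ) ≤ D₀ := by exact_mod_cast hD₀
  have hU' : (D₀ : ℝ) * U = T := by exact_mod_cast hU
  have hU0 : (0 : ℝ) < U := by
    by_contra! h
    have : (U : ℝ) = 0 := le_antisymm h (Nat.cast_nonneg _)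
    rw [this, mul_zero] at hU'; linarith
  have hUT : (U : ℝ) ≤ T := by rw [← hU']; exact le_mul_of_one_le_left hU0.le hD₀'
  set lam := Real.exp (0.02 * u) with hlam
  have hlam0 : 0 < lam := Real.exp_pos _
  have hTU : (T : ℝ) ^ (0.9 : ℝ) * (2 * lam ^ 2) ≤ U := by
    have h1 : 2 * D₀ * lam ^ 2 ≤ (T : ℝ) ^ (0.1 : ℝ) := by
      rw [Real.rpow_def_of_pos hT0, hlam, ← Real.exp_nat_mul,
        ← Real.exp_log (by positivity : (0 : ℝ) < 2 * D₀), ← Real.exp_add]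
      refine Real.exp_le_exp.2 ?_
      refine le_trans (le_of_eq ?_) (hlog2.trans (le_of_eq (by rw [hLu, mul_comm])))
      push_cast; ring
    have h2 : (T : ℝ) ^ (0.9 : ℝ) * (T : ℝ) ^ (0.1 : ℝ) = T := by
      rw [← Real.rpow_add hT0]; norm_num
    have h3 : D₀ * ((T : ℝ) ^ (0.9 : ℝ) * (2 * lam ^ 2)) ≤ D₀ * U := by
      rw [hU']
      calc _ = (T : ℝ) ^ (0.9 : ℝ) * (2 * D₀ * lam ^ 2) := by ring
        _ ≤ (T : ℝ) ^ (0.9 : ℝ) * (T : ℝ) ^ (0.1 : ℝ) := by gcongr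
        _ = T := h2
    exact le_of_mul_le_mul_left h3 (by linarith)
  have hlam1 : 1 ≤ lam := Real.one_le_exp (by positivity)
  have hT9 : 1 ≤ (T : ℝ) ^ (0.9 : ℝ) := Real.one_le_rpow (by linarith) (by norm_num)
  have hlamU : lam ^ 2 ≤ U := by nlinarith [sq_nonneg lam]
  set X₀ := ⌊(U : ℝ) / lam⌋₊ with hX₀
  have hX₀le : (X₀ : ℝ) ≤ U / lam := Nat.floor_le (by positivity)
  have hX₀lt : (U : ℝ) / lam < X₀ + 1 := Nat.lt_floor_add_one _
  have hX₀T : (T : ℝ) ^ (0.9 : ℝ) ≤ X₀ := by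
    have : (T : ℝ) ^ (0.9 : ℝ) * 2 ≤ U / lam := by
      rw [le_div_iff₀ hlam0]
      refine le_trans ?_ hTU
      have : lam ≤ lam ^ 2 := by nlinarith
      rw [mul_assoc]; gcongr
    linarith
  have hX₀3 : X₀ ≤ 3 * T := by
    have : (X₀ : ℝ) ≤ U := hX₀le.trans (div_le_self hU0.le hlam1)
    have h2 : (X₀ : ℝ) ≤ T := this.trans hUT
    have : X₀ ≤ T := by exact_mod_cast h2
    omega
  set j := ⌈(U : ℝ) / lam ^ 2⌉₊ with hj
  have hj1 : (U : ℝ) / lam ^ 2 ≤ j := Nat.le_ceil _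
  have hjpos : (0 : ℝ) < j := lt_of_lt_of_le (by positivity) hj1
  have hj2 : (j : ℝ) ≤ 2 * U / lam ^ 2 := by
    have h1 := Nat.ceil_lt_add_one (by positivity : 0 ≤ (U : ℝ) / lam ^ 2)
    have h2 : 1 ≤ (U : ℝ) / lam ^ 2 := by rw [one_le_div (by positivity)]; exact hlamU
    rw [mul_div_assoc]; linarith
  have hX3T : (T : ℝ) ^ (0.9 : ℝ) ≤ (3 * T : ℕ) := by
    refine hX₀T.trans ?_
    exact_mod_cast hX₀3
  set S : ℤ → ℕ → ℝ := fun h X => ∑ e ∈ Icc 1 X with Odd e,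
      ∑ p ∈ primesIoc 0 T, ‖expSum e (h * v e) (D - (p : ℤ) ^ 2)‖ with hS
  have hS0 : ∀ X : ℕ, (T : ℝ) ^ (0.9 : ℝ) ≤ X → X ≤ 3 * T →
      S 0 X ≤ T * X * Real.exp (-(0.99 * u)) := by
    intro X h1 h2
    have := hav D 0 X v hD hD3 h1 h2 (fun h => absurd rfl h)
    rwa [if_pos rfl] at this
  have hSh : ∀ h : ℕ, h ≠ 0 →
      S h (3 * T) ≤ T * (3 * T) * (√(h : ℝ) * Real.exp (-(1.06 * u))) := by
    intro h h0
    have := hav D h (3 * T) v hD hD3 hX3T le_rfl (fun _ e _ => (hv e).1)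
    rw [if_neg (by exact_mod_cast h0)] at this
    have h3 : |(((h : ℕ) : ℤ) : ℝ)| = h := by rw [Int.cast_natCast, abs_of_nonneg (Nat.cast_nonneg h)]
    rw [h3] at this
    push_cast at this
    exact this
  set err : ℕ → ℕ → ℝ := fun p e =>
    |(#{u ∈ Ico (A p e) U | (e : ℤ) ∣ (α p + c * ((u : ℕ) : ℤ)) ^ 2 - (D - (p : ℤ) ^ 2)} : ℝ) -
        rootCount (D - (p : ℤ) ^ 2) e * ((U - A p e : ℕ) : ℝ) / e| with herr
  have hb : ∀ p ∈ primesIoc 0 T, ∀ e ∈ {e ∈ Icc 1 (3 * T) | Odd e ∧ IsCoprime c ((e : ℕ) : ℤ)},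
      err p e ≤ (if e ≤ X₀ then ‖expSum e (0 * v e) (D - (p : ℤ) ^ 2)‖ else 0) +
        2 / lam * ‖expSum e (0 * v e) (D - (p : ℤ) ^ 2)‖ +
        3 / 2 * D₀ * lam ^ 2 * ∑ h ∈ Icc 1 (3 * T),
          ‖expSum e (h * v e) (D - (p : ℤ) ^ 2)‖ / (h : ℝ) ^ 2 := by
    intro p hp e he
    obtain ⟨h1, hodd, hcop⟩ := mem_filter.1 he
    have he1 := mem_Icc.1 h1
    have he0 : (0 : ℝ) < e := by exact_mod_cast he1.1
    haveI : NeZero e := ⟨by omega⟩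
    refine abs_count_sub_le_add (D - (p : ℤ) ^ 2) (α p) c (v e) ((hv e).2 hcop)
      (by exact_mod_cast hjpos) (hA p e) (by positivity) (by positivity) (fun hXe => ?_) ?_ he1.2
    · have h3 : (U : ℝ) / lam ≤ e := by
        have : (X₀ : ℝ) + 1 ≤ e := by exact_mod_cast hXe
        linarith
      calc (j : ℝ) ≤ 2 * U / lam ^ 2 := hj2
        _ = 2 / lam * (U / lam) := by rw [div_mul_div_comm, sq]
        _ ≤ _ := by gcongr
    · calc (e : ℝ) ≤ 3 * T := by exact_mod_cast he1.2
        _ = 3 / 2 * D₀ * lam ^ 2 * (2 * (U / lam ^ 2)) := by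
            rw [← hU', ← mul_div_assoc, ← mul_div_assoc, eq_div_iff (by positivity)]; ring
        _ ≤ _ := by gcongr
  have hsubset : ∀ G : ℕ → ℝ, (∀ e, 0 ≤ G e) →
      ∑ e ∈ Icc 1 (3 * T) with Odd e ∧ IsCoprime c ((e : ℕ) : ℤ), G e ≤
        ∑ e ∈ Icc 1 (3 * T) with Odd e, G e := by
    intro G hG
    refine sum_le_sum_of_subset_of_nonneg ?_ fun _ _ _ => hG _
    intro e he
    obtain ⟨h1, h2, _⟩ := mem_filter.1 he
    exact mem_filter.2 ⟨h1, h2⟩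
  have hS0' : ∑ p ∈ primesIoc 0 T, ∑ e ∈ Icc 1 (3 * T) with Odd e ∧ IsCoprime c ((e : ℕ) : ℤ),
      ‖expSum e (0 * v e) (D - (p : ℤ) ^ 2)‖ ≤ S 0 (3 * T) := by
    rw [sum_comm]
    exact hsubset _ fun _ => sum_nonneg fun _ _ => norm_nonneg _
  have hSX' : ∑ p ∈ primesIoc 0 T, ∑ e ∈ Icc 1 (3 * T) with Odd e ∧ IsCoprime c ((e : ℕ) : ℤ),
      (if e ≤ X₀ then ‖expSum e (0 * v e) (D - (p : ℤ) ^ 2)‖ else 0) ≤ S 0 X₀ := by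
    rw [sum_comm]
    refine (hsubset _ fun _ => sum_nonneg fun _ _ => ?_).trans ?_
    · split_ifs
      · exact norm_nonneg _
      · exact le_rfl
    · rw [hS]; dsimp only
      have h1 : ∀ e ∈ {e ∈ Icc 1 (3 * T) | Odd e}, (∑ p ∈ primesIoc 0 T,
          (if e ≤ X₀ then ‖expSum e (0 * v e) (D - (p : ℤ) ^ 2)‖ else 0)) =
          if e ≤ X₀ then ∑ p ∈ primesIoc 0 T, ‖expSum e (0 * v e) (D - (p : ℤ) ^ 2)‖ else 0 := by
        intro e _
        split_ifs <;> simp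
      rw [sum_congr rfl h1, ← sum_filter]
      refine sum_le_sum_of_subset_of_nonneg ?_ fun _ _ _ => sum_nonneg fun _ _ => norm_nonneg _
      intro e he
      simp only [mem_filter, mem_Icc] at he ⊢
      exact ⟨⟨he.1.1.1, he.2⟩, he.1.2⟩
  have hSh' : ∑ p ∈ primesIoc 0 T, ∑ e ∈ Icc 1 (3 * T) with Odd e ∧ IsCoprime c ((e : ℕ) : ℤ),
      ∑ h ∈ Icc 1 (3 * T), ‖expSum e (((h : ℕ) : ℤ) * v e) (D - (p : ℤ) ^ 2)‖ / (h : ℝ) ^ 2 ≤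
      T * (3 * T) * Real.exp (-(1.06 * u)) * C := by
    have h1 : ∑ p ∈ primesIoc 0 T, ∑ e ∈ Icc 1 (3 * T) with Odd e ∧ IsCoprime c ((e : ℕ) : ℤ),
      ∑ h ∈ Icc 1 (3 * T), ‖expSum e (((h : ℕ) : ℤ) * v e) (D - (p : ℤ) ^ 2)‖ / (h : ℝ) ^ 2 =
      ∑ h ∈ Icc 1 (3 * T), (∑ e ∈ Icc 1 (3 * T) with Odd e ∧ IsCoprime c ((e : ℕ) : ℤ),
        ∑ p ∈ primesIoc 0 T, ‖expSum e (((h : ℕ) : ℤ) * v e) (D - (p : ℤ) ^ 2)‖) / (h : ℝ) ^ 2 := by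
      simp_rw [sum_div]
      rw [sum_congr rfl fun p _ => sum_comm, sum_comm]
      exact sum_congr rfl fun h _ => sum_comm
    rw [h1]
    calc _ ≤ ∑ h ∈ Icc 1 (3 * T), T * (3 * T) * Real.exp (-(1.06 * u)) * (√(h : ℝ) / (h : ℝ) ^ 2) := by
          refine sum_le_sum fun h hh => ?_
          have h0 : h ≠ 0 := by have := mem_Icc.1 hh; omega
          rw [← mul_div_assoc]
          gcongr
          refine (hsubset _ fun _ => sum_nonneg fun _ _ => norm_nonneg _).trans ?_
          refine (hSh h h0).trans (le_of_eq ?_)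
          ring
      _ ≤ _ := by
          rw [← mul_sum]
          gcongr
          exact summable_sqrt_div_sq.sum_le_tsum _ fun _ _ => by positivity
  have hexp1 : Real.exp (-(0.99 * u)) / lam = Real.exp (-(1.01 * u)) := by
    rw [hlam, ← Real.exp_sub]; congr 1; ring
  have hexp2 : lam ^ 2 * Real.exp (-(1.06 * u)) ≤ Real.exp (-(1.01 * u)) := by
    rw [hlam, ← Real.exp_nat_mul, ← Real.exp_add]
    refine Real.exp_le_exp.2 ?_
    have h1 : (1.01 : ℝ) = 101 / 100 := by norm_num
    have h2 : (1.06 : ℝ) = 106 / 100 := by norm_num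
    have h3 : (0.02 : ℝ) = 2 / 100 := by norm_num
    rw [h1, h2, h3]; push_cast; linarith
  calc ∑ p ∈ primesIoc 0 T, ∑ e ∈ Icc 1 (3 * T) with Odd e ∧ IsCoprime c ((e : ℕ) : ℤ), err p e
      ≤ ∑ p ∈ primesIoc 0 T, ∑ e ∈ Icc 1 (3 * T) with Odd e ∧ IsCoprime c ((e : ℕ) : ℤ),
        ((if e ≤ X₀ then ‖expSum e (0 * v e) (D - (p : ℤ) ^ 2)‖ else 0) +
        2 / lam * ‖expSum e (0 * v e) (D - (p : ℤ) ^ 2)‖ +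
        3 / 2 * D₀ * lam ^ 2 * ∑ h ∈ Icc 1 (3 * T),
          ‖expSum e (((h : ℕ) : ℤ) * v e) (D - (p : ℤ) ^ 2)‖ / (h : ℝ) ^ 2) :=
        sum_le_sum fun p hp => sum_le_sum fun e he => hb p hp e he
    _ ≤ T * X₀ * Real.exp (-(0.99 * u)) + 2 / lam * (T * (3 * T : ℕ) * Real.exp (-(0.99 * u))) +
        3 / 2 * D₀ * lam ^ 2 * (T * (3 * T) * Real.exp (-(1.06 * u)) * C) := by
        simp_rw [sum_add_distrib, ← mul_sum]
        gcongr
        · exact hSX'.trans (hS0 _ hX₀T hX₀3)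
        · exact hS0'.trans (hS0 _ hX3T le_rfl)
    _ ≤ T * (T / lam) * Real.exp (-(0.99 * u)) + 2 / lam * (T * (3 * T) * Real.exp (-(0.99 * u))) +
        3 / 2 * D₀ * lam ^ 2 * (T * (3 * T) * Real.exp (-(1.06 * u)) * C) := by
        push_cast
        gcongr
        exact hX₀le.trans (by gcongr)
    _ = (T : ℝ) ^ 2 * (7 * (Real.exp (-(0.99 * u)) / lam) +
        9 / 2 * D₀ * C * (lam ^ 2 * Real.exp (-(1.06 * u)))) := by field_simp; ring
    _ ≤ (T : ℝ) ^ 2 * (7 * Real.exp (-(1.01 * u)) + 9 / 2 * D₀ * C * Real.exp (-(1.01 * u))) := by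
        rw [hexp1]; gcongr
    _ = (T : ℝ) ^ 2 * ((7 + 9 / 2 * D₀ * C) * Real.exp (-(1.01 * u))) := by ring
    _ ≤ (T : ℝ) ^ 2 * (Real.exp (0.005 * u) * Real.exp (-(1.01 * u))) := by gcongr
    _ = _ := by rw [← Real.exp_add]; congr 2; ring

/-- The quadratic character `χ₈'` with its values at the multiples of `m` removed. -/
noncomputable def chiAway (m a : ℕ) : ℝ := if m ∣ a then 0 else ((ZMod.χ₈' a : ℤ) : ℝ)

theorem abs_chi_le_one (a : ℕ) : |((ZMod.χ₈' a : ℤ) : ℝ)| ≤ 1 := by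
  generalize (a : ZMod 8) = x
  revert x
  have : ∀ x : ZMod 8, |ZMod.χ₈' x| ≤ 1 := by decide
  intro x
  exact_mod_cast this x

theorem abs_chiAway_le_one (m a : ℕ) : |chiAway m a| ≤ 1 := by
  rw [chiAway]
  split_ifs
  · simp
  · exact abs_chi_le_one a

theorem chiAway_mul {m : ℕ} (hm : m.Prime) (a b : ℕ) :
    chiAway m (a * b) = chiAway m a * chiAway m b := by
  simp only [chiAway, hm.dvd_mul]
  by_cases h1 : m ∣ a
  · simp [h1]
  · by_cases h2 : m ∣ b
    · simp [h2]
    · rw [if_neg (by tauto), if_neg h1, if_neg h2, Nat.cast_mul, map_mul, Int.cast_mul]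

theorem chiAway_one {m : ℕ} (hm : m.Prime) : chiAway m 1 = 1 := by
  rw [chiAway, if_neg fun h => hm.one_lt.ne' (Nat.dvd_one.1 h)]
  simp

theorem chiAway_of_even (m : ℕ) {a : ℕ} (ha : 2 ∣ a) : chiAway m a = 0 := by
  rw [chiAway]
  split_ifs
  · rfl
  · obtain ⟨b, rfl⟩ := ha
    have : ∀ x : ZMod 8, ZMod.χ₈' (2 * x) = 0 := by decide
    have := this b
    push_cast
    exact_mod_cast this

theorem sum_chi_mem_Icc (v : ℕ) :
    0 ≤ ∑ a ∈ Icc 1 v, ZMod.χ₈' (a : ZMod 8) ∧ ∑ a ∈ Icc 1 v, ZMod.χ₈' (a : ZMod 8) ≤ 2 := by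
  have key : ∀ k r : ℕ, r < 8 → ∑ a ∈ range (8 * k + r), ZMod.χ₈' (a : ZMod 8) =
      ∑ a ∈ range r, ZMod.χ₈' (a : ZMod 8) := by
    intro k r _
    induction k with
    | zero => simp
    | succ k ih =>
      rw [← ih, show 8 * (k + 1) + r = 8 + (8 * k + r) by ring, sum_range_add]
      have h1 : ∑ a ∈ range 8, ZMod.χ₈' (a : ZMod 8) = 0 := by decide
      rw [h1, zero_add]
      refine sum_congr rfl fun a _ => ?_
      congr 1
      push_cast
      have h8 : (8 : ZMod 8) = 0 := by decide
      rw [h8, zero_add]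
  have h0 : ∑ a ∈ Icc 1 v, ZMod.χ₈' (a : ZMod 8) = ∑ a ∈ range (v + 1), ZMod.χ₈' (a : ZMod 8) := by
    rw [range_eq_Ico, sum_eq_sum_Ico_succ_bot (by omega)]
    simp
    rfl
  rw [h0, ← Nat.div_add_mod (v + 1) 8, key _ _ (Nat.mod_lt _ (by norm_num))]
  have : ∀ r < 8, 0 ≤ ∑ a ∈ range r, ZMod.χ₈' (a : ZMod 8) ∧
      ∑ a ∈ range r, ZMod.χ₈' (a : ZMod 8) ≤ 2 := by decide
  exact this _ (Nat.mod_lt _ (by norm_num))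

theorem exists_abs_sum_chi_div_sub_le : ∃ L : ℝ, 1 / 2 ≤ L ∧ L ≤ 2 ∧ ∀ v : ℕ,
    |∑ a ∈ Icc 1 v, ((ZMod.χ₈' a : ℤ) : ℝ) / a - L| ≤ 2 / (v + 1) := by
  set S : ℕ → ℝ := fun v => ∑ a ∈ Icc 1 v, ((ZMod.χ₈' a : ℤ) : ℝ) with hS
  have hS0 : ∀ v, 0 ≤ S v ∧ S v ≤ 2 := fun v => by
    have := sum_chi_mem_Icc v
    rw [hS]; dsimp only
    exact_mod_cast this
  set H : ℕ → ℝ := fun v => ∑ a ∈ Icc 1 v, S a * (1 / (a : ℝ) - 1 / (a + 1)) with hH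
  have hterm : ∀ a : ℕ, 0 < a → 0 ≤ 1 / (a : ℝ) - 1 / (a + 1) := fun a ha => by
    have : (0 : ℝ) < a := by exact_mod_cast ha
    rw [sub_nonneg]
    exact one_div_le_one_div_of_le this (by linarith)
  have hmono : Monotone H := monotone_nat_of_le_succ fun v => by
    rw [hH]; dsimp only
    rw [sum_Icc_succ_top (by omega)]
    have := mul_nonneg (hS0 (v + 1)).1 (hterm (v + 1) (by omega))
    linarith
  have hanti : Antitone fun v => H v + 2 / ((v : ℝ) + 1) := antitone_nat_of_succ_le fun v => by
    rw [hH]; dsimp only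
    rw [sum_Icc_succ_top (by omega)]
    have h1 := mul_le_mul_of_nonneg_right (hS0 (v + 1)).2 (hterm (v + 1) (by omega))
    push_cast at h1 ⊢
    have h2 : 2 * (1 / ((v : ℝ) + 1) - 1 / (v + 1 + 1)) = 2 / (v + 1) - 2 / (v + 1 + 1) := by ring
    linarith
  have hle : ∀ v w, H v ≤ H w + 2 / ((w : ℝ) + 1) := fun v w => by
    have h1 := hanti (le_max_right v w)
    have h2 := hmono (le_max_left v w)
    have h3 : (0 : ℝ) ≤ 2 / ((max v w : ℕ) + 1) := by positivity
    dsimp only at h1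
    linarith
  have hbdd : BddAbove (Set.range H) := ⟨H 0 + 2 / (((0 : ℕ) : ℝ) + 1), by
    rintro _ ⟨v, rfl⟩; exact hle v 0⟩
  have hsup : ∀ w, (⨆ v, H v) ≤ H w + 2 / ((w : ℝ) + 1) := fun w => ciSup_le fun v => hle v w
  have hid : ∀ v : ℕ, ∑ a ∈ Icc 1 v, ((ZMod.χ₈' a : ℤ) : ℝ) / a = S v / (v + 1) + H v := by
    intro v
    induction v with
    | zero => simp [hS, hH]
    | succ v ih =>
      have h1 : S (v + 1) = S v + ((ZMod.χ₈' (v + 1 : ℕ) : ℤ) : ℝ) := by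
        rw [hS]; dsimp only; rw [sum_Icc_succ_top (by omega)]
      have h2 : H (v + 1) = H v + S (v + 1) * (1 / ((v + 1 : ℕ) : ℝ) - 1 / ((v + 1 : ℕ) + 1)) := by
        rw [hH]; dsimp only; rw [sum_Icc_succ_top (by omega)]
      rw [sum_Icc_succ_top (by omega), ih, h2, h1]
      push_cast
      field_simp
      ring
  refine ⟨⨆ v, H v, ?_, ?_, fun v => ?_⟩
  · refine le_trans (le_of_eq ?_) (le_ciSup hbdd 1)
    simp [hH, hS]
    norm_num
  · refine (hsup 0).trans (le_of_eq ?_)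
    simp [hH]
  · have h1 := hsup v
    have h2 := le_ciSup hbdd v
    have h3 : 0 ≤ S v / ((v : ℝ) + 1) := div_nonneg (hS0 v).1 (by positivity)
    have h4 : S v / ((v : ℝ) + 1) ≤ 2 / (v + 1) := by gcongr; exact (hS0 v).2
    rw [hid, abs_le]
    constructor <;> linarith

theorem exists_abs_sum_chiAway_div_sub_le {m : ℕ} (hm : m % 8 = 5) : ∃ L : ℝ, 1 / 2 ≤ L ∧ L ≤ 4 ∧
    ∀ v : ℕ, |∑ a ∈ Icc 1 v, chiAway m a / a - L| ≤ 4 / (v + 1) := by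
  obtain ⟨L, hL, hL2, hLv⟩ := exists_abs_sum_chi_div_sub_le
  have hm0 : 0 < m := by omega
  have hm1 : (1 : ℝ) ≤ m := by exact_mod_cast hm0
  have hχm : ZMod.χ₈' (m : ZMod 8) = -1 := by
    have : (m : ZMod 8) = 5 := by
      rw [← ZMod.natCast_mod, hm]; rfl
    rw [this]; decide
  have hinv : 1 / (m : ℝ) ≤ 1 := by rw [div_le_one (by linarith)]; exact hm1
  have hinv0 : 0 < 1 / (m : ℝ) := by positivity
  refine ⟨L + 1 / m * L, ?_, ?_, fun v => ?_⟩
  · have : 0 ≤ 1 / (m : ℝ) * L := by positivity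
    linarith
  · have := mul_le_mul hinv hL2 (by linarith) zero_le_one
    linarith
  · have h1 : ∑ a ∈ Icc 1 v, chiAway m a / a = ∑ a ∈ Icc 1 v, ((ZMod.χ₈' a : ℤ) : ℝ) / a +
        1 / m * ∑ a ∈ Icc 1 (v / m), ((ZMod.χ₈' a : ℤ) : ℝ) / a := by
      have h2 : ∑ a ∈ Icc 1 v with m ∣ a, ((ZMod.χ₈' a : ℤ) : ℝ) / a =
          -(1 / m * ∑ a ∈ Icc 1 (v / m), ((ZMod.χ₈' a : ℤ) : ℝ) / a) := by
        rw [mul_sum, ← sum_neg_distrib]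
        symm
        refine sum_bij (fun a _ => m * a) ?_ ?_ ?_ ?_
        · intro a ha
          have := mem_Icc.1 ha
          refine mem_filter.2 ⟨mem_Icc.2 ⟨Nat.mul_pos hm0 this.1, ?_⟩, dvd_mul_right _ _⟩
          rw [mul_comm]
          exact (Nat.le_div_iff_mul_le hm0).1 this.2
        · intro a _ b _ h
          exact Nat.eq_of_mul_eq_mul_left hm0 h
        · intro b hb
          obtain ⟨h3, a, rfl⟩ := mem_filter.1 hb
          have := mem_Icc.1 h3
          refine ⟨a, mem_Icc.2 ⟨Nat.pos_of_mul_pos_left this.1, ?_⟩, rfl⟩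
          rw [Nat.le_div_iff_mul_le hm0, mul_comm]
          exact this.2
        · intro a _
          rw [Nat.cast_mul, map_mul, hχm, Nat.cast_mul]
          push_cast
          rw [div_mul_div_comm]
          ring
      have h3 : ∑ a ∈ Icc 1 v, chiAway m a / a =
          ∑ a ∈ Icc 1 v with ¬ m ∣ a, ((ZMod.χ₈' a : ℤ) : ℝ) / a := by
        rw [sum_filter]
        refine sum_congr rfl fun a _ => ?_
        rw [chiAway]
        split_ifs <;> simp_all
      rw [h3, ← sum_filter_add_sum_filter_not (Icc 1 v) (fun a => m ∣ a) (fun a => ((ZMod.χ₈' a : ℤ) : ℝ) / a), h2]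
      ring
    have h4 := hLv v
    have h5 := hLv (v / m)
    have h6 : 1 / (m : ℝ) * (2 / ((v / m : ℕ) + 1)) ≤ 2 / (v + 1) := by
      rw [div_mul_div_comm, one_mul]
      gcongr
      have := Nat.lt_mul_div_succ v hm0
      exact_mod_cast (by omega : v + 1 ≤ m * (v / m + 1))
    set x := ∑ a ∈ Icc 1 v, ((ZMod.χ₈' a : ℤ) : ℝ) / a
    set y := ∑ a ∈ Icc 1 (v / m), ((ZMod.χ₈' a : ℤ) : ℝ) / a
    calc |∑ a ∈ Icc 1 v, chiAway m a / a - (L + 1 / m * L)| = |(x - L) + 1 / m * (y - L)| := by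
          rw [h1]; congr 1; ring
      _ ≤ |x - L| + 1 / m * |y - L| := by
          refine (abs_add_le _ _).trans ?_
          rw [abs_mul, abs_of_pos hinv0]
      _ ≤ 2 / (v + 1) + 1 / m * (2 / ((v / m : ℕ) + 1)) := by gcongr
      _ ≤ 2 / (v + 1) + 2 / (v + 1) := by gcongr
      _ = _ := by ring

/-- `rootCount K` as an arithmetic function. -/
noncomputable def rootArith (K : ℤ) : ArithmeticFunction ℝ :=
  ⟨fun e => if e = 0 then 0 else rootCount K e, if_pos rfl⟩

/-- The Dirichlet convolution of `rootCount K` with the Möbius function. -/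
noncomputable def rootMoebius (K : ℤ) : ArithmeticFunction ℝ :=
  (ArithmeticFunction.moebius : ArithmeticFunction ℝ) * rootArith K

/-- The coefficients `c` with `χ · rootCount K = χ * c` for `χ = chiAway m`. -/
noncomputable def rootCoeff (m : ℕ) (K : ℤ) (b : ℕ) : ℝ := chiAway m b * rootMoebius K b

theorem rootArith_apply (K : ℤ) {e : ℕ} (he : e ≠ 0) : rootArith K e = rootCount K e :=
  if_neg he

theorem isMultiplicative_rootArith (K : ℤ) : (rootArith K).IsMultiplicative := by
  rw [ArithmeticFunction.IsMultiplicative.iff_ne_zero]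
  refine ⟨by rw [rootArith_apply K one_ne_zero, rootCount_one, Nat.cast_one],
    fun {a b} ha hb hab => ?_⟩
  rw [rootArith_apply K (mul_ne_zero ha hb), rootArith_apply K ha, rootArith_apply K hb,
    rootCount_mul K hab, Nat.cast_mul]

theorem isMultiplicative_rootMoebius (K : ℤ) : (rootMoebius K).IsMultiplicative :=
  ArithmeticFunction.isMultiplicative_moebius.intCast.mul (isMultiplicative_rootArith K)

theorem sum_divisors_rootMoebius (K : ℤ) {e : ℕ} (he : e ≠ 0) :
    ∑ b ∈ e.divisors, rootMoebius K b = rootCount K e := by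
  rw [← ArithmeticFunction.coe_zeta_mul_apply, rootMoebius, ← mul_assoc,
    ArithmeticFunction.coe_zeta_mul_coe_moebius, one_mul, rootArith_apply K he]

theorem rootMoebius_prime_pow_succ (K : ℤ) {p : ℕ} (hp : p.Prime) (j : ℕ) :
    rootMoebius K (p ^ (j + 1)) = rootCount K (p ^ (j + 1)) - rootCount K (p ^ j) := by
  rw [← sum_divisors_rootMoebius K (pow_ne_zero (j + 1) hp.ne_zero),
    ← sum_divisors_rootMoebius K (pow_ne_zero j hp.ne_zero), Nat.sum_divisors_prime_pow hp,
    Nat.sum_divisors_prime_pow hp, sum_range_succ]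
  ring

theorem rootCoeff_one {m : ℕ} (hm : m.Prime) (K : ℤ) : rootCoeff m K 1 = 1 := by
  rw [rootCoeff, chiAway_one hm, (isMultiplicative_rootMoebius K).1, one_mul]

theorem rootCoeff_mul {m : ℕ} (hm : m.Prime) (K : ℤ) {a b : ℕ} (hab : a.Coprime b) :
    rootCoeff m K (a * b) = rootCoeff m K a * rootCoeff m K b := by
  rw [rootCoeff, chiAway_mul hm, (isMultiplicative_rootMoebius K).2 hab, rootCoeff, rootCoeff]
  ring

theorem rootCoeff_prime (m : ℕ) (K : ℤ) {p : ℕ} (hp : p.Prime) :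
    rootCoeff m K p = chiAway m p * (rootCount K p - 1) := by
  have := rootMoebius_prime_pow_succ K hp 0
  rw [zero_add, pow_one, pow_zero, rootCount_one, Nat.cast_one] at this
  rw [rootCoeff, this]

theorem abs_rootCoeff_prime_le_one (m : ℕ) (K : ℤ) {p : ℕ} (hp : p.Prime) :
    |rootCoeff m K p| ≤ 1 := by
  rw [rootCoeff_prime m K hp, abs_mul]
  have h1 : (rootCount K p : ℝ) ≤ 2 := by exact_mod_cast rootCount_prime_le_two hp K
  have h2 : |(rootCount K p : ℝ) - 1| ≤ 1 := by
    rw [abs_le]; constructor <;> linarith [Nat.cast_nonneg (α := ℝ) (rootCount K p)]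
  exact mul_le_one₀ (abs_chiAway_le_one m p) (abs_nonneg _) h2

theorem abs_sub_le_of_nonneg_of_le_of_le {x y B : ℝ} (hx : 0 ≤ x) (hy : 0 ≤ y) (hxB : x ≤ B)
    (hyB : y ≤ B) : |x - y| ≤ B := by
  rw [abs_le]; constructor <;> linarith

theorem rootLike_abs_rootCoeff {m : ℕ} (hm : m.Prime) (K : ℤ) :
    RootLike (fun b => |rootCoeff m K b|) K where
  nonneg _ := abs_nonneg _
  one_le := by simp [rootCoeff_one hm]
  mul_le a b _ _ hab := by rw [rootCoeff_mul hm K hab, abs_mul]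
  even e he := by rw [rootCoeff, chiAway_of_even m he, zero_mul, abs_zero]
  prime_pow_le p j hp := by
    rcases j with _ | j
    · rw [pow_zero, rootCoeff_one hm]; norm_num
    · rw [rootCoeff, abs_mul, rootMoebius_prime_pow_succ K hp]
      refine (mul_le_of_le_one_left (abs_nonneg _) (abs_chiAway_le_one _ _)).trans ?_
      refine abs_sub_le_of_nonneg_of_le_of_le (Nat.cast_nonneg _) (Nat.cast_nonneg _)
        (by exact_mod_cast rootCount_prime_pow_le hp K (j + 1)) ?_
      have h1 := rootCount_prime_pow_le hp K j
      have h2 : p ^ (j / 2) ≤ p ^ ((j + 1) / 2) := Nat.pow_le_pow_right hp.pos (by omega)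
      exact_mod_cast h1.trans (Nat.mul_le_mul_left 2 h2)
  prime_pow_le_two p j hp hK := by
    rcases j with _ | j
    · rw [pow_zero, rootCoeff_one hm]; norm_num
    · by_cases hp2 : p = 2
      · subst hp2
        rw [rootCoeff, chiAway_of_even m (dvd_pow_self 2 (Nat.succ_ne_zero j)), zero_mul, abs_zero]
        norm_num
      · rw [rootCoeff, abs_mul, rootMoebius_prime_pow_succ K hp]
        refine (mul_le_of_le_one_left (abs_nonneg _) (abs_chiAway_le_one _ _)).trans ?_
        refine abs_sub_le_of_nonneg_of_le_of_le (Nat.cast_nonneg _) (Nat.cast_nonneg _) ?_ ?_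
        · exact_mod_cast rootCount_prime_pow_le_two hp hp2 hK (j + 1)
        · exact_mod_cast rootCount_prime_pow_le_two hp hp2 hK j

theorem sum_chiAway_mul_rootCount_eq {m : ℕ} (hm : m.Prime) (K : ℤ) (X : ℕ) :
    ∑ e ∈ Icc 1 X, chiAway m e * rootCount K e / e =
      ∑ b ∈ Icc 1 X, rootCoeff m K b / b * ∑ a ∈ Icc 1 (X / b), chiAway m a / a := by
  have hI : ∀ N, Icc 1 N = Ioc 0 N := fun N => by ext; simp [Nat.succ_le_iff]
  simp only [hI]
  obtain ⟨F, hF⟩ : ∃ F : ArithmeticFunction ℝ, ∀ b, F b = rootCoeff m K b / b :=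
    ⟨⟨fun b => rootCoeff m K b / b, by simp⟩, fun _ => rfl⟩
  obtain ⟨G, hG⟩ : ∃ G : ArithmeticFunction ℝ, ∀ a, G a = chiAway m a / a :=
    ⟨⟨fun a => chiAway m a / a, by simp⟩, fun _ => rfl⟩
  simp only [← hF, ← hG]
  rw [← ArithmeticFunction.sum_Ioc_mul_eq_sum_sum F G X]
  refine sum_congr rfl fun e he => ?_
  have he0 : e ≠ 0 := by have := mem_Ioc.1 he; omega
  rw [ArithmeticFunction.mul_apply, ← sum_divisors_rootMoebius K he0, mul_sum, sum_div,
    ← Nat.sum_divisorsAntidiagonal (fun i _ => chiAway m e * rootMoebius K i / (e : ℝ))]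
  refine sum_congr rfl fun x hx => ?_
  obtain ⟨hx1, _⟩ := Nat.mem_divisorsAntidiagonal.1 hx
  rw [hF, hG, ← hx1, chiAway_mul hm, rootCoeff, div_mul_div_comm, Nat.cast_mul]
  ring

theorem alternating_sum_mem_Icc (J : ℕ) : ∀ a : ℕ → ℝ, Antitone a → (∀ j, 0 ≤ a j) →
    0 ≤ ∑ j ∈ range (J + 1), (-1) ^ j * a j ∧ ∑ j ∈ range (J + 1), (-1) ^ j * a j ≤ a 0 := by
  induction J with
  | zero => intro a _ h; simpa using h 0
  | succ J ih =>
    intro a ha h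
    obtain ⟨h1, h2⟩ := ih (fun j => a (j + 1)) (fun i j hij => ha (by omega)) fun j => h _
    rw [sum_range_succ']
    have h3 : ∑ k ∈ range (J + 1), (-1 : ℝ) ^ (k + 1) * a (k + 1) =
        -∑ k ∈ range (J + 1), (-1) ^ k * a (k + 1) := by
      rw [← sum_neg_distrib]
      refine sum_congr rfl fun k _ => ?_
      rw [pow_succ]; ring
    have h4 := ha (Nat.zero_le 1)
    simp only [zero_add] at h2
    rw [h3, pow_zero, one_mul]
    constructor <;> linarith

theorem one_sub_le_alternating_sum (J : ℕ) (a : ℕ → ℝ) (ha : Antitone a) (h : ∀ j, 0 ≤ a j) :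
    a 0 - a 1 ≤ ∑ j ∈ range (J + 1), (-1) ^ j * a j := by
  rcases J with _ | J
  · simpa using h 1
  · obtain ⟨h1, h2⟩ := alternating_sum_mem_Icc J (fun j => a (j + 1))
      (fun i j hij => ha (by omega)) fun j => h _
    rw [sum_range_succ']
    have h3 : ∑ k ∈ range (J + 1), (-1 : ℝ) ^ (k + 1) * a (k + 1) =
        -∑ k ∈ range (J + 1), (-1) ^ k * a (k + 1) := by
      rw [← sum_neg_distrib]
      refine sum_congr rfl fun k _ => ?_
      rw [pow_succ]; ring
    have h2' : ∑ k ∈ range (J + 1), (-1 : ℝ) ^ k * a (k + 1) ≤ a 1 := h2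
    rw [h3, pow_zero, one_mul]
    rw [sub_eq_neg_add]
    exact add_le_add_left (neg_le_neg h2') _

theorem one_sub_two_mul_le_sub_mul {A B x : ℝ} (hAB : B ≤ A) (hA : 1 ≤ A) (hx : 0 ≤ x)
    (hx1 : x ≤ 1) : 1 - 2 * x ≤ A - x * B := by
  have h1 := mul_le_mul_of_nonneg_left hAB hx
  have h2 := mul_le_mul_of_nonneg_left hA (sub_nonneg.2 hx1)
  linarith

theorem sum_rootCoeff_prime_pow_eq {m : ℕ} (hm : m.Prime) (K : ℤ) {p : ℕ} (hp : p.Prime)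
    (J : ℕ) : ∑ j ∈ range (J + 1), rootCoeff m K (p ^ j) / (p ^ j : ℕ) =
      ∑ j ∈ range (J + 1), chiAway m p ^ j * (rootCount K (p ^ j) / (p ^ j : ℕ)) -
        chiAway m p / p * ∑ j ∈ range J, chiAway m p ^ j *
          (rootCount K (p ^ j) / (p ^ j : ℕ)) := by
  have hp0 : (0 : ℝ) < p := by exact_mod_cast hp.pos
  have hχpow : ∀ j, chiAway m (p ^ j) = chiAway m p ^ j := fun j => by
    induction j with
    | zero => rw [pow_zero, pow_zero, chiAway_one hm]
    | succ j ih => rw [pow_succ, chiAway_mul hm, ih, pow_succ]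
  rw [sum_range_succ', sum_range_succ', mul_sum, add_sub_right_comm, ← sum_sub_distrib]
  congr 1
  · refine sum_congr rfl fun j _ => ?_
    rw [rootCoeff, hχpow, rootMoebius_prime_pow_succ K hp]
    have : (p : ℝ) ^ j ≠ 0 := by positivity
    push_cast
    field_simp
    ring
  · rw [pow_zero, rootCoeff_one hm, pow_zero]; simp [rootCount_one]

theorem antitone_rootCount_div (K : ℤ) {p : ℕ} (hp : p.Prime) :
    Antitone fun j : ℕ => (rootCount K (p ^ j) : ℝ) / (p ^ j : ℕ) :=
  antitone_nat_of_succ_le fun j => by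
    have h1 := rootCount_prime_pow_succ_le hp K j
    have h2 : (rootCount K (p ^ (j + 1)) : ℝ) ≤ p * rootCount K (p ^ j) := by exact_mod_cast h1
    rw [div_le_div_iff₀ (by exact_mod_cast pow_pos hp.pos _) (by exact_mod_cast pow_pos hp.pos _)]
    push_cast
    have h3 : (0 : ℝ) ≤ (p : ℝ) ^ j := by positivity
    refine (mul_le_mul_of_nonneg_right h2 h3).trans (le_of_eq ?_)
    rw [pow_succ]
    ring

theorem chiAway_eq_zero_or_one_or_neg_one (m a : ℕ) :
    chiAway m a = 0 ∨ chiAway m a = 1 ∨ chiAway m a = -1 := by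
  rw [chiAway]
  split_ifs
  · exact Or.inl rfl
  · have : ∀ x : ZMod 8, ZMod.χ₈' x = 0 ∨ ZMod.χ₈' x = 1 ∨ ZMod.χ₈' x = -1 := by decide
    exact_mod_cast this a

/-- The Euler factors of `rootCoeff` are bounded below. -/
theorem sum_rootCoeff_prime_pow_ge {m : ℕ} (hm : m.Prime) (K : ℤ) {p : ℕ} (hp : p.Prime)
    (J : ℕ) : 1 - 2 / (p : ℝ) ≤ ∑ j ∈ range (J + 1), rootCoeff m K (p ^ j) / (p ^ j : ℕ) := by
  have hp0 : (0 : ℝ) < p := by exact_mod_cast hp.pos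
  rw [sum_rootCoeff_prime_pow_eq hm K hp J]
  have ha0 : (rootCount K (p ^ 0) : ℝ) / (p ^ 0 : ℕ) = 1 := by simp [rootCount_one]
  have ha1 : (rootCount K (p ^ 1) : ℝ) / (p ^ 1 : ℕ) ≤ 2 / p := by
    rw [pow_one]
    have : (rootCount K p : ℝ) ≤ 2 := by exact_mod_cast rootCount_prime_le_two hp K
    gcongr
  have hpos : ∀ j : ℕ, 0 ≤ (rootCount K (p ^ j) : ℝ) / (p ^ j : ℕ) := fun j => by positivity
  have hanti := antitone_rootCount_div K hp
  generalize hag : (fun j : ℕ => (rootCount K (p ^ j) : ℝ) / (p ^ j : ℕ)) = a at hanti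
  have ha : ∀ j : ℕ, (rootCount K (p ^ j) : ℝ) / (p ^ j : ℕ) = a j := fun j => by rw [← hag]
  simp only [ha] at ha0 ha1 hpos ⊢
  have h2p : 0 ≤ 2 / (p : ℝ) := by positivity
  rcases chiAway_eq_zero_or_one_or_neg_one m p with h | h | h
  · rw [h, sum_range_succ']
    simpa [ha0] using h2p
  · rw [h]
    simp only [one_pow, one_mul]
    have h1 : ∑ j ∈ range J, a j ≤ ∑ j ∈ range (J + 1), a j := by
      rw [sum_range_succ]; linarith [hpos J]
    have h2 : 1 ≤ ∑ j ∈ range (J + 1), a j := by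
      rw [sum_range_succ', ha0]
      have : 0 ≤ ∑ k ∈ range J, a (k + 1) := sum_nonneg fun _ _ => hpos _
      linarith
    have h3 : 1 / (p : ℝ) ≤ 1 := by
      rw [div_le_one hp0]; exact_mod_cast hp.one_lt.le
    rw [show 2 / (p : ℝ) = 2 * (1 / p) by ring]
    exact one_sub_two_mul_le_sub_mul h1 h2 (by positivity) h3
  · rw [h]
    have h1 := one_sub_le_alternating_sum J a hanti hpos
    have h2 : 0 ≤ ∑ j ∈ range J, (-1) ^ j * a j := by
      rcases J with _ | J
      · simp
      · exact (alternating_sum_mem_Icc J a hanti hpos).1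
    have h3 : 0 ≤ 1 / (p : ℝ) * ∑ j ∈ range J, (-1) ^ j * a j := by positivity
    rw [neg_div, neg_mul, sub_neg_eq_add]
    linarith

theorem smoothPart_eq_self {w s : ℕ} (h0 : s ≠ 0) (hs : s.primeFactors ⊆ primesIoc 0 w) :
    smoothPart w s = s := by
  conv_rhs => rw [← Nat.prod_factorization_pow_eq_self h0]
  exact Finsupp.prod_congr fun p hp => if_pos (mem_primesIoc.1 (hs hp)).2.1

theorem RootLike.sum_smooth_rpow_le {f : ℕ → ℝ} {K : ℤ} (hf : RootLike f K) (w : ℕ) {σ : ℝ}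
    (hσ0 : 0 ≤ σ) (hσ : σ ≤ 0.2) (A : Finset ℕ)
    (hA : ∀ n ∈ A, n ≠ 0 ∧ n.primeFactors ⊆ primesIoc 0 w) :
    ∑ e ∈ A, f e / e * (e : ℝ) ^ σ ≤
      ∏ ℓ ∈ primesIoc 0 w, (1 + 10 * ((ℓ : ℝ) ^ (2 * σ) / ℓ)) := by
  have h := hf.sum_smoothPart_rpow_le w hσ0 hσ (primesIoc 0 w)
    (fun p hp => (mem_primesIoc.1 hp).2.2) A hA
  calc ∑ e ∈ A, f e / e * (e : ℝ) ^ σ = ∑ e ∈ A, f e / e * (smoothPart w e : ℝ) ^ σ :=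
        sum_congr rfl fun e he => by rw [smoothPart_eq_self (hA e he).1 (hA e he).2]
    _ ≤ _ := h
    _ = _ := prod_congr rfl fun ℓ hℓ => by rw [if_pos (mem_primesIoc.1 hℓ).2.1]

theorem sum_divisors_prod_primes_pow {g : ℕ → ℝ} (hg1 : g 1 = 1)
    (hg : ∀ a b : ℕ, a.Coprime b → g (a * b) = g a * g b) (J : ℕ) (s : Finset ℕ)
    (hs : ∀ p ∈ s, p.Prime) : ∑ e ∈ ((∏ ℓ ∈ s, ℓ) ^ J).divisors, g e =
      ∏ ℓ ∈ s, ∑ j ∈ range (J + 1), g (ℓ ^ j) := by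
  induction s using Finset.induction_on with
  | empty => simp [hg1]
  | insert p s hp ih =>
    have hpp := hs p (mem_insert_self p s)
    have hc : (p ^ J).Coprime ((∏ ℓ ∈ s, ℓ) ^ J) := by
      refine Nat.Coprime.pow _ _ (Nat.Coprime.prod_right fun q hq => ?_)
      exact (Nat.coprime_primes hpp (hs q (mem_insert_of_mem hq))).2
        fun h => hp (h ▸ hq)
    rw [prod_insert hp, prod_insert hp, mul_pow, Nat.divisors_mul, Finset.mul_def,
      Finset.sum_image hc.mul_injOn_divisors, sum_product,
      ← ih fun q hq => hs q (mem_insert_of_mem hq), Nat.divisors_prime_pow hpp, sum_map,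
      Finset.sum_mul_sum]
    refine sum_congr rfl fun i hi => sum_congr rfl fun e he => hg _ _ ?_
    exact (hc.coprime_dvd_left (pow_dvd_pow p (Nat.lt_succ_iff.1 (mem_range.1 hi)))).coprime_dvd_right
      (Nat.dvd_of_mem_divisors he)

/-- Smooth numbers at most `J` divide the `J`-th power of the product of the small primes. -/
theorem dvd_prod_primes_pow {w s J : ℕ} (h0 : s ≠ 0) (hs : s.primeFactors ⊆ primesIoc 0 w)
    (hJ : s ≤ J) : s ∣ (∏ ℓ ∈ primesIoc 0 w, ℓ) ^ J := by
  conv_lhs => rw [← Nat.prod_factorization_pow_eq_self h0]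
  rw [Finsupp.prod, ← prod_pow]
  refine (prod_dvd_prod_of_dvd _ _ fun p _ => ?_).trans (prod_dvd_prod_of_subset _ _ _ hs)
  exact pow_dvd_pow p (((Nat.factorization_lt p h0).le).trans hJ)

theorem primeFactors_prod_primes_pow_subset {w J s : ℕ}
    (hs : s ∣ (∏ ℓ ∈ primesIoc 0 w, ℓ) ^ J) : s.primeFactors ⊆ primesIoc 0 w := by
  intro p hp
  have hpp := Nat.prime_of_mem_primeFactors hp
  have h := hpp.dvd_of_dvd_pow ((Nat.dvd_of_mem_primeFactors hp).trans hs)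
  obtain ⟨q, hq, hpq⟩ := (Prime.dvd_finset_prod_iff hpp.prime _).1 h
  rwa [(Nat.prime_dvd_prime_iff_eq hpp (mem_primesIoc.1 hq).2.2).1 hpq]

theorem prod_primesIoc_pow_ne_zero (w J : ℕ) : (∏ ℓ ∈ primesIoc 0 w, ℓ) ^ J ≠ 0 :=
  pow_ne_zero _ (prod_ne_zero_iff.2 fun _ hq => (mem_primesIoc.1 hq).2.2.ne_zero)

theorem one_div_div_add_one_le_rpow {σ : ℝ} (hσ0 : 0 ≤ σ) (hσ : σ ≤ 1) {v s : ℕ} (hv : 0 < v)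
    (hs : 0 < s) : 1 / (((v / s : ℕ) : ℝ) + 1) ≤ (s : ℝ) ^ σ * (v : ℝ) ^ (-σ) := by
  have hv' : (0 : ℝ) < v := by exact_mod_cast hv
  have hs' : (0 : ℝ) < s := by exact_mod_cast hs
  have e : (s : ℝ) ^ σ * (v : ℝ) ^ (-σ) = ((s : ℝ) / v) ^ σ := by
    rw [Real.div_rpow hs'.le hv'.le, Real.rpow_neg hv'.le, div_eq_mul_inv]
  rw [e]
  rcases le_or_gt s v with h | h
  · have h1 : (s : ℝ) / v ≤ 1 := by rw [div_le_one hv']; exact_mod_cast h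
    have h2 : (v : ℝ) / s ≤ ((v / s : ℕ) : ℝ) + 1 := by
      rw [div_le_iff₀ hs']
      have := Nat.lt_mul_div_succ v hs
      have : (v : ℝ) ≤ s * ((v / s : ℕ) + 1) := by exact_mod_cast this.le
      linarith
    calc 1 / (((v / s : ℕ) : ℝ) + 1) ≤ 1 / ((v : ℝ) / s) :=
          one_div_le_one_div_of_le (by positivity) h2
      _ = ((s : ℝ) / v) ^ (1 : ℝ) := by rw [one_div_div, Real.rpow_one]
      _ ≤ _ := Real.rpow_le_rpow_of_exponent_ge (by positivity) h1 hσ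
  · rw [Nat.div_eq_of_lt h]
    have h1 : 1 ≤ (s : ℝ) / v := by rw [one_le_div hv']; exact_mod_cast h.le
    simpa using Real.one_le_rpow h1 hσ0

/-- Twisted sums over smooth numbers factor approximately. -/
theorem abs_sum_smooth_sub_le {m : ℕ} (hm : m.Prime) (K : ℤ) {L : ℝ}
    (hL : ∀ v : ℕ, |∑ a ∈ Icc 1 v, chiAway m a / a - L| ≤ 4 / (v + 1)) (w : ℕ) {σ : ℝ}
    (hσ0 : 0 ≤ σ) (hσ : σ ≤ 0.2) {v J : ℕ} (hv : 0 < v) (hJ : v ≤ J) :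
    |∑ s ∈ Icc 1 v with s.primeFactors ⊆ primesIoc 0 w,
        rootCoeff m K s / s * ∑ a ∈ Icc 1 (v / s), chiAway m a / a -
      L * ∑ s ∈ ((∏ ℓ ∈ primesIoc 0 w, ℓ) ^ J).divisors, rootCoeff m K s / s| ≤
      4 * (v : ℝ) ^ (-σ) * ∏ ℓ ∈ primesIoc 0 w, (1 + 10 * ((ℓ : ℝ) ^ (2 * σ) / ℓ)) := by
  set N := (∏ ℓ ∈ primesIoc 0 w, ℓ) ^ J with hN
  have hN0 : N ≠ 0 := prod_primesIoc_pow_ne_zero w J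
  have hsub : {s ∈ Icc 1 v | s.primeFactors ⊆ primesIoc 0 w} ⊆ N.divisors := fun s hs => by
    obtain ⟨h1, h2⟩ := mem_filter.1 hs
    have h3 := mem_Icc.1 h1
    exact Nat.mem_divisors.2 ⟨dvd_prod_primes_pow (by omega) h2 (by omega), hN0⟩
  rw [sum_subset hsub fun s hs hs' => ?_, mul_sum, ← sum_sub_distrib]
  · have hterm : ∀ s ∈ N.divisors, |rootCoeff m K s / s * ∑ a ∈ Icc 1 (v / s), chiAway m a / a -
        L * (rootCoeff m K s / s)| ≤
          4 * (v : ℝ) ^ (-σ) * (|rootCoeff m K s| / s * (s : ℝ) ^ σ) := fun s hs => by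
      have hs0 : 0 < s := Nat.pos_of_mem_divisors hs
      have e : rootCoeff m K s / s * ∑ a ∈ Icc 1 (v / s), chiAway m a / a -
          L * (rootCoeff m K s / s) =
            rootCoeff m K s / s * (∑ a ∈ Icc 1 (v / s), chiAway m a / a - L) := by ring
      rw [e, abs_mul, abs_div, Nat.abs_cast]
      have h1 := hL (v / s)
      have h2 := one_div_div_add_one_le_rpow hσ0 (hσ.trans (by norm_num)) hv hs0
      have h3 : |∑ a ∈ Icc 1 (v / s), chiAway m a / a - L| ≤
          4 * ((s : ℝ) ^ σ * (v : ℝ) ^ (-σ)) := by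
        refine h1.trans ?_
        rw [div_eq_mul_one_div]
        gcongr
      refine (mul_le_mul_of_nonneg_left h3 (by positivity)).trans (le_of_eq (by ring))
    refine (abs_sum_le_sum_abs _ _).trans ((sum_le_sum hterm).trans ?_)
    rw [← mul_sum]
    refine mul_le_mul_of_nonneg_left ?_ (by positivity)
    exact (rootLike_abs_rootCoeff hm K).sum_smooth_rpow_le w hσ0 hσ _ fun n hn =>
      ⟨(Nat.pos_of_mem_divisors hn).ne', primeFactors_prod_primes_pow_subset
        (Nat.dvd_of_mem_divisors hn)⟩
  · have h1 : 0 < s := Nat.pos_of_mem_divisors hs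
    have h2 := primeFactors_prod_primes_pow_subset (Nat.dvd_of_mem_divisors hs)
    have h3 : v < s := by
      by_contra h
      exact hs' (mem_filter.2 ⟨mem_Icc.2 ⟨h1, not_lt.1 h⟩, h2⟩)
    rw [Nat.div_eq_of_lt h3]
    simp

theorem exp_neg_le_one_sub {x : ℝ} (hx0 : 0 ≤ x) (hx : x ≤ 2 / 3) :
    Real.exp (-(2 * x)) ≤ 1 - x := by
  rw [Real.exp_neg, inv_le_comm₀ (Real.exp_pos _) (by linarith)]
  have h1 := Real.quadratic_le_exp_of_nonneg (mul_nonneg zero_le_two hx0)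
  refine le_trans ?_ h1
  rw [inv_le_iff_one_le_mul₀ (by linarith)]
  nlinarith [mul_nonneg hx0 (mul_nonneg (sub_nonneg.2 hx) (by linarith : (0:ℝ) ≤ 2 / 3 + x))]

theorem sum_divisors_rootCoeff_ge {m : ℕ} (hm : m.Prime) (K : ℤ) (w J : ℕ) :
    Real.exp (-(4 * ∑ ℓ ∈ primesIoc 0 w, 1 / (ℓ : ℝ))) ≤
      ∑ s ∈ ((∏ ℓ ∈ primesIoc 0 w, ℓ) ^ J).divisors, rootCoeff m K s / s := by
  rw [sum_divisors_prod_primes_pow (g := fun s => rootCoeff m K s / s)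
    (by simp [rootCoeff_one hm]) (fun a b hab => by
      rw [rootCoeff_mul hm K hab, Nat.cast_mul, div_mul_div_comm]) J _
    (fun p hp => (mem_primesIoc.1 hp).2.2), mul_sum, ← sum_neg_distrib, Real.exp_sum]
  refine prod_le_prod (fun _ _ => (Real.exp_pos _).le) fun p hp => ?_
  have hpp := (mem_primesIoc.1 hp).2.2
  rcases hpp.eq_two_or_odd' with rfl | hodd
  · rw [sum_range_succ', sum_eq_zero fun j _ => ?_]
    · simp [rootCoeff_one hm]
    · rw [rootCoeff, chiAway_of_even m (dvd_pow_self 2 (Nat.succ_ne_zero j)), zero_mul, zero_div]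
  · refine le_trans ?_ (sum_rootCoeff_prime_pow_ge hm K hpp J)
    have hp3 : 3 ≤ p := by
      have := hpp.two_le
      rcases hodd with ⟨k, hk⟩
      omega
    have hp3' : (3 : ℝ) ≤ p := by exact_mod_cast hp3
    have := exp_neg_le_one_sub (x := 2 / (p : ℝ)) (by positivity)
      (div_le_div_of_nonneg_left (by norm_num) (by norm_num) hp3')
    refine le_trans (le_of_eq ?_) this
    congr 1
    ring

theorem primeFactors_smoothPart_subset (w b : ℕ) :
    (smoothPart w b).primeFactors ⊆ primesIoc 0 w := fun p hp => by
  have hpp := Nat.prime_of_mem_primeFactors hp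
  exact mem_primesIoc.2 ⟨hpp.pos, (prime_dvd_smoothPart hpp (Nat.dvd_of_mem_primeFactors hp)).1,
    hpp⟩

theorem coprime_smoothPart_of_lt {w ℓ : ℕ} (hℓ : ℓ.Prime) (hw : w < ℓ) (b : ℕ) :
    ℓ.Coprime (smoothPart w b) :=
  (Nat.Prime.coprime_iff_not_dvd hℓ).2 fun h => absurd (prime_dvd_smoothPart hℓ h).1 (by omega)

theorem pow_dvd_roughPart {w b ℓ j : ℕ} (hb : b ≠ 0) (hℓ : ℓ.Prime) (hw : w < ℓ)
    (h : ℓ ^ j ∣ b) : ℓ ^ j ∣ roughPart w b := by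
  rw [← smoothPart_mul_roughPart w hb] at h
  exact ((coprime_smoothPart_of_lt hℓ hw b).pow_left j).dvd_of_dvd_mul_left h

theorem dvd_roughPart {w b ℓ : ℕ} (hb : b ≠ 0) (hℓ : ℓ.Prime) (hw : w < ℓ)
    (h : ℓ ∣ b) : ℓ ∣ roughPart w b := by
  simpa using pow_dvd_roughPart (j := 1) hb hℓ hw (by simpa using h)

theorem smoothPart_mul_prime {w s ℓ : ℕ} (h0 : s ≠ 0) (hs : s.primeFactors ⊆ primesIoc 0 w)
    (hℓ : ℓ.Prime) (hw : w < ℓ) : smoothPart w (s * ℓ) = s := by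
  have hc : s.Coprime ℓ := by
    have := (coprime_smoothPart_of_lt hℓ hw s).symm
    rwa [smoothPart_eq_self h0 hs] at this
  rw [smoothPart_mul w hc, smoothPart_eq_self h0 hs]
  have := smoothPart_prime_pow w hℓ 1
  rw [pow_one, if_neg (not_le.2 hw)] at this
  rw [this, mul_one]

theorem roughPart_mul_prime {w s ℓ : ℕ} (h0 : s ≠ 0) (hs : s.primeFactors ⊆ primesIoc 0 w)
    (hℓ : ℓ.Prime) (hw : w < ℓ) : roughPart w (s * ℓ) = ℓ := by
  have h := smoothPart_mul_roughPart w (mul_ne_zero h0 hℓ.ne_zero)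
  rw [smoothPart_mul_prime h0 hs hℓ hw] at h
  exact Nat.eq_of_mul_eq_mul_left (Nat.pos_of_ne_zero h0) h

theorem smooth_of_roughPart_eq_one {w b : ℕ} (hb : b ≠ 0) :
    roughPart w b = 1 ↔ b.primeFactors ⊆ primesIoc 0 w := by
  constructor
  · intro h
    have := smoothPart_mul_roughPart w hb
    rw [h, mul_one] at this
    rw [← this]
    exact primeFactors_smoothPart_subset w b
  · intro h
    have := smoothPart_mul_roughPart w hb
    rw [smoothPart_eq_self hb h] at this
    exact Nat.eq_of_mul_eq_mul_left (Nat.pos_of_ne_zero hb) (by rw [this, mul_one])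

/-- `b` is divisible by the square of a prime above `w`. -/
def SqDvdAbove (w b : ℕ) : Prop := ∃ ℓ, ℓ.Prime ∧ w < ℓ ∧ ℓ ^ 2 ∣ b

/-- The largest prime factor of `b` in `(w, Z]`, or `0` if there is none. -/
def midPrime (w Z b : ℕ) : ℕ := {ℓ ∈ primesIoc w Z | ℓ ∣ b}.sup id

theorem le_midPrime {w Z b ℓ : ℕ} (h : ℓ ∈ primesIoc w Z) (hb : ℓ ∣ b) : ℓ ≤ midPrime w Z b :=
  le_sup (f := id) (mem_filter.2 ⟨h, hb⟩)

theorem midPrime_mem {w Z b : ℕ} (h : midPrime w Z b ≠ 0) :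
    midPrime w Z b ∈ primesIoc w Z ∧ midPrime w Z b ∣ b := by
  have hne : {ℓ ∈ primesIoc w Z | ℓ ∣ b}.Nonempty := by
    rw [nonempty_iff_ne_empty]
    intro he
    exact h (by rw [midPrime, he]; rfl)
  obtain ⟨ℓ, hℓ, he⟩ := exists_mem_eq_sup _ hne id
  rw [midPrime, he]
  exact mem_filter.1 hℓ

/-- `b` has exactly two prime factors above `w`, both of them distinct and above `Z`. -/
def TwoLargePrimes (w Z b : ℕ) : Prop :=
  ∃ p q : ℕ, p.Prime ∧ q.Prime ∧ p ≠ q ∧ Z < p ∧ Z < q ∧ roughPart w b = p * q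

theorem roughPart_trichotomy {w Z b : ℕ} (hb : b ≠ 0) (hbZ : b < Z ^ 3)
    (h1 : ¬SqDvdAbove w b) (h2 : midPrime w Z b = 0) :
    roughPart w b = 1 ∨ ((roughPart w b).Prime ∧ Z < roughPart w b) ∨ TwoLargePrimes w Z b := by
  have hrb : roughPart w b ∣ b := by
    conv_rhs => rw [← smoothPart_mul_roughPart w hb]
    exact dvd_mul_left _ _
  have hlarge : ∀ ℓ : ℕ, ℓ.Prime → ℓ ∣ roughPart w b → Z < ℓ := fun ℓ hℓ hd => by
    by_contra hZ
    have h3 := prime_dvd_roughPart hℓ hd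
    have := le_midPrime (mem_primesIoc.2 ⟨h3.1, not_lt.1 hZ, hℓ⟩) h3.2
    rw [h2] at this
    exact hℓ.ne_zero (Nat.le_zero.1 this)
  by_cases hr : roughPart w b = 1
  · exact Or.inl hr
  right
  obtain ⟨p, hp, r, hpr⟩ := Nat.exists_prime_and_dvd hr
  have hpZ := hlarge p hp (by rw [hpr]; exact dvd_mul_right _ _)
  by_cases hr1 : r = 1
  · left
    rw [hr1, mul_one] at hpr
    rw [hpr]
    exact ⟨hp, hpZ⟩
  right
  obtain ⟨q, hq, t, hqt⟩ := Nat.exists_prime_and_dvd hr1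
  have hqZ := hlarge q hq (by rw [hpr, hqt]; exact ⟨p * t, by ring⟩)
  by_cases ht1 : t = 1
  · rw [ht1, mul_one] at hqt
    refine ⟨p, q, hp, hq, ?_, hpZ, hqZ, by rw [hpr, hqt]⟩
    rintro rfl
    exact h1 ⟨p, hp, (prime_dvd_roughPart hp (by rw [hpr]; exact dvd_mul_right _ _)).1,
      dvd_trans (by rw [hpr, hqt, sq]) hrb⟩
  · exfalso
    obtain ⟨q', hq', t', ht⟩ := Nat.exists_prime_and_dvd ht1
    have hqZ' := hlarge q' hq' (by rw [hpr, hqt, ht]; exact ⟨p * q * t', by ring⟩)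
    have h3 : p * q * q' ≤ b := Nat.le_of_dvd (Nat.pos_of_ne_zero hb)
      (dvd_trans ⟨t', by rw [hpr, hqt, ht]; ring⟩ hrb)
    have h4 : Z ^ 3 ≤ p * q * q' := by
      rw [pow_succ, sq]
      gcongr
    omega

theorem not_sqDvdAbove_of_roughPart_eq_one {w Z b : ℕ} (hb : b ≠ 0) (h : roughPart w b = 1) :
    ¬SqDvdAbove w b ∧ midPrime w Z b = 0 := by
  have key : ∀ ℓ : ℕ, ℓ.Prime → w < ℓ → ¬ℓ ∣ b := fun ℓ hℓ hw hd => by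
    have := dvd_roughPart hb hℓ hw hd
    rw [h] at this
    exact hℓ.one_lt.ne' (Nat.dvd_one.1 this)
  refine ⟨fun ⟨ℓ, hℓ, hw, hd⟩ => key ℓ hℓ hw ((dvd_pow_self ℓ two_ne_zero).trans hd), ?_⟩
  by_contra hne
  obtain ⟨h1, h2⟩ := midPrime_mem hne
  have := mem_primesIoc.1 h1
  exact key _ this.2.2 this.1 h2

theorem not_sqDvdAbove_of_roughPart_prime {w Z b : ℕ} (hb : b ≠ 0) (h : (roughPart w b).Prime)
    (hZ : Z < roughPart w b) : ¬SqDvdAbove w b ∧ midPrime w Z b = 0 := by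
  have key : ∀ ℓ : ℕ, ℓ.Prime → w < ℓ → ℓ ∣ b → ℓ = roughPart w b := fun ℓ hℓ hw hd =>
    (Nat.prime_dvd_prime_iff_eq hℓ h).1 (dvd_roughPart hb hℓ hw hd)
  refine ⟨fun ⟨ℓ, hℓ, hw, hd⟩ => ?_, ?_⟩
  · have h1 := key ℓ hℓ hw ((dvd_pow_self ℓ two_ne_zero).trans hd)
    have h2 := pow_dvd_roughPart hb hℓ hw hd
    rw [← h1] at h2
    have h3 := Nat.le_of_dvd hℓ.pos h2
    have := hℓ.one_lt
    nlinarith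
  · by_contra hne
    obtain ⟨h1, h2⟩ := midPrime_mem hne
    have := mem_primesIoc.1 h1
    have h3 := key _ this.2.2 this.1 h2
    omega

open Classical in
/-- The classification of integers by their prime factors above `w`. -/
theorem abs_sum_sub_le_of_classification {w Z X : ℕ} (hX : X < Z ^ 3) (F g : ℕ → ℝ)
    (hFg : ∀ b, |F b| ≤ g b) :
    |∑ b ∈ Icc 1 X, F b - (∑ b ∈ Icc 1 X with roughPart w b = 1, F b +
      ∑ b ∈ Icc 1 X with (roughPart w b).Prime ∧ Z < roughPart w b, F b +
      ∑ b ∈ Icc 1 X with ¬SqDvdAbove w b ∧ midPrime w Z b ≠ 0, F b)| ≤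
    ∑ b ∈ Icc 1 X with SqDvdAbove w b, g b + ∑ b ∈ Icc 1 X with TwoLargePrimes w Z b, g b := by
  simp only [sum_filter]
  rw [← sum_add_distrib, ← sum_add_distrib, ← sum_sub_distrib, ← sum_add_distrib]
  refine (abs_sum_le_sum_abs _ _).trans (sum_le_sum fun b hb => ?_)
  have hb' := mem_Icc.1 hb
  have hb0 : b ≠ 0 := by omega
  have hg0 : 0 ≤ g b := (abs_nonneg _).trans (hFg b)
  have hnn : 0 ≤ (if SqDvdAbove w b then g b else 0) + if TwoLargePrimes w Z b then g b else 0 :=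
    add_nonneg (ite_nonneg hg0 le_rfl) (ite_nonneg hg0 le_rfl)
  by_cases h1 : roughPart w b = 1
  · obtain ⟨h2, h3⟩ := not_sqDvdAbove_of_roughPart_eq_one (Z := Z) hb0 h1
    have h4 : ¬((roughPart w b).Prime ∧ Z < roughPart w b) := fun h => by
      rw [h1] at h; exact Nat.not_prime_one h.1
    rw [if_pos h1, if_neg h4, if_neg fun h => h.2 h3]
    simpa using hnn
  by_cases h2 : (roughPart w b).Prime ∧ Z < roughPart w b
  · obtain ⟨h3, h4⟩ := not_sqDvdAbove_of_roughPart_prime hb0 h2.1 h2.2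
    rw [if_neg h1, if_pos h2, if_neg fun h => h.2 h4]
    simpa using hnn
  rw [if_neg h1, if_neg h2]
  by_cases h3 : SqDvdAbove w b
  · rw [if_neg fun h => h.1 h3, if_pos h3]
    simpa using (hFg b).trans (le_add_of_nonneg_right (ite_nonneg hg0 le_rfl))
  by_cases h4 : midPrime w Z b = 0
  · rw [if_neg fun h => h.2 h4, if_neg h3,
      if_pos ((roughPart_trichotomy hb0 (by omega) h3 h4).resolve_left h1 |>.resolve_left h2)]
    simpa using hFg b
  · rw [if_pos ⟨h3, h4⟩]
    simpa using hnn

theorem sum_roughPart_prime_eq {w Z : ℕ} (hwZ : w ≤ Z) (X : ℕ) (F : ℕ → ℝ) :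
    ∑ b ∈ Icc 1 X with (roughPart w b).Prime ∧ Z < roughPart w b, F b =
      ∑ ℓ ∈ primesIoc Z X, ∑ s ∈ Icc 1 (X / ℓ) with s.primeFactors ⊆ primesIoc 0 w,
        F (s * ℓ) := by
  rw [sum_sigma']
  refine sum_bij' (fun b _ => ⟨roughPart w b, smoothPart w b⟩) (fun x _ => x.2 * x.1) ?_ ?_ ?_ ?_ ?_
  · intro b hb
    obtain ⟨hb1, hp, hZ⟩ := mem_filter.1 hb
    have hb2 := mem_Icc.1 hb1
    have hb0 : b ≠ 0 := by omega
    have h1 := smoothPart_mul_roughPart w hb0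
    have h2 := smoothPart_pos (z := w) hb0
    refine mem_sigma.2 ⟨mem_primesIoc.2 ⟨hZ, ?_, hp⟩, mem_filter.2 ⟨mem_Icc.2 ⟨h2, ?_⟩,
      primeFactors_smoothPart_subset w b⟩⟩
    · exact (Nat.le_of_dvd (by omega) ⟨_, by rw [mul_comm]; exact h1.symm⟩).trans hb2.2
    · rw [Nat.le_div_iff_mul_le hp.pos, h1]; exact hb2.2
  · rintro ⟨ℓ, s⟩ hx
    obtain ⟨h1, h2⟩ := mem_sigma.1 hx
    obtain ⟨hZ, hX, hℓ⟩ := mem_primesIoc.1 h1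
    obtain ⟨h3, hs⟩ := mem_filter.1 h2
    have h4 := mem_Icc.1 h3
    have hs0 : s ≠ 0 := by have := h4.1; dsimp only at this; omega
    dsimp only at *
    rw [mem_filter, roughPart_mul_prime hs0 hs hℓ (by omega), mem_Icc]
    exact ⟨⟨Nat.mul_pos h4.1 hℓ.pos, (Nat.le_div_iff_mul_le hℓ.pos).1 h4.2⟩, hℓ, hZ⟩
  · intro b hb
    have hb2 := mem_Icc.1 (mem_filter.1 hb).1
    exact smoothPart_mul_roughPart w (by omega)
  · rintro ⟨ℓ, s⟩ hx
    obtain ⟨h1, h2⟩ := mem_sigma.1 hx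
    obtain ⟨hZ, hX, hℓ⟩ := mem_primesIoc.1 h1
    obtain ⟨h3, hs⟩ := mem_filter.1 h2
    have h4 := mem_Icc.1 h3
    have hs0 : s ≠ 0 := by have := h4.1; dsimp only at this; omega
    dsimp only at *
    rw [roughPart_mul_prime hs0 hs hℓ (by omega), smoothPart_mul_prime hs0 hs hℓ (by omega)]
  · intro b hb
    have hb2 := mem_Icc.1 (mem_filter.1 hb).1
    rw [smoothPart_mul_roughPart w (by omega)]

theorem midPrime_mul {w Z c ℓ : ℕ} (hℓ : ℓ ∈ primesIoc w Z) (hc : midPrime w Z c < ℓ) :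
    midPrime w Z (c * ℓ) = ℓ := by
  refine le_antisymm (Finset.sup_le fun q hq => ?_) (le_midPrime hℓ (dvd_mul_left _ _))
  obtain ⟨h1, h2⟩ := mem_filter.1 hq
  have hqp := (mem_primesIoc.1 h1).2.2
  rcases hqp.dvd_mul.1 h2 with h | h
  · exact (le_midPrime h1 h).trans hc.le
  · exact ((Nat.prime_dvd_prime_iff_eq hqp (mem_primesIoc.1 hℓ).2.2).1 h).le

theorem not_dvd_of_midPrime_lt {w Z c ℓ : ℕ} (hℓ : ℓ ∈ primesIoc w Z)
    (hc : midPrime w Z c < ℓ) : ¬ℓ ∣ c := fun h => absurd (le_midPrime hℓ h) (not_le.2 hc)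

theorem mem_primesIoc_max_iff {w Z M Y ℓ : ℕ} :
    ℓ ∈ primesIoc (max w M) (min Z Y) ↔ ℓ ∈ primesIoc w Z ∧ M < ℓ ∧ ℓ ≤ Y := by
  simp only [mem_primesIoc, max_lt_iff, le_min_iff]
  tauto

open Classical in
theorem sum_midPrime_ne_zero_eq (w Z X : ℕ) (F : ℕ → ℝ) :
    ∑ b ∈ Icc 1 X with ¬SqDvdAbove w b ∧ midPrime w Z b ≠ 0, F b =
      ∑ c ∈ Icc 1 X with ¬SqDvdAbove w c,
        ∑ ℓ ∈ primesIoc (max w (midPrime w Z c)) (min Z (X / c)), F (c * ℓ) := by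
  rw [sum_sigma']
  refine sum_bij' (fun b _ => ⟨b / midPrime w Z b, midPrime w Z b⟩) (fun x _ => x.1 * x.2)
    ?_ ?_ ?_ ?_ ?_
  · intro b hb
    obtain ⟨hb1, hsq, hne⟩ := mem_filter.1 hb
    have hb2 := mem_Icc.1 hb1
    obtain ⟨hmem, c, hc⟩ := midPrime_mem hne
    have hp := (mem_primesIoc.1 hmem).2.2
    have hdiv : b / midPrime w Z b = c := Nat.div_eq_of_eq_mul_right hp.pos hc
    have hmax : ∀ q ∈ primesIoc w Z, q ∣ b → q ≤ midPrime w Z b := fun q => le_midPrime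
    rw [hdiv]
    generalize midPrime w Z b = ℓ at hmem hc hp hne hdiv hmax ⊢
    have hc0 : 0 < c := Nat.pos_of_ne_zero fun h => by rw [h, mul_zero] at hc; omega
    have hcb : c ∣ b := ⟨ℓ, by rw [hc, mul_comm]⟩
    refine mem_sigma.2 ⟨mem_filter.2 ⟨mem_Icc.2 ⟨hc0, (Nat.le_of_dvd (by omega) hcb).trans hb2.2⟩,
      fun ⟨q, hq, hw, hd⟩ => hsq ⟨q, hq, hw, hd.trans hcb⟩⟩, ?_⟩
    refine mem_primesIoc_max_iff.2 ⟨hmem, ?_, ?_⟩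
    · by_cases h0 : midPrime w Z c = 0
      · rw [h0]; exact hp.pos
      · obtain ⟨h1, h2⟩ := midPrime_mem h0
        refine lt_of_le_of_ne (hmax _ h1 (h2.trans hcb)) fun h => ?_
        rw [h] at h2
        refine hsq ⟨ℓ, hp, (mem_primesIoc.1 hmem).1, ?_⟩
        rw [hc, sq]
        exact mul_dvd_mul_left ℓ h2
    · rw [Nat.le_div_iff_mul_le hc0, ← hc]; exact hb2.2
  · rintro ⟨c, ℓ⟩ hx
    obtain ⟨h1, h2⟩ := mem_sigma.1 hx
    obtain ⟨h3, hsq⟩ := mem_filter.1 h1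
    have h4 := mem_Icc.1 h3
    obtain ⟨hℓ, hlt, hle⟩ := mem_primesIoc_max_iff.1 h2
    dsimp only at *
    have hp := (mem_primesIoc.1 hℓ).2.2
    have hnd := not_dvd_of_midPrime_lt hℓ hlt
    rw [mem_filter, midPrime_mul hℓ hlt, mem_Icc]
    refine ⟨⟨Nat.mul_pos h4.1 hp.pos, ?_⟩, ?_, hp.ne_zero⟩
    · rw [mul_comm]; exact (Nat.le_div_iff_mul_le h4.1).1 hle
    · rintro ⟨q, hq, hw, hd⟩
      by_cases hqℓ : q = ℓ
      · rw [hqℓ, sq] at hd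
        exact hnd (Nat.dvd_of_mul_dvd_mul_right hp.pos hd)
      · exact hsq ⟨q, hq, hw, (((Nat.coprime_primes hq hp).2 hqℓ).pow_left 2).dvd_of_dvd_mul_right
          hd⟩
  · intro b hb
    obtain ⟨_, _, hne⟩ := mem_filter.1 hb
    exact Nat.div_mul_cancel (midPrime_mem hne).2
  · rintro ⟨c, ℓ⟩ hx
    obtain ⟨h1, h2⟩ := mem_sigma.1 hx
    obtain ⟨hℓ, hlt, hle⟩ := mem_primesIoc_max_iff.1 h2
    dsimp only at *
    rw [midPrime_mul hℓ hlt, Nat.mul_div_cancel _ (mem_primesIoc.1 hℓ).2.2.pos]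
  · intro b hb
    obtain ⟨_, _, hne⟩ := mem_filter.1 hb
    rw [Nat.div_mul_cancel (midPrime_mem hne).2]

theorem sum_primesIoc_mul_sum_comm (M Z Y : ℕ) (f g : ℕ → ℝ) :
    ∑ ℓ ∈ primesIoc M (min Z Y), f ℓ * ∑ a ∈ Icc 1 (Y / ℓ), g a =
      ∑ a ∈ Icc 1 Y, g a * ∑ ℓ ∈ primesIoc M (min Z (Y / a)), f ℓ := by
  simp only [mul_sum]
  rw [sum_comm' (t' := Icc 1 Y) (s' := fun a => primesIoc M (min Z (Y / a)))]
  · exact sum_congr rfl fun _ _ => sum_congr rfl fun _ _ => mul_comm _ _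
  · intro ℓ a
    simp only [mem_primesIoc, mem_Icc, le_min_iff]
    constructor
    · rintro ⟨⟨h1, ⟨h2, h3⟩, h4⟩, h5, h6⟩
      have h7 := (Nat.le_div_iff_mul_le h4.pos).1 h6
      refine ⟨⟨h1, ⟨h2, ?_⟩, h4⟩, h5, ?_⟩
      · rw [Nat.le_div_iff_mul_le h5, mul_comm]; exact h7
      · exact (Nat.le_mul_of_pos_right a h4.pos).trans h7
    · rintro ⟨⟨h1, ⟨h2, h3⟩, h4⟩, h5, h6⟩
      have h7 := (Nat.le_div_iff_mul_le h5).1 h3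
      refine ⟨⟨h1, ⟨h2, ?_⟩, h4⟩, h5, ?_⟩
      · exact (Nat.le_mul_of_pos_right ℓ h5).trans h7
      · rw [Nat.le_div_iff_mul_le h4.pos, mul_comm]; exact h7

/-- The twisted sum of `rootCoeff` over primes in `(w, Z]` is small on every subinterval. -/
def GoodDiscriminant (m : ℕ) (K : ℤ) (w Z : ℕ) (δ : ℝ) : Prop :=
  ∀ a b : ℕ, w ≤ a → b ≤ Z → |∑ ℓ ∈ primesIoc a b, rootCoeff m K ℓ / ℓ| ≤ δ

open Classical in
theorem abs_sum_midPrime_ne_zero_le {m : ℕ} (hm : m.Prime) {K : ℤ} {w Z : ℕ} {δ : ℝ}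
    (hgood : GoodDiscriminant m K w Z δ) (X : ℕ) :
    |∑ b ∈ Icc 1 X with ¬SqDvdAbove w b ∧ midPrime w Z b ≠ 0,
      rootCoeff m K b / b * ∑ a ∈ Icc 1 (X / b), chiAway m a / a| ≤
      δ * ((∑ c ∈ Icc 1 X, |rootCoeff m K c| / c) * ∑ a ∈ Icc 1 X, 1 / (a : ℝ)) := by
  have hδ : 0 ≤ δ := (abs_nonneg _).trans (hgood w 0 le_rfl (Nat.zero_le _))
  rw [sum_midPrime_ne_zero_eq w Z X
    (fun b => rootCoeff m K b / b * ∑ a ∈ Icc 1 (X / b), chiAway m a / a)]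
  have hterm : ∀ c ∈ Icc 1 X, |∑ ℓ ∈ primesIoc (max w (midPrime w Z c)) (min Z (X / c)),
      rootCoeff m K (c * ℓ) / (c * ℓ : ℕ) * ∑ a ∈ Icc 1 (X / (c * ℓ)), chiAway m a / a| ≤
      |rootCoeff m K c| / c * (δ * ∑ a ∈ Icc 1 X, 1 / (a : ℝ)) := fun c hc => by
    have e : ∑ ℓ ∈ primesIoc (max w (midPrime w Z c)) (min Z (X / c)),
        rootCoeff m K (c * ℓ) / (c * ℓ : ℕ) * ∑ a ∈ Icc 1 (X / (c * ℓ)), chiAway m a / a =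
        rootCoeff m K c / c * ∑ a ∈ Icc 1 (X / c), chiAway m a / a *
          ∑ ℓ ∈ primesIoc (max w (midPrime w Z c)) (min Z (X / c / a)), rootCoeff m K ℓ / ℓ := by
      rw [← sum_primesIoc_mul_sum_comm _ Z (X / c) (fun ℓ => rootCoeff m K ℓ / ℓ)
        (fun a => chiAway m a / a), mul_sum]
      refine sum_congr rfl fun ℓ hℓ => ?_
      obtain ⟨h1, h2, h3⟩ := mem_primesIoc_max_iff.1 hℓ
      have hcop : c.Coprime ℓ := ((Nat.Prime.coprime_iff_not_dvd (mem_primesIoc.1 h1).2.2).2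
        (not_dvd_of_midPrime_lt h1 h2)).symm
      rw [rootCoeff_mul hm K hcop, Nat.div_div_eq_div_mul, Nat.cast_mul, ← mul_assoc,
        div_mul_div_comm]
    rw [e, abs_mul, abs_div, Nat.abs_cast]
    refine mul_le_mul_of_nonneg_left ?_ (by positivity)
    refine (abs_sum_le_sum_abs _ _).trans ?_
    rw [mul_sum]
    refine (sum_le_sum fun a ha => ?_).trans (sum_le_sum_of_subset_of_nonneg
      (Icc_subset_Icc_right (Nat.div_le_self X c)) fun _ _ _ => by positivity)
    rw [abs_mul, abs_div, Nat.abs_cast, mul_comm]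
    have h1 := hgood (max w (midPrime w Z c)) (min Z (X / c / a)) (le_max_left _ _)
      (min_le_left _ _)
    have h2 := abs_chiAway_le_one m a
    gcongr
  refine (abs_sum_le_sum_abs _ _).trans ?_
  refine (sum_le_sum fun c hc => hterm c (mem_filter.1 hc).1).trans ?_
  refine (sum_le_sum_of_subset_of_nonneg (filter_subset _ _) fun _ _ _ => by positivity).trans ?_
  rw [← sum_mul]
  exact le_of_eq (by ring)

open Classical in
theorem sum_twoLargePrimes_le {m : ℕ} (hm : m.Prime) (K : ℤ) {w Z : ℕ} (hZ : 0 < Z) (X : ℕ) :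
    ∑ b ∈ Icc 1 X with TwoLargePrimes w Z b, |rootCoeff m K b| / b ≤
      (∑ s ∈ Icc 1 X with s.primeFactors ⊆ primesIoc 0 w, |rootCoeff m K s| / s) *
        (∑ ℓ ∈ primesIoc Z (X / Z), 1 / (ℓ : ℝ)) ^ 2 := by
  have hchoice : ∀ b : ℕ, ∃ x : ℕ × ℕ, TwoLargePrimes w Z b → x.1.Prime ∧ x.2.Prime ∧ x.1 ≠ x.2 ∧
      Z < x.1 ∧ Z < x.2 ∧ roughPart w b = x.1 * x.2 := fun b => by
    by_cases h : TwoLargePrimes w Z b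
    · obtain ⟨p, q, h⟩ := h
      exact ⟨(p, q), fun _ => h⟩
    · exact ⟨0, fun h' => absurd h' h⟩
  choose x hx using hchoice
  have hrhs : (∑ s ∈ Icc 1 X with s.primeFactors ⊆ primesIoc 0 w, |rootCoeff m K s| / s) *
        (∑ ℓ ∈ primesIoc Z (X / Z), 1 / (ℓ : ℝ)) ^ 2 =
      ∑ y ∈ {s ∈ Icc 1 X | s.primeFactors ⊆ primesIoc 0 w} ×ˢ
        (primesIoc Z (X / Z) ×ˢ primesIoc Z (X / Z)),
        |rootCoeff m K y.1| / y.1 * (1 / (y.2.1 : ℝ) * (1 / (y.2.2 : ℝ))) := by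
    rw [sum_product, sum_mul]
    refine sum_congr rfl fun s _ => ?_
    rw [sq, sum_mul_sum, ← sum_product', mul_sum]
  rw [hrhs]
  refine sum_le_sum_of_injOn_of_le (fun b => (smoothPart w b, x b)) ?_ ?_ ?_
    fun _ _ => by positivity
  · intro b hb
    obtain ⟨hb1, hT⟩ := mem_filter.1 hb
    have hb2 := mem_Icc.1 hb1
    have hb0 : b ≠ 0 := by omega
    obtain ⟨hp, hq, hne, hpZ, hqZ, hr⟩ := hx b hT
    have h1 := smoothPart_mul_roughPart w hb0
    have h2 := smoothPart_pos (z := w) hb0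
    rw [hr] at h1
    have h3 : (x b).1 * (x b).2 ≤ X := by
      refine le_trans ?_ hb2.2
      conv_rhs => rw [← h1]
      exact Nat.le_mul_of_pos_left _ h2
    have hmem : ∀ p q : ℕ, p.Prime → Z < p → Z < q → p * q ≤ X → p ∈ primesIoc Z (X / Z) :=
      fun p q hp hpZ hqZ hpq => by
        refine mem_primesIoc.2 ⟨hpZ, ?_, hp⟩
        rw [Nat.le_div_iff_mul_le hZ]
        exact (Nat.mul_le_mul_left p hqZ.le).trans hpq
    refine mem_product.2 ⟨mem_filter.2 ⟨mem_Icc.2 ⟨h2, ?_⟩, primeFactors_smoothPart_subset w b⟩,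
      mem_product.2 ⟨hmem _ _ hp hpZ hqZ h3, hmem _ _ hq hqZ hpZ (by rw [mul_comm]; exact h3)⟩⟩
    exact (Nat.le_of_dvd (by omega) ⟨_, h1.symm⟩).trans hb2.2
  · intro b hb b' hb' hbb
    obtain ⟨hb1, hT⟩ := mem_filter.1 hb
    obtain ⟨hb1', hT'⟩ := mem_filter.1 hb'
    have hb2 := mem_Icc.1 hb1
    have hb2' := mem_Icc.1 hb1'
    rw [Prod.mk.injEq] at hbb
    rw [← smoothPart_mul_roughPart w (show b ≠ 0 by omega),
      ← smoothPart_mul_roughPart w (show b' ≠ 0 by omega), (hx b hT).2.2.2.2.2,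
      (hx b' hT').2.2.2.2.2, hbb.1, hbb.2]
  · intro b hb
    obtain ⟨hb1, hT⟩ := mem_filter.1 hb
    have hb2 := mem_Icc.1 hb1
    have hb0 : b ≠ 0 := by omega
    obtain ⟨hp, hq, hne, hpZ, hqZ, hr⟩ := hx b hT
    have h1 := smoothPart_mul_roughPart w hb0
    have hc := smoothPart_coprime_roughPart w b
    have h2 : |rootCoeff m K b| ≤ |rootCoeff m K (smoothPart w b)| := by
      conv_lhs => rw [← h1]
      rw [rootCoeff_mul hm K hc, hr, rootCoeff_mul hm K ((Nat.coprime_primes hp hq).2 hne),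
        abs_mul, abs_mul]
      exact mul_le_of_le_one_right (abs_nonneg _) (mul_le_one₀ (abs_rootCoeff_prime_le_one m K hp)
        (abs_nonneg _) (abs_rootCoeff_prime_le_one m K hq))
    have h3 : (b : ℝ) = smoothPart w b * ((x b).1 * (x b).2) := by
      rw [hr] at h1
      exact_mod_cast h1.symm
    dsimp only
    rw [div_mul_div_comm, one_mul, div_mul_div_comm, mul_one, ← h3]
    gcongr

theorem sum_smooth_div_le {f : ℕ → ℝ} {K : ℤ} (hf : RootLike f K) (w X : ℕ) {σ : ℝ}
    (hσ0 : 0 ≤ σ) (hσ : σ ≤ 0.2) :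
    ∑ s ∈ Icc 1 X with s.primeFactors ⊆ primesIoc 0 w, f s / s ≤
      ∏ ℓ ∈ primesIoc 0 w, (1 + 10 * ((ℓ : ℝ) ^ (2 * σ) / ℓ)) := by
  have hA : ∀ n ∈ {s ∈ Icc 1 X | s.primeFactors ⊆ primesIoc 0 w},
      n ≠ 0 ∧ n.primeFactors ⊆ primesIoc 0 w := fun n hn => by
    obtain ⟨h1, h2⟩ := mem_filter.1 hn
    have := mem_Icc.1 h1
    exact ⟨by omega, h2⟩
  refine le_trans (sum_le_sum fun s hs => ?_) (hf.sum_smooth_rpow_le w hσ0 hσ _ hA)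
  have h1 : (1 : ℝ) ≤ s := by exact_mod_cast Nat.one_le_iff_ne_zero.2 (hA s hs).1
  exact le_mul_of_one_le_right (div_nonneg (hf.nonneg s) (by positivity))
    (Real.one_le_rpow h1 hσ0)

theorem rpow_neg_div_le {σ : ℝ} (hσ0 : 0 ≤ σ) {X ℓ V : ℕ} (hℓ : 0 < ℓ) (hℓX : ℓ ≤ X)
    (hV : 0 < V) :
    ((X / ℓ : ℕ) : ℝ) ^ (-σ) ≤ (V : ℝ) ^ (-σ) + if X / V < ℓ then 1 else 0 := by
  have h1 : 1 ≤ X / ℓ := (Nat.one_le_div_iff hℓ).2 hℓX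
  split_ifs with h
  · have h2 : ((X / ℓ : ℕ) : ℝ) ^ (-σ) ≤ 1 :=
      Real.rpow_le_one_of_one_le_of_nonpos (by exact_mod_cast h1) (by linarith)
    have : 0 ≤ (V : ℝ) ^ (-σ) := by positivity
    linarith
  · rw [add_zero]
    have h2 : V ≤ X / ℓ := by
      rw [Nat.le_div_iff_mul_le hℓ, mul_comm]
      exact (Nat.le_div_iff_mul_le hV).1 (not_lt.1 h)
    exact Real.rpow_le_rpow_of_nonpos (by exact_mod_cast hV) (by exact_mod_cast h2) (by linarith)

theorem sum_primesIoc_rpow_neg_div_le {σ : ℝ} (hσ0 : 0 ≤ σ) (Z X : ℕ) {V : ℕ} (hV : 0 < V) :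
    ∑ ℓ ∈ primesIoc Z X, 1 / (ℓ : ℝ) * ((X / ℓ : ℕ) : ℝ) ^ (-σ) ≤
      (V : ℝ) ^ (-σ) * ∑ ℓ ∈ primesIoc Z X, 1 / (ℓ : ℝ) +
        ∑ ℓ ∈ primesIoc (X / V) X, 1 / (ℓ : ℝ) := by
  have h1 : ∑ ℓ ∈ primesIoc Z X with X / V < ℓ, 1 / (ℓ : ℝ) ≤
      ∑ ℓ ∈ primesIoc (X / V) X, 1 / (ℓ : ℝ) :=
    sum_le_sum_of_subset_of_nonneg (fun ℓ hℓ => by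
      obtain ⟨h1, h2⟩ := mem_filter.1 hℓ
      have h3 := mem_primesIoc.1 h1
      exact mem_primesIoc.2 ⟨h2, h3.2⟩) fun _ _ _ => by positivity
  refine le_trans ?_ (add_le_add_right h1 _)
  rw [mul_sum, sum_filter, ← sum_add_distrib]
  refine sum_le_sum fun ℓ hℓ => ?_
  obtain ⟨_, h3, h4⟩ := mem_primesIoc.1 hℓ
  refine (mul_le_mul_of_nonneg_left (rpow_neg_div_le hσ0 h4.pos h3 hV) (by positivity)).trans
    (le_of_eq ?_)
  split_ifs <;> ring

/-- The contribution of integers with at most one prime factor above `w`, and that one above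
`Z`. -/
theorem smooth_add_prime_sum_ge {m : ℕ} (hm : m.Prime) (K : ℤ) {L : ℝ} (hL0 : 1 / 2 ≤ L)
    (hL : ∀ v : ℕ, |∑ a ∈ Icc 1 v, chiAway m a / a - L| ≤ 4 / (v + 1)) (w Z : ℕ) {σ : ℝ}
    (hσ0 : 0 ≤ σ) (hσ : σ ≤ 0.2) {X V : ℕ} (hX : 0 < X) (hV : 0 < V)
    (hθ : ∑ ℓ ∈ primesIoc Z X, 1 / (ℓ : ℝ) ≤ 1) :
    1 / 2 * Real.exp (-(4 * ∑ ℓ ∈ primesIoc 0 w, 1 / (ℓ : ℝ))) *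
      (1 - ∑ ℓ ∈ primesIoc Z X, 1 / (ℓ : ℝ)) -
      4 * (∏ ℓ ∈ primesIoc 0 w, (1 + 10 * ((ℓ : ℝ) ^ (2 * σ) / ℓ))) *
        ((X : ℝ) ^ (-σ) + (V : ℝ) ^ (-σ) + ∑ ℓ ∈ primesIoc (X / V) X, 1 / (ℓ : ℝ)) ≤
    ∑ s ∈ Icc 1 X with s.primeFactors ⊆ primesIoc 0 w,
        rootCoeff m K s / s * ∑ a ∈ Icc 1 (X / s), chiAway m a / a +
      ∑ ℓ ∈ primesIoc Z X, rootCoeff m K ℓ / ℓ *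
        ∑ s ∈ Icc 1 (X / ℓ) with s.primeFactors ⊆ primesIoc 0 w,
          rootCoeff m K s / s * ∑ a ∈ Icc 1 (X / ℓ / s), chiAway m a / a := by
  set W := ∏ ℓ ∈ primesIoc 0 w, (1 + 10 * ((ℓ : ℝ) ^ (2 * σ) / ℓ)) with hW
  have hW0 : 0 ≤ W := prod_nonneg fun _ _ => by positivity
  set S := ∑ s ∈ ((∏ ℓ ∈ primesIoc 0 w, ℓ) ^ X).divisors, rootCoeff m K s / s with hS
  have hSge := sum_divisors_rootCoeff_ge hm K w X
  rw [← hS] at hSge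
  set E := Real.exp (-(4 * ∑ ℓ ∈ primesIoc 0 w, 1 / (ℓ : ℝ))) with hE
  have hE0 : 0 < E := Real.exp_pos _
  set Φ : ℕ → ℝ := fun v => ∑ s ∈ Icc 1 v with s.primeFactors ⊆ primesIoc 0 w,
        rootCoeff m K s / s * ∑ a ∈ Icc 1 (v / s), chiAway m a / a with hΦ
  have hΦv : ∀ v, 0 < v → v ≤ X → |Φ v - L * S| ≤ 4 * (v : ℝ) ^ (-σ) * W := fun v h1 h2 =>
    abs_sum_smooth_sub_le hm K hL w hσ0 hσ h1 h2
  change _ ≤ Φ X + ∑ ℓ ∈ primesIoc Z X, rootCoeff m K ℓ / ℓ * Φ (X / ℓ)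
  have hLS : 1 / 2 * E ≤ L * S := by gcongr
  have hterm : ∀ ℓ ∈ primesIoc Z X, -(1 / (ℓ : ℝ) * (L * S) +
      4 * W * (1 / (ℓ : ℝ) * ((X / ℓ : ℕ) : ℝ) ^ (-σ))) ≤ rootCoeff m K ℓ / ℓ * Φ (X / ℓ) :=
    fun ℓ hℓ => by
      obtain ⟨_, h2, h3⟩ := mem_primesIoc.1 hℓ
      have h4 := hΦv (X / ℓ) (Nat.div_pos h2 h3.pos) (Nat.div_le_self X ℓ)
      have h5 : |Φ (X / ℓ)| ≤ L * S + 4 * ((X / ℓ : ℕ) : ℝ) ^ (-σ) * W := by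
        have h6 : 0 ≤ L * S := (by positivity : 0 ≤ 1 / 2 * E).trans hLS
        rw [abs_le] at h4 ⊢
        constructor <;> linarith
      have h6 : |rootCoeff m K ℓ / ℓ * Φ (X / ℓ)| ≤
          1 / ℓ * (L * S + 4 * ((X / ℓ : ℕ) : ℝ) ^ (-σ) * W) := by
        rw [abs_mul, abs_div, Nat.abs_cast]
        have := abs_rootCoeff_prime_le_one m K h3
        gcongr
      refine le_trans (le_of_eq ?_) (neg_le_of_abs_le h6)
      ring
  have hsum := sum_le_sum hterm
  rw [sum_neg_distrib, sum_add_distrib, ← sum_mul, ← mul_sum] at hsum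
  have h1 := neg_le_of_abs_le (hΦv X hX le_rfl)
  have h2 := sum_primesIoc_rpow_neg_div_le hσ0 Z X hV
  generalize ∑ ℓ ∈ primesIoc Z X, 1 / (ℓ : ℝ) = θ at *
  have h3 : (V : ℝ) ^ (-σ) * θ ≤ (V : ℝ) ^ (-σ) * 1 := by gcongr
  have h4 := mul_le_mul_of_nonneg_left (h2.trans (add_le_add_left h3 _))
    (by positivity : 0 ≤ 4 * W)
  have h5 := mul_le_mul_of_nonneg_right hLS (sub_nonneg.2 hθ)
  linarith

theorem sum_roughPart_eq_one_eq (w X : ℕ) (F : ℕ → ℝ) :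
    ∑ b ∈ Icc 1 X with roughPart w b = 1, F b =
      ∑ b ∈ Icc 1 X with b.primeFactors ⊆ primesIoc 0 w, F b := by
  refine sum_congr (filter_congr fun b hb => ?_) fun _ _ => rfl
  have := mem_Icc.1 hb
  exact smooth_of_roughPart_eq_one (by omega)

open Classical in
theorem abs_sum_sub_smooth_add_prime_le {m : ℕ} (hm : m.Prime) {K : ℤ} (hK : K ≠ 0) {L : ℝ}
    (hL0 : 1 / 2 ≤ L) (hL4 : L ≤ 4)
    (hL : ∀ v : ℕ, |∑ a ∈ Icc 1 v, chiAway m a / a - L| ≤ 4 / (v + 1)) {w Z : ℕ} (hw : 0 < w)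
    (hwZ : w ≤ Z) {δ : ℝ} (hgood : GoodDiscriminant m K w Z δ) {σ : ℝ} (hσ0 : 0 ≤ σ)
    (hσ : σ ≤ 0.2) {X : ℕ} (hXZ : X < Z ^ 3) :
    |∑ e ∈ Icc 1 X, chiAway m e * rootCount K e / e -
      (∑ s ∈ Icc 1 X with s.primeFactors ⊆ primesIoc 0 w,
        rootCoeff m K s / s * ∑ a ∈ Icc 1 (X / s), chiAway m a / a +
      ∑ ℓ ∈ primesIoc Z X, rootCoeff m K ℓ / ℓ *
        ∑ s ∈ Icc 1 (X / ℓ) with s.primeFactors ⊆ primesIoc 0 w,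
          rootCoeff m K s / s * ∑ a ∈ Icc 1 (X / ℓ / s), chiAway m a / a)| ≤
    8 * ((4 + 10 * (#K.natAbs.primeFactors : ℝ)) / w * ∏ ℓ ∈ primesIoc 0 X, (1 + 10 / (ℓ : ℝ))) +
      8 * ((∏ ℓ ∈ primesIoc 0 w, (1 + 10 * ((ℓ : ℝ) ^ (2 * σ) / ℓ))) *
        (∑ ℓ ∈ primesIoc Z (X / Z), 1 / (ℓ : ℝ)) ^ 2) +
      δ * ((∏ ℓ ∈ primesIoc 0 X, (1 + 10 / (ℓ : ℝ))) * ∑ a ∈ Icc 1 X, 1 / (a : ℝ)) := by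
  have hf := rootLike_abs_rootCoeff hm K
  have hδ : 0 ≤ δ := (abs_nonneg _).trans (hgood w 0 le_rfl (Nat.zero_le _))
  have hG : ∀ v : ℕ, |∑ a ∈ Icc 1 v, chiAway m a / (a : ℝ)| ≤ 8 := fun v => by
    have h1 := hL v
    have h2 : 4 / ((v : ℝ) + 1) ≤ 4 := div_le_self (by norm_num) (by simp)
    rw [abs_le] at h1 ⊢
    constructor <;> linarith
  set F : ℕ → ℝ := fun b => rootCoeff m K b / b * ∑ a ∈ Icc 1 (X / b), chiAway m a / a with hF
  have hFg : ∀ b, |F b| ≤ 8 * (|rootCoeff m K b| / b) := fun b => by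
    rw [hF, abs_mul, abs_div, Nat.abs_cast, mul_comm]
    exact mul_le_mul_of_nonneg_right (hG _) (by positivity)
  have h1 := abs_sum_sub_le_of_classification (w := w) hXZ F _ hFg
  have h2 := abs_sum_midPrime_ne_zero_le hm hgood X
  rw [sum_roughPart_eq_one_eq, sum_roughPart_prime_eq hwZ, ← mul_sum, ← mul_sum] at h1
  have h3 : ∑ b ∈ Icc 1 X with SqDvdAbove w b, |rootCoeff m K b| / (b : ℝ) ≤ _ :=
    hf.sum_sq_dvd_le hK X hw
  have h4 := (sum_twoLargePrimes_le hm K (hw.trans_le hwZ) X).trans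
    (mul_le_mul_of_nonneg_right (sum_smooth_div_le hf w X hσ0 hσ) (sq_nonneg _))
  have h5 := hf.sum_div_le X
  have h6 : ∑ ℓ ∈ primesIoc Z X, ∑ s ∈ Icc 1 (X / ℓ) with s.primeFactors ⊆ primesIoc 0 w,
      F (s * ℓ) = ∑ ℓ ∈ primesIoc Z X, rootCoeff m K ℓ / ℓ *
        ∑ s ∈ Icc 1 (X / ℓ) with s.primeFactors ⊆ primesIoc 0 w,
          rootCoeff m K s / s * ∑ a ∈ Icc 1 (X / ℓ / s), chiAway m a / a := by
    refine sum_congr rfl fun ℓ hℓ => ?_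
    rw [mul_sum]
    refine sum_congr rfl fun s hs => ?_
    obtain ⟨hZ, _, hp⟩ := mem_primesIoc.1 hℓ
    obtain ⟨hs1, hs2⟩ := mem_filter.1 hs
    have hs0 : s ≠ 0 := by have := mem_Icc.1 hs1; omega
    have hc := (coprime_smoothPart_of_lt hp (hwZ.trans_lt hZ) s).symm
    rw [smoothPart_eq_self hs0 hs2] at hc
    rw [hF]
    dsimp only
    rw [rootCoeff_mul hm K hc, Nat.div_div_eq_div_mul, Nat.cast_mul, mul_comm s ℓ, ← mul_assoc,
      div_mul_div_comm, mul_comm (rootCoeff m K s), mul_comm (s : ℝ)]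
  rw [h6] at h1
  rw [sum_chiAway_mul_rootCount_eq hm]
  have h7 := mul_le_mul_of_nonneg_left (mul_le_mul_of_nonneg_right h5
    (sum_nonneg fun _ _ => by positivity : 0 ≤ ∑ a ∈ Icc 1 X, 1 / (a : ℝ))) hδ
  have h8 := mul_le_mul_of_nonneg_left h3 (by norm_num : (0 : ℝ) ≤ 8)
  have h9 := mul_le_mul_of_nonneg_left h4 (by norm_num : (0 : ℝ) ≤ 8)
  have h10 := h2.trans h7
  rw [abs_le] at h1 h10 ⊢
  constructor <;> linarith [h1.1, h1.2, h10.1, h10.2]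

theorem sum_chi_rootCount_ge {m : ℕ} (hm : m.Prime) {K : ℤ} (hK : K ≠ 0) {L : ℝ}
    (hL0 : 1 / 2 ≤ L) (hL4 : L ≤ 4)
    (hL : ∀ v : ℕ, |∑ a ∈ Icc 1 v, chiAway m a / a - L| ≤ 4 / (v + 1)) {w Z : ℕ} (hw : 0 < w)
    (hwZ : w ≤ Z) {δ : ℝ} (hgood : GoodDiscriminant m K w Z δ) {σ : ℝ} (hσ0 : 0 ≤ σ)
    (hσ : σ ≤ 0.2) {X V : ℕ} (hX : 0 < X) (hXZ : X < Z ^ 3) (hV : 0 < V)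
    (hθ : ∑ ℓ ∈ primesIoc Z X, 1 / (ℓ : ℝ) ≤ 1) :
    1 / 2 * Real.exp (-(4 * ∑ ℓ ∈ primesIoc 0 w, 1 / (ℓ : ℝ))) *
      (1 - ∑ ℓ ∈ primesIoc Z X, 1 / (ℓ : ℝ)) ≤
    ∑ e ∈ Icc 1 X, chiAway m e * rootCount K e / e +
      (4 * (∏ ℓ ∈ primesIoc 0 w, (1 + 10 * ((ℓ : ℝ) ^ (2 * σ) / ℓ))) *
        ((X : ℝ) ^ (-σ) + (V : ℝ) ^ (-σ) + ∑ ℓ ∈ primesIoc (X / V) X, 1 / (ℓ : ℝ)) +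
      8 * ((4 + 10 * (#K.natAbs.primeFactors : ℝ)) / w *
        ∏ ℓ ∈ primesIoc 0 X, (1 + 10 / (ℓ : ℝ))) +
      8 * ((∏ ℓ ∈ primesIoc 0 w, (1 + 10 * ((ℓ : ℝ) ^ (2 * σ) / ℓ))) *
        (∑ ℓ ∈ primesIoc Z (X / Z), 1 / (ℓ : ℝ)) ^ 2) +
      δ * ((∏ ℓ ∈ primesIoc 0 X, (1 + 10 / (ℓ : ℝ))) * ∑ a ∈ Icc 1 X, 1 / (a : ℝ))) := by
  have h1 := smooth_add_prime_sum_ge hm K hL0 hL w Z hσ0 hσ hX hV hθ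
  have h2 := (abs_le.1
    (abs_sum_sub_smooth_add_prime_le hm hK hL0 hL4 hL hw hwZ hgood hσ0 hσ hXZ)).1
  linarith

theorem sum_primesIoc_inv_le_div {a b : ℕ} {D : ℝ} (ha : 1 ≤ a) (hD : 0 ≤ D)
    (h : Real.log b ≤ Real.log ((a + 1 : ℕ) : ℝ) + D) :
    ∑ p ∈ primesIoc a b, 1 / (p : ℝ) ≤ Real.log 4 * ((1 + D) / Real.log ((a + 1 : ℕ) : ℝ)) := by
  have hy : 0 < Real.log ((a + 1 : ℕ) : ℝ) := Real.log_pos (by exact_mod_cast (by omega : 1 < a + 1))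
  have h4 : 0 < Real.log 4 := Real.log_pos (by norm_num)
  rcases le_or_gt b a with hab | hab
  · have : primesIoc a b = ∅ := by rw [primesIoc, Ioc_eq_empty (by omega), filter_empty]
    rw [this, sum_empty]
    positivity
  refine (sum_primesIoc_inv_le a b ha hab).trans ?_
  gcongr
  have hb : Real.log ((a + 1 : ℕ) : ℝ) ≤ Real.log b :=
    Real.log_le_log (by positivity) (by exact_mod_cast hab)
  rw [← Real.log_div (hy.trans_le hb).ne' hy.ne', add_div]
  have h1 := Real.log_le_sub_one_of_pos (div_pos (hy.trans_le hb) hy)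
  have h2 : Real.log b / Real.log ((a + 1 : ℕ) : ℝ) - 1 ≤ D / Real.log ((a + 1 : ℕ) : ℝ) := by
    rw [div_sub_one hy.ne']
    gcongr
    linarith
  linarith

theorem half_le_floor {y : ℝ} (hy : 1 ≤ y) : y / 2 ≤ (⌊y⌋₊ : ℝ) := by
  have h1 : 1 ≤ ⌊y⌋₊ := (Nat.one_le_floor_iff y).2 hy
  have h2 : (1 : ℝ) ≤ (⌊y⌋₊ : ℝ) := by exact_mod_cast h1
  have := Nat.lt_floor_add_one y
  linarith

theorem le_log_floor_add_one {y : ℝ} : y ≤ Real.log ((⌊Real.exp y⌋₊ + 1 : ℕ) : ℝ) := by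
  rw [Real.le_log_iff_exp_le (by positivity)]
  push_cast
  exact (Nat.lt_floor_add_one _).le

theorem sub_one_le_log_floor {y : ℝ} (hy : 0 ≤ y) :
    y - 1 ≤ Real.log (⌊Real.exp y⌋₊ : ℝ) := by
  have h1 := half_le_floor (Real.one_le_exp hy)
  rw [Real.le_log_iff_exp_le (lt_of_lt_of_le (by positivity) h1), Real.exp_sub]
  refine le_trans ?_ h1
  have : 2 ≤ Real.exp 1 := by linarith [Real.exp_one_gt_d9]
  gcongr

/-- The bound below which primes are treated by an Euler product. -/
noncomputable def smallLevel (T : ℕ) : ℕ := ⌊Real.exp (130 * Real.log (Real.log T))⌋₊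

/-- The bound above which an integer below `3 * T` has at most two prime factors. -/
noncomputable def largeLevel (T : ℕ) : ℕ :=
  ⌊Real.exp (Real.log T / 2 - 70 * Real.log (Real.log T))⌋₊

/-- The conditions on `u = log (log T)` under which `T` is large enough. -/
structure LargeLogLog (T : ℕ) (u : ℝ) : Prop where
  log_eq : Real.log T = Real.exp u
  thousand_le : 1000 ≤ u
  sq_le : 10 ^ 9 * u ^ 2 ≤ Real.exp (u / 2)
  log_le : 2 * Real.log (130 * u) + 3 ≤ u / 100000
  sum_inv_le : ∑ ℓ ∈ primesIoc 0 (3 * T), 1 / (ℓ : ℝ) ≤ 2 * u + 5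
  main_le : Real.exp (-(u / 1000)) + 100 * Real.exp (-(2 / 5 * u)) ≤
    3 / 200 * Real.exp (-(u / 25000))

theorem eventually_largeLogLog : ∀ᶠ T : ℕ in atTop, LargeLogLog T (Real.log (Real.log T)) := by
  have h1 := eventually_loglog (eventually_ge_atTop 1000)
  have h2 := eventually_loglog (eventually_mul_le_exp (10 ^ 9) 2 (1 / 2) (by norm_num))
  have h3 := eventually_loglog (P := fun u => 2 * Real.log (130 * u) + 3 ≤ u / 100000) (by
    filter_upwards [eventually_mul_le_exp (130 * Real.exp 2) 1 (1 / 200000) (by norm_num),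
      eventually_gt_atTop 0] with u hu hu0
    rw [Real.rpow_one] at hu
    have h := Real.log_le_log (by positivity) hu
    rw [Real.log_exp, show 130 * Real.exp 2 * u = 130 * u * Real.exp 2 by ring,
      Real.log_mul (by positivity) (by positivity), Real.log_exp] at h
    linarith)
  have h4 := eventually_loglog (P := fun u => Real.exp (-(u / 1000)) +
      100 * Real.exp (-(2 / 5 * u)) ≤ 3 / 200 * Real.exp (-(u / 25000))) (by
    filter_upwards [eventually_mul_le_exp 20000 0 (1 / 2000) (by norm_num),
      eventually_gt_atTop 0] with u hu hu0
    rw [Real.rpow_zero, mul_one] at hu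
    have e1 : Real.exp (-(u / 1000)) * 20000 ≤ Real.exp (-(u / 25000)) := by
      refine (mul_le_mul_of_nonneg_left hu (Real.exp_pos _).le).trans ?_
      rw [← Real.exp_add]
      exact Real.exp_le_exp.2 (by linarith)
    have e2 : Real.exp (-(2 / 5 * u)) * 20000 ≤ Real.exp (-(u / 25000)) := by
      refine (mul_le_mul_of_nonneg_left hu (Real.exp_pos _).le).trans ?_
      rw [← Real.exp_add]
      exact Real.exp_le_exp.2 (by linarith)
    have := Real.exp_pos (-(u / 25000))
    linarith)
  filter_upwards [h1, h2, h3, h4, eventually_log_log_three_mul] with T g1 g2 g3 g4 g5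
  refine ⟨?_, g1, ?_, g3, g5.2.2.2, g4⟩
  · rw [Real.exp_log]
    exact Real.log_pos (by exact_mod_cast (by omega : 1 < T))
  · rw [Real.rpow_ofNat, one_div_mul_eq_div] at g2
    exact_mod_cast g2

namespace LargeLogLog

variable {T : ℕ} {u : ℝ}

theorem log_log_eq (h : LargeLogLog T u) : Real.log (Real.log T) = u := by
  rw [h.log_eq, Real.log_exp]

theorem exp_ge (h : LargeLogLog T u) : 10 ^ 9 * u ^ 2 * 1000 ≤ Real.exp u := by
  have h1 := h.sq_le
  have h2 : Real.exp u = Real.exp (u / 2) * Real.exp (u / 2) := by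
    rw [← Real.exp_add]; congr 1; ring
  have h3 : 1000 ≤ Real.exp (u / 2) := by nlinarith [h.thousand_le]
  rw [h2]
  gcongr

theorem linear_le (h : LargeLogLog T u) : 10 ^ 12 * u ≤ Real.exp u := by
  have := h.exp_ge
  nlinarith [h.thousand_le]

theorem pos (h : LargeLogLog T u) : (0 : ℝ) < T := by
  rcases Nat.eq_zero_or_pos T with h0 | h0
  · have := h.log_eq
    rw [h0, Nat.cast_zero, Real.log_zero] at this
    exact absurd this (Real.exp_pos u).ne
  · exact_mod_cast h0

theorem log_le_of_le (h : LargeLogLog T u) {X : ℕ} (hX : X ≤ 3 * T) :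
    Real.log X ≤ Real.exp u + 2 := by
  rcases Nat.eq_zero_or_pos X with h0 | h0
  · rw [h0, Nat.cast_zero, Real.log_zero]; positivity
  have h1 : (X : ℝ) ≤ 3 * T := by exact_mod_cast hX
  have h2 := Real.log_le_log (by exact_mod_cast h0) h1
  rw [Real.log_mul (by norm_num) h.pos.ne', h.log_eq] at h2
  have h3 := Real.log_le_sub_one_of_pos (by norm_num : (0 : ℝ) < 3)
  linarith

theorem le_log_of_le (h : LargeLogLog T u) {X : ℕ} (hX : T ≤ 4 * X) :
    Real.exp u - 3 ≤ Real.log X := by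
  have h1 : (T : ℝ) ≤ 4 * X := by exact_mod_cast hX
  have h0 : (0 : ℝ) < X := by have := h.pos; linarith
  have h2 := Real.log_le_log h.pos h1
  rw [Real.log_mul (by norm_num) h0.ne', h.log_eq] at h2
  have h3 := Real.log_le_sub_one_of_pos (by norm_num : (0 : ℝ) < 4)
  linarith

theorem smallLevel_le (h : LargeLogLog T u) : (smallLevel T : ℝ) ≤ Real.exp (130 * u) := by
  rw [smallLevel, h.log_log_eq]
  exact Nat.floor_le (Real.exp_pos _).le

theorem le_smallLevel (h : LargeLogLog T u) : Real.exp (130 * u) / 2 ≤ smallLevel T := by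
  rw [smallLevel, h.log_log_eq]
  exact half_le_floor (Real.one_le_exp (by linarith [h.thousand_le]))

theorem two_le_smallLevel (h : LargeLogLog T u) : 2 ≤ smallLevel T := by
  have h1 := h.le_smallLevel
  have h2 := Real.add_one_le_exp (130 * u)
  have h3 : (2 : ℝ) ≤ smallLevel T := by linarith [h.thousand_le]
  exact_mod_cast h3

theorem log_smallLevel_le (h : LargeLogLog T u) : Real.log (smallLevel T) ≤ 130 * u := by
  have h1 := h.two_le_smallLevel
  rw [Real.log_le_iff_le_exp (by exact_mod_cast (by omega : 0 < smallLevel T))]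
  exact h.smallLevel_le

theorem largeLevel_eq (h : LargeLogLog T u) :
    largeLevel T = ⌊Real.exp (Real.exp u / 2 - 70 * u)⌋₊ := by
  rw [largeLevel, h.log_log_eq, h.log_eq]

theorem le_log_largeLevel_add_one (h : LargeLogLog T u) :
    Real.exp u / 2 - 70 * u ≤ Real.log ((largeLevel T + 1 : ℕ) : ℝ) := by
  rw [h.largeLevel_eq]
  exact le_log_floor_add_one

theorem le_log_largeLevel (h : LargeLogLog T u) :
    Real.exp u / 2 - 70 * u - 1 ≤ Real.log (largeLevel T) := by
  rw [h.largeLevel_eq]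
  exact sub_one_le_log_floor (by linarith [h.linear_le, h.thousand_le])

theorem largeLevel_pos (h : LargeLogLog T u) : 0 < largeLevel T := by
  rw [h.largeLevel_eq]
  exact Nat.floor_pos.2 (Real.one_le_exp (by linarith [h.linear_le, h.thousand_le]))

theorem largeLevel_le (h : LargeLogLog T u) :
    (largeLevel T : ℝ) ≤ Real.exp (Real.exp u / 2 - 70 * u) := by
  rw [h.largeLevel_eq]
  exact Nat.floor_le (Real.exp_pos _).le

theorem smallLevel_le_largeLevel (h : LargeLogLog T u) : smallLevel T ≤ largeLevel T := by
  rw [h.largeLevel_eq, smallLevel, h.log_log_eq]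
  exact Nat.floor_le_floor (Real.exp_le_exp.2 (by linarith [h.linear_le, h.thousand_le]))

theorem lt_largeLevel_pow (h : LargeLogLog T u) {X : ℕ} (hX : X ≤ 3 * T) :
    X < largeLevel T ^ 3 := by
  rcases Nat.eq_zero_or_pos X with h0 | h0
  · rw [h0]; exact pow_pos h.largeLevel_pos 3
  have h1 := h.log_le_of_le hX
  have h2 := h.le_log_largeLevel
  have h3 : (0 : ℝ) < largeLevel T := by exact_mod_cast h.largeLevel_pos
  have h4 : Real.log X < Real.log ((largeLevel T : ℝ) ^ 3) := by
    rw [Real.log_pow]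
    push_cast
    linarith [h.linear_le, h.thousand_le]
  have h5 := (Real.log_lt_log_iff (by exact_mod_cast h0) (by positivity)).1 h4
  exact_mod_cast h5

theorem sum_inv_smallLevel_le (h : LargeLogLog T u) :
    ∑ ℓ ∈ primesIoc 0 (smallLevel T), 1 / (ℓ : ℝ) ≤ u / 100000 := by
  have h1 := sum_primesIoc_inv_le' (smallLevel T) h.two_le_smallLevel
  have h2 : Real.log (Real.log (smallLevel T)) ≤ Real.log (130 * u) :=
    Real.log_le_log (Real.log_pos (by exact_mod_cast h.two_le_smallLevel)) h.log_smallLevel_le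
  linarith [h.log_le]

theorem prod_smallLevel_le (h : LargeLogLog T u) :
    ∏ ℓ ∈ primesIoc 0 (smallLevel T), (1 + 10 * ((ℓ : ℝ) ^ (2 * (1 / (130 * u))) / ℓ)) ≤
      Real.exp (u / 1000) := by
  have hu := h.thousand_le
  calc ∏ ℓ ∈ primesIoc 0 (smallLevel T), (1 + 10 * ((ℓ : ℝ) ^ (2 * (1 / (130 * u))) / ℓ)) ≤
      ∏ ℓ ∈ primesIoc 0 (smallLevel T), Real.exp (80 * (1 / (ℓ : ℝ))) := by
        refine prod_le_prod (fun _ _ => by positivity) fun ℓ hℓ => ?_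
        obtain ⟨h1, h2, h3⟩ := mem_primesIoc.1 hℓ
        have hℓ0 : (0 : ℝ) < ℓ := by exact_mod_cast h1
        have h4 : (ℓ : ℝ) ^ (2 * (1 / (130 * u))) ≤ 8 := by
          rw [Real.rpow_def_of_pos hℓ0]
          have h5 : Real.log ℓ ≤ 130 * u :=
            (Real.log_le_log hℓ0 (by exact_mod_cast h2)).trans h.log_smallLevel_le
          have h6 : Real.log ℓ * (2 * (1 / (130 * u))) ≤ 2 := by
            rw [show Real.log ℓ * (2 * (1 / (130 * u))) = 2 * (Real.log ℓ / (130 * u)) by ring]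
            have : Real.log ℓ / (130 * u) ≤ 1 := by rwa [div_le_one (by positivity)]
            linarith
          refine (Real.exp_le_exp.2 h6).trans ?_
          rw [show (2 : ℝ) = 1 + 1 by norm_num, Real.exp_add]
          nlinarith [Real.exp_one_lt_d9, Real.exp_one_gt_d9]
        have h5 := Real.add_one_le_exp (80 * (1 / (ℓ : ℝ)))
        refine le_trans ?_ h5
        have : (ℓ : ℝ) ^ (2 * (1 / (130 * u))) / ℓ ≤ 8 / ℓ := by gcongr
        rw [show 80 * (1 / (ℓ : ℝ)) = 10 * (8 / ℓ) by ring]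
        linarith
    _ = Real.exp (80 * ∑ ℓ ∈ primesIoc 0 (smallLevel T), 1 / (ℓ : ℝ)) := by
        rw [mul_sum, Real.exp_sum]
    _ ≤ _ := Real.exp_le_exp.2 (by linarith [h.sum_inv_smallLevel_le])

theorem prod_le_exp (h : LargeLogLog T u) {X : ℕ} (hX : X ≤ 3 * T) :
    ∏ ℓ ∈ primesIoc 0 X, (1 + 10 / (ℓ : ℝ)) ≤ Real.exp (20 * u + 50) := by
  have h1 : ∑ ℓ ∈ primesIoc 0 X, 1 / (ℓ : ℝ) ≤ 2 * u + 5 :=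
    (sum_le_sum_of_subset_of_nonneg (primesIoc_subset le_rfl hX) fun _ _ _ => by
      positivity).trans h.sum_inv_le
  calc ∏ ℓ ∈ primesIoc 0 X, (1 + 10 / (ℓ : ℝ)) ≤
      ∏ ℓ ∈ primesIoc 0 X, Real.exp (10 * (1 / (ℓ : ℝ))) :=
        prod_le_prod (fun _ _ => by positivity) fun ℓ _ => by
          have := Real.add_one_le_exp (10 * (1 / (ℓ : ℝ)))
          rw [mul_one_div] at *
          linarith
    _ = Real.exp (10 * ∑ ℓ ∈ primesIoc 0 X, 1 / (ℓ : ℝ)) := by rw [mul_sum, Real.exp_sum]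
    _ ≤ _ := Real.exp_le_exp.2 (by linarith)

end LargeLogLog

theorem log_four_lt : Real.log 4 < 1387 / 1000 := by
  rw [show (4 : ℝ) = 2 ^ 2 by norm_num, Real.log_pow]
  have := Real.log_two_lt_d9
  push_cast
  linarith

namespace LargeLogLog

variable {T : ℕ} {u : ℝ}

theorem log_four_mul_div_le (h : LargeLogLog T u) {A y : ℝ} (hA : A ≤ 10 ^ 6 * u ^ 2)
    (hy : Real.exp u / 4 ≤ y) : Real.log 4 * (A / y) ≤ Real.exp (-(u / 2)) := by
  have h1 := h.sq_le
  have hy0 : 0 < y := lt_of_lt_of_le (by positivity) hy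
  rw [← mul_div_assoc, div_le_iff₀ hy0]
  have h2 : Real.exp (-(u / 2)) * Real.exp u = Real.exp (u / 2) := by
    rw [← Real.exp_add]; congr 1; ring
  have h3 : Real.exp (-(u / 2)) * (Real.exp u / 4) ≤ Real.exp (-(u / 2)) * y := by gcongr
  have h4 : 0 < Real.log 4 := Real.log_pos (by norm_num)
  have h5 : Real.log 4 * A ≤ Real.log 4 * (10 ^ 6 * u ^ 2) := by gcongr
  have h6 : Real.log 4 * (10 ^ 6 * u ^ 2) ≤ 1387 / 1000 * (10 ^ 6 * u ^ 2) := by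
    have := log_four_lt
    gcongr
  nlinarith [sq_nonneg u]

theorem sum_inv_above_largeLevel_le (h : LargeLogLog T u) {X : ℕ} (hX : X ≤ 3 * T) :
    ∑ ℓ ∈ primesIoc (largeLevel T) X, 1 / (ℓ : ℝ) ≤ 97 / 100 := by
  rcases le_or_gt X (largeLevel T) with hZ | hZ
  · rw [primesIoc, Ioc_eq_empty (by omega), filter_empty, sum_empty]
    norm_num
  have hu := h.thousand_le
  have hlin := h.linear_le
  have h1 := h.le_log_largeLevel_add_one
  have h2 := h.log_le_of_le hX
  set y := Real.log ((largeLevel T + 1 : ℕ) : ℝ)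
  have hy : 1000 ≤ y := by linarith
  refine (sum_primesIoc_inv_le _ X h.largeLevel_pos hZ).trans ?_
  have hX0 : Real.log X ≤ 2 * y * (1001 / 1000) := by linarith
  have hX1 : 0 < Real.log X := by
    refine lt_of_lt_of_le (by linarith : 0 < y) (Real.log_le_log (by positivity) ?_)
    exact_mod_cast hZ
  have h3 : Real.log (Real.log X) ≤ Real.log 2 + Real.log y + 1 / 1000 := by
    refine (Real.log_le_log hX1 hX0).trans ?_
    rw [Real.log_mul (by positivity) (by norm_num), Real.log_mul (by norm_num) (by positivity)]
    have := Real.log_le_sub_one_of_pos (by norm_num : (0 : ℝ) < 1001 / 1000)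
    linarith
  have h4 : 1 / y ≤ 1 / 1000 := by gcongr
  have h5 := Real.log_two_lt_d9
  have h6 : 1 / y + (Real.log (Real.log X) - Real.log y) ≤ 6952 / 10000 := by linarith
  have h7 : 0 < Real.log 4 := Real.log_pos (by norm_num)
  calc Real.log 4 * (1 / y + (Real.log (Real.log X) - Real.log y)) ≤
      Real.log 4 * (6952 / 10000) := by gcongr
    _ ≤ _ := by linarith [log_four_lt]

theorem sum_inv_div_largeLevel_le (h : LargeLogLog T u) {X : ℕ} (hX0 : 0 < X) (hX : X ≤ 3 * T) :
    ∑ ℓ ∈ primesIoc (largeLevel T) (X / largeLevel T), 1 / (ℓ : ℝ) ≤ Real.exp (-(u / 2)) := by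
  have hu := h.thousand_le
  have hlin := h.linear_le
  have h1 := h.le_log_largeLevel_add_one
  have h2 := h.log_le_of_le hX
  have h3 := h.le_log_largeLevel
  have hZ : (0 : ℝ) < largeLevel T := by exact_mod_cast h.largeLevel_pos
  have h4 : Real.log ((X / largeLevel T : ℕ) : ℝ) ≤
      Real.log ((largeLevel T + 1 : ℕ) : ℝ) + (140 * u + 3) := by
    rcases Nat.eq_zero_or_pos (X / largeLevel T) with h0 | h0
    · rw [h0, Nat.cast_zero, Real.log_zero]
      linarith
    have h5 : Real.log ((X / largeLevel T : ℕ) : ℝ) ≤ Real.log (X / largeLevel T) :=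
      Real.log_le_log (by exact_mod_cast h0) Nat.cast_div_le
    rw [Real.log_div (by positivity) hZ.ne'] at h5
    linarith
  refine (sum_primesIoc_inv_le_div h.largeLevel_pos (by linarith) h4).trans ?_
  exact h.log_four_mul_div_le (by nlinarith) (by linarith)

theorem sum_inv_top_le (h : LargeLogLog T u) {X V : ℕ} (hTX : T ≤ 4 * X)
    (hV0 : 0 < V) (hV : Real.log V ≤ 130 * u ^ 2 + 1) :
    ∑ ℓ ∈ primesIoc (X / V) X, 1 / (ℓ : ℝ) ≤ Real.exp (-(u / 2)) := by
  have hu := h.thousand_le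
  have hlin := h.linear_le
  have hsq := h.exp_ge
  have h1 := h.le_log_of_le hTX
  have hX0 : 0 < X := by have : 0 < T := by exact_mod_cast h.pos
                         omega
  have hX' : (0 : ℝ) < X := by exact_mod_cast hX0
  have hV' : (0 : ℝ) < V := by exact_mod_cast hV0
  have hVX : V ≤ X := by
    have : Real.log V ≤ Real.log X := by nlinarith
    exact_mod_cast (Real.log_le_log_iff hV' hX').1 this
  have h2 : Real.log X - Real.log V ≤ Real.log ((X / V + 1 : ℕ) : ℝ) := by
    rw [← Real.log_div hX'.ne' hV'.ne']
    refine Real.log_le_log (by positivity) ?_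
    push_cast
    rw [div_le_iff₀ hV']
    have := Nat.lt_div_mul_add (a := X) hV0
    exact_mod_cast (by nlinarith : X ≤ (X / V + 1) * V)
  refine (sum_primesIoc_inv_le_div (Nat.div_pos hVX hV0) (by positivity)
    (by linarith : Real.log X ≤ _ + (130 * u ^ 2 + 1))).trans ?_
  exact h.log_four_mul_div_le (by nlinarith) (by nlinarith)

theorem rpow_neg_le (h : LargeLogLog T u) {Y : ℕ} (hY0 : 0 < Y) (hY : 130 * u ^ 2 ≤ Real.log Y) :
    (Y : ℝ) ^ (-(1 / (130 * u))) ≤ Real.exp (-(u / 2)) := by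
  have hu := h.thousand_le
  rw [Real.rpow_def_of_pos (by exact_mod_cast hY0)]
  refine Real.exp_le_exp.2 ?_
  rw [mul_neg, neg_le_neg_iff, mul_one_div, le_div_iff₀ (by positivity)]
  nlinarith

theorem card_primeFactors_term_le (h : LargeLogLog T u) {k X : ℕ} (hk0 : k ≠ 0) (hk : k ≤ T ^ 3)
    (hX : X ≤ 3 * T) : (4 + 10 * (#k.primeFactors : ℝ)) / smallLevel T *
      ∏ ℓ ∈ primesIoc 0 X, (1 + 10 / (ℓ : ℝ)) ≤ Real.exp (-(2 / 5 * u)) := by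
  have hu := h.thousand_le
  have h1 := card_primeFactors_le_log k hk0
  have h2 : Real.log k ≤ 3 * Real.exp u := by
    rw [← h.log_eq, ← Nat.cast_ofNat, ← Real.log_pow]
    exact Real.log_le_log (by exact_mod_cast Nat.pos_of_ne_zero hk0) (by exact_mod_cast hk)
  have h3 : 4 + 10 * (#k.primeFactors : ℝ) ≤ 64 * Real.exp u := by
    linarith [Real.one_le_exp (by linarith : 0 ≤ u)]
  have h4 := h.le_smallLevel
  have h5 := h.prod_le_exp hX
  have h6 : (64 : ℝ) * 2 ≤ Real.exp 127 := by linarith [Real.add_one_le_exp (127 : ℝ)]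
  calc (4 + 10 * (#k.primeFactors : ℝ)) / smallLevel T * ∏ ℓ ∈ primesIoc 0 X, (1 + 10 / (ℓ : ℝ)) ≤
      64 * Real.exp u / (Real.exp (130 * u) / 2) * Real.exp (20 * u + 50) := by gcongr
    _ = 64 * 2 * Real.exp (u - 130 * u + (20 * u + 50)) := by
        rw [Real.exp_add (u - 130 * u), Real.exp_sub]
        field_simp
    _ ≤ Real.exp 127 * Real.exp (u - 130 * u + (20 * u + 50)) := by gcongr
    _ ≤ _ := by
        rw [← Real.exp_add]
        exact Real.exp_le_exp.2 (by linarith)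

theorem prod_mul_sum_inv_le (h : LargeLogLog T u) {X : ℕ} (hX : X ≤ 3 * T) :
    Real.exp (-(40 * u)) * ((∏ ℓ ∈ primesIoc 0 X, (1 + 10 / (ℓ : ℝ))) *
      ∑ a ∈ Icc 1 X, 1 / (a : ℝ)) ≤ Real.exp (-(2 / 5 * u)) := by
  have hu := h.thousand_le
  have h1 : ∑ a ∈ Icc 1 X, 1 / (a : ℝ) ≤ 2 * Real.exp u := by
    have e1 := harmonic_le_one_add_log X
    rw [harmonic_eq_sum_Icc] at e1
    push_cast at e1
    simp only [one_div]
    linarith [h.log_le_of_le hX, h.linear_le]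
  have h5 := h.prod_le_exp hX
  calc Real.exp (-(40 * u)) * ((∏ ℓ ∈ primesIoc 0 X, (1 + 10 / (ℓ : ℝ))) *
      ∑ a ∈ Icc 1 X, 1 / (a : ℝ)) ≤
      Real.exp (-(40 * u)) * (Real.exp (20 * u + 50) * (2 * Real.exp u)) := by gcongr
    _ ≤ Real.exp (-(40 * u)) * (Real.exp (20 * u + 50) * (Real.exp 1 * Real.exp u)) := by
        have := Real.add_one_le_exp (1 : ℝ)
        gcongr
        linarith
    _ ≤ _ := by
        simp only [← Real.exp_add]
        exact Real.exp_le_exp.2 (by linarith)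

theorem error_le (h : LargeLogLog T u) {k X V : ℕ} (hk0 : k ≠ 0) (hk : k ≤ T ^ 3)
    (hTX : T ≤ 4 * X) (hX : X ≤ 3 * T) (hX0 : 0 < X) (hV0 : 0 < V)
    (hV1 : 130 * u ^ 2 ≤ Real.log V) (hV : Real.log V ≤ 130 * u ^ 2 + 1) :
    4 * (∏ ℓ ∈ primesIoc 0 (smallLevel T), (1 + 10 * ((ℓ : ℝ) ^ (2 * (1 / (130 * u))) / ℓ))) *
        ((X : ℝ) ^ (-(1 / (130 * u))) + (V : ℝ) ^ (-(1 / (130 * u))) +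
          ∑ ℓ ∈ primesIoc (X / V) X, 1 / (ℓ : ℝ)) +
      8 * ((4 + 10 * (#k.primeFactors : ℝ)) / smallLevel T *
        ∏ ℓ ∈ primesIoc 0 X, (1 + 10 / (ℓ : ℝ))) +
      8 * ((∏ ℓ ∈ primesIoc 0 (smallLevel T),
          (1 + 10 * ((ℓ : ℝ) ^ (2 * (1 / (130 * u))) / ℓ))) *
        (∑ ℓ ∈ primesIoc (largeLevel T) (X / largeLevel T), 1 / (ℓ : ℝ)) ^ 2) +
      Real.exp (-(40 * u)) * ((∏ ℓ ∈ primesIoc 0 X, (1 + 10 / (ℓ : ℝ))) *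
        ∑ a ∈ Icc 1 X, 1 / (a : ℝ)) ≤ 100 * Real.exp (-(2 / 5 * u)) := by
  have hu := h.thousand_le
  have hW := h.prod_smallLevel_le
  set W := ∏ ℓ ∈ primesIoc 0 (smallLevel T), (1 + 10 * ((ℓ : ℝ) ^ (2 * (1 / (130 * u))) / ℓ))
  have e1 := h.rpow_neg_le hX0 (by nlinarith [h.le_log_of_le hTX, h.exp_ge])
  have e2 := h.rpow_neg_le hV0 hV1
  have e3 := h.sum_inv_top_le hTX hV0 hV
  have e4 := h.card_primeFactors_term_le hk0 hk hX
  have e5 := h.sum_inv_div_largeLevel_le hX0 hX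
  have e6 := h.prod_mul_sum_inv_le hX
  set s1 := ∑ ℓ ∈ primesIoc (X / V) X, 1 / (ℓ : ℝ)
  set s2 := ∑ ℓ ∈ primesIoc (largeLevel T) (X / largeLevel T), 1 / (ℓ : ℝ) with hs2
  have hs20 : 0 ≤ s2 := sum_nonneg fun _ _ => by positivity
  have f1 : Real.exp (u / 1000) * Real.exp (-(u / 2)) ≤ Real.exp (-(2 / 5 * u)) := by
    rw [← Real.exp_add]
    exact Real.exp_le_exp.2 (by linarith)
  have f2 : 4 * W * ((X : ℝ) ^ (-(1 / (130 * u))) + (V : ℝ) ^ (-(1 / (130 * u))) + s1) ≤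
      12 * Real.exp (-(2 / 5 * u)) := by
    calc 4 * W * ((X : ℝ) ^ (-(1 / (130 * u))) + (V : ℝ) ^ (-(1 / (130 * u))) + s1) ≤
        4 * Real.exp (u / 1000) * (3 * Real.exp (-(u / 2))) := by
          gcongr
          linarith
      _ ≤ _ := by linarith
  have f3 : W * s2 ^ 2 ≤ Real.exp (-(2 / 5 * u)) := by
    have : s2 ^ 2 ≤ Real.exp (-(u / 2)) := by
      have : Real.exp (-(u / 2)) ≤ 1 := Real.exp_le_one_iff.2 (by linarith)
      nlinarith
    calc W * s2 ^ 2 ≤ Real.exp (u / 1000) * Real.exp (-(u / 2)) := by gcongr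
      _ ≤ _ := f1
  linarith [Real.exp_pos (-(2 / 5 * u))]

theorem sum_chi_rootCount_ge (h : LargeLogLog T u) {m : ℕ} (hm : m.Prime) (hm5 : m % 8 = 5)
    {K : ℤ} (hK0 : K ≠ 0) (hK : K.natAbs ≤ T ^ 3)
    (hgood : GoodDiscriminant m K (smallLevel T) (largeLevel T) (Real.exp (-(40 * u))))
    {X : ℕ} (hTX : T ≤ 4 * X) (hX : X ≤ 3 * T) :
    Real.exp (-(u / 1000)) ≤ ∑ e ∈ Icc 1 X, chiAway m e * rootCount K e / e := by
  have hu := h.thousand_le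
  obtain ⟨L, hL0, hL4, hL⟩ := exists_abs_sum_chiAway_div_sub_le hm5
  have hX0 : 0 < X := by
    have : 0 < T := by exact_mod_cast h.pos
    omega
  set V := ⌈Real.exp (130 * u ^ 2)⌉₊ with hVdef
  have hV0 : 0 < V := Nat.ceil_pos.2 (Real.exp_pos _)
  have hV1 : 130 * u ^ 2 ≤ Real.log V := by
    rw [Real.le_log_iff_exp_le (by exact_mod_cast hV0)]
    exact Nat.le_ceil _
  have hV2 : Real.log V ≤ 130 * u ^ 2 + 1 := by
    rw [Real.log_le_iff_le_exp (by exact_mod_cast hV0), Real.exp_add]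
    have e1 := (Nat.ceil_lt_add_one (Real.exp_pos (130 * u ^ 2)).le).le
    have e2 := Real.one_le_exp (by positivity : 0 ≤ 130 * u ^ 2)
    have e3 := Real.add_one_le_exp (1 : ℝ)
    refine e1.trans ?_
    nlinarith
  have hθ := h.sum_inv_above_largeLevel_le hX
  have hσ : 1 / (130 * u) ≤ 0.2 := by
    rw [div_le_iff₀ (by positivity)]
    norm_num
    linarith
  have key := _root_.sum_chi_rootCount_ge hm hK0 hL0 hL4 hL
    (by have := h.two_le_smallLevel; omega) h.smallLevel_le_largeLevel hgood
    (by positivity : 0 ≤ 1 / (130 * u)) hσ hX0 (h.lt_largeLevel_pow hX) hV0 (by linarith)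
  have herr := h.error_le (Int.natAbs_ne_zero.2 hK0) hK hTX hX hX0 hV0 hV1 hV2
  have hmain : 3 / 200 * Real.exp (-(u / 25000)) ≤
      1 / 2 * Real.exp (-(4 * ∑ ℓ ∈ primesIoc 0 (smallLevel T), 1 / (ℓ : ℝ))) *
        (1 - ∑ ℓ ∈ primesIoc (largeLevel T) X, 1 / (ℓ : ℝ)) := by
    calc 3 / 200 * Real.exp (-(u / 25000)) = 1 / 2 * Real.exp (-(u / 25000)) * (3 / 100) := by ring
      _ ≤ _ := by
        have := h.sum_inv_smallLevel_le
        gcongr <;> linarith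
  linarith [h.main_le]

end LargeLogLog

theorem abs_sum_range_le_of_periodic {q : ℕ} (hq : 0 < q) {f : ℤ → ℝ}
    (hf : ∀ s t : ℤ, (q : ℤ) ∣ s - t → f s = f t) (hf1 : ∀ t, |f t| ≤ 1)
    (hsum : |∑ t ∈ range q, f t| ≤ 1) (N : ℕ) :
    |∑ t ∈ range N, f t| ≤ N / q + q := by
  have hshift : ∀ k i : ℕ, f ((q * k + i : ℕ) : ℤ) = f i := fun k i => hf _ _ ⟨k, by push_cast; ring⟩
  have hper : ∀ k : ℕ, ∑ t ∈ range (q * k), f t = k * ∑ t ∈ range q, f t := by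
    intro k
    induction k with
    | zero => simp
    | succ k ih =>
      rw [mul_add_one, sum_range_add, ih, sum_congr rfl fun i _ => hshift k i]
      push_cast
      ring
  rw [← Nat.div_add_mod N q, sum_range_add, hper, sum_congr rfl fun i _ => hshift _ i,
    Nat.div_add_mod N q]
  refine (abs_add_le _ _).trans (add_le_add ?_ ?_)
  · rw [abs_mul, Nat.abs_cast]
    refine (mul_le_of_le_one_right (by positivity) hsum).trans Nat.cast_div_le
  · refine (abs_sum_le_sum_abs _ _).trans ((sum_le_sum fun (i : ℕ) _ => hf1 i).trans ?_)
    rw [sum_const, card_range, nsmul_one]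
    exact_mod_cast (Nat.mod_lt N hq).le

theorem abs_rootCount_prime_sub_one_le {p : ℕ} (hp : p.Prime) (K : ℤ) :
    |(rootCount K p : ℝ) - 1| ≤ 1 := by
  have h1 : (rootCount K p : ℝ) ≤ 2 := by exact_mod_cast rootCount_prime_le_two hp K
  have h2 : (0 : ℝ) ≤ rootCount K p := by positivity
  rw [abs_le]
  constructor <;> linarith

theorem abs_sum_range_rootCount_mul_le {p q : ℕ} (hp : p.Prime) (hq : q.Prime) (hp2 : p ≠ 2)
    (hq2 : q ≠ 2) (hpq : p ≠ q) {D : ℤ} (hpD : ¬(p : ℤ) ∣ D) (hqD : ¬(q : ℤ) ∣ D) (N : ℕ) :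
    |∑ t ∈ range N, ((rootCount (D - ((t : ℕ) : ℤ) ^ 2) p : ℝ) - 1) *
      ((rootCount (D - ((t : ℕ) : ℤ) ^ 2) q : ℝ) - 1)| ≤ N / (p * q : ℕ) + (p * q : ℕ) := by
  haveI := Fact.mk hp
  haveI := Fact.mk hq
  have hfp : ∀ s t : ℤ, (p : ℤ) ∣ s - t →
      (rootCount (D - s ^ 2) p : ℝ) - 1 = (rootCount (D - t ^ 2) p : ℝ) - 1 :=
    fun s t h => by rw [rootCount_periodic p D s t h]
  have hfq : ∀ s t : ℤ, (q : ℤ) ∣ s - t →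
      (rootCount (D - s ^ 2) q : ℝ) - 1 = (rootCount (D - t ^ 2) q : ℝ) - 1 :=
    fun s t h => by rw [rootCount_periodic q D s t h]
  refine abs_sum_range_le_of_periodic (Nat.mul_pos hp.pos hq.pos)
    (f := fun t => ((rootCount (D - t ^ 2) p : ℝ) - 1) * ((rootCount (D - t ^ 2) q : ℝ) - 1))
    (fun s t h => ?_) (fun t => ?_) ?_ N
  · push_cast at h
    rw [hfp s t (dvd_of_mul_right_dvd h), hfq s t (dvd_of_mul_left_dvd h)]
  · rw [abs_mul]
    exact mul_le_one₀ (abs_rootCount_prime_sub_one_le hp _) (abs_nonneg _)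
      (abs_rootCount_prime_sub_one_le hq _)
  · rw [sum_range_mul_coprime ((Nat.coprime_primes hp hq).2 hpq)
      (fun t => (rootCount (D - t ^ 2) p : ℝ) - 1) (fun t => (rootCount (D - t ^ 2) q : ℝ) - 1)
      hfp hfq, abs_mul]
    exact mul_le_one₀ (abs_sum_rootCount_sub_one_le hp2 hpD) (abs_nonneg _)
      (abs_sum_rootCount_sub_one_le hq2 hqD)

theorem sum_primesIoc_inv_sq_le_inv {w : ℕ} (hw : 0 < w) (v : ℕ) :
    ∑ p ∈ primesIoc w v, ((p : ℝ) ^ 2)⁻¹ ≤ (w : ℝ)⁻¹ := by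
  rcases le_or_gt v w with h | h
  · rw [primesIoc, Ioc_eq_empty (by omega), filter_empty, sum_empty]
    positivity
  calc ∑ p ∈ primesIoc w v, ((p : ℝ) ^ 2)⁻¹ ≤ ∑ p ∈ Ioc w v, ((p : ℝ) ^ 2)⁻¹ :=
        sum_le_sum_of_subset_of_nonneg (filter_subset _ _) fun _ _ _ => by positivity
    _ ≤ (w : ℝ)⁻¹ - (v : ℝ)⁻¹ := sum_Ioc_inv_sq_le_sub (by omega) h.le
    _ ≤ _ := by
        have : (0 : ℝ) ≤ (v : ℝ)⁻¹ := by positivity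
        linarith

theorem sum_sq_rootCoeff_le {m : ℕ} {D : ℤ} {w v : ℕ} (hw : 2 ≤ w) (N : ℕ) :
    ∑ t ∈ range N, (∑ ℓ ∈ primesIoc w v with ¬((ℓ : ℕ) : ℤ) ∣ D,
      rootCoeff m (D - ((t : ℕ) : ℤ) ^ 2) ℓ / ℓ) ^ 2 ≤ 2 * N / w + (v : ℝ) ^ 2 := by
  have hw0 : (0 : ℝ) < w := by exact_mod_cast (by omega : 0 < w)
  set P := (primesIoc w v).filter fun ℓ => ¬((ℓ : ℕ) : ℤ) ∣ D
  have hP : ∀ ℓ ∈ P, w < ℓ ∧ ℓ ≤ v ∧ ℓ.Prime ∧ ¬((ℓ : ℕ) : ℤ) ∣ D := fun ℓ hℓ => by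
    obtain ⟨h1, h2⟩ := mem_filter.1 hℓ
    obtain ⟨h3, h4, h5⟩ := mem_primesIoc.1 h1
    exact ⟨h3, h4, h5, h2⟩
  have hPv : (#P : ℝ) ≤ v := by
    have : #P ≤ #(Ioc 0 v) := card_le_card fun ℓ hℓ => by
      obtain ⟨h1, h2, h3, -⟩ := hP ℓ hℓ
      exact mem_Ioc.2 ⟨by omega, h2⟩
    rw [Nat.card_Ioc, Nat.sub_zero] at this
    exact_mod_cast this
  have hs := sum_primesIoc_inv_sq_le_inv (by omega : 0 < w) v
  have hsP : ∑ ℓ ∈ P, ((ℓ : ℝ) ^ 2)⁻¹ ≤ (w : ℝ)⁻¹ :=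
    (sum_le_sum_of_subset_of_nonneg (filter_subset _ _) fun _ _ _ => by positivity).trans hs
  set κ : ℕ → ℕ → ℝ := fun t ℓ => (rootCount (D - (t : ℤ) ^ 2) ℓ : ℝ) - 1
  have hpair : ∀ ℓ ∈ P, ∀ q ∈ P, ∑ t ∈ range N, rootCoeff m (D - ((t : ℕ) : ℤ) ^ 2) ℓ / ℓ *
      (rootCoeff m (D - ((t : ℕ) : ℤ) ^ 2) q / q) ≤
      (if ℓ = q then N * ((ℓ : ℝ) ^ 2)⁻¹ else 0) +
        (N * (((ℓ : ℝ) ^ 2)⁻¹ * ((q : ℝ) ^ 2)⁻¹) + 1) := by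
    intro ℓ hℓ q hq
    obtain ⟨h1, h2, h3, h4⟩ := hP ℓ hℓ
    obtain ⟨k1, k2, k3, k4⟩ := hP q hq
    have hℓ0 : (0 : ℝ) < ℓ := by exact_mod_cast h3.pos
    have hq0 : (0 : ℝ) < q := by exact_mod_cast k3.pos
    have heq : ∑ t ∈ range N, rootCoeff m (D - ((t : ℕ) : ℤ) ^ 2) ℓ / ℓ *
        (rootCoeff m (D - ((t : ℕ) : ℤ) ^ 2) q / q) =
        chiAway m ℓ * chiAway m q * ((ℓ : ℝ) * q)⁻¹ * ∑ t ∈ range N, κ t ℓ * κ t q := by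
      rw [mul_sum]
      refine sum_congr rfl fun t _ => ?_
      rw [rootCoeff_prime m _ h3, rootCoeff_prime m _ k3, mul_inv]
      ring
    have hle : |chiAway m ℓ * chiAway m q * ((ℓ : ℝ) * q)⁻¹| ≤ ((ℓ : ℝ) * q)⁻¹ := by
      rw [abs_mul, abs_mul, abs_of_nonneg (by positivity : 0 ≤ ((ℓ : ℝ) * q)⁻¹)]
      exact mul_le_of_le_one_left (by positivity) (mul_le_one₀ (abs_chiAway_le_one m ℓ)
        (abs_nonneg _) (abs_chiAway_le_one m q))
    rw [heq]
    refine (le_abs_self _).trans ?_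
    rw [abs_mul]
    split_ifs with hℓq
    · subst hℓq
      have : |∑ t ∈ range N, κ t ℓ * κ t ℓ| ≤ N := by
        refine (abs_sum_le_sum_abs _ _).trans ?_
        calc ∑ t ∈ range N, |κ t ℓ * κ t ℓ| ≤ ∑ t ∈ range N, (1 : ℝ) := sum_le_sum fun t _ => by
              rw [abs_mul]
              exact mul_le_one₀ (abs_rootCount_prime_sub_one_le h3 _) (abs_nonneg _)
                (abs_rootCount_prime_sub_one_le h3 _)
          _ = N := by simp
      calc _ ≤ ((ℓ : ℝ) * ℓ)⁻¹ * N := by gcongr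
        _ = N * ((ℓ : ℝ) ^ 2)⁻¹ + 0 := by ring
        _ ≤ _ := by gcongr; positivity
    · have := abs_sum_range_rootCount_mul_le h3 k3 (by omega) (by omega) hℓq h4 k4 N
      push_cast at this
      calc _ ≤ ((ℓ : ℝ) * q)⁻¹ * (N / (ℓ * q) + ℓ * q) := by gcongr
        _ = _ := by field_simp; ring
  calc ∑ t ∈ range N, (∑ ℓ ∈ P, rootCoeff m (D - ((t : ℕ) : ℤ) ^ 2) ℓ / ℓ) ^ 2 =
      ∑ ℓ ∈ P, ∑ q ∈ P, ∑ t ∈ range N, rootCoeff m (D - ((t : ℕ) : ℤ) ^ 2) ℓ / ℓ *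
        (rootCoeff m (D - ((t : ℕ) : ℤ) ^ 2) q / q) := by
        simp only [sq (∑ ℓ ∈ P, _), sum_mul_sum]
        rw [sum_comm]
        exact sum_congr rfl fun _ _ => sum_comm
    _ ≤ ∑ ℓ ∈ P, ∑ q ∈ P, ((if ℓ = q then N * ((ℓ : ℝ) ^ 2)⁻¹ else 0) +
        (N * (((ℓ : ℝ) ^ 2)⁻¹ * ((q : ℝ) ^ 2)⁻¹) + 1)) :=
        sum_le_sum fun ℓ hℓ => sum_le_sum fun q hq => hpair ℓ hℓ q hq
    _ = N * ∑ ℓ ∈ P, ((ℓ : ℝ) ^ 2)⁻¹ +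
        (N * ((∑ ℓ ∈ P, ((ℓ : ℝ) ^ 2)⁻¹) * ∑ q ∈ P, ((q : ℝ) ^ 2)⁻¹) + (#P : ℝ) * #P) := by
        simp only [sum_add_distrib, sum_ite_eq, sum_const, nsmul_eq_mul, mul_one, ← mul_sum,
          ← sum_mul]
        congr 1
        rw [mul_sum]
        exact sum_congr rfl fun ℓ hℓ => by rw [if_pos hℓ]
    _ ≤ N * (w : ℝ)⁻¹ + (N * ((w : ℝ)⁻¹ * 1) + v * v) := by
        have : (w : ℝ)⁻¹ ≤ 1 := inv_le_one_of_one_le₀ (by exact_mod_cast (by omega : 1 ≤ w))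
        have hs0 : 0 ≤ ∑ ℓ ∈ P, ((ℓ : ℝ) ^ 2)⁻¹ := sum_nonneg fun _ _ => by positivity
        gcongr
        exact hsP.trans this
    _ = _ := by ring

theorem sum_primesIoc_inv_le_log_sub {a b : ℕ} (ha : 0 < a) (hab : a ≤ b) :
    ∑ p ∈ primesIoc a b, 1 / (p : ℝ) ≤ Real.log b - Real.log a := by
  have h : ∑ p ∈ Ioc a b, 1 / (p : ℝ) ≤ Real.log b - Real.log a := by
    induction b, hab using Nat.le_induction with
    | base => simp
    | succ k hk ih =>
      have hk0 : (0 : ℝ) < k := by exact_mod_cast (by omega : 0 < k)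
      rw [Ioc_succ_insert hk, sum_insert (by simp)]
      have h1 := Real.log_le_sub_one_of_pos (by positivity : (0 : ℝ) < k / (k + 1))
      rw [Real.log_div (by positivity) (by positivity)] at h1
      have h2 : (k : ℝ) / (k + 1) - 1 = -(1 / (k + 1)) := by field_simp; ring
      push_cast
      linarith
  exact (sum_le_sum_of_subset_of_nonneg (filter_subset _ _) fun _ _ _ => by positivity).trans h

/-- The logarithmic grid with `R` points in each interval `[x, e * x)`. -/
noncomputable def logGrid (R k : ℕ) : ℕ := ⌊Real.exp (k / R)⌋₊

theorem exists_logGrid {R : ℕ} (hR : 0 < R) {v Z : ℕ} (hv : 0 < v) (hvZ : v ≤ Z) :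
    ∃ k ≤ ⌊R * Real.log Z⌋₊, logGrid R k ≤ v ∧
      ∑ p ∈ primesIoc (logGrid R k) v, 1 / (p : ℝ) ≤ 1 / R + 6 / v := by
  have hv0 : (0 : ℝ) < v := by exact_mod_cast hv
  have hR0 : (0 : ℝ) < R := by exact_mod_cast hR
  have hlog : 0 ≤ Real.log v := Real.log_natCast_nonneg v
  have hk1 := Nat.floor_le (by positivity : 0 ≤ R * Real.log v)
  have hk2 := Nat.lt_floor_add_one (R * Real.log v)
  refine ⟨⌊R * Real.log v⌋₊, Nat.floor_le_floor (by gcongr), ?_⟩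
  set k := ⌊R * Real.log v⌋₊
  have hkR : (k : ℝ) / R ≤ Real.log v := by rw [div_le_iff₀ hR0]; linarith
  have hkR' : Real.log v ≤ k / R + 1 / R := by rw [← add_div, le_div_iff₀ hR0]; linarith
  have hle : logGrid R k ≤ v := by
    rw [logGrid]
    refine Nat.floor_le_of_le ?_
    rw [← Real.le_log_iff_exp_le hv0]
    exact hkR
  have h1 : (1 : ℝ) ≤ Real.exp (k / R) := Real.one_le_exp (by positivity)
  have hg := half_le_floor h1
  have hg0 : 0 < logGrid R k := Nat.floor_pos.2 h1
  have hg0' : (0 : ℝ) < logGrid R k := by exact_mod_cast hg0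
  refine ⟨hle, (sum_primesIoc_inv_le_log_sub hg0 hle).trans ?_⟩
  have hR1 : 1 / (R : ℝ) ≤ 1 := by
    rw [div_le_one hR0]
    exact_mod_cast hR
  have hv6 : (v : ℝ) ≤ 6 * logGrid R k := by
    have e1 : (v : ℝ) ≤ Real.exp (k / R) * Real.exp 1 := by
      rw [← Real.exp_add, ← Real.log_le_iff_le_exp hv0]
      linarith
    have e2 := Real.exp_one_lt_d9
    rw [logGrid]
    nlinarith [Real.exp_pos ((k : ℝ) / R)]
  have h2 : (k : ℝ) / R ≤ Real.log ((logGrid R k + 1 : ℕ) : ℝ) := le_log_floor_add_one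
  have h3 : Real.log ((logGrid R k + 1 : ℕ) : ℝ) - Real.log (logGrid R k) ≤
      1 / (logGrid R k : ℝ) := by
    rw [← Real.log_div (by positivity) hg0'.ne']
    have := Real.log_le_sub_one_of_pos
      (by positivity : (0 : ℝ) < ((logGrid R k + 1 : ℕ) : ℝ) / logGrid R k)
    refine this.trans (le_of_eq ?_)
    push_cast
    field_simp
    ring
  have h4 : 1 / (logGrid R k : ℝ) ≤ 6 / v := by
    rw [div_le_div_iff₀ hg0' hv0]
    linarith
  linarith

theorem abs_rootCoeff_div_le {ℓ : ℕ} (hℓ : ℓ.Prime) (m : ℕ) (K : ℤ) :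
    |rootCoeff m K ℓ / ℓ| ≤ 1 / (ℓ : ℝ) := by
  rw [abs_div, Nat.abs_cast]
  gcongr
  exact abs_rootCoeff_prime_le_one m K hℓ

theorem abs_sum_dvd_rootCoeff_le (m : ℕ) (K : ℤ) {D : ℤ} (hD : D ≠ 0) {w : ℕ} (hw : 0 < w) (v : ℕ) :
    |∑ ℓ ∈ primesIoc w v with ((ℓ : ℕ) : ℤ) ∣ D, rootCoeff m K ℓ / ℓ| ≤
      (#D.natAbs.primeFactors : ℝ) / w := by
  refine (abs_sum_le_sum_abs _ _).trans ?_
  calc ∑ ℓ ∈ primesIoc w v with ((ℓ : ℕ) : ℤ) ∣ D, |rootCoeff m K ℓ / ℓ| ≤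
      ∑ ℓ ∈ primesIoc w v with ((ℓ : ℕ) : ℤ) ∣ D, 1 / (w : ℝ) := sum_le_sum fun ℓ hℓ => by
        obtain ⟨h1, -, h3⟩ := mem_primesIoc.1 (mem_filter.1 hℓ).1
        refine (abs_rootCoeff_div_le h3 m K).trans ?_
        gcongr
    _ ≤ ∑ ℓ ∈ D.natAbs.primeFactors, 1 / (w : ℝ) := by
        refine sum_le_sum_of_subset_of_nonneg (fun ℓ hℓ => ?_) fun _ _ _ => by positivity
        obtain ⟨h1, h2⟩ := mem_filter.1 hℓ
        exact Nat.mem_primeFactors.2 ⟨(mem_primesIoc.1 h1).2.2, Int.natCast_dvd.1 h2,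
          Int.natAbs_ne_zero.2 hD⟩
    _ = _ := by rw [sum_const, nsmul_eq_mul, mul_one_div]

theorem goodDiscriminant_of_logGrid {m : ℕ} {K D : ℤ} (hD : D ≠ 0) {w Z R : ℕ} (hw : 0 < w) (hwZ : w ≤ Z)
    (hR : 0 < R) {η δ : ℝ}
    (hη : ∀ k ≤ ⌊R * Real.log Z⌋₊, logGrid R k ≤ Z →
      |∑ ℓ ∈ primesIoc w (logGrid R k) with ¬((ℓ : ℕ) : ℤ) ∣ D, rootCoeff m K ℓ / ℓ| ≤ η)
    (hδ : 2 * (η + (#D.natAbs.primeFactors : ℝ) / w + (1 / R + 6 / w)) ≤ δ) :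
    GoodDiscriminant m K w Z δ := by
  have hinit : ∀ v, w ≤ v → v ≤ Z → |∑ ℓ ∈ primesIoc w v, rootCoeff m K ℓ / ℓ| ≤ δ / 2 := by
    intro v hwv hvZ
    obtain ⟨k, hk, hkv, hsum⟩ := exists_logGrid hR (hw.trans_le hwv) hvZ
    set g := logGrid R k
    have hwv' : 6 / (v : ℝ) ≤ 6 / w := by gcongr
    have h1 : ∑ ℓ ∈ primesIoc w v, rootCoeff m K ℓ / ℓ =
        ∑ ℓ ∈ primesIoc w g, rootCoeff m K ℓ / ℓ +
          ∑ ℓ ∈ primesIoc w v with ¬ℓ ≤ g, rootCoeff m K ℓ / ℓ := by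
      rw [← sum_filter_add_sum_filter_not (primesIoc w v) (fun ℓ => ℓ ≤ g)]
      congr 2
      ext ℓ
      simp only [mem_filter, mem_primesIoc]
      refine ⟨fun h => ⟨h.1.1, h.2, h.1.2.2⟩, fun h => ⟨⟨h.1, h.2.1.trans hkv, h.2.2⟩, h.2.1⟩⟩
    have h2 : |∑ ℓ ∈ primesIoc w v with ¬ℓ ≤ g, rootCoeff m K ℓ / ℓ| ≤ 1 / R + 6 / v := by
      refine (abs_sum_le_sum_abs _ _).trans (le_trans ?_ hsum)
      refine (sum_le_sum fun ℓ hℓ => abs_rootCoeff_div_le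
        (mem_primesIoc.1 (mem_filter.1 hℓ).1).2.2 m K).trans ?_
      refine sum_le_sum_of_subset_of_nonneg (fun ℓ hℓ => ?_) fun _ _ _ => by positivity
      obtain ⟨h3, h4⟩ := mem_filter.1 hℓ
      obtain ⟨h5, h6, h7⟩ := mem_primesIoc.1 h3
      exact mem_primesIoc.2 ⟨not_le.1 h4, h6, h7⟩
    have h3 : |∑ ℓ ∈ primesIoc w g, rootCoeff m K ℓ / ℓ| ≤
        (#D.natAbs.primeFactors : ℝ) / w + η := by
      rw [← sum_filter_add_sum_filter_not (primesIoc w g) (fun ℓ => ((ℓ : ℕ) : ℤ) ∣ D)]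
      exact (abs_add_le _ _).trans (add_le_add (abs_sum_dvd_rootCoeff_le m K hD hw g)
        (hη k hk (hkv.trans hvZ)))
    rw [h1]
    refine (abs_add_le _ _).trans ?_
    linarith
  intro a b hwa hbZ
  rcases le_or_gt a b with hab | hab
  · have h1 := hinit a hwa (hab.trans hbZ)
    have h2 := hinit b (hwa.trans hab) hbZ
    have h3 : ∑ ℓ ∈ primesIoc w b, rootCoeff m K ℓ / ℓ =
        ∑ ℓ ∈ primesIoc w a, rootCoeff m K ℓ / ℓ + ∑ ℓ ∈ primesIoc a b, rootCoeff m K ℓ / ℓ := by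
      simp only [primesIoc, sum_filter]
      exact (sum_Ioc_consecutive _ hwa hab).symm
    rw [abs_le] at *
    constructor <;> linarith [h1.1, h1.2, h2.1, h2.2]
  · have h1 := (abs_nonneg _).trans (hinit w le_rfl hwZ)
    rw [primesIoc, Ioc_eq_empty (by omega), filter_empty, sum_empty, abs_zero]
    linarith

namespace LargeLogLog

variable {T : ℕ} {u : ℝ}

theorem largeLevel_sq_le (h : LargeLogLog T u) :
    (largeLevel T : ℝ) ^ 2 ≤ T * Real.exp (-(140 * u)) := by
  have h1 : (T : ℝ) = Real.exp (Real.exp u) := by rw [← h.log_eq, Real.exp_log h.pos]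
  calc (largeLevel T : ℝ) ^ 2 ≤ Real.exp (Real.exp u / 2 - 70 * u) ^ 2 := by
        have := h.largeLevel_le
        gcongr
    _ = _ := by
        rw [h1, ← Real.exp_add, ← Real.exp_nat_mul]
        congr 1
        push_cast
        ring

theorem sum_sq_rootCoeff_le (h : LargeLogLog T u) (m : ℕ) (D : ℤ) {v : ℕ} (hv : v ≤ largeLevel T) :
    ∑ t ∈ range (T + 1), (∑ ℓ ∈ primesIoc (smallLevel T) v with ¬((ℓ : ℕ) : ℤ) ∣ D,
      rootCoeff m (D - ((t : ℕ) : ℤ) ^ 2) ℓ / ℓ) ^ 2 ≤ 9 * T * Real.exp (-(130 * u)) := by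
  have h1 := h.largeLevel_sq_le
  have h2 := h.le_smallLevel
  have hT : (1 : ℝ) ≤ T := by exact_mod_cast h.pos
  refine (_root_.sum_sq_rootCoeff_le h.two_le_smallLevel (T + 1)).trans ?_
  have h3 : (v : ℝ) ^ 2 ≤ (largeLevel T : ℝ) ^ 2 := by gcongr
  have h4 : Real.exp (-(140 * u)) ≤ Real.exp (-(130 * u)) :=
    Real.exp_le_exp.2 (by linarith [h.thousand_le])
  have h5 : 2 * ((T + 1 : ℕ) : ℝ) / smallLevel T ≤ 2 * (2 * T) / (Real.exp (130 * u) / 2) := by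
    push_cast
    gcongr
    linarith
  have h6 : 2 * (2 * T) / (Real.exp (130 * u) / 2) = 8 * T * Real.exp (-(130 * u)) := by
    rw [Real.exp_neg]
    field_simp
    ring
  have h7 : T * Real.exp (-(140 * u)) ≤ T * Real.exp (-(130 * u)) := by gcongr
  linarith

theorem card_lt_abs_rootCoeff_sum_le (h : LargeLogLog T u) (m : ℕ) (D : ℤ) {v : ℕ}
    (hv : v ≤ largeLevel T) :
    (#{t ∈ range (T + 1) | Real.exp (-(40 * u)) / 8 <
      |∑ ℓ ∈ primesIoc (smallLevel T) v with ¬((ℓ : ℕ) : ℤ) ∣ D,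
        rootCoeff m (D - ((t : ℕ) : ℤ) ^ 2) ℓ / ℓ|} : ℝ) ≤ 576 * T * Real.exp (-(50 * u)) := by
  have h1 := h.sum_sq_rootCoeff_le m D hv
  set S := {t ∈ range (T + 1) | Real.exp (-(40 * u)) / 8 <
      |∑ ℓ ∈ primesIoc (smallLevel T) v with ¬((ℓ : ℕ) : ℤ) ∣ D,
        rootCoeff m (D - ((t : ℕ) : ℤ) ^ 2) ℓ / ℓ|}
  have h2 : (#S : ℝ) * (Real.exp (-(40 * u)) / 8) ^ 2 ≤ 9 * T * Real.exp (-(130 * u)) := by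
    rw [← nsmul_eq_mul, ← sum_const]
    refine le_trans ?_ h1
    calc ∑ t ∈ S, (Real.exp (-(40 * u)) / 8) ^ 2 ≤
        ∑ t ∈ S, (∑ ℓ ∈ primesIoc (smallLevel T) v with ¬((ℓ : ℕ) : ℤ) ∣ D,
          rootCoeff m (D - ((t : ℕ) : ℤ) ^ 2) ℓ / ℓ) ^ 2 := sum_le_sum fun t ht => by
          have := (mem_filter.1 ht).2
          rw [← sq_abs (∑ ℓ ∈ primesIoc (smallLevel T) v with ¬((ℓ : ℕ) : ℤ) ∣ D, _)]
          gcongr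
      _ ≤ _ := sum_le_sum_of_subset_of_nonneg (filter_subset _ _) fun _ _ _ => sq_nonneg _
  have h3 : (Real.exp (-(40 * u)) / 8) ^ 2 = Real.exp (-(80 * u)) / 64 := by
    rw [div_pow, ← Real.exp_nat_mul]
    norm_num
    ring
  rw [h3, ← le_div_iff₀ (by positivity)] at h2
  refine h2.trans (le_of_eq ?_)
  rw [show -(130 * u) = -(50 * u) + -(80 * u) by ring, Real.exp_add]
  field_simp
  ring

open Classical in
theorem card_not_goodDiscriminant_le (h : LargeLogLog T u) (m : ℕ) {D : ℤ} (hD : D ≠ 0)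
    (hDT : D.natAbs ≤ T ^ 3) :
    (#{t ∈ range (T + 1) | ¬GoodDiscriminant m (D - ((t : ℕ) : ℤ) ^ 2) (smallLevel T)
      (largeLevel T) (Real.exp (-(40 * u)))} : ℝ) ≤ T * Real.exp (-(2 * u)) := by
  have hu := h.thousand_le
  set R := ⌈16 * Real.exp (40 * u)⌉₊
  set Z := largeLevel T
  set w := smallLevel T
  have hR0 : 0 < R := Nat.ceil_pos.2 (by positivity)
  have hw := h.two_le_smallLevel
  have hw' := h.le_smallLevel
  have hRle : (16 : ℝ) * Real.exp (40 * u) ≤ R := Nat.le_ceil _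
  have hRle' : (R : ℝ) ≤ 17 * Real.exp (40 * u) := by
    have e1 := (Nat.ceil_lt_add_one (by positivity : 0 ≤ 16 * Real.exp (40 * u))).le
    have e2 := Real.one_le_exp (by linarith : 0 ≤ 40 * u)
    linarith
  have hexp : Real.exp (-(40 * u)) = 1 / Real.exp (40 * u) := by rw [Real.exp_neg, one_div]
  have hR1 : 1 / (R : ℝ) ≤ Real.exp (-(40 * u)) / 16 := by
    calc 1 / (R : ℝ) ≤ 1 / (16 * Real.exp (40 * u)) := by gcongr
      _ = _ := by rw [hexp]; field_simp
  have hω : (#D.natAbs.primeFactors : ℝ) / w + 6 / w ≤ Real.exp (-(40 * u)) / 16 := by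
    have h1 := card_primeFactors_le_log _ (Int.natAbs_ne_zero.2 hD)
    have h2 : Real.log D.natAbs ≤ 3 * Real.exp u := by
      rw [← h.log_eq, ← Nat.cast_ofNat, ← Real.log_pow]
      exact Real.log_le_log (by exact_mod_cast Int.natAbs_pos.2 hD) (by exact_mod_cast hDT)
    have h3 : (#D.natAbs.primeFactors : ℝ) + 6 ≤ 7 * Real.exp u := by
      linarith [h.linear_le]
    rw [← add_div]
    calc ((#D.natAbs.primeFactors : ℝ) + 6) / w ≤ 7 * Real.exp u / (Real.exp (130 * u) / 2) := by
          gcongr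
      _ = 224 * Real.exp (u - 130 * u) / 16 := by
          rw [Real.exp_sub]
          field_simp
          norm_num
      _ ≤ Real.exp 223 * Real.exp (u - 130 * u) / 16 := by
          have := Real.add_one_le_exp (223 : ℝ)
          gcongr
          linarith
      _ ≤ _ := by
          rw [← Real.exp_add]
          gcongr
          linarith
  set N := ⌊R * Real.log Z⌋₊
  set bad : ℕ → Finset ℕ := fun k => if logGrid R k ≤ Z then
    {t ∈ range (T + 1) | Real.exp (-(40 * u)) / 8 <
      |∑ ℓ ∈ primesIoc w (logGrid R k) with ¬((ℓ : ℕ) : ℤ) ∣ D,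
        rootCoeff m (D - ((t : ℕ) : ℤ) ^ 2) ℓ / ℓ|} else ∅
  have hsub : {t ∈ range (T + 1) | ¬GoodDiscriminant m (D - ((t : ℕ) : ℤ) ^ 2) w Z
      (Real.exp (-(40 * u)))} ⊆ (range (N + 1)).biUnion bad := by
    intro t ht
    obtain ⟨h1, h2⟩ := mem_filter.1 ht
    by_contra hnot
    refine h2 (goodDiscriminant_of_logGrid hD (by omega : 0 < w)
      h.smallLevel_le_largeLevel hR0
      (η := Real.exp (-(40 * u)) / 8) (fun k hk hkZ => ?_) ?_)
    · by_contra hlt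
      refine hnot (mem_biUnion.2 ⟨k, mem_range.2 (Nat.lt_succ_of_le hk), ?_⟩)
      dsimp only [bad]
      rw [if_pos hkZ, mem_filter]
      exact ⟨h1, not_le.1 hlt⟩
    · linarith [Real.exp_pos (-(40 * u))]
  have hbad : ∀ k ∈ range (N + 1), (#(bad k) : ℝ) ≤ 576 * T * Real.exp (-(50 * u)) := by
    intro k _
    simp only [bad]
    split_ifs with hk
    · exact h.card_lt_abs_rootCoeff_sum_le m D hk
    · simp only [card_empty, Nat.cast_zero]
      positivity
  have hN : (N : ℝ) + 1 ≤ 18 * Real.exp (41 * u) := by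
    have e1 : Real.log Z ≤ Real.exp u := by
      rw [Real.log_le_iff_le_exp (by exact_mod_cast h.largeLevel_pos)]
      exact h.largeLevel_le.trans (Real.exp_le_exp.2 (by linarith [Real.exp_pos u]))
    have e0 : 0 ≤ Real.log Z := Real.log_natCast_nonneg Z
    have e2 : (N : ℝ) ≤ R * Real.log Z := Nat.floor_le (by positivity)
    have e3 : R * Real.log Z ≤ 17 * Real.exp (40 * u) * Real.exp u := by gcongr
    have e4 : Real.exp (41 * u) = Real.exp (40 * u) * Real.exp u := by
      rw [← Real.exp_add]; congr 1; ring
    have e5 := Real.one_le_exp (by linarith : 0 ≤ 41 * u)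
    linarith
  calc _ ≤ (#((range (N + 1)).biUnion bad) : ℝ) := by exact_mod_cast card_le_card hsub
    _ ≤ ∑ k ∈ range (N + 1), (#(bad k) : ℝ) := by exact_mod_cast card_biUnion_le
    _ ≤ ∑ k ∈ range (N + 1), 576 * T * Real.exp (-(50 * u)) := sum_le_sum hbad
    _ = ((N : ℝ) + 1) * (576 * T * Real.exp (-(50 * u))) := by
        rw [sum_const, card_range, nsmul_eq_mul]
        push_cast
        ring
    _ ≤ 18 * Real.exp (41 * u) * (576 * T * Real.exp (-(50 * u))) := by gcongr
    _ = T * (10368 * Real.exp (41 * u + -(50 * u))) := by rw [Real.exp_add]; ring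
    _ ≤ T * (Real.exp u * Real.exp (41 * u + -(50 * u))) := by
        gcongr
        linarith [h.linear_le]
    _ ≤ _ := by
        rw [← Real.exp_add]
        gcongr
        linarith

end LargeLogLog

theorem exists_threshold {U : ℕ} {P : ℕ → Prop} (hP : ∀ u v, u ≤ v → v < U → P u → P v) :
    ∃ A ≤ U, ∀ u < U, P u ↔ A ≤ u := by
  classical
  have hex : ∃ a, U ≤ a ∨ P a := ⟨U, Or.inl le_rfl⟩
  refine ⟨Nat.find hex, Nat.find_min' hex (Or.inl le_rfl), fun u hu =>
    ⟨fun h => Nat.find_min' hex (Or.inr h), fun h => ?_⟩⟩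
  rcases Nat.find_spec hex with h1 | h1
  · omega
  · exact hP _ u h hu h1

theorem odd_and_isCoprime_of_dvd {m : ℕ} (hm : m.Prime) {k e : ℕ}
    (hk : k % 8 = 1 ∨ k % 8 = 3) (hmk : ¬m ∣ k) (he : e ∣ k) :
    Odd e ∧ IsCoprime (16 * (m : ℤ) ^ 2) (e : ℤ) := by
  have hodd : Odd e := Odd.of_dvd_nat (Nat.odd_iff.2 (by omega)) he
  refine ⟨hodd, ?_⟩
  have h1 : Nat.Coprime (16 * m ^ 2) e := by
    refine Nat.Coprime.mul_left ?_ (Nat.Coprime.pow_left 2 ?_)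
    · exact (Nat.Coprime.pow_left 4 (Nat.coprime_two_left.2 hodd) : Nat.Coprime (2 ^ 4) e)
    · exact (Nat.Prime.coprime_iff_not_dvd hm).2 fun h => hmk (h.trans he)
  have := Nat.isCoprime_iff_coprime.2 h1
  push_cast at this
  exact this

theorem chiAway_eq_zero_of_not_isCoprime {m : ℕ} (hm : m.Prime) {e : ℕ}
    (he : ¬(Odd e ∧ IsCoprime (16 * (m : ℤ) ^ 2) (e : ℤ))) : chiAway m e = 0 := by
  by_cases hodd : Odd e
  · rw [chiAway, if_pos]
    by_contra hme
    refine he ⟨hodd, ?_⟩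
    have h1 : Nat.Coprime (16 * m ^ 2) e := by
      refine Nat.Coprime.mul_left ?_ (Nat.Coprime.pow_left 2 ?_)
      · exact (Nat.Coprime.pow_left 4 (Nat.coprime_two_left.2 hodd) : Nat.Coprime (2 ^ 4) e)
      · exact (Nat.Prime.coprime_iff_not_dvd hm).2 hme
    have := Nat.isCoprime_iff_coprime.2 h1
    push_cast at this
    exact this
  · exact chiAway_of_even m (even_iff_two_dvd.1 (Nat.not_odd_iff_even.1 hodd))

theorem sum_chiAway_small_divisors_eq_zero {m : ℕ} (hm : m.Prime) {k Y : ℕ}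
    (hk : k % 8 = 1 ∨ k % 8 = 3) (hmk : ¬m ∣ k) (hrep : ¬IsSqAddTwoSq k) (hkY : k ≤ Y ^ 2) :
    ∑ e ∈ Icc 1 Y with Odd e ∧ IsCoprime (16 * (m : ℤ) ^ 2) ((e : ℕ) : ℤ),
      (if e ^ 2 < k ∧ e ∣ k then chiAway m e else 0) = 0 := by
  have h1 := sum_small_divisors_eq_zero hk hrep
  have h2 : ∑ e ∈ k.divisors with e ^ 2 < k, chiAway m e = 0 := by
    have : ∑ e ∈ k.divisors with e ^ 2 < k, ((ZMod.χ₈' (e : ℕ) : ℤ) : ℝ) = 0 := by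
      exact_mod_cast h1
    rw [← this]
    refine sum_congr rfl fun e he => ?_
    rw [chiAway, if_neg]
    exact fun h => hmk (h.trans (Nat.dvd_of_mem_divisors (mem_filter.1 he).1))
  rw [← sum_filter, ← h2]
  refine sum_congr ?_ fun _ _ => rfl
  ext e
  simp only [mem_filter, mem_Icc, Nat.mem_divisors]
  refine ⟨fun h => ⟨⟨h.2.2, by omega⟩, h.2.1⟩, fun h => ?_⟩
  have he0 : 0 < e := Nat.pos_of_ne_zero (by rintro rfl; simp at h)
  exact ⟨⟨⟨he0, (Nat.pow_lt_pow_iff_left two_ne_zero).1 (h.2.trans_le hkY) |>.le⟩,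
    odd_and_isCoprime_of_dvd hm hk hmk h.1.1⟩, h.2, h.1.1⟩

theorem sum_chiAway_rootCount_eq {m : ℕ} (hm : m.Prime) (K : ℤ) {k Y : ℕ} (hk : 0 < k)
    (hkY : k ≤ Y ^ 2) :
    ∑ e ∈ Icc 1 Y with Odd e ∧ IsCoprime (16 * (m : ℤ) ^ 2) ((e : ℕ) : ℤ),
      (if e ^ 2 < k then chiAway m e * rootCount K e / e else 0) =
    ∑ e ∈ Icc 1 (Nat.sqrt (k - 1)), chiAway m e * rootCount K e / e := by
  rw [← sum_filter, filter_filter]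
  refine sum_subset_zero_on_sdiff (fun e he => ?_) (fun e he => ?_) fun _ _ => rfl
  · obtain ⟨h1, -, h2⟩ := mem_filter.1 he
    exact mem_Icc.2 ⟨(mem_Icc.1 h1).1, Nat.le_sqrt'.2 (by omega)⟩
  · obtain ⟨h1, h2⟩ := mem_sdiff.1 he
    have h3 := mem_Icc.1 h1
    have h4 : e ^ 2 < k := by have := Nat.le_sqrt'.1 h3.2; omega
    rw [chiAway_eq_zero_of_not_isCoprime hm, zero_mul, zero_div]
    intro h5
    refine h2 (mem_filter.2 ⟨mem_Icc.2 ⟨h3.1, ?_⟩, h5, h4⟩)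
    exact ((Nat.pow_lt_pow_iff_left two_ne_zero).1 (h4.trans_le hkY)).le

theorem sum_main_le_sum_error {m : ℕ} (hm : m.Prime) {K α : ℤ} {U Y : ℕ} {k : ℕ → ℕ}
    (hmod : ∀ u < U, k u % 8 = 1 ∨ k u % 8 = 3) (hmk : ∀ u < U, ¬m ∣ k u)
    (hdvd : ∀ u < U, ∀ e : ℕ, Odd e → IsCoprime (16 * (m : ℤ) ^ 2) (e : ℤ) →
      (e ∣ k u ↔ (e : ℤ) ∣ (α + 16 * (m : ℤ) ^ 2 * u) ^ 2 - K))
    (hmono : ∀ u v, u ≤ v → v < U → k u ≤ k v) (hkY : ∀ u < U, k u ≤ Y ^ 2)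
    (hrep : ∀ u < U, ¬IsSqAddTwoSq (k u)) :
    ∃ A : ℕ → ℕ, (∀ e, A e ≤ U) ∧
      ∑ u ∈ range U, ∑ e ∈ Icc 1 (Nat.sqrt (k u - 1)), chiAway m e * rootCount K e / e ≤
        ∑ e ∈ Icc 1 Y with Odd e ∧ IsCoprime (16 * (m : ℤ) ^ 2) ((e : ℕ) : ℤ),
          |(#{u ∈ Ico (A e) U | (e : ℤ) ∣ (α + 16 * (m : ℤ) ^ 2 * ((u : ℕ) : ℤ)) ^ 2 - K} : ℝ) -
            rootCount K e * ((U - A e : ℕ) : ℝ) / e| := by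
  have hA : ∀ e, ∃ a ≤ U, ∀ u < U, e ^ 2 < k u ↔ a ≤ u := fun e =>
    exists_threshold fun u v huv hv h => h.trans_le (hmono u v huv hv)
  choose A hAU hA using hA
  refine ⟨A, hAU, ?_⟩
  set F := {e ∈ Icc 1 Y | Odd e ∧ IsCoprime (16 * (m : ℤ) ^ 2) ((e : ℕ) : ℤ)}
  set Nc : ℕ → ℝ := fun e =>
    (#{u ∈ Ico (A e) U | (e : ℤ) ∣ (α + 16 * (m : ℤ) ^ 2 * ((u : ℕ) : ℤ)) ^ 2 - K} : ℝ)
  have hN : ∀ e ∈ F, Nc e = ∑ u ∈ range U, if e ^ 2 < k u ∧ e ∣ k u then (1 : ℝ) else 0 := by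
    intro e he
    obtain ⟨-, h2, h3⟩ := mem_filter.1 he
    rw [← sum_filter, sum_const, nsmul_one]
    simp only [Nc]
    congr 2
    ext u
    simp only [mem_filter, mem_Ico, mem_range]
    refine ⟨fun h => ⟨h.1.2, (hA e u h.1.2).2 h.1.1, (hdvd u h.1.2 e h2 h3).2 h.2⟩, fun h =>
      ⟨⟨(hA e u h.1).1 h.2.1, h.1⟩, (hdvd u h.1 e h2 h3).1 h.2.2⟩⟩
  have hUA : ∀ e, ((U - A e : ℕ) : ℝ) = ∑ u ∈ range U, if e ^ 2 < k u then (1 : ℝ) else 0 := by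
    intro e
    rw [← sum_filter, sum_const, nsmul_one, ← Nat.card_Ico]
    congr 2
    ext u
    simp only [mem_filter, mem_Ico, mem_range]
    exact ⟨fun h => ⟨h.2, (hA e u h.2).2 h.1⟩, fun h => ⟨(hA e u h.1).1 h.2, h.1⟩⟩
  have hzero : ∑ e ∈ F, chiAway m e * Nc e = 0 := by
    calc ∑ e ∈ F, chiAway m e * Nc e =
        ∑ e ∈ F, ∑ u ∈ range U, if e ^ 2 < k u ∧ e ∣ k u then chiAway m e else 0 := by
          refine sum_congr rfl fun e he => ?_
          rw [hN e he, mul_sum]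
          exact sum_congr rfl fun u _ => by rw [mul_ite, mul_one, mul_zero]
      _ = 0 := by
          rw [sum_comm]
          refine sum_eq_zero fun u hu => ?_
          have hu' := mem_range.1 hu
          exact sum_chiAway_small_divisors_eq_zero hm (hmod u hu') (hmk u hu') (hrep u hu')
            (hkY u hu')
  have hmain : ∑ u ∈ range U, ∑ e ∈ Icc 1 (Nat.sqrt (k u - 1)), chiAway m e * rootCount K e / e =
      ∑ e ∈ F, chiAway m e * (rootCount K e * ((U - A e : ℕ) : ℝ) / e) := by
    calc _ = ∑ u ∈ range U, ∑ e ∈ F,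
          (if e ^ 2 < k u then chiAway m e * rootCount K e / e else 0) :=
          sum_congr rfl fun u hu => by
            have hu' := mem_range.1 hu
            exact (sum_chiAway_rootCount_eq hm K (by have := hmod u hu'; omega) (hkY u hu')).symm
      _ = _ := by
          rw [sum_comm]
          refine sum_congr rfl fun e _ => ?_
          rw [hUA, mul_sum, sum_div, mul_sum]
          refine sum_congr rfl fun u _ => ?_
          split_ifs <;> ring
  calc _ = ∑ e ∈ F, -(chiAway m e * (Nc e - rootCount K e * ((U - A e : ℕ) : ℝ) / e)) := by
        rw [hmain, sum_neg_distrib]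
        simp only [mul_sub, sum_sub_distrib]
        rw [hzero]
        ring
    _ ≤ _ := sum_le_sum fun e _ => by
        refine (neg_le_abs _).trans ?_
        rw [abs_mul]
        exact mul_le_of_le_one_left (abs_nonneg _) (abs_chiAway_le_one m e)

theorem dvd_iff_dvd_sq_sub {m e k : ℕ} {j : ℕ} {κ D p v : ℤ} (hk : κ = 2 ^ j * k)
    (hκ : m * κ = D - p ^ 2 - v ^ 2) (he : Odd e) (hcop : IsCoprime (16 * (m : ℤ) ^ 2) (e : ℤ)) :
    e ∣ k ↔ (e : ℤ) ∣ v ^ 2 - (D - p ^ 2) := by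
  have h2 : IsCoprime (e : ℤ) (2 ^ j) := by
    have := Nat.isCoprime_iff_coprime.2 ((Nat.coprime_two_right.2 he).pow_right j)
    push_cast at this
    exact this
  have hm : IsCoprime (e : ℤ) m := by
    have h3 := (hcop.of_mul_left_right).symm
    rw [sq] at h3
    exact h3.of_mul_right_left
  rw [← Int.natCast_dvd_natCast, show v ^ 2 - (D - p ^ 2) = -((m : ℤ) * (2 ^ j * k)) by
    rw [← hk, hκ]; ring, dvd_neg]
  exact ⟨fun h => (h.mul_left _).mul_left _, fun h =>
    h2.dvd_of_dvd_mul_left (hm.dvd_of_dvd_mul_left h)⟩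

theorem exists_family {n d p T U : ℕ} (hd : 0 < d) (hodd : Odd d) (hm : (4 * d ^ 2 + 1).Prime)
    (hp : p.Prime) (hp2 : p ≠ 2) (hpm : p ≠ 4 * d ^ 2 + 1)
    (hT : 200 * d * (4 * d ^ 2 + 1) * U = T) (hTp : T < 4 * p) (hpT : p ≤ T)
    (hn : 4 * T ^ 2 ≤ n) (hn' : n ≤ (3 * T) ^ 2)
    (hrep : ¬∃ x y z w : ℕ, n = x ^ 2 + y ^ 2 + z ^ 2 + 2 * w ^ 2 ∧ x + 2 * d * y = p) :
    ∃ (α : ℤ) (k : ℕ → ℕ), (∀ u < U, k u % 8 = 1 ∨ k u % 8 = 3) ∧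
      (∀ u < U, ¬(4 * d ^ 2 + 1) ∣ k u) ∧
      (∀ u < U, ∀ e : ℕ, Odd e → IsCoprime (16 * ((4 * d ^ 2 + 1 : ℕ) : ℤ) ^ 2) (e : ℤ) →
        (e ∣ k u ↔ (e : ℤ) ∣ (α + 16 * ((4 * d ^ 2 + 1 : ℕ) : ℤ) ^ 2 * u) ^ 2 -
          (((4 * d ^ 2 + 1) * n : ℕ) - (p : ℤ) ^ 2))) ∧
      (∀ u v, u ≤ v → v < U → k u ≤ k v) ∧ (∀ u < U, k u ≤ (3 * T) ^ 2) ∧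
      (∀ u < U, ¬IsSqAddTwoSq (k u)) ∧ ∀ u < U, T ≤ 4 * Nat.sqrt (k u - 1) := by
  obtain ⟨y₀, hy₀, j, hj, hloc⟩ := exists_local_residue (n := n) hodd hm hp hp2 hpm
  have hmd : 4 * d ^ 2 + 1 ≤ 5 * d ^ 2 := by nlinarith
  set m := 4 * d ^ 2 + 1 with hmdef
  have hmZ : (m : ℤ) = 4 * (d : ℤ) ^ 2 + 1 := by rw [hmdef]; push_cast; ring
  have hpow : (2 : ℤ) ^ j ≤ 4 := by
    have : (2 : ℤ) ^ j ≤ 2 ^ 2 := pow_le_pow_right₀ (by norm_num) hj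
    linarith
  have hpow0 : (0 : ℤ) < 2 ^ j := by positivity
  have hpow1 : (1 : ℤ) ≤ 2 ^ j := hpow0
  set y : ℕ → ℕ := fun u => y₀ + 16 * m * u with hy
  set κ : ℕ → ℤ := fun u => n - (p - 2 * d * (y u : ℤ)) ^ 2 - (y u : ℤ) ^ 2 with hκ
  have hyU : ∀ u < U, y u ≤ 16 * (m * U) := by
    intro u hu
    have : 16 * m * (u + 1) ≤ 16 * m * U := Nat.mul_le_mul_left _ hu
    simp only [hy]
    nlinarith
  have hy_mod : ∀ u, (y u : ℤ) ≡ y₀ [ZMOD 16 * (4 * d ^ 2 + 1)] := by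
    intro u
    refine (Int.modEq_iff_dvd.2 ⟨-u, ?_⟩)
    simp only [hy]
    push_cast
    rw [hmZ]
    ring
  set q := d * (m * U) with hq
  have hqT : T = 200 * q := by rw [← hT, hq]; ring
  have hmq : m * U ≤ q := Nat.le_mul_of_pos_left _ hd
  have hx : ∀ u < U, 2 * d * y u ≤ 32 * q := by
    intro u hu
    have := Nat.mul_le_mul_left (2 * d) (hyU u hu)
    rw [hq]
    linarith
  have hκ_spec : ∀ u, κ u = 2 ^ j * (κ u / 2 ^ j) ∧
      (κ u / 2 ^ j % 8 = 1 ∨ κ u / 2 ^ j % 8 = 3) ∧ ¬(m : ℤ) ∣ κ u := by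
    intro u
    obtain ⟨h1, h2, h3⟩ := hloc (y u) (κ u) (hy_mod u) rfl
    exact ⟨(Int.mul_ediv_cancel' h1).symm, h2, h3⟩
  have hκ_low : ∀ u < U, 119744 * (q : ℤ) ^ 2 ≤ κ u := by
    intro u hu
    have h1 : (0 : ℤ) ≤ p - 2 * d * (y u : ℤ) := by
      have := hx u hu
      have h2 : 2 * d * y u ≤ p := by omega
      have h3 : ((2 * d * y u : ℕ) : ℤ) ≤ p := by exact_mod_cast h2
      push_cast at h3
      linarith
    have h2 : (p : ℤ) - 2 * d * (y u : ℤ) ≤ 200 * q := by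
      have : (p : ℤ) ≤ 200 * q := by exact_mod_cast hqT ▸ hpT
      have : (0 : ℤ) ≤ 2 * d * (y u : ℤ) := by positivity
      linarith
    have h3 : (y u : ℤ) ≤ 16 * q := by exact_mod_cast (hyU u hu).trans (by omega)
    have h4 : 4 * (200 * (q : ℤ)) ^ 2 ≤ n := by exact_mod_cast hqT ▸ hn
    have h5 : ((p : ℤ) - 2 * d * (y u : ℤ)) ^ 2 ≤ (200 * q) ^ 2 := by gcongr
    have h6 : (y u : ℤ) ^ 2 ≤ (16 * q) ^ 2 := by gcongr
    simp only [hκ]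
    nlinarith
  have hκ_nonneg : ∀ u < U, 0 ≤ κ u / 2 ^ j := fun u hu =>
    Int.ediv_nonneg ((by positivity : (0 : ℤ) ≤ 119744 * (q : ℤ) ^ 2).trans (hκ_low u hu)) hpow0.le
  set k : ℕ → ℕ := fun u => (κ u / 2 ^ j).toNat
  have hk : ∀ u < U, (k u : ℤ) = κ u / 2 ^ j := fun u hu => Int.toNat_of_nonneg (hκ_nonneg u hu)
  have hκk : ∀ u < U, κ u = 2 ^ j * k u := fun u hu => by rw [hk u hu]; exact (hκ_spec u).1
  refine ⟨m * y₀ - 2 * d * p, k, fun u hu => ?_, fun u hu h => ?_, fun u hu e he hcop => ?_,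
    fun u v huv hv => ?_, fun u hu => ?_, fun u hu h => ?_, fun u hu => ?_⟩
  · have := (hκ_spec u).2.1
    rw [← hk u hu] at this
    omega
  · refine (hκ_spec u).2.2 ?_
    rw [hκk u hu]
    exact (Int.natCast_dvd_natCast.2 h).mul_left _
  · refine dvd_iff_dvd_sq_sub (hκk u hu) ?_ he hcop
    simp only [hκ, hy]
    push_cast
    rw [hmZ]
    ring
  · have h1 : (y u : ℤ) ≤ y v := by
      simp only [hy]
      exact_mod_cast Nat.add_le_add_left (Nat.mul_le_mul_left _ huv) _
    have h2 : (y v : ℤ) ≤ 16 * (m * U) := by exact_mod_cast hyU v hv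
    have h3 : (m : ℤ) * (m * U) ≤ 5 * (d * q) := by
      have : m * (m * U) ≤ 5 * d ^ 2 * (m * U) := Nat.mul_le_mul_right _ hmd
      have h4 : 5 * d ^ 2 * (m * U) = 5 * (d * q) := by rw [hq]; ring
      exact_mod_cast h4 ▸ this
    have h4 : (d : ℤ) * (200 * q) ≤ d * (4 * p) := by
      have : 200 * q ≤ 4 * p := by omega
      exact_mod_cast Nat.mul_le_mul_left d this
    have h5 : (m : ℤ) * (y u + y v) ≤ m * (32 * (m * U)) := by
      gcongr
      linarith
    have h6 : 0 ≤ ((y v : ℤ) - y u) * (4 * d * p - m * (y u + y v)) := by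
      refine mul_nonneg (by linarith) ?_
      have : (0 : ℤ) ≤ d * q := by positivity
      linarith
    have h7 : κ u ≤ κ v := by
      have : κ v - κ u = ((y v : ℤ) - y u) * (4 * d * p - m * (y u + y v)) := by
        simp only [hκ, hmZ]
        ring
      linarith
    exact Int.toNat_le_toNat (Int.ediv_le_ediv hpow0 h7)
  · have h1 : (k u : ℤ) ≤ κ u := by
      rw [hκk u hu]
      exact le_mul_of_one_le_left (by positivity) hpow1
    have h2 : κ u ≤ n := by
      simp only [hκ]
      linarith [sq_nonneg ((p : ℤ) - 2 * d * (y u : ℤ)), sq_nonneg (y u : ℤ)]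
    exact (by exact_mod_cast h1.trans h2 : k u ≤ n).trans hn'
  · obtain ⟨z, w, hzw⟩ := (IsSqAddTwoSq.two.pow j).mul h
    have h1 : 2 * d * y u ≤ p := by
      have := hx u hu
      omega
    refine hrep ⟨p - 2 * d * y u, y u, z, w, ?_, Nat.sub_add_cancel h1⟩
    have h2 : ((2 ^ j * k u : ℕ) : ℤ) = z ^ 2 + 2 * w ^ 2 := by rw [hzw]; push_cast; ring
    have h3 := hκk u hu
    push_cast at h2
    rw [h2] at h3
    simp only [hκ] at h3
    zify [h1]
    linarith
  · have hq0 : 0 < q := Nat.mul_pos hd (Nat.mul_pos (by omega) (by omega))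
    have h1 : 119744 * (q : ℤ) ^ 2 ≤ 4 * k u := by
      refine (hκ_low u hu).trans ?_
      rw [hκk u hu]
      gcongr
    have h2 : 119744 * q ^ 2 ≤ 4 * k u := by exact_mod_cast h1
    have h3 : 50 * q ≤ Nat.sqrt (k u - 1) := by
      rw [Nat.le_sqrt']
      have : 1 ≤ q ^ 2 := Nat.one_le_pow _ _ hq0
      have h4 : (50 * q) ^ 2 = 2500 * q ^ 2 := by ring
      omega
    omega

open Classical in
theorem LargeLogLog.card_goodDiscriminant_ge {T : ℕ} {u : ℝ} (h : LargeLogLog T u)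
    (hcard : (T : ℝ) / 4 ≤ #(primesIoc (T / 4) T) * Real.log T) (m : ℕ) {D : ℤ} (hD : D ≠ 0)
    (hDT : D.natAbs ≤ T ^ 3) :
    T * Real.exp (-u) / 8 ≤ (#{p ∈ primesIoc (T / 4) T | GoodDiscriminant m
      (D - ((p : ℕ) : ℤ) ^ 2) (smallLevel T) (largeLevel T) (Real.exp (-(40 * u)))} : ℝ) := by
  have h1 := h.card_not_goodDiscriminant_le m hD hDT
  have hT := h.pos
  have h2 : (#(primesIoc (T / 4) T) : ℝ) ≤
      #{p ∈ primesIoc (T / 4) T | GoodDiscriminant m (D - ((p : ℕ) : ℤ) ^ 2) (smallLevel T)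
        (largeLevel T) (Real.exp (-(40 * u)))} +
      #{t ∈ range (T + 1) | ¬GoodDiscriminant m (D - ((t : ℕ) : ℤ) ^ 2) (smallLevel T)
        (largeLevel T) (Real.exp (-(40 * u)))} := by
    rw [← card_filter_add_card_filter_not (s := primesIoc (T / 4) T) (fun p : ℕ =>
      GoodDiscriminant m (D - (p : ℤ) ^ 2) (smallLevel T) (largeLevel T) (Real.exp (-(40 * u))))]
    push_cast
    gcongr
    refine fun p hp => mem_range.2 ?_
    have := (mem_primesIoc.1 hp).2.1
    omega
  have h3 : T * Real.exp (-u) / 4 ≤ (#(primesIoc (T / 4) T) : ℝ) := by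
    rw [h.log_eq] at hcard
    have e : Real.exp u * Real.exp (-u) = 1 := by rw [← Real.exp_add, add_neg_cancel, Real.exp_zero]
    calc T * Real.exp (-u) / 4 = T / 4 * Real.exp (-u) := by ring
      _ ≤ #(primesIoc (T / 4) T) * Real.exp u * Real.exp (-u) := by gcongr
      _ = #(primesIoc (T / 4) T) := by rw [mul_assoc, e, mul_one]
  have h4 : T * Real.exp (-(2 * u)) ≤ T * Real.exp (-u) / 8 := by
    rw [show -(2 * u) = -u + -u by ring, Real.exp_add]
    have h5 : Real.exp (-u) ≤ 1 / 8 := by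
      rw [Real.exp_neg, one_div]
      exact inv_anti₀ (by norm_num) (by linarith [h.linear_le, h.thousand_le])
    have : T * (Real.exp (-u) * Real.exp (-u)) ≤ T * (Real.exp (-u) * (1 / 8)) := by gcongr
    linarith
  linarith

open Classical in
theorem exists_error_sum {n d T U : ℕ} {u : ℝ} (h : LargeLogLog T u) (hd : 0 < d) (hodd : Odd d)
    (hm : (4 * d ^ 2 + 1).Prime) (hT : 200 * d * (4 * d ^ 2 + 1) * U = T)
    (hTm : 36 * (4 * d ^ 2 + 1) ≤ T) (hn : 4 * T ^ 2 ≤ n) (hn' : n ≤ (3 * T) ^ 2)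
    (hrep : ∀ x y z w : ℕ, n = x ^ 2 + y ^ 2 + z ^ 2 + 2 * w ^ 2 → ¬(x + 2 * d * y).Prime)
    (p : ℕ) :
    ∃ (A : ℕ → ℕ) (α : ℤ), (∀ e, A e ≤ U) ∧
      (p ∈ {p ∈ primesIoc (T / 4) T | GoodDiscriminant (4 * d ^ 2 + 1)
        (((4 * d ^ 2 + 1) * n : ℕ) - ((p : ℕ) : ℤ) ^ 2) (smallLevel T) (largeLevel T)
        (Real.exp (-(40 * u)))} →
      U * Real.exp (-(u / 1000)) ≤
        ∑ e ∈ Icc 1 (3 * T) with Odd e ∧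
          IsCoprime (16 * ((4 * d ^ 2 + 1 : ℕ) : ℤ) ^ 2) ((e : ℕ) : ℤ),
          |(#{v ∈ Ico (A e) U | (e : ℤ) ∣ (α + 16 * ((4 * d ^ 2 + 1 : ℕ) : ℤ) ^ 2 *
            ((v : ℕ) : ℤ)) ^ 2 - (((4 * d ^ 2 + 1) * n : ℕ) - (p : ℤ) ^ 2)} : ℝ) -
            rootCount (((4 * d ^ 2 + 1) * n : ℕ) - (p : ℤ) ^ 2) e *
              ((U - A e : ℕ) : ℝ) / e|) := by
  by_cases hp : p ∈ {p ∈ primesIoc (T / 4) T | GoodDiscriminant (4 * d ^ 2 + 1)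
        (((4 * d ^ 2 + 1) * n : ℕ) - ((p : ℕ) : ℤ) ^ 2) (smallLevel T) (largeLevel T)
        (Real.exp (-(40 * u)))}
  swap
  · exact ⟨fun _ => 0, 0, fun _ => Nat.zero_le _, fun h => absurd h hp⟩
  obtain ⟨hp1, hgood⟩ := mem_filter.1 hp
  obtain ⟨hp2, hp3, hp4⟩ := mem_primesIoc.1 hp1
  have hm1 := hm.two_le
  have hm8 : (4 * d ^ 2 + 1) % 8 = 5 := by
    obtain ⟨a, rfl⟩ := hodd
    have : 4 * (2 * a + 1) ^ 2 + 1 = 8 * (2 * a ^ 2 + 2 * a) + 5 := by ring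
    omega
  obtain ⟨α, k, h1, h2, h3, h4, h5, h6, h7⟩ := exists_family (p := p) hd hodd hm hp4
    (by omega) (by omega) hT (by omega) hp3 hn hn' (by
      rintro ⟨x, y, z, w, hx, hy⟩
      exact hrep x y z w hx (hy ▸ hp4))
  obtain ⟨A, hA, hle⟩ := sum_main_le_sum_error hm h1 h2 h3 h4 h5 h6
  refine ⟨A, α, hA, fun _ => le_trans ?_ hle⟩
  have hnp : p ^ 2 < (4 * d ^ 2 + 1) * n := by
    have : p ^ 2 ≤ T ^ 2 := Nat.pow_le_pow_left hp3 2
    have : 0 < T ^ 2 := pow_pos (hp4.pos.trans_le hp3) 2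
    nlinarith
  have hK : ((((4 * d ^ 2 + 1) * n : ℕ) : ℤ) - (p : ℤ) ^ 2) =
      (((4 * d ^ 2 + 1) * n - p ^ 2 : ℕ) : ℤ) := by
    rw [Nat.cast_sub hnp.le]
    push_cast
    ring
  have hKle : ((((4 * d ^ 2 + 1) * n : ℕ) : ℤ) - (p : ℤ) ^ 2).natAbs ≤ T ^ 3 := by
    rw [hK, Int.natAbs_natCast]
    have h8 : (4 * d ^ 2 + 1) * n ≤ (4 * d ^ 2 + 1) * (3 * T) ^ 2 := Nat.mul_le_mul_left _ hn'
    have h9 : 36 * (4 * d ^ 2 + 1) * T ^ 2 ≤ T * T ^ 2 := Nat.mul_le_mul_right _ hTm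
    have h10 : (4 * d ^ 2 + 1) * (3 * T) ^ 2 = 9 * ((4 * d ^ 2 + 1) * T ^ 2) := by ring
    have h11 : T ^ 3 = T * T ^ 2 := by ring
    have h12 : 36 * (4 * d ^ 2 + 1) * T ^ 2 = 36 * ((4 * d ^ 2 + 1) * T ^ 2) := by ring
    omega
  calc U * Real.exp (-(u / 1000)) = ∑ v ∈ range U, Real.exp (-(u / 1000)) := by
        rw [sum_const, card_range, nsmul_eq_mul]
    _ ≤ _ := sum_le_sum fun v hv => by
        have hv' := mem_range.1 hv
        refine h.sum_chi_rootCount_ge hm hm8 ?_ hKle hgood (h7 v hv') ?_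
        · rw [hK]
          exact_mod_cast (Nat.sub_pos_of_lt hnp).ne'
        · have h13 := Nat.sqrt_le_sqrt ((Nat.sub_le _ 1).trans (h5 v hv'))
          rwa [Nat.sqrt_eq'] at h13

theorem exists_prime_representation {n d T U : ℕ} {u : ℝ} (h : LargeLogLog T u) (hd : 0 < d)
    (hodd : Odd d) (hm : (4 * d ^ 2 + 1).Prime) (hT : 200 * d * (4 * d ^ 2 + 1) * U = T)
    (hTm : 36 * (4 * d ^ 2 + 1) ≤ T) (hn : 4 * T ^ 2 ≤ n) (hn' : n ≤ (3 * T) ^ 2)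
    (hcard : (T : ℝ) / 4 ≤ #(primesIoc (T / 4) T) * Real.log T)
    (hu : 8 * (200 * d * (4 * d ^ 2 + 1) : ℕ) < Real.exp (0.004 * u))
    (herr : ∀ (D : ℤ) (U : ℕ) (A : ℕ → ℕ → ℕ) (α : ℕ → ℤ), (T : ℤ) ^ 2 < D → D ≤ (T : ℤ) ^ 3 →
      200 * d * (4 * d ^ 2 + 1) * U = T → (∀ p e, A p e ≤ U) →
      ∑ p ∈ primesIoc 0 T, ∑ e ∈ Icc 1 (3 * T) with
        Odd e ∧ IsCoprime (16 * ((4 * d ^ 2 + 1 : ℕ) : ℤ) ^ 2) ((e : ℕ) : ℤ),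
        |(#{v ∈ Ico (A p e) U | (e : ℤ) ∣ (α p + 16 * ((4 * d ^ 2 + 1 : ℕ) : ℤ) ^ 2 *
          ((v : ℕ) : ℤ)) ^ 2 - (D - (p : ℤ) ^ 2)} : ℝ) -
          rootCount (D - (p : ℤ) ^ 2) e * ((U - A p e : ℕ) : ℝ) / e| ≤
      (T : ℝ) ^ 2 * Real.exp (-(1.005 * Real.log (Real.log T)))) :
    ∃ x y z w : ℕ, n = x ^ 2 + y ^ 2 + z ^ 2 + 2 * w ^ 2 ∧ (x + 2 * d * y).Prime := by
  classical
  by_contra hcon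
  have hrep : ∀ x y z w : ℕ, n = x ^ 2 + y ^ 2 + z ^ 2 + 2 * w ^ 2 → ¬(x + 2 * d * y).Prime :=
    fun x y z w h1 h2 => hcon ⟨x, y, z, w, h1, h2⟩
  choose A α hA hE using exists_error_sum h hd hodd hm hT hTm hn hn' hrep
  have hm1 := hm.two_le
  have hT0 := h.pos
  have hT0' : 0 < T := by exact_mod_cast hT0
  have hD1 : T ^ 2 < (4 * d ^ 2 + 1) * n := by
    have : 0 < T ^ 2 := by positivity
    nlinarith
  have hD2 : (4 * d ^ 2 + 1) * n ≤ T ^ 3 := by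
    have h9 : 36 * (4 * d ^ 2 + 1) * T ^ 2 ≤ T * T ^ 2 := Nat.mul_le_mul_right _ hTm
    have h8 : (4 * d ^ 2 + 1) * n ≤ (4 * d ^ 2 + 1) * (3 * T) ^ 2 := Nat.mul_le_mul_left _ hn'
    nlinarith
  have hupper := herr (((4 * d ^ 2 + 1) * n : ℕ) : ℤ) U A α (by exact_mod_cast hD1)
    (by exact_mod_cast hD2) hT hA
  rw [h.log_log_eq] at hupper
  have hgood := h.card_goodDiscriminant_ge hcard (4 * d ^ 2 + 1)
    (D := (((4 * d ^ 2 + 1) * n : ℕ) : ℤ)) (by exact_mod_cast (by omega)) (by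
      rw [Int.natAbs_natCast]; exact hD2)
  set G := {p ∈ primesIoc (T / 4) T | GoodDiscriminant (4 * d ^ 2 + 1)
        (((4 * d ^ 2 + 1) * n : ℕ) - ((p : ℕ) : ℤ) ^ 2) (smallLevel T) (largeLevel T)
        (Real.exp (-(40 * u)))}
  have hlower : (#G : ℝ) * (U * Real.exp (-(u / 1000))) ≤
      (T : ℝ) ^ 2 * Real.exp (-(1.005 * u)) := by
    rw [← nsmul_eq_mul, ← sum_const]
    refine le_trans ((sum_le_sum fun p hp => hE p hp).trans ?_) hupper
    refine sum_le_sum_of_subset_of_nonneg ((filter_subset _ _).trans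
      (primesIoc_subset (Nat.zero_le _) le_rfl)) fun _ _ _ => sum_nonneg fun _ _ => abs_nonneg _
  set D₀ := 200 * d * (4 * d ^ 2 + 1)
  have hTU : (T : ℝ) = D₀ * U := by exact_mod_cast hT.symm
  have hU0 : (0 : ℝ) < U := by
    rcases Nat.eq_zero_or_pos U with h0 | h0
    · rw [h0, mul_zero] at hT
      omega
    · exact_mod_cast h0
  have h1 : T * Real.exp (-u) / 8 * (U * Real.exp (-(u / 1000))) ≤
      T * (D₀ * U) * Real.exp (-(1.005 * u)) := by
    rw [← hTU, ← sq]
    refine le_trans ?_ hlower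
    gcongr
  have h2 : Real.exp (-u) * Real.exp (-(u / 1000)) =
      Real.exp (-(1.005 * u)) * Real.exp (0.004 * u) := by
    rw [← Real.exp_add, ← Real.exp_add]
    congr 1
    ring
  have h3 : T * U * Real.exp (-(1.005 * u)) * Real.exp (0.004 * u) ≤
      T * U * Real.exp (-(1.005 * u)) * (8 * D₀) := by
    calc T * U * Real.exp (-(1.005 * u)) * Real.exp (0.004 * u) =
        8 * (T * Real.exp (-u) / 8 * (U * Real.exp (-(u / 1000)))) := by
          rw [mul_assoc, ← h2]; ring
      _ ≤ 8 * (T * (D₀ * U) * Real.exp (-(1.005 * u))) := by gcongr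
      _ = _ := by ring
  exact absurd (le_of_mul_le_mul_left h3 (by positivity)) (not_le.2 hu)

theorem sums_of_squares_prime_restriction
    (d : ℕ) (hd : 0 < d) (hodd : Odd d) (hprime : Nat.Prime (4 * d ^ 2 + 1)) :
    ∃ N : ℕ, ∀ n : ℕ, n > N →
      ∃ x y z w : ℕ,
        n = x ^ 2 + y ^ 2 + z ^ 2 + 2 * w ^ 2 ∧
        Nat.Prime (x + 2 * d * y) := by
  set D₀ := 200 * d * (4 * d ^ 2 + 1) with hD₀
  have hD₀pos : 0 < D₀ := by positivity
  obtain ⟨T₁, hT₁⟩ := card_primesIoc_quarter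
  have hexp : ∀ᶠ T : ℕ in atTop, 8 * (D₀ : ℝ) < Real.exp (0.004 * Real.log (Real.log T)) :=
    eventually_loglog (P := fun u => 8 * (D₀ : ℝ) < Real.exp (0.004 * u))
      ((Real.tendsto_exp_atTop.comp (tendsto_id.const_mul_atTop
        (by norm_num : (0 : ℝ) < 0.004))).eventually_gt_atTop _)
  obtain ⟨T₀, hT₀⟩ := eventually_atTop.1 (eventually_largeLogLog.and (hexp.and
    ((eventually_ge_atTop T₁).and ((eventually_ge_atTop (36 * D₀)).and
      (eventually_sum_error_le D₀ hD₀pos (16 * ((4 * d ^ 2 + 1 : ℕ) : ℤ) ^ 2))))))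
  refine ⟨(2 * D₀ * (T₀ + 1)) ^ 2, fun n hn => ?_⟩
  set U := Nat.sqrt n / (2 * D₀) with hU
  have hs : 2 * D₀ * (T₀ + 1) ≤ Nat.sqrt n := Nat.le_sqrt'.2 hn.le
  have hUT : T₀ + 1 ≤ U := (Nat.le_div_iff_mul_le (by positivity)).2 (by linarith)
  have hT₀U : T₀ ≤ D₀ * U := by nlinarith
  obtain ⟨h1, h2, h3, h4, h5⟩ := hT₀ (D₀ * U) hT₀U
  have hle : 2 * (D₀ * U) ≤ Nat.sqrt n := by
    have := Nat.mul_div_le (Nat.sqrt n) (2 * D₀)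
    rw [← hU] at this
    linarith
  have hlt : Nat.sqrt n < 2 * (D₀ * U) + 2 * D₀ := by
    have := Nat.lt_mul_div_succ (Nat.sqrt n) (by positivity : 0 < 2 * D₀)
    rw [← hU] at this
    linarith
  have hmD : 4 * d ^ 2 + 1 ≤ D₀ := Nat.le_mul_of_pos_left _ (by positivity)
  refine exists_prime_representation h1 hd hodd hprime rfl (by omega) ?_ ?_ (hT₁ _ h3) h2 h5
  · calc 4 * (D₀ * U) ^ 2 = (2 * (D₀ * U)) ^ 2 := by ring
      _ ≤ Nat.sqrt n ^ 2 := Nat.pow_le_pow_left hle 2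
      _ ≤ n := Nat.sqrt_le' n
  · calc n ≤ (Nat.sqrt n + 1) ^ 2 := (Nat.lt_succ_sqrt' n).le
      _ ≤ (3 * (D₀ * U)) ^ 2 := Nat.pow_le_pow_left (by omega) 2
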